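/- Fix an integer k ≥ 2. For every ε > 0 there exists n₀ such that for all n ≥ n₀, the number of minimal k-SAT formulae on the labeled variables x_1,…,x_n is at least (1−ε)·2^{n + C(n,k)} and at most (1+ε)·2^{n + C(n,k)}, where C(n,k) denotes the binomial coefficient 'n choose k'. -/

import Mathlib

section Defs

variable {V W : Type*}

/-- A clause is a finite set of literals; a literal is a variable paired with a polarity
(`true` = positive, `false` = negative). -/
abbrev SatClause (V : Type*) := Finset (V × Bool)

/-- A formula is a finite set of clauses. -/
abbrev SatFormula (V : Type*) := Finset (SatClause V)

/-- The set of variables used by a clause. -/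
def clauseVars [DecidableEq V] (C : SatClause V) : Finset V := C.image Prod.fst

/-- A valid `k`-SAT clause: `k` literals on `k` distinct variables. -/
def IsKClause [DecidableEq V] (k : ℕ) (C : SatClause V) : Prop :=
  C.card = k ∧ (clauseVars C).card = k

/-- A valid `k`-SAT formula. -/
def IsKFormula [DecidableEq V] (k : ℕ) (G : SatFormula V) : Prop :=
  ∀ C ∈ G, IsKClause k C

/-- An assignment satisfies a clause if it makes all of its literals true. -/
def SatisfiesClause (a : V → Bool) (C : SatClause V) : Prop := ∀ l ∈ C, a l.1 = l.2

/-- A formula is minimal if every clause has a witness assignment satisfying it and no other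
clause. -/
def MinimalFormula (G : SatFormula V) : Prop :=
  ∀ C ∈ G, ∃ w : V → Bool, SatisfiesClause w C ∧ ∀ C' ∈ G, SatisfiesClause w C' → C' = C

/-- A formula is simple if no two distinct clauses use the same set of variables. -/
def SimpleFormula [DecidableEq V] (G : SatFormula V) : Prop :=
  ∀ C ∈ G, ∀ C' ∈ G, clauseVars C = clauseVars C' → C = C'

/-- A formula is unate if every variable occurs with only one polarity. -/
def UnateFormula (G : SatFormula V) : Prop :=
  ∀ x : V, ¬ ((∃ C ∈ G, (x, true) ∈ C) ∧ (∃ C ∈ G, (x, false) ∈ C))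

/-- The set of variables used by a formula. -/
def formulaVars [DecidableEq V] (G : SatFormula V) : Finset V := G.biUnion clauseVars

/-- `f` is a `k`-SAT function: it is computed by some `k`-SAT formula (value `1` iff some
clause has all its literals satisfied). -/
def IsKSatFunction (k n : ℕ) (f : (Fin n → Bool) → Bool) : Prop :=
  ∃ G : SatFormula (Fin n), IsKFormula k G ∧
    ∀ a : Fin n → Bool, f a = true ↔ ∃ C ∈ G, SatisfiesClause a C

/-- Relabel the variables of a formula along `φ`. -/
def mapFormula [DecidableEq V] [DecidableEq W] (φ : W → V) (F : SatFormula W) : SatFormula V :=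
  F.image (fun C => C.image (fun l => (φ l.1, l.2)))

/-- `G'` is a copy of `F`: it is obtained from `F` by an injective relabeling of variables. -/
def IsCopyOf [DecidableEq V] [DecidableEq W] (F : SatFormula W) (G' : SatFormula V) : Prop :=
  ∃ φ : W → V, Set.InjOn φ ↑(formulaVars F) ∧ G' = mapFormula φ F

/-- The number of copies of `F` in `G`, i.e. of subformulae of `G` isomorphic to `F`. -/
noncomputable def copyCount [DecidableEq V] [DecidableEq W] (F : SatFormula W)
    (G : SatFormula V) : ℕ :=
  Set.ncard {G' : SatFormula V | G' ⊆ G ∧ IsCopyOf F G'}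

/-- The `b`-blowup of a clause: replace each literal by the literal of the same polarity on
one of the `b` duplicates of its variable, in all possible ways. -/
def clauseBlowup [DecidableEq V] (b : ℕ) (C : SatClause V) :
    Finset (SatClause (V × Fin b)) :=
  (C.pi (fun _ => (Finset.univ : Finset (Fin b)))).image
    (fun g => C.attach.image (fun l => ((l.1.1, g l.1 l.2), l.1.2)))

/-- The `b`-blowup of a formula. -/
def formulaBlowup [DecidableEq V] (b : ℕ) (G : SatFormula V) : SatFormula (V × Fin b) :=
  G.biUnion (clauseBlowup b)

/-- The weight of a formula on `n` variables:
`wt(G) = Σ_i log₂(i+1)·α_i(G)` where `α_i(G)·C(n,k)` counts the `k`-sets of variables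
supporting exactly `i` clauses. -/
noncomputable def formulaWt (k n : ℕ) (G : SatFormula (Fin n)) : ℝ :=
  (∑ S ∈ (Finset.univ : Finset (Fin n)).powersetCard k,
    Real.logb 2 (((G.filter (fun C => clauseVars C = S)).card : ℝ) + 1)) / (n.choose k)

/-- A partially directed graph: a set of undirected edges together with a set of directed
(pointed) edges. -/
structure PDG (V : Type*) where
  undir : Finset (Finset V)
  dir : Finset (Finset V × V)

/-- `H` is a valid `k`-PDG: all edges have `k` vertices, each directed edge is pointed at one
of its vertices, and each `k`-set carries at most one edge (undirected or directed). -/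
def PDG.IsValid (k : ℕ) (H : PDG V) : Prop :=
  (∀ e ∈ H.undir, e.card = k) ∧
  (∀ p ∈ H.dir, p.1.card = k ∧ p.2 ∈ p.1) ∧
  (∀ p ∈ H.dir, p.1 ∉ H.undir) ∧
  (∀ p ∈ H.dir, ∀ q ∈ H.dir, p.1 = q.1 → p = q)

/-- `F` is a subgraph of `H`: a copy of `F` can be obtained from `H` by deleting vertices,
deleting edges, and/or forgetting directions of edges. -/
def PDG.IsSubgraph [DecidableEq V] (F : PDG W) (H : PDG V) : Prop :=
  ∃ φ : W → V, Function.Injective φ ∧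
    (∀ e ∈ F.undir, e.image φ ∈ H.undir ∨ ∃ v, (e.image φ, v) ∈ H.dir) ∧
    (∀ p ∈ F.dir, (p.1.image φ, φ p.2) ∈ H.dir)

/-- The image of a PDG under a relabeling of vertices. -/
def PDG.map [DecidableEq V] (φ : W → V) (F : PDG W) : PDG V :=
  ⟨F.undir.image (Finset.image φ), F.dir.image (fun p => (p.1.image φ, φ p.2))⟩

/-- The PDG `T_k` on vertex set `{0, …, k}` (0-indexed): undirected edges everything-but-`k`
and everything-but-`k-2`, and the edge everything-but-`k-1` directed toward `k`. -/
def TkPDG (k : ℕ) : PDG (Fin (k + 1)) where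
  undir := { Finset.univ.erase ⟨k, Nat.lt_succ_self k⟩,
             Finset.univ.erase ⟨k - 2, by omega⟩ }
  dir := { (Finset.univ.erase ⟨k - 1, by omega⟩, ⟨k, Nat.lt_succ_self k⟩) }

/-- A semisimple formula: every `k`-set of variables supports at most one clause, or exactly
two clauses whose polarities differ on exactly one variable. -/
def SemisimpleFormula [DecidableEq V] (G : SatFormula V) : Prop :=
  ∀ C₁ ∈ G, ∀ C₂ ∈ G, C₁ ≠ C₂ → clauseVars C₁ = clauseVars C₂ →
    (((C₁ \ C₂).image Prod.fst).card = 1 ∧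
      ∀ C₃ ∈ G, clauseVars C₃ = clauseVars C₁ → C₃ = C₁ ∨ C₃ = C₂)

/-- The type of a (semisimple) formula: an undirected edge on each variable set supporting
exactly one clause, and for each variable set supporting two clauses a directed edge pointed
at the variable where the two clauses differ. -/
def formulaType [DecidableEq V] (G : SatFormula V) : PDG V where
  undir := (G.filter (fun C => ∀ C' ∈ G, clauseVars C' = clauseVars C → C' = C)).image
    clauseVars
  dir := ((G ×ˢ G).filter (fun p => p.1 ≠ p.2 ∧ clauseVars p.1 = clauseVars p.2)).biUnion
    (fun p => ((p.1 \ p.2).image Prod.fst).image (fun v => (clauseVars p.1, v)))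

end Defs

namespace KSat

open Finset

set_option linter.unusedSectionVars false

section

variable {V : Type*} [Fintype V] [DecidableEq V]

instance (k : ℕ) (C : SatClause V) : Decidable (IsKClause k C) :=
  inferInstanceAs (Decidable (_ ∧ _))

open scoped Classical in
/-- The minimal `k`-SAT formulae on the variable set `V`. -/
noncomputable def minimalFormulas (k : ℕ) (V : Type*) [Fintype V] [DecidableEq V] :
    Finset (SatFormula V) :=
  univ.filter (fun G => IsKFormula k G ∧ MinimalFormula G)

/-- All `k`-SAT clauses on the variable set `V`. -/
def kClauses (k : ℕ) (V : Type*) [Fintype V] [DecidableEq V] : Finset (SatClause V) :=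
  univ.filter (IsKClause k)

/-- The clause on variable set `S` with polarities read off from `σ`. -/
def signedClause (σ : V → Bool) (S : Finset V) : SatClause V := S.image (fun v => (v, σ v))

omit [Fintype V] in
theorem mem_signedClause {σ : V → Bool} {S : Finset V} {l : V × Bool} :
    l ∈ signedClause σ S ↔ l.1 ∈ S ∧ l.2 = σ l.1 := by
  obtain ⟨v, b⟩ := l
  simp only [signedClause, mem_image, Prod.mk.injEq]
  constructor
  · rintro ⟨a, ha, rfl, rfl⟩; exact ⟨ha, rfl⟩
  · rintro ⟨h, rfl⟩; exact ⟨v, h, rfl, rfl⟩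

omit [Fintype V] in
@[simp] theorem clauseVars_signedClause (σ : V → Bool) (S : Finset V) :
    clauseVars (signedClause σ S) = S := by
  ext v; simp [clauseVars, mem_signedClause]

omit [Fintype V] in
theorem card_signedClause (σ : V → Bool) (S : Finset V) : (signedClause σ S).card = S.card :=
  card_image_of_injective _ fun _ _ h => (Prod.mk.inj h).1

omit [Fintype V] in
theorem isKClause_signedClause {k : ℕ} {σ : V → Bool} {S : Finset V} :
    IsKClause k (signedClause σ S) ↔ S.card = k := by
  simp [IsKClause, card_signedClause]

omit [Fintype V] in
theorem satisfies_signedClause {w σ : V → Bool} {S : Finset V} :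
    SatisfiesClause w (signedClause σ S) ↔ ∀ v ∈ S, w v = σ v := by
  constructor
  · intro h v hv; exact h (v, σ v) (mem_signedClause.2 ⟨hv, rfl⟩)
  · rintro h ⟨v, b⟩ hl
    obtain ⟨h1, h2⟩ := mem_signedClause.1 hl
    simp only at h1 h2 ⊢; rw [h2]; exact h v h1

omit [Fintype V] in
theorem signedClause_congr {σ τ : V → Bool} {S : Finset V} :
    signedClause σ S = signedClause τ S ↔ ∀ v ∈ S, σ v = τ v := by
  constructor
  · intro h v hv
    have : (v, σ v) ∈ signedClause τ S := h ▸ mem_signedClause.2 ⟨hv, rfl⟩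
    exact (mem_signedClause.1 this).2
  · intro h
    exact image_congr fun v hv => by rw [h v hv]

omit [Fintype V] in
theorem _root_.IsKClause.polarity_unique {k : ℕ} {C : SatClause V} (h : IsKClause k C) {v : V} {b b' : Bool}
    (hb : (v, b) ∈ C) (hb' : (v, b') ∈ C) : b = b' := by
  have hinj : Set.InjOn Prod.fst (C : Set (V × Bool)) :=
    card_image_iff.1 (h.2.trans h.1.symm)
  exact (Prod.mk.inj (hinj hb hb' rfl)).2

/-- The polarities used by a clause (`false` off its variables). -/
def clauseSign (C : SatClause V) (v : V) : Bool := decide ((v, true) ∈ C)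

omit [Fintype V] in
theorem mem_clauseVars {C : SatClause V} {v : V} : v ∈ clauseVars C ↔ ∃ b, (v, b) ∈ C := by
  simp [clauseVars]

omit [Fintype V] in
theorem _root_.IsKClause.eq_signedClause {k : ℕ} {C : SatClause V} (h : IsKClause k C) :
    C = signedClause (clauseSign C) (clauseVars C) := by
  ext ⟨v, b⟩
  rw [mem_signedClause, mem_clauseVars]
  simp only [clauseSign]
  constructor
  · intro hb
    refine ⟨⟨b, hb⟩, ?_⟩
    cases b
    · by_contra hne
      have h1 : (v, true) ∈ C := by simpa using hne
      exact Bool.noConfusion (h.polarity_unique hb h1)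
    · simpa using hb
  · rintro ⟨⟨b', hb'⟩, hb⟩
    by_cases h1 : (v, true) ∈ C
    · simp [hb, h1]
    · cases b'
      · simpa [hb, h1] using hb'
      · exact absurd hb' h1

omit [Fintype V] in
theorem _root_.IsKClause.sign_of_mem {k : ℕ} {C : SatClause V} (h : IsKClause k C) {v : V} {b : Bool}
    (hb : (v, b) ∈ C) : clauseSign C v = b := by
  rw [h.eq_signedClause] at hb
  exact (mem_signedClause.1 hb).2.symm

omit [Fintype V] in
theorem _root_.IsKClause.mem_iff {k : ℕ} {C : SatClause V} (h : IsKClause k C) {v : V} {b : Bool} :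
    (v, b) ∈ C ↔ v ∈ clauseVars C ∧ clauseSign C v = b := by
  constructor
  · intro hb; exact ⟨mem_clauseVars.2 ⟨b, hb⟩, h.sign_of_mem hb⟩
  · rintro ⟨h1, rfl⟩
    have : (v, clauseSign C v) ∈ signedClause (clauseSign C) (clauseVars C) :=
      mem_signedClause.2 ⟨h1, rfl⟩
    rwa [← h.eq_signedClause] at this

theorem mem_minimalFormulas {k : ℕ} {G : SatFormula V} :
    G ∈ minimalFormulas k V ↔ IsKFormula k G ∧ MinimalFormula G := by
  simp [minimalFormulas]

theorem mem_kClauses {k : ℕ} {C : SatClause V} : C ∈ kClauses k V ↔ IsKClause k C := by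
  simp [kClauses]

theorem isKFormula_iff {k : ℕ} {G : SatFormula V} : IsKFormula k G ↔ G ⊆ kClauses k V := by
  simp [IsKFormula, subset_iff, mem_kClauses]

theorem card_kClauses_le (k : ℕ) : (kClauses k V).card ≤ (2 * Fintype.card V) ^ k := by
  calc (kClauses k V).card ≤ (univ.powersetCard k : Finset (Finset (V × Bool))).card := by
        apply card_le_card
        intro C hC
        simp [mem_powersetCard, (mem_kClauses.1 hC).1]
    _ = (2 * Fintype.card V).choose k := by
        rw [card_powersetCard, card_univ, Fintype.card_prod, Fintype.card_bool, mul_comm]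
    _ ≤ _ := Nat.choose_le_pow _ _

omit [Fintype V] [DecidableEq V] in
theorem _root_.MinimalFormula.mono {G H : SatFormula V} (h : MinimalFormula G) (hH : H ⊆ G) :
    MinimalFormula H := by
  intro C hC
  obtain ⟨w, hw, hw'⟩ := h C (hH hC)
  exact ⟨w, hw, fun C' hC' => hw' C' (hH hC')⟩

/-- A set of size `N` has at most `(N + 1) ^ m` subsets of size at most `m`. -/
theorem card_subsets_le {α : Type*} [DecidableEq α] (Ω : Finset α) (m : ℕ) :
    (Ω.powerset.filter (fun E => E.card ≤ m)).card ≤ (Ω.card + 1) ^ m := by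
  induction m with
  | zero =>
    simp only [Nat.le_zero, card_eq_zero, pow_zero]
    refine card_le_one.2 fun a ha b hb => ?_
    rw [(mem_filter.1 ha).2, (mem_filter.1 hb).2]
  | succ m ih =>
    calc _ ≤ ((Ω.powerset.filter (fun E => E.card ≤ m) ×ˢ insertNone Ω).image
          (fun p => p.2.elim p.1 (fun x => insert x p.1))).card := by
          apply card_le_card
          intro E hE
          obtain ⟨h1, h2⟩ := mem_filter.1 hE
          rw [mem_powerset] at h1
          rcases E.eq_empty_or_nonempty with rfl | ⟨x, hx⟩
          · exact mem_image.2 ⟨(∅, none), by simp, rfl⟩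
          · refine mem_image.2 ⟨(E.erase x, some x), ?_, by simp [insert_erase hx]⟩
            simp only [mem_product, mem_filter, mem_powerset, some_mem_insertNone]
            refine ⟨⟨(erase_subset _ _).trans h1, ?_⟩, h1 hx⟩
            rw [card_erase_of_mem hx]; omega
      _ ≤ _ := card_image_le
      _ ≤ _ := by
          rw [card_product, card_insertNone, pow_succ]
          gcongr

/-- The `k`-uniform hypergraphs on `V` without isolated vertices. -/
def coveringHypergraphs (k : ℕ) (V : Type*) [Fintype V] [DecidableEq V] :
    Finset (Finset (Finset V)) :=
  ((univ.powersetCard k : Finset (Finset V)).powerset).filter (fun H => ∀ v, ∃ S ∈ H, v ∈ S)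

theorem card_coveringHypergraphs (k : ℕ) :
    2 ^ (Fintype.card V).choose k ≤ (coveringHypergraphs k V).card +
      Fintype.card V * 2 ^ (Fintype.card V - 1).choose k := by
  have hsub : ((univ.powersetCard k : Finset (Finset V)).powerset) ⊆
      coveringHypergraphs k V ∪
        univ.biUnion (fun v : V => ((univ.erase v).powersetCard k).powerset) := by
    intro H hH
    by_cases h : ∀ v, ∃ S ∈ H, v ∈ S
    · exact mem_union_left _ (mem_filter.2 ⟨hH, h⟩)
    · push Not at h
      obtain ⟨v, hv⟩ := h
      refine mem_union_right _ (mem_biUnion.2 ⟨v, mem_univ _, mem_powerset.2 fun S hS => ?_⟩)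
      have := mem_powersetCard.1 (mem_powerset.1 hH hS)
      exact mem_powersetCard.2 ⟨fun x hx => mem_erase.2
        ⟨fun hxv => hv S hS (hxv ▸ hx), mem_univ _⟩, this.2⟩
  calc 2 ^ (Fintype.card V).choose k
      = ((univ.powersetCard k : Finset (Finset V)).powerset).card := by
        rw [card_powerset, card_powersetCard, card_univ]
    _ ≤ _ := (card_le_card hsub).trans (card_union_le _ _)
    _ ≤ _ := by
        gcongr
        refine card_biUnion_le.trans ?_
        simp [card_powerset, card_powersetCard, card_erase_of_mem]

theorem card_minimalFormulas_ge (k : ℕ) :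
    2 ^ Fintype.card V * (coveringHypergraphs k V).card ≤ (minimalFormulas k V).card := by
  classical
  have : 2 ^ Fintype.card V = (univ : Finset (V → Bool)).card := by simp
  rw [this, ← card_product]
  refine card_le_card_of_injOn (fun p => p.2.image (signedClause p.1)) ?_ ?_
  · rintro ⟨σ, H⟩ hp
    obtain ⟨-, hH⟩ := mem_product.1 (mem_coe.1 hp)
    obtain ⟨hH, -⟩ := mem_filter.1 hH
    rw [mem_powerset] at hH
    rw [mem_coe, mem_minimalFormulas]
    refine ⟨?_, ?_⟩
    · intro C hC
      obtain ⟨S, hS, rfl⟩ := mem_image.1 hC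
      exact isKClause_signedClause.2 (mem_powersetCard.1 (hH hS)).2
    · intro C hC
      obtain ⟨S, hS, rfl⟩ := mem_image.1 hC
      refine ⟨fun v => if v ∈ S then σ v else !σ v, satisfies_signedClause.2 fun v hv => by
        simp [hv], ?_⟩
      intro C' hC' hsat
      obtain ⟨S', hS', rfl⟩ := mem_image.1 hC'
      rw [satisfies_signedClause] at hsat
      have hss : S' ⊆ S := by
        intro v hv
        by_contra hvS
        simpa [hvS] using hsat v hv
      rw [eq_of_subset_of_card_le hss]
      rw [(mem_powersetCard.1 (hH hS)).2, (mem_powersetCard.1 (hH hS')).2]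
  · rintro ⟨σ, H⟩ hp ⟨τ, H'⟩ hp' heq
    obtain ⟨-, hH⟩ := mem_product.1 (mem_coe.1 hp)
    simp only at heq hH
    obtain ⟨-, hcov⟩ := mem_filter.1 hH
    have hHH : H = H' := by
      have := congrArg (fun G => G.image clauseVars) heq
      simpa [image_image, Function.comp_def] using this
    subst hHH
    have hσ : σ = τ := by
      funext v
      obtain ⟨S, hS, hv⟩ := hcov v
      have : signedClause σ S ∈ H.image (signedClause τ) := heq ▸ mem_image_of_mem _ hS
      obtain ⟨S', hS', h'⟩ := mem_image.1 this
      have hSS : S' = S := by simpa using congrArg clauseVars h'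
      subst hSS
      exact (signedClause_congr.1 h' v hv).symm
    rw [hσ]

theorem two_pow_le_card_minimalFormulas (k : ℕ) :
    2 ^ (Fintype.card V + (Fintype.card V).choose k) ≤ (minimalFormulas k V).card +
      Fintype.card V * 2 ^ (Fintype.card V + (Fintype.card V - 1).choose k) := by
  have h1 := card_coveringHypergraphs (V := V) k
  have h2 := card_minimalFormulas_ge (V := V) k
  calc _ = 2 ^ Fintype.card V * 2 ^ (Fintype.card V).choose k := pow_add _ _ _
    _ ≤ 2 ^ Fintype.card V * _ := Nat.mul_le_mul_left _ h1
    _ ≤ _ := by rw [mul_add, pow_add]; nlinarith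

theorem le_choose {n j : ℕ} (hj : 1 ≤ j) (hjn : j < n) : n ≤ n.choose j := by
  induction n, hjn using Nat.le_induction with
  | base => simp [Nat.choose_succ_self_right]
  | succ n hn ih =>
    obtain ⟨i, rfl⟩ : ∃ i, j = i + 1 := ⟨j - 1, by omega⟩
    have hpos : 0 < n.choose i := Nat.choose_pos (by omega)
    rw [Nat.choose_succ_succ']; omega

theorem lower_bound (k : ℕ) (hk : 2 ≤ k) (ε : ℝ) (hε : 0 < ε) :
    ∃ n₀ : ℕ, ∀ n ≥ n₀, (1 - ε) * 2 ^ (n + n.choose k) ≤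
      ((minimalFormulas k (Fin n)).card : ℝ) := by
  have hlim : Filter.Tendsto (fun n : ℕ => (n : ℝ) ^ 1 * (1 / 2) ^ n) Filter.atTop (nhds 0) :=
    tendsto_pow_const_mul_const_pow_of_abs_lt_one 1 (by norm_num [abs_of_pos])
  obtain ⟨n₁, hn₁⟩ := Filter.eventually_atTop.1 (hlim.eventually (gt_mem_nhds (half_pos hε)))
  refine ⟨max n₁ (k + 2), fun n hn => ?_⟩
  have hnk : k + 2 ≤ n := le_trans (le_max_right _ _) hn
  have h1 := hn₁ n (le_trans (le_max_left _ _) hn)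
  have h2 := two_pow_le_card_minimalFormulas (V := Fin n) k
  rw [Fintype.card_fin] at h2
  have h2' : (2 : ℝ) ^ (n + n.choose k) ≤ (minimalFormulas k (Fin n)).card +
      n * 2 ^ (n + (n - 1).choose k) := by exact_mod_cast h2
  obtain ⟨m, rfl⟩ : ∃ m, n = m + 1 := ⟨n - 1, by omega⟩
  obtain ⟨j, rfl⟩ : ∃ j, k = j + 1 := ⟨k - 1, by omega⟩
  have h3 : m ≤ m.choose j := le_choose (by omega) (by omega)
  have h4 : ((m + 1 : ℕ) : ℝ) ≤ ε * 2 ^ m := by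
    have h5 : (0 : ℝ) < 2 ^ m := by positivity
    have : ((m + 1 : ℕ) : ℝ) * (1 / 2) ^ (m + 1) * 2 ^ (m + 1) < ε / 2 * 2 ^ (m + 1) := by
      gcongr; simpa using h1
    rw [mul_assoc, ← mul_pow] at this
    norm_num [pow_succ] at this
    push_cast; linarith
  have h6 : (2 : ℝ) ^ m ≤ 2 ^ m.choose j := pow_le_pow_right₀ (by norm_num) h3
  have h7 : ((m + 1 : ℕ) : ℝ) * 2 ^ (m + 1 + (m + 1 - 1).choose (j + 1)) ≤
      ε * 2 ^ (m + 1 + (m + 1).choose (j + 1)) := by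
    have h8 : m + 1 + (m + 1).choose (j + 1) = m.choose j + (m + 1 + m.choose (j + 1)) := by
      rw [Nat.choose_succ_succ']; ring
    rw [h8, Nat.add_sub_cancel, pow_add _ (m.choose j), ← mul_assoc]
    gcongr
    exact h4.trans (by gcongr)
  linarith

end

section

variable {V : Type*} [Fintype V] [DecidableEq V] {ι : Type*} [Fintype ι] [DecidableEq ι]

/-- The image of a clause under a relabelling of variables. -/
def mapClause {ι V : Type*} [DecidableEq V] (x : ι → V) (b : SatClause ι) : SatClause V :=
  b.image (fun l => (x l.1, l.2))

omit [Fintype V] [Fintype ι] in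
theorem clauseVars_mapClause (x : ι → V) (b : SatClause ι) :
    clauseVars (mapClause x b) = (clauseVars b).image x := by
  simp [clauseVars, mapClause, image_image, Function.comp_def]

omit [Fintype V] [Fintype ι] [DecidableEq ι] in
theorem satisfies_mapClause {x : ι → V} {b : SatClause ι} {w : V → Bool} :
    SatisfiesClause w (mapClause x b) ↔ SatisfiesClause (w ∘ x) b := by
  simp only [SatisfiesClause, mapClause, forall_mem_image, Function.comp]

/-- A pattern: a finite set of clauses, to be searched for in a formula. -/
abbrev Pattern (ι : Type*) := Finset (SatClause ι)

open scoped Classical in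
/-- The embeddings mapping every clause of the pattern `P` into `A`. -/
noncomputable def hits (A : SatFormula V) (P : Pattern ι) : Finset (ι → V) :=
  univ.filter (fun x => Function.Injective x ∧ ∀ b ∈ P, mapClause x b ∈ A)

/-- The functions agreeing with `y` off `W`. -/
def agreeOff (y : ι → V) (W : Finset ι) (T : Finset V) : Finset (ι → V) :=
  Fintype.piFinset (fun a => if a ∈ W then T else {y a})

omit [Fintype V] in
theorem card_agreeOff (y : ι → V) (W : Finset ι) (T : Finset V) :
    (agreeOff y W T).card = T.card ^ W.card := by
  rw [agreeOff, Fintype.card_piFinset, ← prod_const, ← prod_subset (subset_univ W)]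
  · exact prod_congr rfl fun a ha => by simp [ha]
  · intro a _ ha; simp [ha]

omit [Fintype V] in
theorem mem_agreeOff {y x : ι → V} {W : Finset ι} {T : Finset V} :
    x ∈ agreeOff y W T ↔ (∀ a ∈ W, x a ∈ T) ∧ ∀ a ∉ W, x a = y a := by
  rw [agreeOff, Fintype.mem_piFinset]
  constructor
  · intro h
    exact ⟨fun a ha => by simpa [ha] using h a, fun a ha => by simpa [ha] using h a⟩
  · rintro ⟨h1, h2⟩ a
    by_cases ha : a ∈ W
    · simpa [ha] using h1 a ha
    · simpa [ha] using h2 a ha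

theorem sum_card_filter_agreeOff (X : Finset (ι → V)) (W : Finset ι) :
    ∑ y : ι → V, (X.filter (fun x => ∀ a ∉ W, x a = y a)).card =
      Fintype.card V ^ W.card * X.card := by
  have := sum_card_bipartiteAbove_eq_sum_card_bipartiteBelow (s := (univ : Finset (ι → V))) (t := X)
    (fun y x => ∀ a ∉ W, x a = y a)
  simp only [bipartiteAbove, bipartiteBelow] at this
  rw [this, sum_congr rfl (g := fun _ => Fintype.card V ^ W.card)]
  · rw [sum_const, smul_eq_mul, mul_comm]
  · intro x _
    rw [← card_univ, ← card_agreeOff x W univ]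
    congr 1
    ext y
    simp [mem_agreeOff, eq_comm]

/-- Averaging over the values off `W`. -/
theorem exists_dense_slice (X X' : Finset (ι → V)) (W : Finset ι) (ρ : ℝ)
    (hρ : 0 < ρ) (h : (X'.card : ℝ) < ρ * X.card) :
    ∃ y : ι → V,
      ((X'.filter (fun x => ∀ a ∉ W, x a = y a)).card : ℝ) ≤
        2 * ρ * (X.filter (fun x => ∀ a ∉ W, x a = y a)).card ∧
      (Fintype.card V : ℝ) ^ W.card * X.card ≤
        2 * (Fintype.card V : ℝ) ^ Fintype.card ι *
          (X.filter (fun x => ∀ a ∉ W, x a = y a)).card := by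
  set n : ℝ := (Fintype.card V : ℝ) with hn
  have hXpos : 0 < (X.card : ℝ) := by
    by_contra h0
    have : (X.card : ℝ) = 0 := le_antisymm (not_lt.1 h0) (by positivity)
    rw [this, mul_zero] at h
    exact absurd h (not_lt.2 (by positivity))
  obtain ⟨x₀, -⟩ : X.Nonempty := card_pos.1 (by exact_mod_cast hXpos)
  by_cases hι : Nonempty ι
  swap
  · rw [not_nonempty_iff] at hι
    have hW : W = ∅ := Subsingleton.elim _ _
    subst hW
    refine ⟨x₀, ?_, ?_⟩
    · have : ∀ Z : Finset (ι → V), Z.filter (fun x => ∀ a ∉ (∅ : Finset ι), x a = x₀ a) = Z := by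
        intro Z; exact filter_true_of_mem fun x _ a => (hι.false a).elim
      rw [this, this]; nlinarith
    · have : ∀ Z : Finset (ι → V), Z.filter (fun x => ∀ a ∉ (∅ : Finset ι), x a = x₀ a) = Z := by
        intro Z; exact filter_true_of_mem fun x _ a => (hι.false a).elim
      rw [this]; simp; linarith
  have hnpos : 0 < n := by
    have : Nonempty V := ⟨x₀ hι.some⟩
    rw [hn]; exact_mod_cast Fintype.card_pos
  have h1 : ∑ y : ι → V, ((X.filter (fun x => ∀ a ∉ W, x a = y a)).card : ℝ) =
      n ^ W.card * X.card := by rw [hn]; exact_mod_cast sum_card_filter_agreeOff X W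
  have h2 : ∑ y : ι → V, ((X'.filter (fun x => ∀ a ∉ W, x a = y a)).card : ℝ) =
      n ^ W.card * X'.card := by rw [hn]; exact_mod_cast sum_card_filter_agreeOff X' W
  obtain ⟨y, -, hy⟩ : ∃ y ∈ (univ : Finset (ι → V)), ρ * n ^ W.card * X.card <
      n ^ Fintype.card ι * (2 * ρ * (X.filter (fun x => ∀ a ∉ W, x a = y a)).card -
        (X'.filter (fun x => ∀ a ∉ W, x a = y a)).card) := by
    apply exists_lt_of_sum_lt
    have hs : ∑ y : ι → V, n ^ Fintype.card ι *
        (2 * ρ * ((X.filter (fun x => ∀ a ∉ W, x a = y a)).card : ℝ) -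
          (X'.filter (fun x => ∀ a ∉ W, x a = y a)).card) =
        n ^ Fintype.card ι * (2 * ρ * (n ^ W.card * X.card) - n ^ W.card * X'.card) := by
      rw [← h1, ← h2, mul_sum, mul_sub, mul_sum, mul_sum, ← sum_sub_distrib]
      exact sum_congr rfl fun y _ => mul_sub _ _ _
    rw [hs, sum_const, card_univ, Fintype.card_fun, nsmul_eq_mul, Nat.cast_pow, ← hn]
    have : 0 < n ^ Fintype.card ι * n ^ W.card := by positivity
    nlinarith
  have hpos : 0 < n ^ Fintype.card ι := by positivity
  refine ⟨y, ?_, ?_⟩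
  · by_contra hlt
    push Not at hlt
    have : 0 ≤ ρ * n ^ W.card * X.card := by positivity
    nlinarith
  · have h3 : 0 ≤ n ^ Fintype.card ι * ((X'.filter (fun x => ∀ a ∉ W, x a = y a)).card : ℝ) := by
      positivity
    have : ρ * (n ^ W.card * X.card) ≤ ρ * (2 * n ^ Fintype.card ι *
          (X.filter (fun x => ∀ a ∉ W, x a = y a)).card) := by nlinarith
    exact le_of_mul_le_mul_left this hρ

open scoped Classical in
/-- The embeddings mapping `insert b S` into `A` and the remaining clauses of `P` into `E`. -/
noncomputable def mixedHits (A E : SatFormula V) (P S : Pattern ι) (b : SatClause ι) :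
    Finset (ι → V) :=
  univ.filter (fun x => Function.Injective x ∧ mapClause x b ∈ A ∧ (∀ c ∈ S, mapClause x c ∈ A) ∧
    ∀ c ∈ P, c ∉ S → c ≠ b → mapClause x c ∈ E)

/-- The clauses `b` takes under `mixedHits` when the embedding is `y` off the variables of `b`. -/
noncomputable def removedSet (A E : SatFormula V) (P S : Pattern ι) (b : SatClause ι)
    (y : ι → V) : SatFormula V :=
  ((mixedHits A E P S b).filter (fun x => ∀ a ∉ clauseVars b, x a = y a)).image
    (fun x => mapClause x b)

theorem exists_gap (A G : SatFormula V) (P : Pattern ι) (ρ η : ℝ) (hρ : 0 < ρ) (hρ1 : ρ ≤ 1)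
    (hη : 0 < η) (h0 : hits (G ∩ A) P = ∅) (h1 : η < (hits A P).card) :
    ∃ b ∈ P, ∃ S ⊆ P, ρ ^ P.card * η ≤ (mixedHits A (G ∩ A) P S b).card ∧
      (((mixedHits A (G ∩ A) P S b).filter (fun x => mapClause x b ∈ G)).card : ℝ) <
        ρ * (mixedHits A (G ∩ A) P S b).card := by
  classical
  by_contra hcon
  push Not at hcon
  let N : Pattern ι → Finset (ι → V) := fun S => univ.filter (fun x => Function.Injective x ∧
    (∀ c ∈ S, mapClause x c ∈ A) ∧ ∀ c ∈ P, c ∉ S → mapClause x c ∈ G ∩ A)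
  have key : ∀ T ⊆ P, ((N T).card : ℝ) ≤ ρ ^ (P.card - T.card) * η := by
    intro T
    induction T using Finset.induction_on with
    | empty =>
      intro _
      have : N ∅ = hits (G ∩ A) P := by simp [N, hits]
      rw [this, h0, card_empty, Nat.cast_zero]; positivity
    | insert b S hbS ih =>
      intro hT
      have hb : b ∈ P := hT (mem_insert_self _ _)
      have hS : S ⊆ P := (subset_insert _ _).trans hT
      have e1 : N (insert b S) = mixedHits A (G ∩ A) P S b := by
        ext x
        simp only [N, mixedHits, mem_filter, mem_univ, true_and, mem_insert,
          not_or]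
        grind
      have e2 : N S = (mixedHits A (G ∩ A) P S b).filter (fun x => mapClause x b ∈ G) := by
        ext x
        simp only [N, mixedHits, mem_filter, mem_univ, true_and, and_assoc]
        constructor
        · rintro ⟨h1, h2, h3⟩
          exact ⟨h1, (mem_inter.1 (h3 b hb hbS)).2, h2, fun c hc hcS _ => h3 c hc hcS,
            (mem_inter.1 (h3 b hb hbS)).1⟩
        · rintro ⟨h1, h2, h3, h4, h5⟩
          refine ⟨h1, h3, fun c hc hcS => ?_⟩
          by_cases hcb : c = b
          · rw [hcb]; exact mem_inter.2 ⟨h5, h2⟩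
          · exact h4 c hc hcS hcb
      by_contra hlt
      push Not at hlt
      have hcard : S.card + 1 ≤ P.card := by
        rw [← card_insert_of_notMem hbS]; exact card_le_card hT
      have h2 : ρ ^ P.card * η ≤ (mixedHits A (G ∩ A) P S b).card := by
        rw [← e1]
        refine le_trans ?_ hlt.le
        gcongr ?_ * _
        exact pow_le_pow_of_le_one hρ.le hρ1 (Nat.sub_le _ _)
      have h3 := hcon b hb S hS h2
      rw [← e2, ← e1] at h3
      have h4 := ih hS
      rw [card_insert_of_notMem hbS] at hlt
      have h5 : P.card - S.card = (P.card - (S.card + 1)) + 1 := by omega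
      rw [h5, pow_succ] at h4
      nlinarith
  have := key P subset_rfl
  have e : N P = hits A P := by
    ext x; simp +contextual [N, hits]
  rw [e, Nat.sub_self, pow_zero, one_mul] at this
  linarith

theorem card_removedSet {A E : SatFormula V} {P S : Pattern ι} {b : SatClause ι} {y : ι → V} :
    ((mixedHits A E P S b).filter (fun x => ∀ a ∉ clauseVars b, x a = y a)).card ≤
      (clauseVars b).card ^ (clauseVars b).card * (removedSet A E P S b y).card := by
  classical
  refine card_le_mul_card_image _ _ fun C hC => ?_
  obtain ⟨x₀, hx₀, rfl⟩ := mem_image.1 hC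
  have hinj : Function.Injective x₀ := (mem_filter.1 (mem_filter.1 hx₀).1).2.1
  calc _ ≤ (agreeOff y (clauseVars b) (clauseVars (mapClause x₀ b))).card := by
        apply card_le_card
        intro x hx
        obtain ⟨hx1, hx2⟩ := mem_filter.1 hx
        refine mem_agreeOff.2 ⟨fun a ha => ?_, (mem_filter.1 hx1).2⟩
        rw [← hx2, clauseVars_mapClause]
        exact mem_image_of_mem _ ha
    _ = _ := by
        rw [card_agreeOff, clauseVars_mapClause, card_image_of_injective _ hinj]

/-- The clauses having a variable in the range of `y`. -/
def clausesMeeting (k : ℕ) (y : ι → V) : SatFormula V :=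
  (kClauses k V).filter (fun C => ∃ a, y a ∈ clauseVars C)

theorem card_clausesMeeting_le (k : ℕ) (y : ι → V) :
    (clausesMeeting (k + 1) y).card ≤
      2 * Fintype.card ι * (2 * Fintype.card V) ^ k := by
  calc _ ≤ ((univ : Finset (ι × Bool)).biUnion (fun p =>
        ((univ : Finset (V × Bool)).powersetCard k).image
          (fun L => insert (y p.1, p.2) L))).card := by
        apply card_le_card
        intro C hC
        obtain ⟨hC, a, ha⟩ := mem_filter.1 hC
        obtain ⟨s, hs⟩ := mem_clauseVars.1 ha
        refine mem_biUnion.2 ⟨(a, s), mem_univ _, mem_image.2 ⟨C.erase (y a, s), ?_,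
          insert_erase hs⟩⟩
        rw [mem_powersetCard, card_erase_of_mem hs, (mem_kClauses.1 hC).1]
        exact ⟨subset_univ _, rfl⟩
    _ ≤ ∑ p : ι × Bool, (2 * Fintype.card V) ^ k := by
        refine card_biUnion_le.trans (sum_le_sum fun p _ => card_image_le.trans ?_)
        rw [card_powersetCard, card_univ, Fintype.card_prod, Fintype.card_bool, mul_comm]
        exact Nat.choose_le_pow _ _
    _ = _ := by
        rw [sum_const, card_univ, Fintype.card_prod, Fintype.card_bool, smul_eq_mul]; ring

/-- No clause of the pattern has its variables contained in those of another one. -/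
def IsAntichainPattern (P : Pattern ι) : Prop :=
  ∀ b ∈ P, ∀ c ∈ P, c ≠ b → ∃ a ∈ clauseVars c, a ∉ clauseVars b

theorem removedSet_congr {k : ℕ} {A E : SatFormula V} {P S : Pattern ι} {b : SatClause ι}
    {y : ι → V} (hP : IsAntichainPattern P) (hb : b ∈ P) (hE : E ⊆ kClauses k V) :
    removedSet A (E ∩ clausesMeeting k y) P S b y = removedSet A E P S b y := by
  unfold removedSet
  congr 1
  ext x
  simp only [mem_filter, mixedHits, mem_univ, true_and]
  refine and_congr_left fun hx => ?_
  refine and_congr_right fun _ => and_congr_right fun _ => and_congr_right fun _ => ?_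
  refine forall_congr' fun c => forall_congr' fun hc => forall_congr' fun _ =>
    forall_congr' fun hcb => ?_
  rw [mem_inter, and_iff_left_of_imp]
  intro hcE
  obtain ⟨a, ha, hab⟩ := hP b hb c hc hcb
  refine mem_filter.2 ⟨hE hcE, a, ?_⟩
  rw [← hx a hab, clauseVars_mapClause]
  exact mem_image_of_mem _ ha

theorem container_iteration {α : Type*} [DecidableEq α] (Ω : Finset α)
    (next : Finset α → Finset (Finset α)) (M : ℕ) (hM : ∀ A, (next A).card ≤ M)
    (Sparse Good : Finset α → Prop) (δ β : ℝ)
    (h : ∀ G, Good G → ∀ A ⊆ Ω, ¬ Sparse A → ∃ A' ∈ next A, A' ⊆ A ∧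
      δ ≤ (A.card : ℝ) - A'.card ∧ (((G ∩ A) \ A').card : ℝ) ≤ β * ((A.card : ℝ) - A'.card))
    (s : ℕ) :
    ∃ F : Finset (Finset α), F.card ≤ (1 + M) ^ s ∧ ∀ G, Good G → G ⊆ Ω →
      ∃ A ∈ F, A ⊆ Ω ∧ ((G \ A).card : ℝ) ≤ β * ((Ω.card : ℝ) - A.card) ∧
        (Sparse A ∨ s * δ ≤ (Ω.card : ℝ) - A.card) := by
  induction s with
  | zero =>
    refine ⟨{Ω}, by simp, fun G _ hG => ⟨Ω, by simp, subset_rfl, ?_, Or.inr (by simp)⟩⟩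
    simp [sdiff_eq_empty_iff_subset.2 hG]
  | succ s ih =>
    obtain ⟨F, hF, hFG⟩ := ih
    refine ⟨F ∪ F.biUnion next, ?_, fun G hG hGΩ => ?_⟩
    · calc _ ≤ F.card + F.card * M :=
            (card_union_le _ _).trans (Nat.add_le_add_left (card_biUnion_le_card_mul _ _ _
              fun A _ => hM A) _)
        _ = F.card * (1 + M) := by ring
        _ ≤ _ := by rw [pow_succ]; gcongr
    · obtain ⟨A, hA, hAΩ, hGA, hsp⟩ := hFG G hG hGΩ
      by_cases hs : Sparse A
      · exact ⟨A, mem_union_left _ hA, hAΩ, hGA, Or.inl hs⟩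
      · obtain ⟨A', hA', hsub, hδ, hβ⟩ := h G hG A hAΩ hs
        refine ⟨A', mem_union_right _ (mem_biUnion.2 ⟨A, hA, hA'⟩), hsub.trans hAΩ, ?_, Or.inr ?_⟩
        · have h1 : (G \ A').card ≤ (G \ A).card + ((G ∩ A) \ A').card := by
            refine (card_le_card fun x hx => ?_).trans (card_union_le _ _)
            simp only [mem_union, mem_sdiff, mem_inter] at hx ⊢
            tauto
          have h2 : ((G \ A').card : ℝ) ≤ (G \ A).card + ((G ∩ A) \ A').card := by
            exact_mod_cast h1
          linarith
        · have := hsp.resolve_left hs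
          push_cast; linarith

/-- The sets obtained from `A` by one removal step. -/
noncomputable def nextContainers (k : ℕ) (ι : Type*) [Fintype ι] [DecidableEq ι]
    (A : SatFormula V) : Finset (SatFormula V) :=
  (univ : Finset ((Pattern ι × Pattern ι × SatClause ι) × (ι → V))).biUnion (fun p =>
    (clausesMeeting k p.2).powerset.image
      (fun E => A \ removedSet A E p.1.1 p.1.2.1 p.1.2.2 p.2))

/-- The number of patterns with two marked sub-structures. -/
def patternConst (ι : Type*) [Fintype ι] [DecidableEq ι] : ℕ :=
  Fintype.card (Pattern ι × Pattern ι × SatClause ι)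

theorem card_nextContainers_le {k : ℕ} (hk : 1 ≤ k) (A : SatFormula V) :
    (nextContainers k ι A).card ≤ patternConst ι * Fintype.card V ^ Fintype.card ι *
      2 ^ (2 * Fintype.card ι * (2 * Fintype.card V) ^ (k - 1)) := by
  obtain ⟨k, rfl⟩ : ∃ j, k = j + 1 := ⟨k - 1, by omega⟩
  refine (card_biUnion_le_card_mul _ _ (2 ^ (2 * Fintype.card ι * (2 * Fintype.card V) ^ k))
    fun p _ => ?_).trans ?_
  · refine card_image_le.trans ?_
    rw [card_powerset]
    exact Nat.pow_le_pow_right (by norm_num) (card_clausesMeeting_le k p.2)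
  · rw [card_univ, Fintype.card_prod, Fintype.card_fun]; rfl

theorem container_step {k : ℕ} (hk : 1 ≤ k) {P : Pattern ι} (hP : IsAntichainPattern P)
    (hPk : ∀ b ∈ P, IsKClause k b) {A G : SatFormula V} (hA : A ⊆ kClauses k V)
    (hG : hits G P = ∅) {ρ ε : ℝ} (hρ : 0 < ρ) (hρ1 : ρ ≤ 1) (hε : 0 < ε)
    (hV : 0 < Fintype.card V)
    (hd : ε * Fintype.card V ^ Fintype.card ι < (hits A P).card) :
    ∃ A' ∈ nextContainers k ι A, A' ⊆ A ∧
      ρ ^ P.card * ε * Fintype.card V ^ k / (2 * k ^ k) ≤ (A.card : ℝ) - A'.card ∧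
      (((G ∩ A) \ A').card : ℝ) ≤ 2 * ρ * k ^ k * ((A.card : ℝ) - A'.card) := by
  classical
  have hn : (0 : ℝ) < Fintype.card V := by exact_mod_cast hV
  have hG' : hits (G ∩ A) P = ∅ := by
    rw [eq_empty_iff_forall_notMem] at hG ⊢
    intro x hx
    apply hG x
    simp only [hits, mem_filter, mem_univ, true_and, mem_inter] at hx ⊢
    exact ⟨hx.1, fun b hb => (hx.2 b hb).1⟩
  obtain ⟨b, hb, S, hS, h1, h2⟩ := exists_gap A G P ρ (ε * Fintype.card V ^ Fintype.card ι) hρ hρ1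
    (by positivity) hG' hd
  set X := mixedHits A (G ∩ A) P S b with hX
  obtain ⟨y, hy1, hy2⟩ := exists_dense_slice X (X.filter (fun x => mapClause x b ∈ G))
    (clauseVars b) ρ hρ h2
  set D := removedSet A (G ∩ A) P S b y with hD
  have hDA : D ⊆ A := by
    intro C hC
    obtain ⟨x, hx, rfl⟩ := mem_image.1 hC
    exact (mem_filter.1 (mem_filter.1 hx).1).2.2.1
  have hcard : ((A \ D).card : ℝ) = A.card - D.card := by
    rw [card_sdiff_of_subset hDA, Nat.cast_sub (card_le_card hDA)]
  have hbk := (hPk b hb).2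
  have h3 : ((X.filter (fun x => ∀ a ∉ clauseVars b, x a = y a)).card : ℝ) ≤ k ^ k * D.card := by
    have := card_removedSet (A := A) (E := G ∩ A) (P := P) (S := S) (b := b) (y := y)
    rw [hbk] at this
    exact_mod_cast this
  have hkk : (0 : ℝ) < k ^ k := by positivity
  refine ⟨A \ D, ?_, sdiff_subset, ?_, ?_⟩
  · refine mem_biUnion.2 ⟨((P, S, b), y), mem_univ _, mem_image.2
      ⟨(G ∩ A) ∩ clausesMeeting k y, mem_powerset.2 inter_subset_right, ?_⟩⟩
    simp only
    rw [removedSet_congr hP hb (inter_subset_right.trans hA)]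
  · rw [hcard, sub_sub_cancel, div_le_iff₀ (by positivity)]
    rw [hbk] at hy2
    have hm : (0 : ℝ) < (Fintype.card V : ℝ) ^ Fintype.card ι := by positivity
    have h4 : (Fintype.card V : ℝ) ^ k * (ρ ^ P.card * (ε * Fintype.card V ^ Fintype.card ι)) ≤
        2 * (Fintype.card V : ℝ) ^ Fintype.card ι * (k ^ k * D.card) := by
      calc _ ≤ _ := mul_le_mul_of_nonneg_left h1 (by positivity)
        _ ≤ _ := hy2
        _ ≤ _ := by gcongr
    refine le_of_mul_le_mul_left ?_ hm
    linarith
  · have hGD : (G ∩ A) \ (A \ D) = (G ∩ A) ∩ D := by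
      ext C; simp only [mem_sdiff, mem_inter]; tauto
    rw [hcard, sub_sub_cancel, hGD]
    have h5 : ((G ∩ A) ∩ D).card ≤
        ((X.filter (fun x => mapClause x b ∈ G)).filter (fun x => ∀ a ∉ clauseVars b, x a = y a)).card := by
      refine (card_le_card fun C hC => ?_).trans (card_image_le (f := fun x => mapClause x b))
      obtain ⟨hC1, hC2⟩ := mem_inter.1 hC
      obtain ⟨x, hx, rfl⟩ := mem_image.1 hC2
      obtain ⟨hx1, hx2⟩ := mem_filter.1 hx
      exact mem_image.2 ⟨x, mem_filter.2 ⟨mem_filter.2 ⟨hx1, (mem_inter.1 hC1).1⟩, hx2⟩, rfl⟩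
    have h6 : (((G ∩ A) ∩ D).card : ℝ) ≤ _ := (Nat.cast_le.2 h5).trans hy1
    calc _ ≤ _ := h6
      _ ≤ 2 * ρ * (k ^ k * D.card) := by gcongr
      _ = _ := by ring

/-- A family of containers for the formulae avoiding all the patterns of `Π`. -/
theorem exists_containers {k : ℕ} (hk : 1 ≤ k) (hV : 0 < Fintype.card V)
    (Ps : Finset (Pattern ι)) (r : ℕ)
    (hP : ∀ P ∈ Ps, IsAntichainPattern P ∧ P.card ≤ r ∧ ∀ b ∈ P, IsKClause k b)
    {ρ ε : ℝ} (hρ : 0 < ρ) (hρ1 : ρ ≤ 1) (hε : 0 < ε) (s : ℕ)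
    (hs : 2 * (2 * k) ^ k < s * (ρ ^ r * ε)) :
    ∃ F : Finset (SatFormula V),
      F.card ≤ (1 + patternConst ι * Fintype.card V ^ Fintype.card ι *
        2 ^ (2 * Fintype.card ι * (2 * Fintype.card V) ^ (k - 1))) ^ s ∧
      ∀ G ⊆ kClauses k V, (∀ P ∈ Ps, hits G P = ∅) → ∃ A ∈ F, A ⊆ kClauses k V ∧
        ((G \ A).card : ℝ) ≤ 2 * ρ * k ^ k * (2 * Fintype.card V) ^ k ∧
        ∀ P ∈ Ps, ((hits A P).card : ℝ) ≤ ε * Fintype.card V ^ Fintype.card ι := by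
  have hn : (0 : ℝ) < Fintype.card V := by exact_mod_cast hV
  obtain ⟨F, hF, hFG⟩ := container_iteration (kClauses k V) (nextContainers k ι) _
    (card_nextContainers_le hk)
    (fun A => ∀ P ∈ Ps, ((hits A P).card : ℝ) ≤ ε * Fintype.card V ^ Fintype.card ι)
    (fun G => ∀ P ∈ Ps, hits G P = ∅) (ρ ^ r * ε * Fintype.card V ^ k / (2 * k ^ k))
    (2 * ρ * k ^ k) (fun G hG A hA hsp => by
      push Not at hsp
      obtain ⟨P, hPs, hlt⟩ := hsp
      obtain ⟨h1, h2, h3⟩ := hP P hPs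
      obtain ⟨A', h4, h5, h6, h7⟩ := container_step hk h1 h3 hA (hG P hPs) hρ hρ1 hε hV hlt
      refine ⟨A', h4, h5, le_trans ?_ h6, h7⟩
      gcongr ?_ * _ * _ / _
      exact pow_le_pow_of_le_one hρ.le hρ1 h2) s
  have hΩ : ((kClauses k V).card : ℝ) ≤ (2 * Fintype.card V) ^ k := by
    exact_mod_cast card_kClauses_le k
  refine ⟨F, hF, fun G hG hGP => ?_⟩
  obtain ⟨A, hA, hAΩ, hGA, hor⟩ := hFG G hGP hG
  have hA0 : (0 : ℝ) ≤ A.card := by positivity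
  refine ⟨A, hA, hAΩ, hGA.trans (by gcongr; linarith), hor.resolve_right ?_⟩
  intro hcon
  have h1 : (s * (ρ ^ r * ε * Fintype.card V ^ k / (2 * k ^ k)) : ℝ) ≤ (2 * Fintype.card V) ^ k := by
    linarith
  have hkk : (0 : ℝ) < 2 * (k : ℝ) ^ k := by positivity
  rw [← mul_div_assoc, div_le_iff₀ hkk] at h1
  have hnk : (0 : ℝ) < (Fintype.card V : ℝ) ^ k := by positivity
  have h2 : (s * (ρ ^ r * ε)) * (Fintype.card V : ℝ) ^ k ≤ (2 * (2 * k) ^ k) * Fintype.card V ^ k := by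
    calc _ = (s : ℝ) * (ρ ^ r * ε * Fintype.card V ^ k) := by ring
      _ ≤ _ := h1
      _ = _ := by rw [mul_pow, mul_pow]; ring
  exact absurd (le_of_mul_le_mul_right h2 hnk) (not_le.2 hs)

end

section

variable {V : Type*} [Fintype V] [DecidableEq V]

/-- Iterated Cauchy–Schwarz: the box-blow-up inequality. -/
theorem blowup_inequality (m : ℕ) (F : (Fin m → V) → ℝ) (hF : ∀ x, 0 ≤ F x) :
    (∑ x, F x) ^ 2 ^ m * (Fintype.card V : ℝ) ^ (2 * m) ≤
      (∑ x : Fin m → Bool → V, ∏ f : Fin m → Bool, F (fun i => x i (f i))) *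
        ((Fintype.card V : ℝ) ^ m) ^ 2 ^ m := by
  induction m with
  | zero =>
    simp only [Fintype.sum_unique, Fintype.prod_unique]
    simpa using le_of_eq (congrArg F (Subsingleton.elim _ _))
  | succ m ih =>
    set n : ℝ := (Fintype.card V : ℝ) with hn
    have hn0 : 0 ≤ n := by positivity
    let S : V → ℝ := fun v => ∑ x : Fin m → V, F (Fin.cons v x)
    let R : V → (Fin m → Bool → V) → ℝ := fun v x =>
      ∏ f : Fin m → Bool, F (Fin.cons v (fun i => x i (f i)))
    have hS : ∀ v, 0 ≤ S v := fun v => sum_nonneg fun _ _ => hF _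
    have hR : ∀ v x, 0 ≤ R v x := fun v x => prod_nonneg fun _ _ => hF _
    have h1 : ∑ x, F x = ∑ v, S v := by
      rw [← Fintype.sum_prod_type' (f := fun v x => F (Fin.cons v x))]
      exact (Fintype.sum_equiv (Fin.consEquiv (fun _ => V)) _ _ fun _ => rfl).symm
    have h2 : ∑ x : Fin (m + 1) → Bool → V, ∏ f : Fin (m + 1) → Bool, F (fun i => x i (f i)) =
        ∑ x : Fin m → Bool → V, (∑ v, R v x) ^ 2 := by
      have e1 : ∀ (u : Bool → V) (x : Fin m → Bool → V),
          ∏ f : Fin (m + 1) → Bool, F (fun i => (Fin.cons u x : Fin (m + 1) → Bool → V) i (f i)) =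
            R (u false) x * R (u true) x := by
        intro u x
        rw [← Fintype.prod_equiv (Fin.consEquiv (fun _ => Bool))
          (fun p => F (Fin.cons (u p.1) (fun i => x i (p.2 i)))) _ (fun p => ?_),
          Fintype.prod_prod_type, Fintype.prod_bool, mul_comm]
        congr 1
        funext i
        refine Fin.cases ?_ (fun i => ?_) i <;> simp [Fin.consEquiv]
      rw [← Fintype.sum_equiv (Fin.consEquiv (fun _ => Bool → V))
          (fun p => R (p.1 false) p.2 * R (p.1 true) p.2) _ (fun p => (e1 p.1 p.2).symm),
        Fintype.sum_prod_type_right]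
      refine sum_congr rfl fun x _ => ?_
      rw [pow_two, sum_mul_sum, ← Fintype.sum_prod_type']
      exact Fintype.sum_equiv (Equiv.boolArrowEquivProd V) _ _ fun u => rfl
    have h3 : (∑ v, S v) ^ 2 ^ m * n ^ (2 * m) * n ≤
        (∑ x, ∑ v, R v x) * (n ^ m) ^ 2 ^ m * n ^ 2 ^ m := by
      obtain ⟨j, hj⟩ : ∃ j, 2 ^ m = j + 1 := ⟨2 ^ m - 1, by have := Nat.one_le_two_pow (n := m); omega⟩
      have e1 : (∑ v, S v) ^ 2 ^ m * n ≤ (∑ v, S v ^ 2 ^ m) * n ^ 2 ^ m := by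
        rcases hn0.eq_or_lt with h0 | hpos
        · rw [← h0, hj]; simp
        · have := pow_sum_div_card_le_sum_pow (s := (univ : Finset V)) (f := S)
            (fun v _ => hS v) j
          rw [card_univ, ← hn, div_le_iff₀ (by positivity)] at this
          rw [hj, pow_succ n, ← mul_assoc]
          gcongr
      have e2 : (∑ v, S v ^ 2 ^ m) * n ^ (2 * m) ≤ (∑ x, ∑ v, R v x) * (n ^ m) ^ 2 ^ m := by
        rw [sum_comm, sum_mul, sum_mul]
        exact sum_le_sum fun v _ => ih (fun x => F (Fin.cons v x)) (fun _ => hF _)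
      calc _ = ((∑ v, S v) ^ 2 ^ m * n) * n ^ (2 * m) := by ring
        _ ≤ ((∑ v, S v ^ 2 ^ m) * n ^ 2 ^ m) * n ^ (2 * m) := by gcongr
        _ = ((∑ v, S v ^ 2 ^ m) * n ^ (2 * m)) * n ^ 2 ^ m := by ring
        _ ≤ _ := by gcongr
    have h4 : (∑ x : Fin m → Bool → V, ∑ v, R v x) ^ 2 ≤ n ^ (2 * m) * ∑ x, (∑ v, R v x) ^ 2 := by
      have := sq_sum_le_card_mul_sum_sq (s := (univ : Finset (Fin m → Bool → V)))
        (f := fun x => ∑ v, R v x)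
      simpa [card_univ, ← pow_mul, hn] using this
    rw [h1, h2]
    have hZ : 0 ≤ ∑ x : Fin m → Bool → V, (∑ v, R v x) ^ 2 := sum_nonneg fun _ _ => sq_nonneg _
    rcases hn0.eq_or_lt with h0 | hpos
    · rw [← h0]; simp only [mul_add, mul_one]
      rw [zero_pow (by omega : 2 * m + 2 ≠ 0), mul_zero]; positivity
    · have hSS : 0 ≤ ∑ v, S v := sum_nonneg fun _ _ => hS _
      have h5 := pow_le_pow_left₀ (by positivity) h3 2
      refine le_of_mul_le_mul_left ?_ (show 0 < n ^ (2 * m) by positivity)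
      calc _ = ((∑ v, S v) ^ 2 ^ m * n ^ (2 * m) * n) ^ 2 := by
            rw [pow_succ 2 m]; ring
        _ ≤ _ := h5
        _ = (∑ x, ∑ v, R v x) ^ 2 * ((n ^ m) ^ 2 ^ m * n ^ 2 ^ m) ^ 2 := by ring
        _ ≤ (n ^ (2 * m) * ∑ x, (∑ v, R v x) ^ 2) * ((n ^ m) ^ 2 ^ m * n ^ 2 ^ m) ^ 2 := by gcongr
        _ = _ := by rw [pow_succ 2 m]; ring

open scoped Classical in
theorem card_not_injective_le (ι : Type*) [Fintype ι] [DecidableEq ι] :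
    Fintype.card V * (univ.filter (fun x : ι → V => ¬ Function.Injective x)).card ≤
      Fintype.card ι ^ 2 * Fintype.card V ^ Fintype.card ι := by
  have h1 : (univ.filter (fun x : ι → V => ¬ Function.Injective x)) ⊆
      (univ : Finset (ι × ι)).biUnion (fun p => univ.filter (fun x => p.1 ≠ p.2 ∧ x p.1 = x p.2)) := by
    intro x hx
    have := (mem_filter.1 hx).2
    simp only [Function.Injective, not_forall] at this
    obtain ⟨a, b, hab, hne⟩ := this
    exact mem_biUnion.2 ⟨(a, b), mem_univ _, mem_filter.2 ⟨mem_univ _, hne, hab⟩⟩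
  have h2 : ∀ p : ι × ι, Fintype.card V *
      (univ.filter (fun x : ι → V => p.1 ≠ p.2 ∧ x p.1 = x p.2)).card ≤
        Fintype.card V ^ Fintype.card ι := by
    rintro ⟨a, b⟩
    rw [← card_univ, ← card_product, card_univ, ← Fintype.card_fun, ← card_univ]
    refine card_le_card_of_injOn (fun p => Function.update p.2 a p.1) (fun _ _ => mem_univ _) ?_
    rintro ⟨v, x⟩ hx ⟨v', x'⟩ hx' heq
    obtain ⟨hne, hxab⟩ := (mem_filter.1 (mem_product.1 (mem_coe.1 hx)).2).2
    obtain ⟨-, hxab'⟩ := (mem_filter.1 (mem_product.1 (mem_coe.1 hx')).2).2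
    simp only at heq hne hxab hxab'
    have e : ∀ i, i ≠ a → x i = x' i := fun i hi => by
      have := congrFun heq i; simpa [hi] using this
    have ev : v = v' := by have := congrFun heq a; simpa using this
    have ex : x = x' := by
      funext i
      by_cases hi : i = a
      · rw [hi, hxab, hxab', e b (Ne.symm hne)]
      · exact e i hi
    rw [ev, ex]
  calc _ ≤ Fintype.card V * ∑ p : ι × ι,
        (univ.filter (fun x : ι → V => p.1 ≠ p.2 ∧ x p.1 = x p.2)).card :=
        Nat.mul_le_mul_left _ ((card_le_card h1).trans card_biUnion_le)
    _ ≤ ∑ _p : ι × ι, Fintype.card V ^ Fintype.card ι := by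
        rw [mul_sum]; exact sum_le_sum fun p _ => h2 p
    _ = _ := by simp [card_univ, pow_two]

/-- If all configurations in the blow-up of `Y` hit `P`, and `P` is rarely hit, `Y` is small. -/
theorem card_le_of_hits_le {m : ℕ} {A : SatFormula V} {P : Pattern (Fin m × Bool)}
    {Y : Finset (Fin m → V)}
    (hY : ∀ x : Fin m × Bool → V, (∀ f : Fin m → Bool, (fun i => x (i, f i)) ∈ Y) →
      ∀ b ∈ P, mapClause x b ∈ A) (hV : 0 < Fintype.card V) {ε τ : ℝ} (hτ : 0 ≤ τ)
    (hA : ((hits A P).card : ℝ) ≤ ε * Fintype.card V ^ (2 * m))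
    (hε : ε + 4 * m ^ 2 / Fintype.card V ≤ τ ^ 2 ^ m) :
    (Y.card : ℝ) ≤ τ * Fintype.card V ^ m := by
  classical
  set n : ℝ := (Fintype.card V : ℝ) with hn
  have hnpos : 0 < n := by rw [hn]; exact_mod_cast hV
  have h1 := blowup_inequality m (fun x : Fin m → V => if x ∈ Y then (1 : ℝ) else 0)
    (fun x => by positivity)
  simp only [prod_boole, mem_univ, true_implies] at h1
  rw [sum_boole, sum_boole, filter_mem_eq_inter, univ_inter] at h1
  have h2 : (univ.filter (fun x : Fin m → Bool → V => ∀ f : Fin m → Bool,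
      (fun i => x i (f i)) ∈ Y)).card ≤ (hits A P).card +
        (univ.filter (fun x : Fin m × Bool → V => ¬ Function.Injective x)).card := by
    refine le_trans ?_ (card_union_le _ _)
    refine card_le_card_of_injOn (fun x p => x p.1 p.2) ?_ ?_
    · intro x hx
      have hx := (mem_filter.1 hx).2
      by_cases hinj : Function.Injective (fun p : Fin m × Bool => x p.1 p.2)
      · exact mem_union_left _ (mem_filter.2 ⟨mem_univ _, hinj, hY _ hx⟩)
      · exact mem_union_right _ (mem_filter.2 ⟨mem_univ _, hinj⟩)
    · intro x _ x' _ h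
      funext i b
      exact congrFun h (i, b)
  have h3 := card_not_injective_le (V := V) (Fin m × Bool)
  have hc : Fintype.card (Fin m × Bool) = 2 * m := by simp [mul_comm]
  rw [hc] at h3
  have h3' : n * (univ.filter (fun x : Fin m × Bool → V => ¬ Function.Injective x)).card ≤
      (2 * m) ^ 2 * n ^ (2 * m) := by rw [hn]; exact_mod_cast h3
  have h4 : ((univ.filter (fun x : Fin m → Bool → V => ∀ f : Fin m → Bool,
      (fun i => x i (f i)) ∈ Y)).card : ℝ) ≤ τ ^ 2 ^ m * n ^ (2 * m) := by
    have h2' : ((univ.filter (fun x : Fin m → Bool → V => ∀ f : Fin m → Bool,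
      (fun i => x i (f i)) ∈ Y)).card : ℝ) ≤ (hits A P).card +
        (univ.filter (fun x : Fin m × Bool → V => ¬ Function.Injective x)).card := by
      exact_mod_cast h2
    have h5 : ((univ.filter (fun x : Fin m × Bool → V => ¬ Function.Injective x)).card : ℝ) ≤
        4 * m ^ 2 / n * n ^ (2 * m) := by
      rw [div_mul_eq_mul_div, le_div_iff₀ hnpos]; linarith
    calc _ ≤ _ := h2'
      _ ≤ ε * n ^ (2 * m) + 4 * m ^ 2 / n * n ^ (2 * m) := add_le_add hA h5
      _ = (ε + 4 * m ^ 2 / n) * n ^ (2 * m) := by ring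
      _ ≤ _ := by gcongr
  have h6 : (Y.card : ℝ) ^ 2 ^ m ≤ (τ * n ^ m) ^ 2 ^ m := by
    refine le_of_mul_le_mul_right ?_ (show 0 < n ^ (2 * m) by positivity)
    calc _ ≤ _ := h1
      _ ≤ (τ ^ 2 ^ m * n ^ (2 * m)) * (n ^ m) ^ 2 ^ m := by gcongr
      _ = _ := by rw [mul_pow]; ring
  exact le_of_pow_le_pow_left₀ (by positivity) (by positivity) h6

end

section

variable {V : Type*} [Fintype V] [DecidableEq V] {k : ℕ}

/-- The copy selected by `f` of the clause with signs `s` on all indices but `j`. -/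
def copyClause (s : Fin (k + 1) → Bool) (j : Fin (k + 1)) (f : Fin (k + 1) → Bool) :
    SatClause (Fin (k + 1) × Bool) :=
  mapClause (fun i => (i, f i)) (signedClause s (univ.erase j))

theorem mem_clauseVars_copyClause {s : Fin (k + 1) → Bool} {j : Fin (k + 1)}
    {f : Fin (k + 1) → Bool} {i : Fin (k + 1)} {t : Bool} :
    (i, t) ∈ clauseVars (copyClause s j f) ↔ i ≠ j ∧ t = f i := by
  rw [copyClause, clauseVars_mapClause, clauseVars_signedClause]
  simp only [mem_image, mem_erase, mem_univ, and_true, Prod.mk.injEq]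
  constructor
  · rintro ⟨a, ha, rfl, rfl⟩; exact ⟨ha, rfl⟩
  · rintro ⟨h1, rfl⟩; exact ⟨i, h1, rfl, rfl⟩

theorem satisfies_copyClause {x : Fin (k + 1) × Bool → V} {w : V → Bool}
    {s : Fin (k + 1) → Bool} {j : Fin (k + 1)} {f : Fin (k + 1) → Bool} :
    SatisfiesClause w (mapClause x (copyClause s j f)) ↔ ∀ i ≠ j, w (x (i, f i)) = s i := by
  rw [satisfies_mapClause, copyClause, satisfies_mapClause, satisfies_signedClause]
  simp

theorem isKClause_copyClause (s : Fin (k + 1) → Bool) (j : Fin (k + 1))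
    (f : Fin (k + 1) → Bool) : IsKClause k (copyClause s j f) := by
  have hinj : Function.Injective (fun i : Fin (k + 1) => (i, f i)) := fun a b h => (Prod.mk.inj h).1
  refine ⟨?_, ?_⟩
  · rw [copyClause, mapClause, card_image_of_injective _ fun p q h => ?_, card_signedClause]
    · simp
    · obtain ⟨h1, h2⟩ := Prod.mk.inj h
      exact Prod.ext (hinj h1) h2
  · rw [copyClause, clauseVars_mapClause, card_image_of_injective _ hinj, clauseVars_signedClause]
    simp

/-- The clause on `1, …, k` with signs `s` together with its copies with one index duplicated. -/
def starPattern (s : Fin (k + 1) → Bool) : Pattern (Fin (k + 1) × Bool) :=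
  univ.image (fun a => copyClause s 0 (fun i => decide (i = a)))

/-- Two clauses on the same variables, duplicated. -/
def pairPattern (s t : Fin (k + 1) → Bool) : Pattern (Fin (k + 1) × Bool) :=
  insert (copyClause t 0 (fun i => xor (s i) (t i))) (starPattern s)

/-- Three clauses on `k + 1` variables, duplicated. -/
def triplePattern (p q : Fin (k + 1)) (s t u : Fin (k + 1) → Bool) :
    Pattern (Fin (k + 1) × Bool) :=
  insert (copyClause t q (fun i => decide (i ≠ 0) && xor (s i) (t i)))
    (insert (copyClause u p (fun i => decide (i ≠ 0) && xor (s i) (u i))) (starPattern s))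

theorem not_subset_of_ne {ι : Type*} [DecidableEq ι] {b c : SatClause ι} (hb : IsKClause k b)
    (hc : IsKClause k c) (h : clauseVars b ≠ clauseVars c) : ∃ a ∈ clauseVars c, a ∉ clauseVars b := by
  by_contra hcon
  push Not at hcon
  exact h (eq_of_subset_of_card_le hcon (by rw [hb.2, hc.2])).symm

theorem isAntichainPattern_of {ι : Type*} [DecidableEq ι] {P : Pattern ι}
    (h1 : ∀ b ∈ P, IsKClause k b)
    (h2 : ∀ b ∈ P, ∀ c ∈ P, clauseVars b = clauseVars c → b = c) : IsAntichainPattern P :=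
  fun b hb c hc hne => not_subset_of_ne (h1 b hb) (h1 c hc) fun h => hne (h2 b hb c hc h).symm

theorem starPattern_clauseVars_inj {s : Fin (k + 1) → Bool} {b c : SatClause (Fin (k + 1) × Bool)}
    (hb : b ∈ starPattern s) (hc : c ∈ starPattern s) (h : clauseVars b = clauseVars c) : b = c := by
  obtain ⟨a, -, rfl⟩ := mem_image.1 hb
  obtain ⟨a', -, rfl⟩ := mem_image.1 hc
  by_contra hne
  have haa : a ≠ a' := fun h => hne (by rw [h])
  have key : ∀ a a' : Fin (k + 1), a ≠ a' → a ≠ 0 →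
      clauseVars (copyClause s 0 (fun i => decide (i = a))) ≠
        clauseVars (copyClause s 0 (fun i => decide (i = a'))) := by
    intro a a' haa ha h
    have h1 : (a, true) ∈ clauseVars (copyClause s 0 (fun i => decide (i = a))) :=
      mem_clauseVars_copyClause.2 ⟨ha, by simp⟩
    rw [h] at h1
    have := (mem_clauseVars_copyClause.1 h1).2
    simp [haa] at this
  by_cases ha : a = 0
  · exact key a' a (Ne.symm haa) (fun h => haa (ha.trans h.symm)) h.symm
  · exact key a a' haa ha h

theorem isKClause_of_mem_starPattern {s : Fin (k + 1) → Bool} {b : SatClause (Fin (k + 1) × Bool)}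
    (hb : b ∈ starPattern s) : IsKClause k b := by
  obtain ⟨a, -, rfl⟩ := mem_image.1 hb
  exact isKClause_copyClause _ _ _

theorem pairPattern_props (s t : Fin (k + 1) → Bool) {i j : Fin (k + 1)} (hij : i ≠ j)
    (hi0 : i ≠ 0) (hj0 : j ≠ 0) (hi : s i ≠ t i) (hj : s j ≠ t j) :
    IsAntichainPattern (pairPattern s t) ∧ (pairPattern s t).card ≤ k + 3 ∧
      ∀ b ∈ pairPattern s t, IsKClause k b := by
  have hK : ∀ b ∈ pairPattern s t, IsKClause k b := by
    intro b hb
    rcases mem_insert.1 hb with rfl | hb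
    · exact isKClause_copyClause _ _ _
    · exact isKClause_of_mem_starPattern hb
  have hcard : (starPattern s).card ≤ k + 1 := card_image_le.trans (by simp)
  have key : ∀ b ∈ starPattern s, clauseVars b ≠
      clauseVars (copyClause t 0 (fun i => xor (s i) (t i))) := by
    intro b hb h
    obtain ⟨a, -, rfl⟩ := mem_image.1 hb
    have h1 : ∀ l, l ≠ 0 → s l ≠ t l → l = a := by
      intro l hl hst
      have : (l, true) ∈ clauseVars (copyClause t 0 (fun i => xor (s i) (t i))) :=
        mem_clauseVars_copyClause.2 ⟨hl, by simp [hst]⟩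
      rw [← h] at this
      simpa using (mem_clauseVars_copyClause.1 this).2
    exact hij ((h1 i hi0 hi).trans (h1 j hj0 hj).symm)
  refine ⟨isAntichainPattern_of hK ?_, (card_insert_le _ _).trans (by omega), hK⟩
  intro b hb c hc h
  rcases mem_insert.1 hb with hb' | hb' <;> rcases mem_insert.1 hc with hc' | hc'
  · rw [hb', hc']
  · subst hb'; exact absurd h.symm (key c hc')
  · subst hc'; exact absurd h (key b hb')
  · exact starPattern_clauseVars_inj hb' hc' h

theorem triplePattern_props {p q : Fin (k + 1)} (hp : p ≠ 0) (hq : q ≠ 0) (hpq : p ≠ q)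
    (s t u : Fin (k + 1) → Bool) :
    IsAntichainPattern (triplePattern p q s t u) ∧ (triplePattern p q s t u).card ≤ k + 3 ∧
      ∀ b ∈ triplePattern p q s t u, IsKClause k b := by
  have hK : ∀ b ∈ triplePattern p q s t u, IsKClause k b := by
    intro b hb
    rcases mem_insert.1 hb with rfl | hb
    · exact isKClause_copyClause _ _ _
    rcases mem_insert.1 hb with rfl | hb
    · exact isKClause_copyClause _ _ _
    · exact isKClause_of_mem_starPattern hb
  have hcard : (starPattern s).card ≤ k + 1 := card_image_le.trans (by simp)
  have key : ∀ b ∈ starPattern s, ∀ r ≠ (0 : Fin (k + 1)), ∀ v : Fin (k + 1) → Bool, clauseVars b ≠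
      clauseVars (copyClause v r (fun i => decide (i ≠ 0) && xor (s i) (v i))) := by
    intro b hb r hr v h
    obtain ⟨a, -, rfl⟩ := mem_image.1 hb
    have h1 : (0, false) ∈
        clauseVars (copyClause v r (fun i => decide (i ≠ 0) && xor (s i) (v i))) :=
      mem_clauseVars_copyClause.2 ⟨hr.symm, by simp⟩
    rw [← h] at h1
    exact (mem_clauseVars_copyClause.1 h1).1 rfl
  have key2 : clauseVars (copyClause t q (fun i => decide (i ≠ 0) && xor (s i) (t i))) ≠
      clauseVars (copyClause u p (fun i => decide (i ≠ 0) && xor (s i) (u i))) := by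
    intro h
    have h1 : (p, decide (p ≠ 0) && xor (s p) (t p)) ∈
        clauseVars (copyClause t q (fun i => decide (i ≠ 0) && xor (s i) (t i))) :=
      mem_clauseVars_copyClause.2 ⟨hpq, rfl⟩
    rw [h] at h1
    exact (mem_clauseVars_copyClause.1 h1).1 rfl
  refine ⟨isAntichainPattern_of hK ?_, (card_insert_le _ _).trans (Nat.succ_le_succ
    ((card_insert_le _ _).trans (by omega))), hK⟩
  intro b hb c hc h
  rcases mem_insert.1 hb with rfl | hb
  · rcases mem_insert.1 hc with rfl | hc
    · rfl
    rcases mem_insert.1 hc with rfl | hc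
    · exact absurd h key2
    · exact absurd h.symm (key c hc q hq t)
  rcases mem_insert.1 hb with rfl | hb
  · rcases mem_insert.1 hc with rfl | hc
    · exact absurd h.symm key2
    rcases mem_insert.1 hc with rfl | hc
    · rfl
    · exact absurd h.symm (key c hc p hp u)
  · rcases mem_insert.1 hc with rfl | hc
    · exact absurd h (key b hb q hq t)
    rcases mem_insert.1 hc with rfl | hc
    · exact absurd h (key b hb p hp u)
    · exact starPattern_clauseVars_inj hb hc h

/-- A witness of the base clause of a star is determined on all the copies. -/
theorem exists_forced_witness {G : SatFormula V} (hG : MinimalFormula G)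
    {x : Fin (k + 1) × Bool → V} (hx : Function.Injective x) {s : Fin (k + 1) → Bool}
    (h : ∀ b ∈ starPattern s, mapClause x b ∈ G) :
    ∃ w : V → Bool, (∀ C ∈ G, SatisfiesClause w C →
        clauseVars C = (univ.erase 0).image (fun i => x (i, false))) ∧
      ∀ (t : Fin (k + 1) → Bool) (i), i ≠ 0 → w (x (i, xor (s i) (t i))) = t i := by
  have h0 : mapClause x (copyClause s 0 (fun i => decide (i = 0))) ∈ G :=
    h _ (mem_image_of_mem _ (mem_univ _))
  obtain ⟨w, hw, hw'⟩ := hG _ h0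
  rw [satisfies_copyClause] at hw
  have hvars : clauseVars (mapClause x (copyClause s 0 (fun i => decide (i = 0)))) =
      (univ.erase 0).image (fun i => x (i, false)) := by
    rw [clauseVars_mapClause, copyClause, clauseVars_mapClause, clauseVars_signedClause, image_image]
    refine image_congr fun i hi => ?_
    have : i ≠ 0 := (mem_erase.1 hi).1
    simp [this]
  refine ⟨w, fun C hC hCw => by rw [hw' C hC hCw, hvars], fun t i hi => ?_⟩
  have h1 : w (x (i, false)) = s i := by simpa [hi] using hw i hi
  have h2 : w (x (i, true)) ≠ s i := by
    intro h2
    have hc : mapClause x (copyClause s 0 (fun j => decide (j = i))) ∈ G :=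
      h _ (mem_image_of_mem _ (mem_univ _))
    have h3 := hw' _ hc (satisfies_copyClause.2 fun j hj => by
      by_cases hji : j = i
      · subst hji; simpa using h2
      · simpa [hji, hj] using hw j hj)
    have h4 : x (i, true) ∈ clauseVars (mapClause x (copyClause s 0 (fun j => decide (j = i)))) := by
      rw [clauseVars_mapClause]
      exact mem_image_of_mem _ (mem_clauseVars_copyClause.2 ⟨hi, by simp⟩)
    rw [h3, hvars] at h4
    obtain ⟨j, -, hj⟩ := mem_image.1 h4
    simpa using hx hj
  by_cases hst : s i = t i
  · simpa [hst] using h1.trans hst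
  · rw [show xor (s i) (t i) = true by simpa using hst]
    revert h2 hst
    cases w (x (i, true)) <;> cases s i <;> cases t i <;> simp

theorem hits_pairPattern {G : SatFormula V} (hG : MinimalFormula G) {s t : Fin (k + 1) → Bool}
    {i : Fin (k + 1)} (hi0 : i ≠ 0) (hi : s i ≠ t i) : hits G (pairPattern s t) = ∅ := by
  rw [eq_empty_iff_forall_notMem]
  intro x hx
  obtain ⟨-, hinj, hmem⟩ := mem_filter.1 hx
  obtain ⟨w, hw, hforce⟩ := exists_forced_witness hG hinj
    (fun b hb => hmem b (mem_insert_of_mem hb))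
  have h1 := hw _ (hmem _ (mem_insert_self _ _))
    (satisfies_copyClause.2 fun j hj => hforce t j hj)
  have h2 : x (i, true) ∈
      clauseVars (mapClause x (copyClause t 0 (fun i => xor (s i) (t i)))) := by
    rw [clauseVars_mapClause]
    exact mem_image_of_mem _ (mem_clauseVars_copyClause.2 ⟨hi0, by simp [hi]⟩)
  rw [h1] at h2
  obtain ⟨j, -, hj⟩ := mem_image.1 h2
  simpa using hinj hj

theorem hits_triplePattern {G : SatFormula V} (hG : MinimalFormula G) {p q : Fin (k + 1)}
    (hp : p ≠ 0) (hq : q ≠ 0) {s t u : Fin (k + 1) → Bool} (htu : t 0 ≠ u 0) :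
    hits G (triplePattern p q s t u) = ∅ := by
  rw [eq_empty_iff_forall_notMem]
  intro x hx
  obtain ⟨-, hinj, hmem⟩ := mem_filter.1 hx
  obtain ⟨w, hw, hforce⟩ := exists_forced_witness hG hinj
    (fun b hb => hmem b (mem_insert_of_mem (mem_insert_of_mem hb)))
  have key : ∀ (v : Fin (k + 1) → Bool) (r : Fin (k + 1)), r ≠ 0 →
      mapClause x (copyClause v r (fun i => decide (i ≠ 0) && xor (s i) (v i))) ∈ G →
      w (x (0, false)) ≠ v 0 := by
    intro v r hr hG' hwv
    have h1 := hw _ hG' (satisfies_copyClause.2 fun j hj => by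
      by_cases hj0 : j = 0
      · subst hj0; simpa using hwv
      · simpa [hj0] using hforce v j hj0)
    have h2 : x (0, false) ∈ clauseVars (mapClause x
        (copyClause v r (fun i => decide (i ≠ 0) && xor (s i) (v i)))) := by
      rw [clauseVars_mapClause]
      exact mem_image_of_mem _ (mem_clauseVars_copyClause.2 ⟨hr.symm, by simp⟩)
    rw [h1] at h2
    obtain ⟨j, hj, hj'⟩ := mem_image.1 h2
    exact (mem_erase.1 hj).1 (Prod.mk.inj (hinj hj')).1
  have h1 := key t q hq (hmem _ (mem_insert_self _ _))
  have h2 := key u p hp (hmem _ (mem_insert_of_mem (mem_insert_self _ _)))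
  revert h1 h2 htu
  cases w (x (0, false)) <;> cases t 0 <;> cases u 0 <;> simp

theorem mapClause_copyClause (x : Fin (k + 1) × Bool → V) (s : Fin (k + 1) → Bool)
    (j : Fin (k + 1)) (f : Fin (k + 1) → Bool) :
    mapClause x (copyClause s j f) =
      mapClause (fun i => x (i, f i)) (signedClause s (univ.erase j)) := by
  simp [copyClause, mapClause, image_image, Function.comp_def]

theorem mapClause_signedClause_comp {ι : Type*} [DecidableEq ι] (y : ι → V) (σ : V → Bool)
    (S : Finset ι) : mapClause y (signedClause (σ ∘ y) S) = signedClause σ (S.image y) := by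
  simp [mapClause, signedClause, image_image, Function.comp_def]

/-- `Q` carries three clauses in the configuration of a triple pattern. -/
def IsBad (A : SatFormula V) (Q : Finset V) : Prop :=
  ∃ z ∈ Q, ∃ p ∈ Q, ∃ q ∈ Q, p ≠ z ∧ q ≠ z ∧ p ≠ q ∧ ∃ C₁ ∈ A, ∃ C₂ ∈ A, ∃ C₃ ∈ A,
    clauseVars C₁ = Q.erase z ∧ clauseVars C₂ = Q.erase q ∧ clauseVars C₃ = Q.erase p ∧
      clauseSign C₂ z ≠ clauseSign C₃ z

open scoped Classical in
/-- The bad `(k + 1)`-sets. -/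
noncomputable def badSets (k : ℕ) (A : SatFormula V) : Finset (Finset V) :=
  (univ.powersetCard (k + 1)).filter (IsBad A)

open scoped Classical in
theorem card_badSets_le {A : SatFormula V} (hA : A ⊆ kClauses k V) {p₀ q₀ : Fin (k + 1)}
    (hp : p₀ ≠ 0) (hq : q₀ ≠ 0) (hpq : p₀ ≠ q₀) (hV : 0 < Fintype.card V) {ε τ : ℝ} (hτ : 0 ≤ τ)
    (hsp : ∀ s t u : Fin (k + 1) → Bool, t 0 ≠ u 0 →
      ((hits A (triplePattern p₀ q₀ s t u)).card : ℝ) ≤ ε * Fintype.card V ^ (2 * (k + 1)))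
    (hε : ε + 4 * (k + 1 : ℕ) ^ 2 / Fintype.card V ≤ τ ^ 2 ^ (k + 1)) :
    ((badSets k A).card : ℝ) ≤ 2 ^ (3 * (k + 1)) * (τ * Fintype.card V ^ (k + 1)) := by
  let Y : (Fin (k + 1) → Bool) → (Fin (k + 1) → Bool) → (Fin (k + 1) → Bool) →
      Finset (Fin (k + 1) → V) := fun s t u => univ.filter (fun y => t 0 ≠ u 0 ∧
    mapClause y (signedClause s (univ.erase 0)) ∈ A ∧
    mapClause y (signedClause t (univ.erase q₀)) ∈ A ∧
    mapClause y (signedClause u (univ.erase p₀)) ∈ A)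
  have hY : ∀ s t u, ((Y s t u).card : ℝ) ≤ τ * Fintype.card V ^ (k + 1) := by
    intro s t u
    by_cases htu : t 0 = u 0
    · simp only [Y, htu, ne_eq, not_true_eq_false, false_and, filter_false, card_empty, Nat.cast_zero]
      positivity
    refine card_le_of_hits_le (P := triplePattern p₀ q₀ s t u) ?_ hV hτ (hsp s t u htu) hε
    intro x hx b hb
    have hx' := fun f => (mem_filter.1 (hx f)).2.2
    rcases mem_insert.1 hb with rfl | hb
    · rw [mapClause_copyClause]; exact (hx' _).2.1
    rcases mem_insert.1 hb with rfl | hb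
    · rw [mapClause_copyClause]; exact (hx' _).2.2
    · obtain ⟨a, -, rfl⟩ := mem_image.1 hb
      rw [mapClause_copyClause]; exact (hx' _).1
  have h1 : badSets k A ⊆ (univ : Finset ((Fin (k + 1) → Bool) × (Fin (k + 1) → Bool) ×
      (Fin (k + 1) → Bool))).biUnion (fun p => (Y p.1 p.2.1 p.2.2).image (fun y => univ.image y)) := by
    intro Q hQ
    obtain ⟨hQ, z, hz, p, hpQ, q, hqQ, hpz, hqz, hpq', C₁, h₁, C₂, h₂, C₃, h₃, e₁, e₂, e₃, hne⟩ :=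
      mem_filter.1 hQ
    have hQc := (mem_powersetCard.1 hQ).2
    obtain ⟨g, hg⟩ := exists_equiv_extend_of_card_eq (α := Fin (k + 1)) (t := Q) (by simp [hQc])
      (s := {0, p₀, q₀}) (f := fun i => if i = 0 then z else if i = p₀ then p else q)
      (by
        intro v hv
        obtain ⟨i, -, rfl⟩ := mem_image.1 hv
        split_ifs <;> assumption)
      (by
        intro i hi j hj hij
        simp only [coe_insert, coe_singleton, Set.mem_insert_iff, Set.mem_singleton_iff] at hi hj
        rcases hi with rfl | rfl | rfl <;> rcases hj with rfl | rfl | rfl <;>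
          simp_all [Ne.symm])
    let y : Fin (k + 1) → V := fun i => g i
    have hyinj : Function.Injective y := fun a b h => g.injective (Subtype.ext h)
    have hyQ : univ.image y = Q := by
      ext v; simp only [mem_image, mem_univ, true_and, y]
      constructor
      · rintro ⟨i, rfl⟩; exact (g i).2
      · intro hv; exact ⟨g.symm ⟨v, hv⟩, by simp⟩
    have hy0 : y 0 = z := by simpa using hg 0 (by simp)
    have hyp : y p₀ = p := by simpa [hp] using hg p₀ (by simp)
    have hyq : y q₀ = q := by simpa [hq, Ne.symm hpq] using hg q₀ (by simp)
    have him : ∀ j, (univ.erase j).image y = Q.erase (y j) := by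
      intro j; rw [image_erase hyinj, hyQ]
    have hcl : ∀ C ∈ A, ∀ j, clauseVars C = Q.erase (y j) →
        mapClause y (signedClause (clauseSign C ∘ y) (univ.erase j)) = C := by
      intro C hC j hj
      rw [mapClause_signedClause_comp, him, ← hj, ← (mem_kClauses.1 (hA hC)).eq_signedClause]
    refine mem_biUnion.2 ⟨(clauseSign C₁ ∘ y, clauseSign C₂ ∘ y, clauseSign C₃ ∘ y), mem_univ _,
      mem_image.2 ⟨y, mem_filter.2 ⟨mem_univ _, ?_, ?_, ?_, ?_⟩, hyQ⟩⟩
    · simpa [hy0] using hne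
    · rw [hcl C₁ h₁ 0 (by rw [e₁, hy0])]; exact h₁
    · rw [hcl C₂ h₂ q₀ (by rw [e₂, hyq])]; exact h₂
    · rw [hcl C₃ h₃ p₀ (by rw [e₃, hyp])]; exact h₃
  calc ((badSets k A).card : ℝ) ≤ ∑ p : (Fin (k + 1) → Bool) × (Fin (k + 1) → Bool) ×
        (Fin (k + 1) → Bool), ((Y p.1 p.2.1 p.2.2).card : ℝ) := by
        exact_mod_cast (card_le_card h1).trans (card_biUnion_le.trans
          (sum_le_sum fun p _ => card_image_le))
    _ ≤ ∑ _p : (Fin (k + 1) → Bool) × (Fin (k + 1) → Bool) × (Fin (k + 1) → Bool),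
        τ * (Fintype.card V : ℝ) ^ (k + 1) := sum_le_sum fun p _ => hY _ _ _
    _ = _ := by
        rw [sum_const, card_univ, Fintype.card_prod, Fintype.card_prod]
        simp only [Fintype.card_fun, Fintype.card_bool, Fintype.card_fin, nsmul_eq_mul]
        push_cast; ring

open scoped Classical in
/-- The `k`-sets carrying two clauses of `A` which differ in at least `r` variables. -/
noncomputable def multiSets (k r : ℕ) (A : SatFormula V) : Finset (Finset V) :=
  (univ.powersetCard k).filter (fun S => ∃ C₁ ∈ A, ∃ C₂ ∈ A, clauseVars C₁ = S ∧
    clauseVars C₂ = S ∧ r ≤ (S.filter (fun v => clauseSign C₁ v ≠ clauseSign C₂ v)).card)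

open scoped Classical in
theorem card_multiSets_le {A : SatFormula V} (hA : A ⊆ kClauses k V) (r : ℕ)
    (hV : 0 < Fintype.card V) {ε τ : ℝ} (hτ : 0 ≤ τ)
    (hsp : ∀ s t : Fin (k + 1) → Bool,
      r ≤ ((univ.erase 0).filter (fun i => s i ≠ t i)).card →
      ((hits A (pairPattern s t)).card : ℝ) ≤ ε * Fintype.card V ^ (2 * (k + 1)))
    (hε : ε + 4 * (k + 1 : ℕ) ^ 2 / Fintype.card V ≤ τ ^ 2 ^ (k + 1)) :
    ((multiSets k r A).card : ℝ) ≤ 2 ^ (2 * (k + 1)) * (τ * Fintype.card V ^ k) := by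
  have hn : (0 : ℝ) < Fintype.card V := by exact_mod_cast hV
  let Y : (Fin (k + 1) → Bool) → (Fin (k + 1) → Bool) →
      Finset (Fin (k + 1) → V) := fun s t => univ.filter (fun y =>
    r ≤ ((univ.erase 0).filter (fun i => s i ≠ t i)).card ∧
    mapClause y (signedClause s (univ.erase 0)) ∈ A ∧
    mapClause y (signedClause t (univ.erase 0)) ∈ A)
  have hY : ∀ s t, ((Y s t).card : ℝ) ≤ τ * Fintype.card V ^ (k + 1) := by
    intro s t
    by_cases hst : r ≤ ((univ.erase 0).filter (fun i => s i ≠ t i)).card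
    swap
    · simp only [Y, hst, false_and, filter_false, card_empty, Nat.cast_zero]
      positivity
    refine card_le_of_hits_le (P := pairPattern s t) ?_ hV hτ (hsp s t hst) hε
    intro x hx b hb
    have hx' := fun f => (mem_filter.1 (hx f)).2.2
    rcases mem_insert.1 hb with rfl | hb
    · rw [mapClause_copyClause]; exact (hx' _).2
    · obtain ⟨a, -, rfl⟩ := mem_image.1 hb
      rw [mapClause_copyClause]; exact (hx' _).1
  have h1 : (univ : Finset V) ×ˢ multiSets k r A ⊆
      (univ : Finset ((Fin (k + 1) → Bool) × (Fin (k + 1) → Bool))).biUnion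
        (fun p => (Y p.1 p.2).image (fun y => (y 0, (univ.erase 0).image y))) := by
    rintro ⟨v, S⟩ hS
    obtain ⟨hS, C₁, h₁, C₂, h₂, e₁, e₂, hr⟩ := mem_filter.1 (mem_product.1 hS).2
    simp only at hS e₁ e₂ hr
    have hSc := (mem_powersetCard.1 hS).2
    let g := S.equivFinOfCardEq hSc
    let y : Fin (k + 1) → V := Fin.cons v (fun i => (g.symm i : V))
    have hyS : (univ.erase 0).image y = S := by
      ext w
      simp only [mem_image, mem_erase, mem_univ, and_true]
      constructor
      · rintro ⟨i, hi, rfl⟩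
        obtain ⟨j, rfl⟩ := Fin.exists_succ_eq.2 hi
        simp [y]
      · intro hw
        exact ⟨Fin.succ (g ⟨w, hw⟩), Fin.succ_ne_zero _, by simp [y]⟩
    have hcl : ∀ C ∈ A, clauseVars C = S →
        mapClause y (signedClause (clauseSign C ∘ y) (univ.erase 0)) = C := by
      intro C hC hj
      rw [mapClause_signedClause_comp, hyS, ← hj, ← (mem_kClauses.1 (hA hC)).eq_signedClause]
    refine mem_biUnion.2 ⟨(clauseSign C₁ ∘ y, clauseSign C₂ ∘ y), mem_univ _,
      mem_image.2 ⟨y, mem_filter.2 ⟨mem_univ _, ?_, ?_, ?_⟩, by simp [hyS, y]⟩⟩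
    · refine hr.trans ?_
      have : S.filter (fun v => clauseSign C₁ v ≠ clauseSign C₂ v) ⊆
          ((univ.erase 0).filter (fun i => (clauseSign C₁ ∘ y) i ≠ (clauseSign C₂ ∘ y) i)).image y := by
        intro w hw
        obtain ⟨hwS, hne⟩ := mem_filter.1 hw
        rw [← hyS] at hwS
        obtain ⟨i, hi, rfl⟩ := mem_image.1 hwS
        exact mem_image.2 ⟨i, mem_filter.2 ⟨hi, hne⟩, rfl⟩
      exact (card_le_card this).trans card_image_le
    · rw [hcl C₁ h₁ e₁]; exact h₁
    · rw [hcl C₂ h₂ e₂]; exact h₂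
  have h2 : (Fintype.card V : ℝ) * (multiSets k r A).card ≤
      2 ^ (2 * (k + 1)) * (τ * Fintype.card V ^ (k + 1)) := by
    calc (Fintype.card V : ℝ) * (multiSets k r A).card ≤
        ∑ p : (Fin (k + 1) → Bool) × (Fin (k + 1) → Bool), ((Y p.1 p.2).card : ℝ) := by
          have := (card_le_card h1).trans (card_biUnion_le.trans
            (sum_le_sum fun p _ => card_image_le))
          rw [card_product, card_univ] at this
          exact_mod_cast this
      _ ≤ ∑ _p : (Fin (k + 1) → Bool) × (Fin (k + 1) → Bool),
          τ * (Fintype.card V : ℝ) ^ (k + 1) := sum_le_sum fun p _ => hY _ _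
      _ = _ := by
          rw [sum_const, card_univ, Fintype.card_prod]
          simp only [Fintype.card_fun, Fintype.card_bool, Fintype.card_fin, nsmul_eq_mul]
          push_cast; ring
  refine le_of_mul_le_mul_left ?_ hn
  calc _ ≤ _ := h2
    _ = _ := by ring

/-- The vertices extending `T` to a member of `U`. -/
def extensions (U : Finset (Finset V)) (T : Finset V) : Finset V :=
  univ.filter (fun v => v ∉ T ∧ insert v T ∈ U)

theorem mem_extensions {U : Finset (Finset V)} {T : Finset V} {v : V} :
    v ∈ extensions U T ↔ v ∉ T ∧ insert v T ∈ U := by simp [extensions]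

theorem sum_sum_erase {M : Type*} [AddCommMonoid M] {m : ℕ} {U : Finset (Finset V)}
    (hU : U ⊆ univ.powersetCard (m + 1)) (f : Finset V → V → M) :
    ∑ S ∈ U, ∑ v ∈ S, f S v =
      ∑ T ∈ univ.powersetCard m, ∑ v ∈ extensions U T, f (insert v T) v := by
  rw [sum_sigma', sum_sigma']
  refine sum_bij' (fun p _ => ⟨p.1.erase p.2, p.2⟩) (fun p _ => ⟨insert p.2 p.1, p.2⟩)
    ?_ ?_ ?_ ?_ ?_
  · rintro ⟨S, v⟩ h
    obtain ⟨h1, h2⟩ := mem_sigma.1 h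
    simp only at h1 h2
    have := (mem_powersetCard.1 (hU h1)).2
    simp only [mem_sigma, mem_powersetCard, subset_univ, true_and, mem_extensions, mem_erase,
      ne_eq, not_true_eq_false, false_and, not_false_eq_true, insert_erase h2, h1, and_true]
    rw [card_erase_of_mem h2]; omega
  · rintro ⟨T, v⟩ h
    obtain ⟨h1, h2⟩ := mem_sigma.1 h
    simp only [mem_extensions] at h2
    simp [h2.2]
  · rintro ⟨S, v⟩ h
    obtain ⟨h1, h2⟩ := mem_sigma.1 h
    simp only at h2
    simp [insert_erase h2]
  · rintro ⟨T, v⟩ h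
    obtain ⟨h1, h2⟩ := mem_sigma.1 h
    simp only [mem_extensions] at h2
    simp [erase_insert h2.1]
  · rintro ⟨S, v⟩ h
    obtain ⟨h1, h2⟩ := mem_sigma.1 h
    simp only at h2
    simp [insert_erase h2]

theorem extensions_powersetCard {m : ℕ} {T : Finset V} (hT : T ∈ univ.powersetCard m) :
    extensions (univ.powersetCard (m + 1)) T = univ \ T := by
  ext v
  simp only [mem_extensions, mem_powersetCard, subset_univ, true_and, mem_sdiff, mem_univ]
  refine ⟨fun h => h.1, fun h => ⟨h, ?_⟩⟩
  rw [card_insert_of_notMem h, (mem_powersetCard.1 hT).2]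

theorem sum_inv_extensions_le {m : ℕ} {U : Finset (Finset V)}
    (hU : U ⊆ univ.powersetCard (m + 1)) :
    ∑ S ∈ U, ∑ v ∈ S, (1 : ℝ) / (extensions U (S.erase v)).card ≤
      (Fintype.card V).choose m := by
  rw [sum_sum_erase hU (fun S v => (1 : ℝ) / (extensions U (S.erase v)).card)]
  calc _ ≤ ∑ T ∈ univ.powersetCard m, (1 : ℝ) := by
        refine sum_le_sum fun T _ => ?_
        rw [sum_congr rfl (g := fun _ => (1 : ℝ) / (extensions U T).card)
          (fun v hv => by rw [erase_insert (mem_extensions.1 hv).1]), sum_const, nsmul_eq_mul,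
          mul_one_div]
        exact div_self_le_one _
    _ = _ := by simp [card_powersetCard]

/-- Support sets `U`, among them two-clause sets `D` with heads, and exceptional `(k+1)`-sets `B`. -/
structure HeadedSystem (k : ℕ) (U D B : Finset (Finset V)) (head : Finset V → V) : Prop where
  support_subset : U ⊆ univ.powersetCard k
  double_subset : D ⊆ U
  head_mem : ∀ S ∈ D, head S ∈ S
  forbidden : ∀ S ∈ D, ∀ v ∉ S, insert v S ∉ B → insert v (S.erase (head S)) ∈ U →
    ∀ b ∈ S, b ≠ head S → insert v (S.erase b) ∉ U

variable {U D B : Finset (Finset V)} {head : Finset V → V}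

theorem HeadedSystem.local_bound (h : HeadedSystem k U D B head) (hk : 1 ≤ k) {Q : Finset V}
    (hQ : Q ∈ univ.powersetCard (k + 1)) :
    ∑ v ∈ Q, ((if Q.erase v ∈ U then (1 : ℝ) else 0) + (k - 1) / 2 *
      (if Q.erase v ∈ D ∧ Q.erase (head (Q.erase v)) ∈ U then 1 else 0)) ≤
      (k + 1) + (k - 1) / 2 * (k + 1) * (if Q ∈ B then 1 else 0) := by
  have hk' : (0 : ℝ) ≤ (k - 1) / 2 := by
    have : (1 : ℝ) ≤ k := by exact_mod_cast hk
    linarith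
  have hQc := (mem_powersetCard.1 hQ).2
  have hm : ∑ v ∈ Q, (if Q.erase v ∈ U then (1 : ℝ) else 0) ≤ k + 1 := by
    rw [sum_boole]
    exact_mod_cast (card_filter_le _ _).trans hQc.le
  have hle : ∀ v ∈ Q, (if Q.erase v ∈ D ∧ Q.erase (head (Q.erase v)) ∈ U then (1 : ℝ) else 0) ≤
      if Q.erase v ∈ U then 1 else 0 := by
    intro v _
    split_ifs with h1 h2 h2
    · exact le_rfl
    · exact absurd (h.double_subset h1.1) h2
    · exact zero_le_one
    · exact le_rfl
  have hhm := sum_le_sum hle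
  rw [sum_add_distrib, ← mul_sum]
  by_cases hB : Q ∈ B
  · rw [if_pos hB, mul_one]
    have := mul_le_mul_of_nonneg_left (hhm.trans hm) hk'
    linarith
  rw [if_neg hB, mul_zero, add_zero]
  by_cases hex : ∃ v ∈ Q, Q.erase v ∈ D ∧ Q.erase (head (Q.erase v)) ∈ U
  · obtain ⟨v, hv, h1, h2⟩ := hex
    have hc : head (Q.erase v) ∈ Q.erase v := h.head_mem _ h1
    have hm2 : ∑ v ∈ Q, (if Q.erase v ∈ U then (1 : ℝ) else 0) ≤ 2 := by
      rw [sum_boole]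
      have : Q.filter (fun v => Q.erase v ∈ U) ⊆ {v, head (Q.erase v)} := by
        intro b hb
        obtain ⟨hbQ, hbU⟩ := mem_filter.1 hb
        simp only [mem_insert, mem_singleton]
        by_contra hne
        push Not at hne
        have hins : ∀ a, a ≠ v → insert v ((Q.erase v).erase a) = Q.erase a := by
          intro a ha
          rw [erase_right_comm, insert_erase (mem_erase.2 ⟨ha.symm, hv⟩)]
        refine h.forbidden _ h1 v (by simp) (by rwa [insert_erase hv]) ?_ b
          (mem_erase.2 ⟨hne.1, hbQ⟩) hne.2 ?_
        · rwa [hins _ (mem_erase.1 hc).1]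
        · rwa [hins _ hne.1]
      exact_mod_cast (card_le_card this).trans card_le_two
    have := mul_le_mul_of_nonneg_left (hhm.trans hm2) hk'
    linarith
  · rw [sum_eq_zero (f := fun v => if Q.erase v ∈ D ∧ Q.erase (head (Q.erase v)) ∈ U then
      (1 : ℝ) else 0) (fun v hv => if_neg fun h' => hex ⟨v, hv, h'⟩)]
    simpa using hm

theorem HeadedSystem.extension_sum_le (h : HeadedSystem k U D B head) (hk : 1 ≤ k)
    (hB : B ⊆ univ.powersetCard (k + 1)) (hkV : k ≤ Fintype.card V) :
    ((Fintype.card V : ℝ) - k) * U.card +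
      (k - 1) / 2 * ∑ S ∈ D, (((extensions U (S.erase (head S))).card : ℝ) - 1) ≤
    ((Fintype.card V : ℝ) - k) * (Fintype.card V).choose k + (k - 1) / 2 * (k + 1) * B.card := by
  have h1 := sum_le_sum fun Q hQ => h.local_bound (Q := Q) hk hQ
  rw [sum_sum_erase (Subset.refl _)] at h1
  have hL : ∑ T ∈ univ.powersetCard k, ∑ v ∈ extensions (univ.powersetCard (k + 1)) T,
      ((if (insert v T).erase v ∈ U then (1 : ℝ) else 0) + (k - 1) / 2 *
      (if (insert v T).erase v ∈ D ∧ (insert v T).erase (head ((insert v T).erase v)) ∈ U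
        then 1 else 0)) = ∑ T ∈ univ.powersetCard k, ((if T ∈ U then
          ((Fintype.card V : ℝ) - k) else 0) + (k - 1) / 2 * (if T ∈ D then
          (((extensions U (T.erase (head T))).card : ℝ) - 1) else 0)) := by
    refine sum_congr rfl fun T hT => ?_
    have hTc := (mem_powersetCard.1 hT).2
    rw [extensions_powersetCard hT]
    have hcard : ((univ \ T).card : ℝ) = (Fintype.card V : ℝ) - k := by
      rw [card_sdiff_of_subset (subset_univ _), card_univ, hTc, Nat.cast_sub hkV]
    rw [sum_congr rfl (g := fun v => (if T ∈ U then (1 : ℝ) else 0) + (k - 1) / 2 *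
      (if T ∈ D ∧ (insert v T).erase (head T) ∈ U then 1 else 0)) (fun v hv => by
        rw [erase_insert (mem_sdiff.1 hv).2])]
    rw [sum_add_distrib, sum_const, ← mul_sum, nsmul_eq_mul, hcard]
    congr 1
    · split_ifs <;> simp
    congr 1
    by_cases hTD : T ∈ D
    · rw [if_pos hTD, sum_boole]
      have hc := h.head_mem _ hTD
      have : extensions U (T.erase (head T)) = insert (head T)
          ((univ \ T).filter (fun v => T ∈ D ∧ (insert v T).erase (head T) ∈ U)) := by
        ext v
        simp only [mem_extensions, mem_insert, mem_filter, mem_sdiff, mem_univ, true_and, hTD,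
          mem_erase, not_and]
        by_cases hv : v = head T
        · subst hv
          simp [insert_erase hc, h.double_subset hTD]
        · rw [erase_insert_of_ne hv]
          simp [hv]
      rw [this, card_insert_of_notMem (by simp [hc])]
      push_cast; ring
    · simp [hTD]
  rw [hL, sum_add_distrib, ← mul_sum, ← sum_filter, ← sum_filter] at h1
  have hUf : (univ.powersetCard k).filter (· ∈ U) = U := by
    ext S; simp only [mem_filter]; exact ⟨fun h => h.2, fun hS => ⟨h.support_subset hS, hS⟩⟩
  have hDf : (univ.powersetCard k).filter (· ∈ D) = D := by
    ext S; simp only [mem_filter]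
    exact ⟨fun h => h.2, fun hS => ⟨h.support_subset (h.double_subset hS), hS⟩⟩
  have hBf : (univ.powersetCard (k + 1)).filter (· ∈ B) = B := by
    ext S; simp only [mem_filter]; exact ⟨fun h => h.2, fun hS => ⟨hB hS, hS⟩⟩
  rw [hUf, hDf, sum_const, nsmul_eq_mul, sum_add_distrib, ← mul_sum, sum_const, nsmul_eq_mul,
    card_powersetCard, card_univ, sum_boole, hBf] at h1
  have hch : ((Fintype.card V).choose (k + 1) : ℝ) * (k + 1) =
      ((Fintype.card V).choose k : ℝ) * ((Fintype.card V : ℝ) - k) := by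
    rw [← Nat.cast_sub hkV]
    exact_mod_cast Nat.choose_succ_right_eq (Fintype.card V) k
  linarith

theorem HeadedSystem.extensions_add_le (h : HeadedSystem k U D B head)
    {S : Finset V} (hS : S ∈ D) {b : V} (hb : b ∈ S) (hne : b ≠ head S) :
    (extensions U (S.erase (head S))).card + (extensions U (S.erase b)).card ≤
      Fintype.card V + ((univ \ S).filter (fun v => insert v S ∈ B)).card := by
  rw [← card_union_add_card_inter]
  have h1 : (extensions U (S.erase (head S)) ∩ extensions U (S.erase b)) ⊆
      (univ \ S).filter (fun v => insert v S ∈ B) := by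
    intro v hv
    obtain ⟨h1, h2⟩ := mem_inter.1 hv
    rw [mem_extensions] at h1 h2
    have hvS : v ∉ S := by
      intro hvS
      have e1 : v = head S := by
        by_contra hne'; exact h1.1 (mem_erase.2 ⟨hne', hvS⟩)
      have e2 : v = b := by
        by_contra hne'; exact h2.1 (mem_erase.2 ⟨hne', hvS⟩)
      exact hne (e2.symm.trans e1)
    rw [mem_filter]
    refine ⟨by simp [hvS], ?_⟩
    by_contra hB
    exact h.forbidden S hS v hvS hB h1.2 b hb hne h2.2
  exact Nat.add_le_add (card_le_univ _) (card_le_card h1)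

theorem exists_turan_weights (hk : 2 ≤ k) : ∃ a b : ℝ, 0 ≤ a ∧ 0 ≤ b ∧ b ≤ 2 ∧
    a ^ 2 = k * (k - 1) / 2 + (k - 1) * b ^ 2 ∧
    (11 / 5 : ℝ) * k ≤ 2 * a + (k - 1) * (2 * b - b ^ 2) := by
  have hk' : (2 : ℝ) ≤ k := by exact_mod_cast hk
  rcases Nat.lt_or_ge 2 k with h3 | h3
  · have h3 : (3 : ℝ) ≤ k := by exact_mod_cast h3
    have hnn : (0 : ℝ) ≤ k * (k - 1) / 2 + (k - 1) * (5 / 4) ^ 2 := by nlinarith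
    refine ⟨Real.sqrt (k * (k - 1) / 2 + (k - 1) * (5 / 4) ^ 2), 5 / 4, Real.sqrt_nonneg _,
      by norm_num, by norm_num, Real.sq_sqrt hnn, ?_⟩
    have : (1.2625 * k + 0.9375) / 2 ≤ Real.sqrt (k * (k - 1) / 2 + (k - 1) * (5 / 4) ^ 2) := by
      apply Real.le_sqrt_of_sq_le
      nlinarith
    nlinarith
  · obtain rfl : k = 2 := le_antisymm h3 hk
    refine ⟨Real.sqrt (4.24), 9 / 5, Real.sqrt_nonneg _,
      by norm_num, by norm_num, ?_, ?_⟩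
    · rw [Real.sq_sqrt (by norm_num)]; norm_num
    · have : (2.03 : ℝ) ≤ Real.sqrt (4.24) := by
        apply Real.le_sqrt_of_sq_le; norm_num
      norm_num at this ⊢
      nlinarith

end

section

variable {V : Type*} [Fintype V] [DecidableEq V] {k : ℕ}
variable {U D B : Finset (Finset V)} {head : Finset V → V}

theorem sum_card_extensions_le {m : ℕ} {D B : Finset (Finset V)} (hD : D ⊆ univ.powersetCard m)
    (hB : B ⊆ univ.powersetCard (m + 1)) :
    ∑ S ∈ D, (extensions B S).card ≤ (m + 1) * B.card := by
  calc ∑ S ∈ D, (extensions B S).card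
      ≤ ∑ S ∈ univ.powersetCard m, (extensions B S).card :=
        sum_le_sum_of_subset hD
    _ = ∑ Q ∈ B, ∑ v ∈ Q, 1 := by
        rw [sum_sum_erase hB]; simp
    _ = _ := by
        rw [sum_congr rfl (g := fun _ => m + 1) (fun Q hQ => by
          rw [sum_const, (mem_powersetCard.1 (hB hQ)).2]; simp)]
        simp [mul_comm]

theorem tangent_bound {a x : ℝ} (hx : 0 < x) : 2 * a - a ^ 2 * x ≤ 1 / x := by
  rw [le_div_iff₀ hx]; nlinarith [sq_nonneg (a * x - 1)]

theorem turan_arith {m N u w C C' Y bs β P : ℝ} (hm : 1 ≤ m) (hu' : u / N ≤ P) (hw' : w / N ≤ P)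
    (hbs : bs / N ≤ (m + 2) * β) (hch : C' ≤ P) (hC0 : 0 ≤ C / N) (hP : 0 ≤ P) (hB0 : 0 ≤ β)
    (h1' : (1 - (m + 1) / N) * u + m / 2 * (Y / N - w / N) ≤
      (1 - (m + 1) / N) * C + m / 2 * (m + 2) * β)
    (h3' : (u - w) * (m + 1) + (11 / 5 * (m + 1) * w - (m + 1) * m / 2 * (Y / N)
      - 4 * m * (bs / N)) ≤ C' * N) (hch2 : C' * N = C * (m + 1) + m * C') :
    u - w + 8 / 5 * w ≤ C + 2 * (m + 1) * P + 2 * (m + 1) ^ 2 * β := by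
  have e1 : (m + 1) / N * u = (m + 1) * (u / N) := by ring
  have e2 : (m + 1) / N * C = (m + 1) * (C / N) := by ring
  rw [sub_mul, sub_mul, e1, e2, one_mul, one_mul] at h1'
  have f1 := mul_le_mul_of_nonneg_left h1' (show (0 : ℝ) ≤ m + 1 by linarith)
  have f2 := mul_le_mul_of_nonneg_left hu' (show (0 : ℝ) ≤ (m + 1) * (m + 1) by positivity)
  have f3 := mul_le_mul_of_nonneg_left hw' (show (0 : ℝ) ≤ (m + 1) * m / 2 by positivity)
  have f4 := mul_le_mul_of_nonneg_left hbs (show (0 : ℝ) ≤ 4 * m by positivity)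
  have f5 := mul_le_mul_of_nonneg_left hch (show (0 : ℝ) ≤ m by positivity)
  have f6 : (0 : ℝ) ≤ (m + 1) * ((m + 1) * (C / N)) := by positivity
  have key : (m + 1) * (2 * (u - w) + 16 / 5 * w) ≤ (m + 1) * (2 * C) +
      ((m + 1) * (m + 1) * P + (m + 1) * m / 2 * P + m * P) +
      ((m + 1) * (m / 2 * (m + 2)) + 4 * m * (m + 2)) * β := by
    ring_nf at f1 f2 f3 f4 f5 f6 h3' hch2 ⊢
    linarith
  have hm0 : 0 ≤ m := by linarith
  have g1 : ((m + 1) * (m + 1) + (m + 1) * m / 2 + m) * P ≤ (m + 1) * (4 * (m + 1)) * P := by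
    apply mul_le_mul_of_nonneg_right _ hP
    nlinarith
  have g2 : ((m + 1) * (m / 2 * (m + 2)) + 4 * m * (m + 2)) * β ≤
      (m + 1) * (4 * (m + 1) ^ 2) * β := by
    apply mul_le_mul_of_nonneg_right _ hB0
    nlinarith [mul_nonneg hm0 hm0, mul_nonneg (mul_nonneg hm0 hm0) hm0]
  refine le_of_mul_le_mul_left (a := 2 * (m + 1)) ?_ (by linarith)
  linarith

theorem HeadedSystem.turan (h : HeadedSystem k U D B head) (hk : 2 ≤ k)
    (hB : B ⊆ univ.powersetCard (k + 1)) (hkV : k ≤ Fintype.card V) :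
    ((U \ D).card : ℝ) + 8 / 5 * D.card ≤ (Fintype.card V).choose k +
      2 * k * (Fintype.card V : ℝ) ^ (k - 1) + 2 * k ^ 2 * (B.card / Fintype.card V) := by
  obtain ⟨a, b, ha, hb, hb2, hab, hval⟩ := exists_turan_weights hk
  have hk' : (2 : ℝ) ≤ k := by exact_mod_cast hk
  set N : ℝ := (Fintype.card V : ℝ) with hNdef
  have hN : 0 < N := by
    have : (k : ℝ) ≤ N := by rw [hNdef]; exact_mod_cast hkV
    linarith
  obtain ⟨m, rfl⟩ : ∃ m, k = m + 1 := ⟨k - 1, by omega⟩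
  rw [Nat.add_sub_cancel]
  have hm' : (1 : ℝ) ≤ m := by push_cast at hk'; linarith
  set d : Finset V → ℝ := fun T => (extensions U T).card with hd
  have hdle : ∀ T, d T ≤ N := fun T => by
    simp only [hd, hNdef]; exact_mod_cast card_le_univ _
  have hdpos : ∀ S ∈ U, ∀ v ∈ S, 0 < d (S.erase v) := by
    intro S hS v hv
    simp only [hd]
    exact_mod_cast card_pos.2 ⟨v, mem_extensions.2 ⟨by simp, by rwa [insert_erase hv]⟩⟩
  have h1 := h.extension_sum_le (by omega) hB hkV
  have h2 : ∑ S ∈ U, ∑ v ∈ S, 1 / d (S.erase v) ≤ (Fintype.card V).choose m :=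
    sum_inv_extensions_le h.support_subset
  set bad : Finset V → ℝ := fun S => (extensions B S).card with hbad
  have hbadsum : ∑ S ∈ D, bad S ≤ (m + 2) * B.card := by
    have := sum_card_extensions_le (h.double_subset.trans h.support_subset) hB
    simp only [hbad]
    rw [← Nat.cast_sum]
    calc _ ≤ (((m + 1 + 1) * B.card : ℕ) : ℝ) := by exact_mod_cast this
      _ = _ := by push_cast; ring
  -- lower bounds for the inner sums
  have hsing : ∀ S ∈ U, ((m : ℝ) + 1) / N ≤ ∑ v ∈ S, 1 / d (S.erase v) := by
    intro S hS
    have : ∑ v ∈ S, 1 / N ≤ ∑ v ∈ S, 1 / d (S.erase v) :=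
      sum_le_sum fun v hv => one_div_le_one_div_of_le (hdpos S hS v hv) (hdle _)
    rw [sum_const, (mem_powersetCard.1 (h.support_subset hS)).2, nsmul_eq_mul] at this
    push_cast at this
    rwa [mul_one_div] at this
  have hsc : ∀ c x : ℝ, 0 < x → (2 * c - c ^ 2 * (x / N)) / N ≤ 1 / x := by
    intro c x hx
    have := tangent_bound (a := c) (div_pos hx hN)
    rw [div_le_iff₀ hN]
    refine this.trans (le_of_eq ?_)
    field_simp
  have hdoub : ∀ S ∈ D, ((11 / 5 * (m + 1) - (m + 1) * m / 2 * (d (S.erase (head S)) / N)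
      - 4 * m * (bad S / N))) / N ≤ ∑ v ∈ S, 1 / d (S.erase v) := by
    intro S hS
    have hSU := h.double_subset hS
    have hc := h.head_mem S hS
    rw [← add_sum_erase _ _ hc]
    have e1 := hsc a _ (hdpos S hSU _ hc)
    have e2 : ∑ v ∈ S.erase (head S), (2 * b - b ^ 2 * (1 - d (S.erase (head S)) / N + bad S / N)) / N
        ≤ ∑ v ∈ S.erase (head S), 1 / d (S.erase v) := by
      refine sum_le_sum fun v hv => ?_
      obtain ⟨hv1, hv2⟩ := mem_erase.1 hv
      refine le_trans ?_ (hsc b _ (hdpos S hSU _ hv2))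
      have e3 : d (S.erase (head S)) + d (S.erase v) ≤ N + bad S := by
        have := h.extensions_add_le hS hv2 hv1
        have e4 : (univ \ S).filter (fun v => insert v S ∈ B) = extensions B S := by
          ext v; simp [mem_extensions]
        rw [e4] at this
        simp only [hd, hbad, hNdef]
        exact_mod_cast this
      have e5 : d (S.erase v) / N ≤ 1 - d (S.erase (head S)) / N + bad S / N := by
        rw [div_le_iff₀ hN]; field_simp; linarith
      gcongr
    rw [sum_const, card_erase_of_mem hc, (mem_powersetCard.1 (h.support_subset hSU)).2,
      nsmul_eq_mul, Nat.add_sub_cancel] at e2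
    refine le_trans ?_ (add_le_add e1 e2)
    have hbn : 0 ≤ bad S / N := by positivity
    rw [← mul_div_assoc (m : ℝ) (2 * b - b ^ 2 * _) N, ← add_div]
    gcongr
    push_cast at hab hval
    have hb4 : b ^ 2 ≤ 4 := by nlinarith
    have := mul_le_mul_of_nonneg_right hb4 (mul_nonneg (show (0 : ℝ) ≤ m by linarith) hbn)
    set y := d (S.erase (head S)) / N
    have e6 : a ^ 2 * y = ((m + 1) * m / 2 + m * b ^ 2) * y := by rw [hab]; ring
    nlinarith
  have h3 : ((U \ D).card : ℝ) * ((m + 1) / N) + ∑ S ∈ D, ((11 / 5 * (m + 1) -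
      (m + 1) * m / 2 * (d (S.erase (head S)) / N) - 4 * m * (bad S / N))) / N ≤
      (Fintype.card V).choose m := by
    refine le_trans ?_ h2
    rw [← sum_sdiff h.double_subset, ← nsmul_eq_mul]
    exact add_le_add (card_nsmul_le_sum _ _ _ fun S hS => hsing S (mem_sdiff.1 hS).1)
      (sum_le_sum hdoub)
  have hUD : ((U \ D).card : ℝ) = U.card - D.card := by
    rw [card_sdiff_of_subset h.double_subset, Nat.cast_sub (card_le_card h.double_subset)]
  have hUle : (U.card : ℝ) ≤ N ^ (m + 1) := by
    have := card_le_card h.support_subset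
    rw [card_powersetCard, card_univ] at this
    rw [hNdef]; exact_mod_cast this.trans (Nat.choose_le_pow _ _)
  have hDle : (D.card : ℝ) ≤ N ^ (m + 1) := le_trans (by exact_mod_cast card_le_card h.double_subset) hUle
  have hch : ((Fintype.card V).choose m : ℝ) ≤ N ^ m := by
    simp only [hNdef]; exact_mod_cast Nat.choose_le_pow _ _
  have hch2 : ((Fintype.card V).choose (m + 1) : ℝ) * (m + 1) =
      ((Fintype.card V).choose m : ℝ) * (N - m) := by
    rw [hNdef, ← Nat.cast_sub (by omega)]
    exact_mod_cast Nat.choose_succ_right_eq (Fintype.card V) m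
  set Y := ∑ S ∈ D, d (S.erase (head S)) with hY
  have h4 : ∑ S ∈ D, ((11 / 5 * ((m : ℝ) + 1) - (m + 1) * m / 2 * (d (S.erase (head S)) / N)
      - 4 * m * (bad S / N))) / N = (11 / 5 * (m + 1) * D.card - (m + 1) * m / 2 * (Y / N)
      - 4 * m * ((∑ S ∈ D, bad S) / N)) / N := by
    rw [← sum_div, sum_sub_distrib, sum_sub_distrib, sum_const, ← mul_sum, ← mul_sum,
      ← sum_div, ← sum_div, nsmul_eq_mul]
    ring
  rw [h4] at h3
  rw [sum_sub_distrib, sum_const, nsmul_eq_mul, mul_one] at h1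
  rw [hUD] at h3 ⊢
  set u : ℝ := (U.card : ℝ)
  set w : ℝ := (D.card : ℝ)
  set Bc : ℝ := (B.card : ℝ)
  set bs := ∑ S ∈ D, bad S
  set C : ℝ := ((Fintype.card V).choose (m + 1) : ℝ)
  set C' : ℝ := ((Fintype.card V).choose m : ℝ)
  push_cast at h1
  have h3' : (u - w) * (m + 1) + (11 / 5 * (m + 1) * w - (m + 1) * m / 2 * (Y / N)
      - 4 * m * (bs / N)) ≤ C' * N := by
    have := mul_le_mul_of_nonneg_right h3 hN.le
    rw [add_mul, div_mul_cancel₀ _ hN.ne'] at this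
    rwa [mul_assoc, div_mul_cancel₀ _ hN.ne'] at this
  have h1' : (1 - (m + 1) / N) * u + m / 2 * (Y / N - w / N) ≤
      (1 - (m + 1) / N) * C + m / 2 * (m + 2) * (Bc / N) := by
    have : ∀ x y : ℝ, x ≤ y → x / N ≤ y / N := fun x y hxy => by gcongr
    have := this _ _ h1
    calc _ = ((N - (m + 1)) * u + (m + 1 - 1) / 2 * (Y - w)) / N := by field_simp; ring
      _ ≤ _ := this
      _ = _ := by field_simp; ring
  have hbs : bs / N ≤ (m + 2) * (Bc / N) := by rw [← mul_div_assoc]; gcongr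
  have hu' : u / N ≤ N ^ m := by rw [div_le_iff₀ hN, ← pow_succ]; exact hUle
  have hw' : w / N ≤ N ^ m := by rw [div_le_iff₀ hN, ← pow_succ]; exact hDle
  have hB0 : 0 ≤ Bc / N := by positivity
  have hC0 : 0 ≤ C / N := by positivity
  have hP : 0 ≤ N ^ m := by positivity
  set β := Bc / N
  set P := N ^ m
  push_cast
  exact turan_arith hm' hu' hw' hbs hch hC0 hP hB0 h1' h3' (by linarith [hch2])

end

section

variable {V : Type*} [Fintype V] [DecidableEq V] {k : ℕ}

/-- A property of sets preserved by exchanging one element is invariant inside `W`. -/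
theorem swap_path {W : Finset V} {m : ℕ} {p : Finset V → Prop}
    (hstep : ∀ M ⊆ W, M.card = m → ∀ b ∈ M, ∀ a ∈ W, a ∉ M → p M → p (insert a (M.erase b)))
    {L L' : Finset V} (hL : L ⊆ W) (hL' : L' ⊆ W) (hc : L.card = m) (hc' : L'.card = m)
    (hp : p L) : p L' := by
  induction hd : (L' \ L).card generalizing L with
  | zero =>
    have h1 : L' ⊆ L := by rwa [card_eq_zero, sdiff_eq_empty_iff_subset] at hd
    rwa [eq_of_subset_of_card_le h1 (by omega)]
  | succ d ih =>
    obtain ⟨a, ha⟩ : (L' \ L).Nonempty := card_pos.1 (by omega)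
    obtain ⟨b, hb⟩ : (L \ L').Nonempty := card_pos.1 (by
      rw [card_sdiff_comm (hc.trans hc'.symm)]; omega)
    rw [mem_sdiff] at ha hb
    refine ih (L := insert a (L.erase b)) ?_ ?_ (hstep L hL hc b hb.1 a (hL' ha.1) ha.2 hp) ?_
    · exact insert_subset (hL' ha.1) ((erase_subset _ _).trans hL)
    · rw [card_insert_of_notMem (fun h => ha.2 (mem_of_mem_erase h)), card_erase_of_mem hb.1]
      have := card_pos.2 ⟨b, hb.1⟩
      omega
    · have : L' \ insert a (L.erase b) = (L' \ L).erase a := by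
        ext v
        simp only [mem_sdiff, mem_insert, mem_erase, not_or, not_and]
        constructor
        · rintro ⟨h1, h2, h3⟩
          exact ⟨h2, h1, h3 (fun h => hb.2 (h ▸ h1))⟩
        · rintro ⟨h1, h2, h3⟩
          exact ⟨h2, h1, fun _ => h3⟩
      rw [this, card_erase_of_mem (mem_sdiff.2 ha)]
      omega

theorem card_supersets_le (m : ℕ) (X : Finset V) :
    ((univ.powersetCard m).filter (X ⊆ ·)).card ≤ Fintype.card V ^ (m - X.card) := by
  calc _ ≤ ((univ : Finset V).powersetCard (m - X.card)).card := by
        refine card_le_card_of_injOn (· \ X) ?_ ?_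
        · intro S hS
          obtain ⟨h1, h2⟩ := mem_filter.1 hS
          rw [mem_coe, mem_powersetCard]
          exact ⟨subset_univ _, by rw [card_sdiff_of_subset h2, (mem_powersetCard.1 h1).2]⟩
        · intro S hS S' hS' h
          rw [← sdiff_union_of_subset (mem_filter.1 hS).2,
            ← sdiff_union_of_subset (mem_filter.1 hS').2]
          exact congrArg (· ∪ X) h
    _ ≤ _ := by
        rw [card_powersetCard, card_univ]; exact Nat.choose_le_pow _ _

theorem card_pairs_covering_le (m : ℕ) (T : Finset V) :
    (((univ.powersetCard m) ×ˢ (univ.powersetCard m)).filter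
      (fun p : Finset V × Finset V => T ⊆ p.1 ∪ p.2)).card ≤
      2 ^ T.card * Fintype.card V ^ (2 * m - T.card) := by
  calc _ ≤ (T.powerset.biUnion (fun X => ((univ.powersetCard m).filter (X ⊆ ·)) ×ˢ
        ((univ.powersetCard m).filter (T \ X ⊆ ·)))).card := by
        apply card_le_card
        rintro ⟨L, L'⟩ h
        obtain ⟨h1, h2⟩ := mem_filter.1 h
        obtain ⟨h3, h4⟩ := mem_product.1 h1
        refine mem_biUnion.2 ⟨T ∩ L, mem_powerset.2 inter_subset_left, mem_product.2
          ⟨mem_filter.2 ⟨h3, inter_subset_right⟩, mem_filter.2 ⟨h4, ?_⟩⟩⟩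
        intro v hv
        obtain ⟨h5, h6⟩ := mem_sdiff.1 hv
        rcases mem_union.1 (h2 h5) with h | h
        · exact absurd (mem_inter.2 ⟨h5, h⟩) h6
        · exact h
    _ ≤ ∑ X ∈ T.powerset, Fintype.card V ^ (2 * m - T.card) := by
        refine card_biUnion_le.trans (sum_le_sum fun X hX => ?_)
        rw [mem_powerset] at hX
        rw [card_product]
        have hTX : (T \ X).card = T.card - X.card := card_sdiff_of_subset hX
        have hle := card_le_card hX
        have hempty : ∀ Z : Finset V, m < Z.card →
            (univ.powersetCard m).filter (Z ⊆ ·) = ∅ := by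
          intro Z hZ
          refine filter_eq_empty_iff.2 fun S hS h => ?_
          have := card_le_card h
          rw [(mem_powersetCard.1 hS).2] at this
          omega
        by_cases h1 : m < X.card
        · rw [hempty _ h1]; simp
        by_cases h2 : m < (T \ X).card
        · rw [hempty _ h2]; simp
        calc _ ≤ Fintype.card V ^ (m - X.card) * Fintype.card V ^ (m - (T \ X).card) :=
              Nat.mul_le_mul (card_supersets_le _ _) (card_supersets_le _ _)
          _ = _ := by rw [← pow_add]; congr 1; omega
    _ = _ := by rw [sum_const, card_powerset, smul_eq_mul]

/-- If every pair in `P × P'` covers a member of `𝒯`, then `P × P'` is small. -/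
theorem card_mul_card_le_of_covering {m t : ℕ} {P P' 𝒯 : Finset (Finset V)}
    (hP : P ⊆ univ.powersetCard m) (hP' : P' ⊆ univ.powersetCard m)
    (h𝒯 : 𝒯 ⊆ univ.powersetCard t)
    (h : ∀ L ∈ P, ∀ L' ∈ P', ∃ T ∈ 𝒯, T ⊆ L ∪ L') :
    P.card * P'.card ≤ 𝒯.card * (2 ^ t * Fintype.card V ^ (2 * m - t)) := by
  rw [← card_product, ← smul_eq_mul, ← sum_const]
  calc (P ×ˢ P').card ≤ (𝒯.biUnion (fun T => ((univ.powersetCard m) ×ˢ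
        (univ.powersetCard m)).filter (fun p : Finset V × Finset V => T ⊆ p.1 ∪ p.2))).card := by
        apply card_le_card
        rintro ⟨L, L'⟩ hL
        obtain ⟨h1, h2⟩ := mem_product.1 hL
        obtain ⟨T, hT, hs⟩ := h L h1 L' h2
        exact mem_biUnion.2 ⟨T, hT, mem_filter.2 ⟨mem_product.2 ⟨hP h1, hP' h2⟩, hs⟩⟩
    _ ≤ _ := by
        refine card_biUnion_le.trans (sum_le_sum fun T hT => ?_)
        have := card_pairs_covering_le m T
        rwa [(mem_powersetCard.1 (h𝒯 hT)).2] at this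

theorem min_le_add_mul_div {a b x : ℝ} (ha : 0 ≤ a) (hb : 0 ≤ b) (hx : 0 < x) :
    min a b ≤ x + a * b / x := by
  have hab : 0 ≤ a * b / x := by positivity
  rcases le_total (min a b) x with h | h
  · linarith
  · have : min a b ≤ a * b / x := by
      rw [le_div_iff₀ hx, ← min_mul_max a b]
      exact mul_le_mul_of_nonneg_left (h.trans (min_le_max)) (le_min ha hb)
    linarith

/-- The `k`-sets not carrying exactly one clause. -/
noncomputable def nonSingleSets (k : ℕ) (A : SatFormula V) : Finset (Finset V) :=
  univ.powersetCard k \ (A.image clauseVars \ multiSets k 1 A)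

theorem mem_multiSets_one {A : SatFormula V} (hA : A ⊆ kClauses k V) {C C' : SatClause V}
    (hC : C ∈ A) (hC' : C' ∈ A) (hne : C ≠ C') (he : clauseVars C = clauseVars C') :
    clauseVars C ∈ multiSets k 1 A := by
  classical
  refine mem_filter.2 ⟨mem_powersetCard.2 ⟨subset_univ _, (mem_kClauses.1 (hA hC)).2⟩, C, hC, C',
    hC', rfl, he.symm, ?_⟩
  by_contra h
  refine hne ?_
  rw [(mem_kClauses.1 (hA hC)).eq_signedClause, (mem_kClauses.1 (hA hC')).eq_signedClause, ← he,
    signedClause_congr]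
  intro v hv
  by_contra hv'
  have : v ∈ (clauseVars C).filter (fun v => clauseSign C v ≠ clauseSign C' v) :=
    mem_filter.2 ⟨hv, hv'⟩
  exact h (card_pos.2 ⟨v, this⟩)

theorem clause_unique_of_notMem_nonSingleSets {A : SatFormula V} (hA : A ⊆ kClauses k V)
    {C C' : SatClause V} (hC : C ∈ A) (hC' : C' ∈ A) (he : clauseVars C = clauseVars C')
    (h : clauseVars C ∉ nonSingleSets k A) : C = C' := by
  by_contra hne
  refine h (mem_sdiff.2 ⟨mem_powersetCard.2 ⟨subset_univ _, (mem_kClauses.1 (hA hC)).2⟩, fun h' =>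
    (mem_sdiff.1 h').2 (mem_multiSets_one hA hC hC' hne he)⟩)

theorem exists_clause_of_notMem_nonSingleSets {A : SatFormula V} {S : Finset V}
    (hS : S ∈ univ.powersetCard k) (h : S ∉ nonSingleSets k A) : ∃ C ∈ A, clauseVars C = S := by
  have : S ∈ A.image clauseVars \ multiSets k 1 A := by
    by_contra h'; exact h (mem_sdiff.2 ⟨hS, h'⟩)
  exact mem_image.1 (mem_sdiff.1 this).1

theorem card_clauses_on_le {A : SatFormula V} (hA : A ⊆ kClauses k V) {S : Finset V} :
    (A.filter (fun C => clauseVars C = S)).card ≤ 2 ^ k := by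
  rcases (A.filter (fun C => clauseVars C = S)).eq_empty_or_nonempty with h | ⟨C₀, hC₀⟩
  · rw [h]; simp
  have hSc : S.card = k := by
    rw [← (mem_filter.1 hC₀).2]; exact (mem_kClauses.1 (hA (mem_filter.1 hC₀).1)).2
  rw [← hSc, ← card_powerset]
  refine card_le_card_of_injOn (fun C => S.filter (fun v => clauseSign C v)) ?_ ?_
  · intro C _; exact mem_coe.2 (mem_powerset.2 (filter_subset _ _))
  · intro C hC C' hC' h
    obtain ⟨h1, h2⟩ := mem_filter.1 hC
    obtain ⟨h1', h2'⟩ := mem_filter.1 hC'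
    rw [(mem_kClauses.1 (hA h1)).eq_signedClause, (mem_kClauses.1 (hA h1')).eq_signedClause, h2,
      h2', signedClause_congr]
    intro v hv
    have := congrArg (v ∈ ·) h
    simp only [mem_filter, hv, true_and, eq_iff_iff] at this
    exact Bool.eq_iff_iff.2 this

theorem card_clauses_within_le {A : SatFormula V} (hA : A ⊆ kClauses k V)
    (X : Finset (Finset V)) :
    (A.filter (fun C => clauseVars C ∈ X)).card ≤ 2 ^ k * X.card := by
  calc _ ≤ (X.biUnion (fun S => A.filter (fun C => clauseVars C = S))).card := by
        apply card_le_card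
        intro C hC
        obtain ⟨h1, h2⟩ := mem_filter.1 hC
        exact mem_biUnion.2 ⟨_, h2, mem_filter.2 ⟨h1, rfl⟩⟩
    _ ≤ ∑ S ∈ X, 2 ^ k := card_biUnion_le.trans (sum_le_sum fun S _ => card_clauses_on_le hA)
    _ = _ := by rw [sum_const, smul_eq_mul, mul_comm]

/-- The clauses containing a literal falsified by `σ`. -/
def nonMonotone (σ : V → Bool) (A : SatFormula V) : SatFormula V :=
  A.filter (fun C => ∃ v ∈ clauseVars C, clauseSign C v ≠ σ v)

open scoped Classical in
/-- The `(k+1)`-sets which are bad or contain a `k`-set not carrying exactly one clause. -/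
noncomputable def roughSets (k : ℕ) (A : SatFormula V) : Finset (Finset V) :=
  badSets k A ∪ (univ.powersetCard (k + 1)).filter (fun Q => ∃ v ∈ Q, Q.erase v ∈ nonSingleSets k A)

theorem card_roughSets_le (A : SatFormula V) :
    (roughSets k A).card ≤ (badSets k A).card + Fintype.card V * (nonSingleSets k A).card := by
  classical
  refine (card_union_le _ _).trans (Nat.add_le_add_left ?_ _)
  rw [← card_univ, ← card_product]
  refine (card_le_card (t := ((univ : Finset V) ×ˢ nonSingleSets k A).image
    (fun p => insert p.1 p.2)) ?_).trans card_image_le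
  intro Q hQ
  obtain ⟨_, v, hv, h⟩ := mem_filter.1 hQ
  exact mem_image.2 ⟨(v, Q.erase v), mem_product.2 ⟨mem_univ _, h⟩, insert_erase hv⟩

open scoped Classical in
/-- The sets `L` such that the single clause on `L ∪ {v}` contains `v` with sign `b`. -/
noncomputable def signedLinks (m : ℕ) (A : SatFormula V) (v : V) (b : Bool) : Finset (Finset V) :=
  (univ.powersetCard m).filter (fun L => v ∉ L ∧ insert v L ∉ nonSingleSets (m + 1) A ∧
    ∀ C ∈ A, clauseVars C = insert v L → clauseSign C v = b)

theorem signedLinks_covering {m : ℕ} {A : SatFormula V}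
    {v : V} {L L' : Finset V}
    (hL : L ∈ signedLinks m A v true) (hL' : L' ∈ signedLinks m A v false) :
    ∃ T ∈ (univ.powersetCard (m + 1)).filter (fun T => v ∉ T ∧ insert v T ∈ roughSets (m + 1) A),
      T ⊆ L ∪ L' := by
  classical
  by_contra hno
  push Not at hno
  obtain ⟨hLc, hvL, hLs, hLt⟩ := mem_filter.1 hL
  obtain ⟨hLc', hvL', hLs', hLf⟩ := mem_filter.1 hL'
  have hvW : v ∉ L ∪ L' := by simp [hvL, hvL']
  rw [mem_powersetCard] at hLc hLc'
  have hpath : ∀ C ∈ A, clauseVars C = insert v L' → clauseSign C v = true := by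
    refine swap_path (W := L ∪ L') (m := m)
      (p := fun M => ∀ C ∈ A, clauseVars C = insert v M → clauseSign C v = true)
      ?_ subset_union_left subset_union_right hLc.2 hLc'.2 hLt
    intro M hM hMc b hb a haW ha hp C hC hCv
    by_contra hne
    have hvM : v ∉ M := fun h => hvW (hM h)
    have hva : v ≠ a := fun h => hvW (h ▸ haW)
    have hvb : v ≠ b := fun h => hvM (h ▸ hb)
    have hab : a ≠ b := fun h => ha (h ▸ hb)
    have hT : insert a M ⊆ L ∪ L' := insert_subset haW hM
    have hTc : (insert a M).card = m + 1 := by rw [card_insert_of_notMem ha, hMc]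
    have hvT : v ∉ insert a M := by simp [hva, hvM]
    have hQc : (insert v (insert a M)).card = m + 1 + 1 := by rw [card_insert_of_notMem hvT, hTc]
    have hrough : insert v (insert a M) ∉ roughSets (m + 1) A := fun h =>
      hno _ (mem_filter.2 ⟨mem_powersetCard.2 ⟨subset_univ _, hTc⟩, hvT, h⟩) hT
    have hsing : ∀ w ∈ insert v (insert a M),
        ∃ C ∈ A, clauseVars C = (insert v (insert a M)).erase w := by
      intro w hw
      refine exists_clause_of_notMem_nonSingleSets (k := m + 1) (mem_powersetCard.2
        ⟨subset_univ _, by rw [card_erase_of_mem hw, hQc]; rfl⟩) fun h => hrough ?_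
      exact mem_union_right _ (mem_filter.2 ⟨mem_powersetCard.2 ⟨subset_univ _, hQc⟩, w, hw, h⟩)
    obtain ⟨C₁, hC₁, e₁⟩ := hsing v (by simp)
    obtain ⟨C₂, hC₂, e₂⟩ := hsing a (by simp)
    refine hrough (mem_union_left _ (mem_filter.2 ⟨mem_powersetCard.2 ⟨subset_univ _, hQc⟩,
      v, by simp, b, by simp [hb], a, by simp, hvb.symm, hva.symm, hab.symm,
      C₁, hC₁, C₂, hC₂, C, hC, e₁, e₂, ?_, ?_⟩))
    · rw [hCv, erase_insert_of_ne hvb, erase_insert_of_ne hab]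
    · rw [hp C₂ hC₂ ?_]
      · exact fun h => hne h.symm
      · rw [e₂, erase_insert_of_ne hva, erase_insert ha]
  obtain ⟨C, hC, hCv⟩ := exists_clause_of_notMem_nonSingleSets (k := m + 1) (mem_powersetCard.2
        ⟨subset_univ _, by rw [card_insert_of_notMem hvL', hLc'.2]⟩) hLs'
  exact Bool.noConfusion ((hLf C hC hCv).symm.trans (hpath C hC hCv))

theorem card_signedLinks_mul_le {m : ℕ} {A : SatFormula V}
    (v : V) :
    (signedLinks m A v true).card * (signedLinks m A v false).card ≤
    ((univ.powersetCard (m + 1)).filter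
      (fun T => v ∉ T ∧ insert v T ∈ roughSets (m + 1) A)).card *
      (2 ^ (m + 1) * Fintype.card V ^ (2 * m - (m + 1))) :=
  card_mul_card_le_of_covering (filter_subset _ _) (filter_subset _ _) (filter_subset _ _)
    fun _ hL _ hL' => signedLinks_covering hL hL'

theorem sum_card_rough_links {m : ℕ} {A : SatFormula V} :
    ∑ v, ((univ.powersetCard (m + 1)).filter
      (fun T => v ∉ T ∧ insert v T ∈ roughSets (m + 1) A)).card =
      (m + 2) * (roughSets (m + 1) A).card := by
  classical
  have hR : roughSets (m + 1) A ⊆ univ.powersetCard (m + 1 + 1) :=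
    union_subset (filter_subset _ _) (filter_subset _ _)
  have h := sum_sum_erase hR (fun _ _ => 1)
  rw [sum_congr rfl (g := fun _ => m + 2) (fun Q hQ => by
    rw [sum_const, (mem_powersetCard.1 (hR hQ)).2]; simp), sum_const, smul_eq_mul] at h
  rw [mul_comm, h]
  simp only [card_filter, sum_const, smul_eq_mul, mul_one, extensions]
  exact sum_comm

theorem exists_majority {m : ℕ} {A : SatFormula V} (hA : A ⊆ kClauses (m + 1) V) (hm : 1 ≤ m)
    (hV : 0 < Fintype.card V) {l : ℝ} (hl : 0 < l) :
    ∃ σ : V → Bool, ((nonMonotone σ A).card : ℝ) ≤ 2 ^ (m + 1) * (nonSingleSets (m + 1) A).card +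
      l * Fintype.card V ^ (m + 1) + 2 ^ (m + 1) * (m + 2) *
        ((badSets (m + 1) A).card / Fintype.card V + (nonSingleSets (m + 1) A).card) / l := by
  classical
  have hN : (0 : ℝ) < Fintype.card V := by exact_mod_cast hV
  have : Nonempty V := Fintype.card_pos_iff.1 hV
  set σ : V → Bool := fun v =>
    decide ((signedLinks m A v false).card ≤ (signedLinks m A v true).card) with hσ
  refine ⟨σ, ?_⟩
  have h1 : (nonMonotone σ A).card ≤
      (A.filter (fun C => clauseVars C ∈ nonSingleSets (m + 1) A)).card +
      (univ.sigma (fun v => signedLinks m A v (!σ v))).card := by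
    rw [← card_filter_add_card_filter_not (s := nonMonotone σ A)
      (fun C => clauseVars C ∈ nonSingleSets (m + 1) A)]
    refine Nat.add_le_add (card_le_card (filter_subset_filter _ (filter_subset _ _))) ?_
    choose! f hf hf' using fun (C : SatClause V) (hC : C ∈ nonMonotone σ A) => (mem_filter.1 hC).2
    refine card_le_card_of_injOn (fun C => ⟨f C, (clauseVars C).erase (f C)⟩) ?_ ?_
    · intro C hC
      obtain ⟨h1, h2⟩ := mem_filter.1 hC
      have hCA := (mem_filter.1 h1).1
      refine mem_coe.2 (mem_sigma.2 ⟨mem_univ _, mem_filter.2 ⟨mem_powersetCard.2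
        ⟨subset_univ _, ?_⟩, ?_, ?_, ?_⟩⟩)
      · rw [card_erase_of_mem (hf C h1), (mem_kClauses.1 (hA hCA)).2]; rfl
      · simp
      · rw [insert_erase (hf C h1)]; exact h2
      · intro C' hC' he
        rw [insert_erase (hf C h1)] at he
        rw [← clause_unique_of_notMem_nonSingleSets hA hCA hC' he.symm h2]
        exact Bool.eq_not_of_ne (hf' C h1)
    · intro C hC C' hC' h
      obtain ⟨h1, h2⟩ := mem_filter.1 hC
      obtain ⟨h1', h2'⟩ := mem_filter.1 hC'
      simp only [Sigma.mk.injEq, heq_eq_eq] at h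
      refine clause_unique_of_notMem_nonSingleSets hA (mem_filter.1 h1).1 (mem_filter.1 h1').1
        ?_ h2
      rw [← insert_erase (hf C h1), ← insert_erase (hf C' h1'), h.2, h.1]
  have h2 : ∀ v, ((signedLinks m A v (!σ v)).card : ℝ) ≤ l * Fintype.card V ^ m +
      ((univ.powersetCard (m + 1)).filter
        (fun T => v ∉ T ∧ insert v T ∈ roughSets (m + 1) A)).card *
        (2 ^ (m + 1) / (l * Fintype.card V)) := by
    intro v
    have hmin : ((signedLinks m A v (!σ v)).card : ℝ) ≤
        min ((signedLinks m A v true).card : ℝ) (signedLinks m A v false).card := by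
      by_cases hle : (signedLinks m A v false).card ≤ (signedLinks m A v true).card
      · have : σ v = true := by simp [hσ, hle]
        rw [this, min_eq_right (by exact_mod_cast hle)]; rfl
      · have : σ v = false := by simp [hσ, hle]
        rw [this, min_eq_left (by exact_mod_cast (not_le.1 hle).le)]; rfl
    refine hmin.trans ((min_le_add_mul_div (Nat.cast_nonneg _) (Nat.cast_nonneg _)
      (show 0 < l * (Fintype.card V : ℝ) ^ m by positivity)).trans ?_)
    have h3 := card_signedLinks_mul_le (m := m) (A := A) v
    have h3' : ((signedLinks m A v true).card : ℝ) * (signedLinks m A v false).card ≤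
      ((univ.powersetCard (m + 1)).filter
        (fun T => v ∉ T ∧ insert v T ∈ roughSets (m + 1) A)).card *
        (2 ^ (m + 1) * (Fintype.card V : ℝ) ^ (2 * m - (m + 1))) := by exact_mod_cast h3
    refine add_le_add_right ?_ _
    rw [div_le_iff₀ (by positivity)]
    refine h3'.trans (le_of_eq ?_)
    have e1 : (Fintype.card V : ℝ) ^ m = Fintype.card V ^ (2 * m - (m + 1)) * Fintype.card V := by
      rw [← pow_succ]; congr 1; omega
    rw [e1]; field_simp
  have h3 : ((univ.sigma (fun v => signedLinks m A v (!σ v))).card : ℝ) ≤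
      l * Fintype.card V ^ (m + 1) + (m + 2) * (roughSets (m + 1) A).card *
        (2 ^ (m + 1) / (l * Fintype.card V)) := by
    rw [card_sigma, Nat.cast_sum]
    refine (sum_le_sum fun v _ => h2 v).trans ?_
    rw [sum_add_distrib, sum_const, card_univ, nsmul_eq_mul, ← sum_mul, ← Nat.cast_sum,
      sum_card_rough_links]
    push_cast
    refine le_of_eq ?_
    ring
  have h4 : ((roughSets (m + 1) A).card : ℝ) ≤ (badSets (m + 1) A).card +
      Fintype.card V * (nonSingleSets (m + 1) A).card := by
    exact_mod_cast card_roughSets_le A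
  have h5 : ((A.filter (fun C => clauseVars C ∈ nonSingleSets (m + 1) A)).card : ℝ) ≤
      2 ^ (m + 1) * (nonSingleSets (m + 1) A).card := by
    exact_mod_cast card_clauses_within_le hA _
  have h1' : ((nonMonotone σ A).card : ℝ) ≤
      (A.filter (fun C => clauseVars C ∈ nonSingleSets (m + 1) A)).card +
      (univ.sigma (fun v => signedLinks m A v (!σ v))).card := by exact_mod_cast h1
  have h6 : ((m : ℝ) + 2) * (roughSets (m + 1) A).card * (2 ^ (m + 1) / (l * Fintype.card V)) ≤
      2 ^ (m + 1) * (m + 2) *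
        ((badSets (m + 1) A).card / Fintype.card V + (nonSingleSets (m + 1) A).card) / l := by
    calc _ ≤ ((m : ℝ) + 2) * ((badSets (m + 1) A).card +
          Fintype.card V * (nonSingleSets (m + 1) A).card) *
          (2 ^ (m + 1) / (l * Fintype.card V)) := by gcongr
      _ = _ := by field_simp
  linarith

theorem multiSets_anti {A : SatFormula V} {r s : ℕ} (h : r ≤ s) :
    multiSets k s A ⊆ multiSets k r A := by
  intro S hS
  obtain ⟨h1, C, hC, C', hC', e, e', h2⟩ := mem_filter.1 hS
  exact mem_filter.2 ⟨h1, C, hC, C', hC', e, e', h.trans h2⟩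

theorem multiSets_subset_image {A : SatFormula V} {r : ℕ} :
    multiSets k r A ⊆ A.image clauseVars := by
  intro S hS
  obtain ⟨h1, C, hC, C', hC', e, e', h2⟩ := mem_filter.1 hS
  exact mem_image.2 ⟨C, hC, e⟩

theorem exists_headedSystem {A : SatFormula V} (hA : A ⊆ kClauses k V) (hV : 0 < Fintype.card V) :
    ∃ head, HeadedSystem k (A.image clauseVars) (multiSets k 1 A \ multiSets k 2 A)
      (badSets k A) head := by
  classical
  have hex : ∀ S, ∃ c, S ∈ multiSets k 1 A → c ∈ S ∧ ∃ C ∈ A, ∃ C' ∈ A,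
      clauseVars C = S ∧ clauseVars C' = S ∧ clauseSign C c ≠ clauseSign C' c := by
    intro S
    by_cases hS : S ∈ multiSets k 1 A
    · obtain ⟨h1, C, hC, C', hC', e, e', h2⟩ := mem_filter.1 hS
      obtain ⟨c, hc⟩ := card_pos.1 h2
      exact ⟨c, fun _ => ⟨(mem_filter.1 hc).1, C, hC, C', hC', e, e', (mem_filter.1 hc).2⟩⟩
    · exact ⟨(Fintype.card_pos_iff.1 hV).some, fun h => absurd h hS⟩
  choose head hhead using hex
  refine ⟨head, ⟨?_, sdiff_subset.trans multiSets_subset_image,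
    fun S hS => (hhead S (mem_sdiff.1 hS).1).1, ?_⟩⟩
  · intro S hS
    obtain ⟨C, hC, rfl⟩ := mem_image.1 hS
    exact mem_powersetCard.2 ⟨subset_univ _, (mem_kClauses.1 (hA hC)).2⟩
  · intro S hS v hv hbad hU b hb hne hUb
    have hS1 := (mem_sdiff.1 hS).1
    obtain ⟨hc, C, hC, C', hC', e, e', hsgn⟩ := hhead S hS1
    have hSc := (mem_powersetCard.1 (mem_filter.1 hS1).1).2
    obtain ⟨C₁, h₁, e₁⟩ := mem_image.1 hU
    obtain ⟨C₃, h₃, e₃⟩ := mem_image.1 hUb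
    have hvc : v ≠ head S := fun h => hv (h ▸ hc)
    have hvb : v ≠ b := fun h => hv (h ▸ hb)
    have hsel : ∃ C₂ ∈ A, clauseVars C₂ = S ∧ clauseSign C₂ (head S) ≠ clauseSign C₃ (head S) := by
      by_cases h : clauseSign C (head S) = clauseSign C₃ (head S)
      · exact ⟨C', hC', e', fun h' => hsgn (h.trans h'.symm)⟩
      · exact ⟨C, hC, e, h⟩
    obtain ⟨C₂, h₂, e₂, hne₂⟩ := hsel
    refine hbad (mem_filter.2 ⟨mem_powersetCard.2 ⟨subset_univ _, by
      rw [card_insert_of_notMem hv, hSc]⟩, head S, by simp [hc], b, by simp [hb], v, by simp, hne, hvc,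
      hvb.symm, C₁, h₁, C₂, h₂, C₃, h₃, ?_, ?_, ?_, hne₂⟩)
    · rw [e₁, erase_insert_of_ne hvc]
    · rw [e₂, erase_insert hv]
    · rw [e₃, erase_insert_of_ne hvb]

theorem card_clauses_on_le_one {A : SatFormula V} (hA : A ⊆ kClauses k V) {S : Finset V}
    (hS : S ∉ multiSets k 1 A) : (A.filter (fun C => clauseVars C = S)).card ≤ 1 := by
  refine card_le_one.2 fun C hC C' hC' => ?_
  obtain ⟨h1, h2⟩ := mem_filter.1 hC
  obtain ⟨h1', h2'⟩ := mem_filter.1 hC'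
  by_contra hne
  exact hS (h2 ▸ mem_multiSets_one hA h1 h1' hne (h2.trans h2'.symm))

theorem card_clauses_on_le_two {A : SatFormula V} (hA : A ⊆ kClauses k V) {S : Finset V}
    (hS : S ∉ multiSets k 2 A) : (A.filter (fun C => clauseVars C = S)).card ≤ 2 := by
  classical
  by_contra hlt
  obtain ⟨C₁, h₁, C₂, h₂, C₃, h₃, h₁₂, h₁₃, h₂₃⟩ := two_lt_card.1 (not_le.1 hlt)
  obtain ⟨h₁, e₁⟩ := mem_filter.1 h₁
  obtain ⟨h₂, e₂⟩ := mem_filter.1 h₂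
  obtain ⟨h₃, e₃⟩ := mem_filter.1 h₃
  have hSc : S ∈ univ.powersetCard k :=
    mem_powersetCard.2 ⟨subset_univ _, e₁ ▸ (mem_kClauses.1 (hA h₁)).2⟩
  have hone : ∀ C ∈ A, ∀ C' ∈ A, clauseVars C = S → clauseVars C' = S → ∀ v ∈ S, ∀ w ∈ S,
      clauseSign C v ≠ clauseSign C' v → clauseSign C w ≠ clauseSign C' w → v = w := by
    intro C hC C' hC' e e' v hv w hw h h'
    by_contra hne
    refine hS (mem_filter.2 ⟨hSc, C, hC, C', hC', e, e', ?_⟩)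
    exact one_lt_card.2 ⟨v, mem_filter.2 ⟨hv, h⟩, w, mem_filter.2 ⟨hw, h'⟩, hne⟩
  have hdiff : ∀ C ∈ A, ∀ C' ∈ A, clauseVars C = S → clauseVars C' = S → C ≠ C' →
      ∃ v ∈ S, clauseSign C v ≠ clauseSign C' v := by
    intro C hC C' hC' e e' hne
    by_contra h
    push Not at h
    refine hne ?_
    rw [(mem_kClauses.1 (hA hC)).eq_signedClause, (mem_kClauses.1 (hA hC')).eq_signedClause, e, e',
      signedClause_congr]
    exact h
  obtain ⟨v, hv, hv'⟩ := hdiff C₁ h₁ C₂ h₂ e₁ e₂ h₁₂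
  obtain ⟨w, hw, hw'⟩ := hdiff C₁ h₁ C₃ h₃ e₁ e₃ h₁₃
  obtain ⟨z, hz, hz'⟩ := hdiff C₂ h₂ C₃ h₃ e₂ e₃ h₂₃
  have o₁ := hone C₁ h₁ C₂ h₂ e₁ e₂ v hv
  have o₂ := hone C₁ h₁ C₃ h₃ e₁ e₃ w hw
  have o₃ := hone C₂ h₂ C₃ h₃ e₂ e₃ z hz
  by_cases hvw : v = w
  · subst hvw
    by_cases hzv : z = v
    · subst hzv
      revert hv' hw' hz'
      cases clauseSign C₁ z <;> cases clauseSign C₂ z <;> cases clauseSign C₃ z <;> simp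
    · have a1 : clauseSign C₁ z = clauseSign C₂ z := by
        by_contra h; exact hzv (o₁ z hz hv' h).symm
      have a2 : clauseSign C₁ z = clauseSign C₃ z := by
        by_contra h; exact hzv (o₂ z hz hw' h).symm
      exact hz' (a1.symm.trans a2)
  · have a1 : clauseSign C₁ w = clauseSign C₂ w := by
      by_contra h; exact hvw (o₁ w hw hv' h)
    have a2 : clauseSign C₁ v = clauseSign C₃ v := by
      by_contra h; exact hvw (o₂ v hv hw' h).symm
    have b1 : z = v := o₃ v hv hz' (by rw [← a2]; exact hv'.symm)
    have b2 : z = w := o₃ w hw hz' (by rw [← a1]; exact hw')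
    exact hvw (b1.symm.trans b2)

open scoped Classical in
/-- Subformulae of `A` with at most one clause on every variable set. -/
noncomputable def simpleSubformulas (A : SatFormula V) : Finset (SatFormula V) :=
  A.powerset.filter SimpleFormula

theorem card_simpleSubformulas_le_prod (A : SatFormula V) :
    (simpleSubformulas A).card ≤
      ∏ S ∈ A.image clauseVars, ((A.filter (fun C => clauseVars C = S)).card + 1) := by
  classical
  calc _ ≤ ((A.image clauseVars).pi (fun S => ((A.filter
        (fun C => clauseVars C = S)).powerset.filter (fun E => E.card ≤ 1)))).card := by
        refine card_le_card_of_injOn (fun H S _ => H.filter (fun C => clauseVars C = S)) ?_ ?_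
        · intro H hH
          obtain ⟨h1, h2⟩ := mem_filter.1 hH
          rw [mem_powerset] at h1
          refine mem_coe.2 (mem_pi.2 fun S _ => mem_filter.2 ⟨mem_powerset.2
            (filter_subset_filter _ h1), card_le_one.2 fun C hC C' hC' => ?_⟩)
          obtain ⟨h3, h4⟩ := mem_filter.1 hC
          obtain ⟨h3', h4'⟩ := mem_filter.1 hC'
          exact h2 C h3 C' h3' (h4.trans h4'.symm)
        · intro H hH H' hH' h
          have hsub : ∀ H H' : SatFormula V, H ⊆ A →
              (∀ S ∈ A.image clauseVars, H.filter (fun C => clauseVars C = S) =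
                H'.filter (fun C => clauseVars C = S)) → H ⊆ H' := by
            intro H H' hH h C hC
            have : C ∈ H.filter (fun C' => clauseVars C' = clauseVars C) := mem_filter.2 ⟨hC, rfl⟩
            rw [h _ (mem_image_of_mem _ (hH hC))] at this
            exact (mem_filter.1 this).1
          have h' : ∀ S ∈ A.image clauseVars, H.filter (fun C => clauseVars C = S) =
                H'.filter (fun C => clauseVars C = S) := fun S hS => congrFun (congrFun h S) hS
          exact Subset.antisymm (hsub H H' (mem_powerset.1 (mem_filter.1 hH).1) h')
            (hsub H' H (mem_powerset.1 (mem_filter.1 hH').1) fun S hS => (h' S hS).symm)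
    _ ≤ _ := by
        rw [card_pi]
        refine prod_le_prod' fun S _ => ?_
        have := card_subsets_le (A.filter (fun C => clauseVars C = S)) 1
        rwa [pow_one] at this

theorem card_simpleSubformulas_le {A : SatFormula V} (hA : A ⊆ kClauses k V) :
    (simpleSubformulas A).card ≤ 2 ^ (A.image clauseVars \ multiSets k 1 A).card *
      3 ^ (multiSets k 1 A \ multiSets k 2 A).card * (2 ^ k + 1) ^ (multiSets k 2 A).card := by
  refine (card_simpleSubformulas_le_prod A).trans ?_
  rw [← prod_sdiff (multiSets_subset_image (k := k) (r := 1) (A := A)),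
    ← prod_sdiff (multiSets_anti (k := k) (A := A) one_le_two), ← mul_assoc]
  refine Nat.mul_le_mul (Nat.mul_le_mul ?_ ?_) ?_
  · exact prod_le_pow_card _ _ _ fun S hS =>
      Nat.succ_le_succ (card_clauses_on_le_one hA (mem_sdiff.1 hS).2)
  · exact prod_le_pow_card _ _ _ fun S hS =>
      Nat.succ_le_succ (card_clauses_on_le_two hA (mem_sdiff.1 hS).2)
  · exact prod_le_pow_card _ _ _ fun S hS => Nat.succ_le_succ (card_clauses_on_le hA)

theorem three_le_two_rpow : (3 : ℝ) ≤ 2 ^ (159 / 100 : ℝ) := by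
  refine le_of_pow_le_pow_left₀ (n := 100) (by norm_num) (by positivity) ?_
  rw [← Real.rpow_natCast (2 ^ (159 / 100 : ℝ)), ← Real.rpow_mul (by norm_num)]
  have : (159 / 100 : ℝ) * (100 : ℕ) = (159 : ℕ) := by norm_num
  rw [this, Real.rpow_natCast]
  norm_num

/-- The constant in the stability theorem. -/
noncomputable def majorityConst (k : ℕ) : ℝ :=
  2 ^ k * (1000 * k ^ 2) + 1 + 2 ^ k * (k + 1) * (1 + 1000 * k ^ 2)

theorem container_dichotomy (hk : 2 ≤ k) {A : SatFormula V} (hA : A ⊆ kClauses k V)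
    (hkV : k ≤ Fintype.card V) {θ l : ℝ} (hl0 : 0 < l) (hl1 : l ≤ 1)
    (hθ : θ ≤ l ^ 2) (hn : 1 ≤ θ * Fintype.card V)
    (hbad : ((badSets k A).card : ℝ) ≤ θ * Fintype.card V ^ (k + 1))
    (hm2 : ((multiSets k 2 A).card : ℝ) ≤ θ * Fintype.card V ^ k) :
    ((simpleSubformulas A).card : ℝ) ≤
      2 ^ (((Fintype.card V).choose k : ℝ) - (l ^ 2 - (k + 1) * θ) * Fintype.card V ^ k) ∨
    ∃ σ, ((nonMonotone σ A).card : ℝ) ≤ majorityConst k * l * Fintype.card V ^ k := by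
  classical
  have hk' : (2 : ℝ) ≤ k := by exact_mod_cast hk
  have hV : 0 < Fintype.card V := by omega
  have hN : (0 : ℝ) < Fintype.card V := by exact_mod_cast hV
  obtain ⟨head, hh⟩ := exists_headedSystem hA hV
  have hT := hh.turan hk (filter_subset _ _) hkV
  set U := A.image clauseVars
  set M₁ := multiSets k 1 A
  set M₂ := multiSets k 2 A
  have hM₁ : M₁ ⊆ U := multiSets_subset_image
  have hM₂ : M₂ ⊆ M₁ := multiSets_anti one_le_two
  have hUD : (U \ (M₁ \ M₂)).card = (U \ M₁).card + M₂.card := by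
    rw [card_sdiff_of_subset (sdiff_subset.trans hM₁), card_sdiff_of_subset hM₂,
      card_sdiff_of_subset hM₁]
    have := card_le_card hM₁
    have := card_le_card hM₂
    omega
  have hns : ((nonSingleSets k A).card : ℝ) = (Fintype.card V).choose k - (U \ M₁).card := by
    have hsub : U \ M₁ ⊆ univ.powersetCard k := sdiff_subset.trans hh.support_subset
    rw [nonSingleSets, card_sdiff_of_subset hsub, card_powersetCard, card_univ, Nat.cast_sub]
    have := card_le_card hsub
    rwa [card_powersetCard, card_univ] at this
  rw [hUD] at hT
  push_cast at hT
  set s : ℝ := ((U \ M₁).card : ℝ) with hs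
  set D : ℝ := ((M₁ \ M₂).card : ℝ) with hD
  set t : ℝ := (M₂.card : ℝ) with ht
  set C : ℝ := ((Fintype.card V).choose k : ℝ)
  set N : ℝ := (Fintype.card V : ℝ)
  set x : ℝ := N ^ k with hx
  have hx0 : 0 < x := by positivity
  have hD0 : 0 ≤ D := Nat.cast_nonneg _
  have ht0 : 0 ≤ t := Nat.cast_nonneg _
  have hkpred : N ^ (k - 1) * N = x := by rw [← pow_succ, hx]; congr 1; omega
  have hpow : N ^ (k - 1) ≤ θ * x := by
    have : N ^ (k - 1) * 1 ≤ N ^ (k - 1) * (θ * N) := by gcongr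
    calc _ ≤ N ^ (k - 1) * (θ * N) := by linarith
      _ = θ * (N ^ (k - 1) * N) := by ring
      _ = _ := by rw [hkpred]
  have hbad' : (badSets k A).card / N ≤ θ * x := by
    rw [div_le_iff₀ hN]
    refine hbad.trans (le_of_eq ?_)
    rw [hx]; ring
  have hT' : s + t + 8 / 5 * D ≤ C + (2 * k + 2 * k ^ 2) * (l ^ 2 * x) := by
    have e1 : 2 * k * N ^ (k - 1) ≤ 2 * k * (l ^ 2 * x) := by
      gcongr; exact hpow.trans (by gcongr)
    have e2 : 2 * (k : ℝ) ^ 2 * ((badSets k A).card / N) ≤ 2 * (k : ℝ) ^ 2 * (l ^ 2 * x) := by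
      gcongr; exact hbad'.trans (by gcongr)
    linarith
  rcases le_or_gt (s + 159 / 100 * D) (C - l ^ 2 * x) with hfar | hnear
  · left
    have hcount : ((simpleSubformulas A).card : ℝ) ≤ 2 ^ (U \ M₁).card *
        3 ^ (M₁ \ M₂).card * (2 ^ k + 1) ^ M₂.card := by
      exact_mod_cast card_simpleSubformulas_le hA
    have e3 : (3 : ℝ) ^ (M₁ \ M₂).card ≤ 2 ^ (159 / 100 * D) := by
      rw [Real.rpow_mul (by norm_num), hD, Real.rpow_natCast]
      exact pow_le_pow_left₀ (by norm_num) three_le_two_rpow _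
    have e4 : ((2 : ℝ) ^ k + 1) ^ M₂.card ≤ 2 ^ ((k + 1) * t) := by
      have : (2 : ℝ) ^ ((k : ℝ) + 1) = 2 ^ (k + 1) := by
        rw [← Real.rpow_natCast]; push_cast; rfl
      rw [Real.rpow_mul (by norm_num), ht, Real.rpow_natCast, this]
      refine pow_le_pow_left₀ (by positivity) ?_ _
      have := one_le_pow₀ (M₀ := ℝ) (n := k) one_le_two
      rw [pow_succ]; linarith
    have e2 : (2 : ℝ) ^ (U \ M₁).card = 2 ^ s := by rw [hs, Real.rpow_natCast]
    calc _ ≤ _ := hcount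
      _ ≤ 2 ^ s * 2 ^ (159 / 100 * D) * 2 ^ ((k + 1) * t) := by
          rw [e2]; gcongr
      _ = 2 ^ (s + 159 / 100 * D + (k + 1) * t) := by
          rw [Real.rpow_add (by norm_num), Real.rpow_add (by norm_num)]
      _ ≤ _ := by
          refine Real.rpow_le_rpow_of_exponent_le one_le_two ?_
          have : (k + 1) * t ≤ (k + 1) * (θ * x) := by gcongr
          linarith
  · right
    have hDle : D ≤ 100 * (1 + 2 * k + 2 * k ^ 2) * (l ^ 2 * x) := by linarith
    have hlx : 0 < l ^ 2 * x := by positivity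
    have hns' : ((nonSingleSets k A).card : ℝ) ≤ 1000 * k ^ 2 * (l ^ 2 * x) := by
      rw [hns]
      have e1 : C - s ≤ (1 + 159 * (1 + 2 * k + 2 * k ^ 2)) * (l ^ 2 * x) := by linarith
      refine e1.trans (mul_le_mul_of_nonneg_right ?_ hlx.le)
      nlinarith
    obtain ⟨m, rfl⟩ : ∃ m, k = m + 1 := ⟨k - 1, by omega⟩
    obtain ⟨σ, hσ⟩ := exists_majority hA (by omega) hV hl0
    refine ⟨σ, hσ.trans ?_⟩
    have e1 : (badSets (m + 1) A).card / N + (nonSingleSets (m + 1) A).card ≤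
        (1 + 1000 * (m + 1 : ℕ) ^ 2) * (l ^ 2 * x) := by
      have : θ * x ≤ l ^ 2 * x := by gcongr
      linarith
    have e2 : 2 ^ (m + 1) * (m + 2) * ((badSets (m + 1) A).card / N +
        (nonSingleSets (m + 1) A).card) / l ≤
        2 ^ (m + 1) * (m + 2) * ((1 + 1000 * (m + 1 : ℕ) ^ 2) * (l * x)) := by
      rw [div_le_iff₀ hl0]
      calc _ ≤ 2 ^ (m + 1) * (m + 2) * ((1 + 1000 * (m + 1 : ℕ) ^ 2) * (l ^ 2 * x)) := by gcongr
        _ = _ := by ring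
    have e3 : l ^ 2 * x ≤ l * x := by
      have : l ^ 2 ≤ l := by nlinarith
      gcongr
    have e4 : 2 ^ (m + 1) * ((nonSingleSets (m + 1) A).card : ℝ) ≤
        2 ^ (m + 1) * (1000 * (m + 1 : ℕ) ^ 2 * (l * x)) := by
      gcongr
      exact hns'.trans (by gcongr)
    rw [majorityConst]
    calc _ ≤ 2 ^ (m + 1) * (1000 * (m + 1 : ℕ) ^ 2 * (l * x)) + l * x +
          2 ^ (m + 1) * (m + 2) * ((1 + 1000 * (m + 1 : ℕ) ^ 2) * (l * x)) :=
          add_le_add (add_le_add e4 (le_refl _)) e2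
      _ = _ := by push_cast; ring

open scoped Classical in
/-- The patterns avoided by all minimal formulae which drive the container argument. -/
noncomputable def drivingPatterns (k : ℕ) : Finset (Pattern (Fin (k + 1) × Bool)) :=
  univ.filter (fun P => IsAntichainPattern P ∧ P.card ≤ k + 3 ∧ (∀ b ∈ P, IsKClause k b) ∧
    ((∃ i s t, i ≠ 0 ∧ s i ≠ t i ∧ P = pairPattern s t) ∨
      ∃ p q s t u, p ≠ 0 ∧ q ≠ 0 ∧ t 0 ≠ u 0 ∧ P = triplePattern p q s t u))

theorem exists_minimal_containers (hk : 2 ≤ k) (hV : 0 < Fintype.card V) {ρ ε τ : ℝ} (hρ : 0 < ρ)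
    (hρ1 : ρ ≤ 1) (hε0 : 0 < ε) (s : ℕ) (hs : 2 * (2 * k) ^ k < s * (ρ ^ (k + 3) * ε))
    (hτ : 0 ≤ τ) (hε : ε + 4 * (k + 1 : ℕ) ^ 2 / Fintype.card V ≤ τ ^ 2 ^ (k + 1)) :
    ∃ F : Finset (SatFormula V),
      F.card ≤ (1 + patternConst (Fin (k + 1) × Bool) * Fintype.card V ^ (2 * (k + 1)) *
        2 ^ (2 * (2 * (k + 1)) * (2 * Fintype.card V) ^ (k - 1))) ^ s ∧
      ∀ G ∈ minimalFormulas k V, ∃ A ∈ F, A ⊆ kClauses k V ∧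
        ((G \ A).card : ℝ) ≤ 2 * ρ * k ^ k * (2 * Fintype.card V) ^ k ∧
        ((badSets k A).card : ℝ) ≤ 2 ^ (3 * (k + 1)) * (τ * Fintype.card V ^ (k + 1)) ∧
        ((multiSets k 2 A).card : ℝ) ≤ 2 ^ (2 * (k + 1)) * (τ * Fintype.card V ^ k) := by
  classical
  have hcard : Fintype.card (Fin (k + 1) × Bool) = 2 * (k + 1) := by simp [mul_comm]
  obtain ⟨F, hF, hFG⟩ := exists_containers (V := V) (by omega : 1 ≤ k) hV (drivingPatterns k) (k + 3)
    (fun P hP => by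
      obtain ⟨-, h1, h2, h3, -⟩ := mem_filter.1 hP
      exact ⟨h1, h2, h3⟩) hρ hρ1 hε0 s hs
  rw [hcard] at hF
  refine ⟨F, hF, fun G hG => ?_⟩
  obtain ⟨hGk, hGm⟩ := mem_minimalFormulas.1 hG
  obtain ⟨A, hAF, hAk, hGA, hhits⟩ := hFG G (isKFormula_iff.1 hGk) (fun P hP => by
    obtain ⟨-, -, -, -, ⟨i, s, t, hi, hst, rfl⟩ | ⟨p, q, s, t, u, hp, hq, htu, rfl⟩⟩ :=
      mem_filter.1 hP
    · exact hits_pairPattern hGm hi hst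
    · exact hits_triplePattern hGm hp hq htu)
  rw [hcard] at hhits
  let p₀ : Fin (k + 1) := ⟨1, by omega⟩
  let q₀ : Fin (k + 1) := ⟨2, by omega⟩
  have hp : p₀ ≠ 0 := by simp [p₀, Fin.ext_iff]
  have hq : q₀ ≠ 0 := by simp [q₀, Fin.ext_iff]
  have hpq : p₀ ≠ q₀ := by simp [p₀, q₀]
  refine ⟨A, hAF, hAk, hGA, ?_, ?_⟩
  · refine card_badSets_le hAk hp hq hpq hV hτ (fun s t u htu => hhits _ ?_) hε
    obtain ⟨h1, h2, h3⟩ := triplePattern_props hp hq hpq s t u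
    exact mem_filter.2 ⟨mem_univ _, h1, h2, h3, Or.inr ⟨p₀, q₀, s, t, u, hp, hq, htu, rfl⟩⟩
  · refine card_multiSets_le hAk 2 hV hτ (fun s t hst => hhits _ ?_) hε
    obtain ⟨i, hi, j, hj, hij⟩ := one_lt_card.1 hst
    simp only [mem_filter, mem_erase, mem_univ, and_true] at hi hj
    obtain ⟨h1, h2, h3⟩ := pairPattern_props s t hij hi.1 hj.1 hi.2 hj.2
    exact mem_filter.2 ⟨mem_univ _, h1, h2, h3, Or.inl ⟨i, s, t, hi.1, hi.2, rfl⟩⟩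

theorem card_multiSets_one_le {G : SatFormula V} (hG : G ∈ minimalFormulas k V)
    (hV : 0 < Fintype.card V) {τ : ℝ} (hτ : 0 ≤ τ)
    (hτV : 4 * (k + 1 : ℕ) ^ 2 / (Fintype.card V : ℝ) ≤ τ ^ 2 ^ (k + 1)) :
    ((multiSets k 1 G).card : ℝ) ≤ 2 ^ (2 * (k + 1)) * (τ * Fintype.card V ^ k) := by
  obtain ⟨hGk, hGm⟩ := mem_minimalFormulas.1 hG
  refine card_multiSets_le (isKFormula_iff.1 hGk) 1 hV (ε := 0) hτ (fun s t hst => ?_)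
    (by simpa using hτV)
  obtain ⟨i, hi⟩ := card_pos.1 (show 0 < _ from hst)
  simp only [mem_filter, mem_erase, mem_univ, and_true] at hi
  simp [hits_pairPattern hGm hi.1 hi.2]

/-- Removing the clauses outside `A` and those on repeated variable sets leaves a simple
subformula of `A`. -/
theorem exists_simple_remainder {G : SatFormula V} (hG : G ⊆ kClauses k V) (A : SatFormula V) :
    ∃ E ⊆ G, E.card ≤ (G \ A).card + 2 ^ k * (multiSets k 1 G).card ∧
      G \ E ∈ simpleSubformulas A := by
  classical
  refine ⟨(G \ A) ∪ G.filter (fun C => clauseVars C ∈ multiSets k 1 G),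
    union_subset sdiff_subset (filter_subset _ _),
    (card_union_le _ _).trans (add_le_add le_rfl (card_clauses_within_le hG _)),
    mem_filter.2 ⟨mem_powerset.2 fun C hC => ?_, fun C hC C' hC' he => ?_⟩⟩
  · simp only [mem_sdiff, mem_union, mem_filter, not_or, not_and, not_not] at hC
    exact hC.2.1 hC.1
  · simp only [mem_sdiff, mem_union, mem_filter, not_or, not_and, not_not] at hC hC'
    by_contra hne
    exact hC.2.2 hC.1 (mem_multiSets_one hG hC.1 hC'.1 hne he)

open scoped Classical in
theorem card_nonMonotone_far_le {δ x : ℝ} (hx : 0 ≤ x) {m : ℕ} {F : Finset (SatFormula V)}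
    (h : ∀ G ∈ minimalFormulas k V, ∃ A ∈ F,
      (G \ A).card + 2 ^ k * (multiSets k 1 G).card ≤ m ∧
      (((simpleSubformulas A).card : ℝ) ≤ x ∨ ∃ σ, ((nonMonotone σ G).card : ℝ) ≤ δ)) :
    (((minimalFormulas k V).filter (fun G => ∀ σ, δ < (nonMonotone σ G).card)).card : ℝ) ≤
      F.card * ((2 * Fintype.card V) ^ k + 1) ^ m * x := by
  have hsub : (minimalFormulas k V).filter (fun G => ∀ σ, δ < (nonMonotone σ G).card) ⊆
      (F.filter (fun A => ((simpleSubformulas A).card : ℝ) ≤ x)).biUnion (fun A =>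
        (((kClauses k V).powerset.filter (fun E => E.card ≤ m)) ×ˢ simpleSubformulas A).image
          (fun p => p.1 ∪ p.2)) := by
    intro G hG
    obtain ⟨hGm, hGσ⟩ := mem_filter.1 hG
    have hGk := isKFormula_iff.1 (mem_minimalFormulas.1 hGm).1
    obtain ⟨A, hAF, hm, hx | ⟨σ, hσ⟩⟩ := h G hGm
    · obtain ⟨E, hEG, hE, hGE⟩ := exists_simple_remainder hGk A
      refine mem_biUnion.2 ⟨A, mem_filter.2 ⟨hAF, hx⟩, mem_image.2 ⟨(E, G \ E), ?_, ?_⟩⟩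
      · exact mem_product.2 ⟨mem_filter.2 ⟨mem_powerset.2 (hEG.trans hGk), hE.trans hm⟩, hGE⟩
      · exact union_sdiff_of_subset hEG
    · exact absurd hσ (not_le.2 (hGσ σ))
  calc _ ≤ ((∑ A ∈ F.filter (fun A => ((simpleSubformulas A).card : ℝ) ≤ x),
        ((kClauses k V).powerset.filter (fun E => E.card ≤ m)).card *
          (simpleSubformulas A).card : ℕ) : ℝ) := by
        refine Nat.cast_le.2 ((card_le_card hsub).trans (card_biUnion_le.trans
          (sum_le_sum fun A _ => ?_)))
        exact card_image_le.trans (card_product _ _).le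
    _ ≤ ∑ A ∈ F.filter (fun A => ((simpleSubformulas A).card : ℝ) ≤ x),
        ((2 * Fintype.card V : ℝ) ^ k + 1) ^ m * x := by
        push_cast
        refine sum_le_sum fun A hA => mul_le_mul ?_ (mem_filter.1 hA).2 (by positivity)
          (by positivity)
        have h1 := (card_subsets_le (kClauses k V) m).trans
          (Nat.pow_le_pow_left (Nat.add_le_add_right (card_kClauses_le (V := V) k) 1) m)
        exact_mod_cast h1
    _ ≤ _ := by
        rw [sum_const, nsmul_eq_mul, ← mul_assoc]
        have := card_filter_le F (fun A => ((simpleSubformulas A).card : ℝ) ≤ x)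
        gcongr

theorem succ_mul_le_two_pow (c x y N e : ℕ) (hx : x ≤ 2 ^ y) (hN : 1 ≤ N) :
    1 + c * x * 2 ^ (e * N) ≤ 2 ^ ((1 + c + y + e) * N) := by
  have h1 : 1 + c ≤ 2 ^ (1 + c) := Nat.lt_two_pow_self.le
  have h2 : 1 ≤ 2 ^ (y + e * N) := Nat.one_le_two_pow
  calc 1 + c * x * 2 ^ (e * N) ≤ 1 + c * 2 ^ y * 2 ^ (e * N) := by gcongr
    _ = 1 + c * 2 ^ (y + e * N) := by rw [pow_add]; ring
    _ ≤ (1 + c) * 2 ^ (y + e * N) := by rw [add_mul]; omega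
    _ ≤ 2 ^ (1 + c) * 2 ^ (y + e * N) := by gcongr
    _ = 2 ^ (1 + c + (y + e * N)) := by rw [← pow_add]
    _ ≤ _ := Nat.pow_le_pow_right (by norm_num) (by nlinarith)

theorem nonMonotone_card_le (σ : V → Bool) (G A : SatFormula V) :
    (nonMonotone σ G).card ≤ (nonMonotone σ A).card + (G \ A).card := by
  refine (card_le_card fun C hC => ?_).trans (card_union_le _ _)
  obtain ⟨h1, h2⟩ := mem_filter.1 hC
  by_cases hA : C ∈ A
  · exact mem_union_left _ (mem_filter.2 ⟨hA, h2⟩)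
  · exact mem_union_right _ (mem_sdiff.2 ⟨h1, hA⟩)

open scoped Classical in
set_option maxHeartbeats 1600000 in
/-- All but few minimal formulae are nearly monotone after flipping variables. -/
theorem card_far_from_monotone_le (hk : 2 ≤ k) : ∃ K u₀ : ℕ, ∀ u ≥ u₀, ∀ n : ℕ, u ^ K ≤ n →
    2 * n ≤ 2 ^ u →
    (((minimalFormulas k (Fin n)).filter
      (fun G => ∀ σ, (n : ℝ) ^ k / u < (nonMonotone σ G).card)).card : ℝ) ≤ 2 ^ n.choose k := by
  set D := 2 ^ (k + 1) with hD
  set a := 6 * (k + 3) + 6 * D + 1 with ha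
  set pc := patternConst (Fin (k + 1) × Bool) with hpc
  set c₁ : ℝ := 2 * k ^ k * 2 ^ k + 2 ^ k * 2 ^ (2 * (k + 1)) with hc₁
  set c₂ : ℕ := 1 + pc + 2 * (k + 1) + 2 * (2 * (k + 1)) * 2 ^ (k - 1) with hc₂
  have hmC : 0 ≤ majorityConst k := by unfold majorityConst; positivity
  have hc₁0 : 0 < c₁ := by positivity
  obtain ⟨u₀, hu₀⟩ := exists_nat_gt (4 * (2 * k : ℝ) ^ k + 8 * (k + 1) ^ 2 +
    4 * (k + 1) * 2 ^ (3 * (k + 1)) + 2 * majorityConst k + 8 * k * c₁ + 4 * c₂ + 4 * k ^ k * 2 ^ k + 1)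
  refine ⟨a + 6, u₀, fun u hu n hn hnu => ?_⟩
  have hk' : (2 : ℝ) ≤ k := by exact_mod_cast hk
  set U : ℝ := (u : ℝ) with hU
  have huU : (u₀ : ℝ) ≤ U := Nat.cast_le.2 hu
  clear_value U pc c₁ D
  have p1 : 0 ≤ 4 * (2 * k : ℝ) ^ k := by positivity
  have p2 : 0 ≤ 8 * (k + 1 : ℝ) ^ 2 := by positivity
  have p3 : 0 ≤ 4 * (k + 1 : ℝ) * 2 ^ (3 * (k + 1)) := by positivity
  have p4 : 0 ≤ 8 * k * c₁ := by positivity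
  have p5 : (0 : ℝ) ≤ 4 * c₂ := by positivity
  have p6 : 0 ≤ 4 * (k : ℝ) ^ k * 2 ^ k := by positivity
  have hU1 : 1 ≤ U := by linarith
  have hU0 : 0 < U := by linarith
  have hnU : U ^ (a + 6) ≤ (n : ℝ) := by rw [hU]; exact_mod_cast hn
  have hnj : ∀ j ≤ a + 6, U ^ j ≤ (n : ℝ) := fun j hj => (pow_le_pow_right₀ hU1 hj).trans hnU
  have hn0 : (0 : ℝ) < n := lt_of_lt_of_le (by positivity) hnU
  have hn1 : 0 < n := by exact_mod_cast hn0
  have hcard : Fintype.card (Fin n) = n := Fintype.card_fin n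
  set τ : ℝ := 1 / U ^ 6 with hτ
  have hτ0 : 0 < τ := by positivity
  have hτ1 : τ ≤ 1 := by
    rw [hτ, div_le_one (by positivity)]; exact one_le_pow₀ hU1
  set ε : ℝ := τ ^ D / 2 with hε
  have hε0 : 0 < ε := by positivity
  have hcv : 4 * ((k + 1 : ℕ) : ℝ) ^ 2 / (n : ℝ) ≤ τ ^ D / 2 := by
    rw [hτ, div_pow, one_pow, ← pow_mul, div_le_iff₀ hn0]
    have h1 : U ^ (6 * D + 1) ≤ (n : ℝ) := hnj _ (by omega)
    have h2 : 8 * ((k + 1 : ℕ) : ℝ) ^ 2 ≤ U := by push_cast; linarith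
    have h3 : 8 * ((k + 1 : ℕ) : ℝ) ^ 2 * U ^ (6 * D) ≤ n := by
      calc _ ≤ U * U ^ (6 * D) := by gcongr
        _ = U ^ (6 * D + 1) := by ring
        _ ≤ _ := h1
    rw [div_div, div_mul_eq_mul_div, one_mul, le_div_iff₀ (by positivity)]
    linarith
  have hs : 2 * (2 * k : ℝ) ^ k < (u ^ a : ℕ) * (τ ^ (k + 3) * ε) := by
    have : ((u ^ a : ℕ) : ℝ) * (τ ^ (k + 3) * ε) = U / 2 := by
      rw [hε, hτ, div_pow, one_pow, div_pow, one_pow, ← pow_mul, ← pow_mul, ha, Nat.cast_pow, ← hU]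
      field_simp
      ring
    rw [this]; linarith
  obtain ⟨F, hF, hFG⟩ := exists_minimal_containers (V := Fin n) hk (by rw [hcard]; exact hn1) hτ0
    hτ1 hε0 (u ^ a) hs hτ0.le (by rw [hcard, ← hD]; linarith)
  rw [hcard, ← hpc] at hF
  rw [hcard] at hFG
  set l : ℝ := 1 / U ^ 2 with hl
  have hl0 : 0 < l := by positivity
  have hl1 : l ≤ 1 := by rw [hl, div_le_one (by positivity)]; exact one_le_pow₀ hU1
  set θ : ℝ := 2 ^ (3 * (k + 1)) * τ with hθ
  have hlτ : τ * U ^ 2 = l ^ 2 := by rw [hl, hτ]; field_simp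
  have hUsq : U ≤ U ^ 2 := le_self_pow₀ hU1 two_ne_zero
  have hθl : 4 * (k + 1) * θ ≤ l ^ 2 := by
    rw [← hlτ, hθ]
    calc _ = τ * (4 * (k + 1) * 2 ^ (3 * (k + 1))) := by ring
      _ ≤ τ * U ^ 2 := by gcongr; linarith
  have hθ0 : 0 < θ := by positivity
  have hθl' : θ ≤ l ^ 2 := by clear * - hθl hk' hθ0; nlinarith
  have hθn : 1 ≤ θ * n := by
    have h1 : 1 ≤ τ * n := by
      rw [hτ, div_mul_eq_mul_div, one_mul, le_div_iff₀ (by positivity), one_mul]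
      exact hnj 6 (by omega)
    have h2 : (1 : ℝ) ≤ 2 ^ (3 * (k + 1)) := one_le_pow₀ (by norm_num)
    rw [hθ, mul_assoc]; exact one_le_mul_of_one_le_of_one_le h2 h1
  have hkn : k ≤ n := by
    have : (k : ℝ) ≤ U := by
      have h1 : (k : ℝ) ≤ 8 * (k + 1 : ℝ) ^ 2 := by clear * - hk'; nlinarith
      linarith
    have h2 := hnj 1 (by omega)
    rw [pow_one] at h2
    exact_mod_cast this.trans h2
  set x : ℝ := (n : ℝ) ^ k with hx
  have hx0 : 0 < x := by positivity
  set m := ⌊c₁ * τ * x⌋₊ with hm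
  have hmle : (m : ℝ) ≤ c₁ * τ * x := Nat.floor_le (by positivity)
  have hmain := card_nonMonotone_far_le (k := k) (V := Fin n) (δ := x / U)
    (x := 2 ^ (((n.choose k : ℕ) : ℝ) - (l ^ 2 - (k + 1) * θ) * x)) (by positivity) (m := m) (F := F)
    (fun G hG => ?_)
  · rw [hcard] at hmain
    refine hmain.trans ?_
    have hN1 : 1 ≤ n ^ (k - 1) := Nat.one_le_pow _ _ hn1
    have hnu' : n ≤ 2 ^ u := by omega
    have e1 : F.card ≤ 2 ^ ((1 + pc + u * (2 * (k + 1)) + 2 * (2 * (k + 1)) * 2 ^ (k - 1)) *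
        n ^ (k - 1) * u ^ a) := by
      rw [pow_mul]
      refine hF.trans (Nat.pow_le_pow_left ?_ _)
      have := succ_mul_le_two_pow pc (n ^ (2 * (k + 1))) (u * (2 * (k + 1))) (n ^ (k - 1))
        (2 * (2 * (k + 1)) * 2 ^ (k - 1)) (by rw [pow_mul 2 u]; exact Nat.pow_le_pow_left hnu' _) hN1
      rwa [mul_assoc (2 * (2 * (k + 1))), ← mul_pow] at this
    have e2 : (2 * n) ^ k + 1 ≤ 2 ^ (u * k + 1) := by
      have : (2 * n) ^ k ≤ 2 ^ (u * k) := by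
        rw [pow_mul]; exact Nat.pow_le_pow_left hnu _
      have h1 : 1 ≤ 2 ^ (u * k) := Nat.one_le_two_pow
      rw [pow_succ]; omega
    set E₁ := (1 + pc + u * (2 * (k + 1)) + 2 * (2 * (k + 1)) * 2 ^ (k - 1)) *
        n ^ (k - 1) * u ^ a with hE₁
    have e3 : ((F.card : ℝ)) * ((2 * n : ℝ) ^ k + 1) ^ m ≤ 2 ^ ((E₁ : ℝ) + (u * k + 1) * m) := by
      have : F.card * ((2 * n) ^ k + 1) ^ m ≤ 2 ^ (E₁ + (u * k + 1) * m) := by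
        rw [pow_add, pow_mul 2 (u * k + 1)]
        exact Nat.mul_le_mul e1 (Nat.pow_le_pow_left e2 _)
      have h2 : ((F.card * ((2 * n) ^ k + 1) ^ m : ℕ) : ℝ) ≤ (2 ^ (E₁ + (u * k + 1) * m) : ℕ) :=
        Nat.cast_le.2 this
      rw [Nat.cast_pow, Nat.cast_ofNat, ← Real.rpow_natCast] at h2
      push_cast at h2 ⊢
      exact h2
    have hl2 : l ^ 2 = τ * U ^ 2 := hlτ.symm
    have e4 : (E₁ : ℝ) ≤ l ^ 2 * x / 4 := by
      have h1 : (E₁ : ℝ) ≤ c₂ * U ^ (a + 1) * n ^ (k - 1) := by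
        rw [hE₁, hc₂]
        push_cast
        rw [← hU]
        have q1 : (1 : ℝ) + pc ≤ (1 + pc) * U := le_mul_of_one_le_right (by positivity) hU1
        have q2 : (2 * (2 * (k + 1)) * 2 ^ (k - 1) : ℝ) ≤ (2 * (2 * (k + 1)) * 2 ^ (k - 1)) * U :=
          le_mul_of_one_le_right (by positivity) hU1
        calc _ ≤ ((1 + pc) * U + U * (2 * (k + 1)) + (2 * (2 * (k + 1)) * 2 ^ (k - 1)) * U : ℝ) *
              n ^ (k - 1) * U ^ a := by gcongr
          _ = _ := by ring
      have hxn : x = n ^ (k - 1) * n := by rw [hx, ← pow_succ]; congr 1; omega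
      have h2 : 4 * c₂ * U ^ (a + 5) ≤ n := by
        calc 4 * c₂ * U ^ (a + 5) ≤ U * U ^ (a + 5) := by gcongr; linarith
          _ = U ^ (a + 6) := by ring
          _ ≤ n := hnU
      refine h1.trans ?_
      rw [hl, div_pow, one_pow, ← pow_mul, hxn, div_mul_eq_mul_div, one_mul, div_div,
        le_div_iff₀ (by positivity)]
      calc _ = (4 * c₂ * U ^ (a + 5)) * n ^ (k - 1) := by ring
        _ ≤ n * n ^ (k - 1) := by gcongr
        _ = _ := by ring
    have e5 : (u * k + 1) * (m : ℝ) ≤ l ^ 2 * x / 4 := by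
      have h1 : (u * k + 1 : ℝ) ≤ 2 * k * U := by
        rw [← hU]; clear * - hk' hU1; nlinarith
      calc _ ≤ (2 * k * U) * (c₁ * τ * x) := by
            refine mul_le_mul h1 hmle (Nat.cast_nonneg _) (by positivity)
        _ = (8 * k * c₁) * (U * τ) * x / 4 := by ring
        _ ≤ U * (U * τ) * x / 4 := by gcongr; linarith
        _ = _ := by rw [hl2]; ring
    calc _ ≤ (2 : ℝ) ^ ((E₁ : ℝ) + (u * k + 1) * m) *
          2 ^ (((n.choose k : ℕ) : ℝ) - (l ^ 2 - (k + 1) * θ) * x) := by gcongr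
      _ = 2 ^ (((E₁ : ℝ) + (u * k + 1) * m) +
          (((n.choose k : ℕ) : ℝ) - (l ^ 2 - (k + 1) * θ) * x)) := by
          rw [← Real.rpow_add (by norm_num)]
      _ ≤ 2 ^ ((n.choose k : ℕ) : ℝ) := by
          refine Real.rpow_le_rpow_of_exponent_le one_le_two ?_
          have h1 : (4 * (k + 1) * θ) * x ≤ l ^ 2 * x := by gcongr
          have h2 : 0 ≤ l ^ 2 * x := by positivity
          linarith
      _ = _ := Real.rpow_natCast _ _
  · obtain ⟨A, hAF, hAk, hGA, hb, hm2⟩ := hFG G hG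
    have hG1 := card_multiSets_one_le hG (by rw [hcard]; exact hn1) hτ0.le
      (by rw [hcard, ← hD]; linarith [pow_pos hτ0 D])
    rw [hcard, ← hx] at hG1
    have hGA' : ((G \ A).card : ℝ) ≤ 2 * k ^ k * 2 ^ k * τ * x := by
      refine hGA.trans (le_of_eq ?_)
      rw [mul_pow, ← hx]; ring
    refine ⟨A, hAF, ?_, ?_⟩
    · rw [hm]
      refine Nat.le_floor ?_
      push_cast
      calc _ ≤ 2 * k ^ k * 2 ^ k * τ * x + 2 ^ k * (2 ^ (2 * (k + 1)) * (τ * x)) := by gcongr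
        _ = _ := by rw [hc₁]; ring
    · have hτx : 0 ≤ τ * x := by positivity
      have := container_dichotomy hk hAk (by rw [hcard]; exact hkn) hl0 hl1 (θ := θ) hθl'
        (by rw [hcard]; exact hθn)
        (by rw [hcard, hθ]; exact hb.trans (le_of_eq (by ring)))
        (by
          rw [hcard, hθ, mul_assoc]
          refine hm2.trans (mul_le_mul_of_nonneg_right ?_ hτx)
          exact pow_le_pow_right₀ one_le_two (by omega))
      rw [hcard] at this
      refine this.imp_right ?_
      rintro ⟨σ, hσ⟩
      refine ⟨σ, ?_⟩
      have h1 : ((nonMonotone σ G).card : ℝ) ≤ (nonMonotone σ A).card + (G \ A).card := by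
        exact_mod_cast nonMonotone_card_le σ G A
      refine h1.trans ((add_le_add hσ hGA').trans ?_)
      rw [le_div_iff₀ hU0, ← hx]
      have q1 : l * U ^ 2 = 1 := by rw [hl]; field_simp
      have q2 : τ * U ≤ l := by
        rw [hτ, hl, div_mul_eq_mul_div, one_mul, div_le_div_iff₀ (by positivity) (by positivity),
          one_mul, ← pow_succ']
        exact pow_le_pow_right₀ hU1 (by norm_num)
      have q3 : 2 * majorityConst k * (l * U) ≤ 1 := by
        calc _ ≤ U * (l * U) := by gcongr; linarith
          _ = 1 := by rw [← q1]; ring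
      have q4 : 4 * k ^ k * 2 ^ k * l ≤ 1 := by
        calc 4 * k ^ k * 2 ^ k * l ≤ U ^ 2 * l := by gcongr; linarith
          _ = 1 := by rw [← q1]; ring
      have q5 : 4 * k ^ k * 2 ^ k * (τ * U) ≤ 1 := le_trans (by gcongr) q4
      calc _ = (2 * majorityConst k * (l * U) + 4 * k ^ k * 2 ^ k * (τ * U)) / 2 * x := by ring
        _ ≤ (1 + 1) / 2 * x := by gcongr
        _ = x := by ring

/-- Flip the literals of the variables on which `σ` is false. -/
def flipLit (σ : V → Bool) : V × Bool ≃ V × Bool :=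
  Function.Involutive.toPerm (fun l => (l.1, l.2 == σ l.1)) fun l => by
    rcases l with ⟨v, b⟩
    cases b <;> cases h : σ v <;> simp [h]

/-- Flip the literals in a clause. -/
def flipClause (σ : V → Bool) : SatClause V ≃ SatClause V := (flipLit σ).finsetCongr

/-- Flip the literals in a formula. -/
def flipFormula (σ : V → Bool) : SatFormula V ≃ SatFormula V := (flipClause σ).finsetCongr

theorem mem_flipClause {σ : V → Bool} {C : SatClause V} {v : V} {b : Bool} :
    (v, b) ∈ flipClause σ C ↔ (v, b == σ v) ∈ C := by
  rw [flipClause, Equiv.finsetCongr_apply, mem_map_equiv]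
  rfl

theorem mem_flipFormula {σ : V → Bool} {G : SatFormula V} {C : SatClause V} :
    flipClause σ C ∈ flipFormula σ G ↔ C ∈ G := by
  rw [flipFormula, Equiv.finsetCongr_apply, mem_map_equiv, Equiv.symm_apply_apply]

theorem clauseVars_flipClause (σ : V → Bool) (C : SatClause V) :
    clauseVars (flipClause σ C) = clauseVars C := by
  ext v
  rw [mem_clauseVars, mem_clauseVars]
  constructor
  · rintro ⟨b, hb⟩
    exact ⟨_, mem_flipClause.1 hb⟩
  · rintro ⟨b, hb⟩
    refine ⟨b == σ v, mem_flipClause.2 ?_⟩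
    have : ((b == σ v) == σ v) = b := by cases b <;> cases σ v <;> rfl
    rwa [this]

theorem isKClause_flipClause {σ : V → Bool} {C : SatClause V} :
    IsKClause k (flipClause σ C) ↔ IsKClause k C := by
  rw [IsKClause, clauseVars_flipClause, flipClause, Equiv.finsetCongr_apply, card_map, IsKClause]

theorem satisfies_flipClause {σ w : V → Bool} {C : SatClause V} :
    SatisfiesClause w (flipClause σ C) ↔ SatisfiesClause (fun v => w v == σ v) C := by
  constructor
  · rintro h ⟨v, b⟩ hb
    have := h (v, b == σ v) (mem_flipClause.2 (by
      have : ((b == σ v) == σ v) = b := by cases b <;> cases σ v <;> rfl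
      rwa [this]))
    simp only at this ⊢
    rw [this]
    cases b <;> cases σ v <;> rfl
  · rintro h ⟨v, b⟩ hb
    have := h _ (mem_flipClause.1 hb)
    simp only at this ⊢
    revert this
    cases w v <;> cases b <;> cases σ v <;> simp

theorem flipFormula_mem_minimalFormulas {σ : V → Bool} {G : SatFormula V}
    (hG : G ∈ minimalFormulas k V) : flipFormula σ G ∈ minimalFormulas k V := by
  obtain ⟨h1, h2⟩ := mem_minimalFormulas.1 hG
  refine mem_minimalFormulas.2 ⟨fun C hC => ?_, fun C hC => ?_⟩
  · obtain ⟨C, rfl⟩ := (flipClause σ).surjective C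
    exact isKClause_flipClause.2 (h1 C (mem_flipFormula.1 hC))
  · obtain ⟨C, rfl⟩ := (flipClause σ).surjective C
    obtain ⟨w, hw, hw'⟩ := h2 C (mem_flipFormula.1 hC)
    have hww : (fun v => (w v == σ v) == σ v) = w := by
      funext v; cases w v <;> cases σ v <;> rfl
    refine ⟨fun v => w v == σ v, satisfies_flipClause.2 (by rwa [hww]), fun C' hC' hs => ?_⟩
    obtain ⟨C', rfl⟩ := (flipClause σ).surjective C'
    have := satisfies_flipClause.1 hs
    rw [hww] at this
    rw [hw' C' (mem_flipFormula.1 hC') this]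

theorem mem_nonMonotone {σ : V → Bool} {G : SatFormula V} (hG : G ⊆ kClauses k V)
    {C : SatClause V} : C ∈ nonMonotone σ G ↔ C ∈ G ∧ ∃ v, (v, !σ v) ∈ C := by
  rw [nonMonotone, mem_filter]
  refine and_congr_right fun hC => ?_
  have hK := mem_kClauses.1 (hG hC)
  constructor
  · rintro ⟨v, hv, hne⟩
    refine ⟨v, hK.mem_iff.2 ⟨hv, ?_⟩⟩
    cases h : clauseSign C v <;> cases h' : σ v <;> simp_all
  · rintro ⟨v, hv⟩
    obtain ⟨h1, h2⟩ := hK.mem_iff.1 hv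
    refine ⟨v, h1, ?_⟩
    rw [← h2.symm] at *
    cases h : clauseSign C v <;> cases h' : σ v <;> simp_all

theorem card_nonMonotone_flip {σ τ : V → Bool} {G : SatFormula V} (hG : G ∈ minimalFormulas k V) :
    (nonMonotone τ (flipFormula σ G)).card = (nonMonotone (fun v => τ v == σ v) G).card := by
  have hGk := isKFormula_iff.1 (mem_minimalFormulas.1 hG).1
  have hGk' := isKFormula_iff.1 (mem_minimalFormulas.1
    (flipFormula_mem_minimalFormulas (σ := σ) hG)).1
  have : nonMonotone τ (flipFormula σ G) =
      (nonMonotone (fun v => τ v == σ v) G).map (flipClause σ).toEmbedding := by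
    ext C
    obtain ⟨C, rfl⟩ := (flipClause σ).surjective C
    rw [mem_nonMonotone hGk', mem_map_equiv, Equiv.symm_apply_apply, mem_nonMonotone hGk,
      mem_flipFormula]
    refine and_congr_right fun _ => exists_congr fun v => ?_
    rw [mem_flipClause]
    have : ((!τ v) == σ v) = !(τ v == σ v) := by cases τ v <;> cases σ v <;> rfl
    rw [this]
  rw [this, card_map]

/-- The clauses with a negative literal. -/
abbrev negClauses (G : SatFormula V) : SatFormula V := nonMonotone (fun _ => true) G

open scoped Classical in
/-- Minimal formulae with few clauses having negative literals, and for which flipping variables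
does not decrease this number. -/
noncomputable def centeredFormulas (k : ℕ) (V : Type*) [Fintype V] [DecidableEq V] (x : ℝ) :
    Finset (SatFormula V) :=
  (minimalFormulas k V).filter (fun G => ((negClauses G).card : ℝ) ≤ x ∧
    ∀ σ, (negClauses G).card ≤ (nonMonotone σ G).card)

open scoped Classical in
theorem card_minimalFormulas_le_centered (x : ℝ) : (minimalFormulas k V).card ≤
    ((minimalFormulas k V).filter (fun G => ∀ σ, x < (nonMonotone σ G).card)).card +
      2 ^ Fintype.card V * (centeredFormulas k V x).card := by
  have hsub : minimalFormulas k V ⊆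
      (minimalFormulas k V).filter (fun G => ∀ σ, x < (nonMonotone σ G).card) ∪
      (univ : Finset (V → Bool)).biUnion (fun σ =>
        (centeredFormulas k V x).image (flipFormula σ).symm) := by
    intro G hG
    by_cases h : ∀ σ, x < (nonMonotone σ G).card
    · exact mem_union_left _ (mem_filter.2 ⟨hG, h⟩)
    refine mem_union_right _ ?_
    push Not at h
    obtain ⟨σ₀, hσ₀⟩ := h
    obtain ⟨σ, -, hσ⟩ := exists_min_image (univ : Finset (V → Bool))
      (fun σ => (nonMonotone σ G).card) ⟨σ₀, mem_univ _⟩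
    refine mem_biUnion.2 ⟨σ, mem_univ _, mem_image.2 ⟨flipFormula σ G, ?_,
      Equiv.symm_apply_apply _ _⟩⟩
    have e : (negClauses (flipFormula σ G)).card = (nonMonotone σ G).card := by
      rw [negClauses, card_nonMonotone_flip hG]
      congr 2; funext v; cases σ v <;> rfl
    refine mem_filter.2 ⟨flipFormula_mem_minimalFormulas hG, ?_, fun τ => ?_⟩
    · rw [e]
      exact le_trans (Nat.cast_le.2 (hσ σ₀ (mem_univ _))) hσ₀
    · rw [e, card_nonMonotone_flip hG]
      exact hσ _ (mem_univ _)
  refine (card_le_card hsub).trans ((card_union_le _ _).trans (Nat.add_le_add_left ?_ _))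
  refine card_biUnion_le.trans ((sum_le_sum fun σ _ => card_image_le).trans (le_of_eq ?_))
  rw [sum_const, smul_eq_mul, card_univ, Fintype.card_fun, Fintype.card_bool]

/-- The positive clause on a set of variables. -/
abbrev posClause (S : Finset V) : SatClause V := signedClause (fun _ => true) S

/-- The variable sets of the positive clauses. -/
def posSets (k : ℕ) (G : SatFormula V) : Finset (Finset V) :=
  (univ.powersetCard k).filter (fun S => posClause S ∈ G)

theorem mem_posSets {G : SatFormula V} {S : Finset V} :
    S ∈ posSets k G ↔ S.card = k ∧ posClause S ∈ G := by
  simp [posSets]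

theorem mem_negClauses {G : SatFormula V} (hG : G ⊆ kClauses k V) {C : SatClause V} :
    C ∈ negClauses G ↔ C ∈ G ∧ ∃ v, (v, false) ∈ C := mem_nonMonotone hG

theorem eq_posClause {C : SatClause V} (hC : IsKClause k C) (h : ∀ v, (v, false) ∉ C) :
    C = posClause (clauseVars C) := by
  conv_lhs => rw [hC.eq_signedClause]
  rw [posClause, signedClause_congr]
  intro v hv
  obtain ⟨b, hb⟩ := mem_clauseVars.1 hv
  cases b
  · exact absurd hb (h v)
  · rw [hC.sign_of_mem hb]

theorem eq_negClauses_union {G : SatFormula V} (hG : G ⊆ kClauses k V) :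
    G = negClauses G ∪ (posSets k G).image posClause := by
  ext C
  rw [mem_union, mem_negClauses hG, mem_image]
  constructor
  · intro hC
    by_cases h : ∃ v, (v, false) ∈ C
    · exact Or.inl ⟨hC, h⟩
    push Not at h
    have hK := mem_kClauses.1 (hG hC)
    have := eq_posClause hK h
    exact Or.inr ⟨_, mem_posSets.2 ⟨hK.2, this ▸ hC⟩, this.symm⟩
  · rintro (h | ⟨S, hS, rfl⟩)
    · exact h.1
    · exact (mem_posSets.1 hS).2

theorem card_formulas_le_sum {𝒢 : Finset (SatFormula V)} (h𝒢 : ∀ G ∈ 𝒢, G ⊆ kClauses k V)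
    (ℳ : Finset (SatFormula V)) (𝒬 : SatFormula V → Finset (Finset (Finset V)))
    (h : ∀ G ∈ 𝒢, negClauses G ∈ ℳ ∧ posSets k G ∈ 𝒬 (negClauses G)) :
    𝒢.card ≤ ∑ M ∈ ℳ, (𝒬 M).card := by
  rw [← card_sigma]
  refine card_le_card_of_injOn (fun G => ⟨negClauses G, posSets k G⟩)
    (fun G hG => mem_sigma.2 (h G hG)) fun G hG G' hG' he => ?_
  simp only [Sigma.mk.injEq, heq_eq_eq] at he
  rw [eq_negClauses_union (h𝒢 G hG), he.1, he.2, ← eq_negClauses_union (h𝒢 G' hG')]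

theorem centeredFormulas_props {x : ℝ} {G : SatFormula V} (hG : G ∈ centeredFormulas k V x) :
    G ⊆ kClauses k V ∧ MinimalFormula G ∧ ((negClauses G).card : ℝ) ≤ x ∧
      ∀ σ, (negClauses G).card ≤ (nonMonotone σ G).card := by
  obtain ⟨h1, h2, h3⟩ := mem_filter.1 hG
  obtain ⟨h4, h5⟩ := mem_minimalFormulas.1 h1
  exact ⟨isKFormula_iff.1 h4, h5, h2, h3⟩

theorem posSets_subset (G : SatFormula V) : posSets k G ⊆ univ.powersetCard k := filter_subset _ _

theorem card_monotone_centered_le (x : ℝ) :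
    ((centeredFormulas k V x).filter (fun G => negClauses G = ∅)).card ≤
      2 ^ (Fintype.card V).choose k := by
  refine (card_formulas_le_sum (k := k) (fun G hG => (centeredFormulas_props (mem_filter.1 hG).1).1)
    {∅} (fun _ => (univ.powersetCard k).powerset) fun G hG => ?_).trans ?_
  · exact ⟨mem_singleton.2 (mem_filter.1 hG).2, mem_powerset.2 (posSets_subset G)⟩
  · rw [sum_singleton, card_powerset, card_powersetCard, card_univ]

/-- The formulae with at most `m` clauses. -/
def smallFormulas (k : ℕ) (V : Type*) [Fintype V] [DecidableEq V] (m : ℕ) :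
    Finset (SatFormula V) := (kClauses k V).powerset.filter (fun M => M.card ≤ m)

theorem card_smallFormulas_le (k m : ℕ) :
    (smallFormulas k V m).card ≤ ((2 * Fintype.card V) ^ k + 1) ^ m :=
  (card_subsets_le _ _).trans (Nat.pow_le_pow_left (Nat.add_le_add_right (card_kClauses_le k) 1) _)

theorem negClauses_mem_smallFormulas {x : ℝ} {m : ℕ} (hm : ⌊x⌋₊ ≤ m) {G : SatFormula V}
    (hG : G ∈ centeredFormulas k V x) : negClauses G ∈ smallFormulas k V m := by
  obtain ⟨h1, -, h3, -⟩ := centeredFormulas_props hG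
  exact mem_filter.2 ⟨mem_powerset.2 ((filter_subset _ _).trans h1), (Nat.le_floor h3).trans hm⟩

/-- Every large set of variables contains a positive clause. -/
def MeetsLargeSets (k a : ℕ) (G : SatFormula V) : Prop :=
  ∀ A : Finset V, a ≤ A.card → ∃ S ∈ posSets k G, S ⊆ A

open scoped Classical in
theorem card_not_meetsLargeSets_le (x : ℝ) (a : ℕ) :
    ((centeredFormulas k V x).filter (fun G => ¬ MeetsLargeSets k a G)).card ≤
      ((2 * Fintype.card V) ^ k + 1) ^ ⌊x⌋₊ *
        (2 ^ Fintype.card V * 2 ^ ((Fintype.card V).choose k - a.choose k)) := by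
  refine (card_formulas_le_sum (k := k) (fun G hG => (centeredFormulas_props (mem_filter.1 hG).1).1)
    (smallFormulas k V ⌊x⌋₊) (fun _ => (univ.powersetCard a).biUnion (fun A =>
      (univ.powersetCard k \ A.powersetCard k).powerset)) fun G hG => ?_).trans ?_
  · obtain ⟨hGc, hG⟩ := mem_filter.1 hG
    refine ⟨negClauses_mem_smallFormulas le_rfl hGc, ?_⟩
    unfold MeetsLargeSets at hG
    push Not at hG
    obtain ⟨A, hA, hAS⟩ := hG
    obtain ⟨B, hBA, hB⟩ := exists_subset_card_eq hA
    refine mem_biUnion.2 ⟨B, mem_powersetCard.2 ⟨subset_univ _, hB⟩, mem_powerset.2 fun S hS => ?_⟩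
    exact mem_sdiff.2 ⟨posSets_subset G hS, fun h =>
      hAS S hS ((mem_powersetCard.1 h).1.trans hBA)⟩
  · rw [sum_const, smul_eq_mul]
    refine Nat.mul_le_mul (card_smallFormulas_le k _) (card_biUnion_le.trans ?_)
    have : ∀ A ∈ (univ : Finset V).powersetCard a,
        ((univ.powersetCard k \ A.powersetCard k).powerset).card ≤
          2 ^ ((Fintype.card V).choose k - a.choose k) := by
      intro A hA
      rw [card_powerset, card_sdiff_of_subset (powersetCard_mono (subset_univ _)),
        card_powersetCard, card_powersetCard, card_univ, (mem_powersetCard.1 hA).2]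
    refine (sum_le_card_nsmul _ _ _ this).trans ?_
    rw [smul_eq_mul]
    refine Nat.mul_le_mul_right _ ?_
    rw [card_powersetCard, card_univ]
    exact Nat.choose_le_two_pow _ _

/-- For each set of literals, few clauses extend it by `j` negative literals. -/
def SparseNegativeExtensions (a : ℕ) (M : SatFormula V) : Prop :=
  ∀ (Z : Finset (V × Bool)) (j : ℕ), 1 ≤ j →
    (M.filter (fun C => Z ⊆ C ∧ (C \ Z).card = j ∧ ∀ l ∈ C \ Z, l.2 = false)).card ≤
      1 + a * Fintype.card V ^ (j - 1)

theorem MeetsLargeSets.sparseNegativeExtensions {a : ℕ} {G : SatFormula V}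
    (h : MeetsLargeSets k a G) (hG : G ⊆ kClauses k V) (hGm : MinimalFormula G) :
    SparseNegativeExtensions a (negClauses G) := by
  intro Z j hj
  set 𝒞 := (negClauses G).filter (fun C => Z ⊆ C ∧ (C \ Z).card = j ∧ ∀ l ∈ C \ Z, l.2 = false)
    with h𝒞
  rcases 𝒞.eq_empty_or_nonempty with h0 | ⟨C₀, hC₀⟩
  · rw [h0, card_empty]; exact Nat.zero_le _
  obtain ⟨hC₀M, hZC₀, -, -⟩ := mem_filter.1 hC₀
  obtain ⟨hC₀G, v₀, hv₀⟩ := (mem_negClauses hG).1 hC₀M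
  obtain ⟨w, hw, hw'⟩ := hGm C₀ hC₀G
  set A : Finset V := univ.filter (fun v => w v = true) with hA
  have hAa : A.card < a := by
    by_contra hle
    obtain ⟨S, hS, hSA⟩ := h A (not_lt.1 hle)
    have := hw' _ (mem_posSets.1 hS).2 (satisfies_signedClause.2 fun v hv =>
      (mem_filter.1 (hSA hv)).2)
    rw [← this, mem_signedClause] at hv₀
    simp at hv₀
  have hinj : Set.InjOn (fun C : SatClause V => (C \ Z).image Prod.fst) (𝒞 : Set (SatClause V)) := by
    have key : ∀ C ∈ 𝒞, C = Z ∪ ((C \ Z).image Prod.fst).image (fun v => (v, false)) := by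
      intro C hC
      obtain ⟨-, hZ, -, hneg⟩ := mem_filter.1 hC
      rw [image_image]
      have : (C \ Z).image ((fun v => (v, false)) ∘ Prod.fst) = C \ Z := by
        conv_rhs => rw [← image_id (s := C \ Z)]
        refine image_congr fun l hl => ?_
        have := hneg l hl
        exact Prod.ext rfl this.symm
      rw [this, union_sdiff_of_subset hZ]
    intro C hC C' hC' he
    rw [key C hC, key C' hC']
    simp only at he
    rw [he]
  have hmaps : ∀ C ∈ 𝒞.erase C₀, (C \ Z).image Prod.fst ∈
      A.biUnion (fun v => (univ.powersetCard j).filter (fun B => {v} ⊆ B)) := by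
    intro C hC
    obtain ⟨hne, hC⟩ := mem_erase.1 hC
    obtain ⟨hCM, hZC, hj', hneg⟩ := mem_filter.1 hC
    have hns : ¬ SatisfiesClause w C := fun hs =>
      hne (hw' C ((mem_negClauses hG).1 hCM).1 hs)
    unfold SatisfiesClause at hns
    push Not at hns
    obtain ⟨l, hl, hlw⟩ := hns
    have hlZ : l ∈ C \ Z := mem_sdiff.2 ⟨hl, fun hZ => hlw (hw l (hZC₀ hZ))⟩
    refine mem_biUnion.2 ⟨l.1, mem_filter.2 ⟨mem_univ _, ?_⟩, mem_filter.2
      ⟨mem_powersetCard.2 ⟨subset_univ _, ?_⟩, singleton_subset_iff.2 (mem_image_of_mem _ hlZ)⟩⟩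
    · rw [hneg l hlZ] at hlw
      simpa using hlw
    · rw [card_image_of_injOn, hj']
      intro l₁ h₁ l₂ h₂ he
      exact Prod.ext he ((hneg l₁ h₁).trans (hneg l₂ h₂).symm)
  have h1 : (𝒞.erase C₀).card ≤ a * Fintype.card V ^ (j - 1) := by
    rw [← card_image_of_injOn (hinj.mono (coe_subset.2 (erase_subset _ _)))]
    refine (card_le_card (image_subset_iff.2 hmaps)).trans (card_biUnion_le.trans ?_)
    refine (sum_le_card_nsmul _ _ (Fintype.card V ^ (j - 1)) fun v _ => ?_).trans ?_
    · exact (card_supersets_le j {v}).trans (by rw [card_singleton])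
    · rw [smul_eq_mul]; exact Nat.mul_le_mul_right _ hAa.le
  have := card_erase_add_one hC₀
  omega

end

section

section Avoidance
variable {ι α : Type*} [DecidableEq α]

theorem card_avoiding_matching_le [DecidableEq ι] {r : ℕ} (T : Finset ι) (h : ι → Finset α)
    (hr : ∀ e ∈ T, (h e).card ≤ r) (hT : (T : Set ι).PairwiseDisjoint h) (Ω : Finset α)
    (hΩ : ∀ e ∈ T, h e ⊆ Ω) :
    ((Ω.powerset.filter (fun 𝒢 => ∀ e ∈ T, ¬ h e ⊆ 𝒢)).card : ℝ) ≤
      2 ^ Ω.card * (1 - 1 / 2 ^ r) ^ T.card := by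
  have hq : (0 : ℝ) ≤ 1 - 1 / 2 ^ r := by
    rw [sub_nonneg, div_le_one (by positivity)]; exact one_le_pow₀ one_le_two
  induction T using Finset.induction_on generalizing Ω with
  | empty => simp [card_powerset]
  | insert e T he ih =>
    have ih' := ih (fun e' h' => hr e' (mem_insert_of_mem h'))
      (hT.subset (coe_subset.2 (subset_insert _ _))) (Ω \ h e) fun e' h' x hx => by
        refine mem_sdiff.2 ⟨hΩ e' (mem_insert_of_mem h') hx, fun hxe => ?_⟩
        have := hT (mem_coe.2 (mem_insert_self e T)) (mem_coe.2 (mem_insert_of_mem h'))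
          (fun heq => he (heq ▸ h'))
        exact disjoint_left.1 this hxe hx
    have hinj : (Ω.powerset.filter (fun 𝒢 => ∀ e' ∈ insert e T, ¬ h e' ⊆ 𝒢)).card ≤
        ((h e).powerset.erase (h e)).card *
          ((Ω \ h e).powerset.filter (fun 𝒢 => ∀ e ∈ T, ¬ h e ⊆ 𝒢)).card := by
      rw [← card_product]
      refine card_le_card_of_injOn (fun 𝒢 => (𝒢 ∩ h e, 𝒢 \ h e)) (fun 𝒢 h𝒢 => ?_)
        fun 𝒢 _ 𝒢' _ heq => ?_
      · obtain ⟨h1, h2⟩ := mem_filter.1 h𝒢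
        refine mem_product.2 ⟨mem_erase.2 ⟨fun heq => ?_, mem_powerset.2 inter_subset_right⟩,
          mem_filter.2 ⟨mem_powerset.2 (sdiff_subset_sdiff (mem_powerset.1 h1) le_rfl),
            fun e' he' hs => h2 e' (mem_insert_of_mem he') (hs.trans sdiff_subset)⟩⟩
        exact h2 e (mem_insert_self _ _) (inter_eq_right.1 heq)
      · simp only [Prod.mk.injEq] at heq
        rw [← sdiff_union_inter 𝒢 (h e), heq.1, heq.2, sdiff_union_inter]
    have hc : (h e).card ≤ Ω.card := card_le_card (hΩ e (mem_insert_self _ _))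
    have h1 : (((h e).powerset.erase (h e)).card : ℝ) ≤ 2 ^ (h e).card * (1 - 1 / 2 ^ r) := by
      rw [card_erase_of_mem (mem_powerset.2 le_rfl), card_powerset, Nat.cast_sub Nat.one_le_two_pow,
        Nat.cast_pow, Nat.cast_ofNat, Nat.cast_one, mul_sub, mul_one, mul_one_div,
        sub_le_sub_iff_left, div_le_one (by positivity)]
      exact pow_le_pow_right₀ one_le_two (hr e (mem_insert_self _ _))
    calc _ ≤ (((h e).powerset.erase (h e)).card : ℝ) *
          ((Ω \ h e).powerset.filter (fun 𝒢 => ∀ e ∈ T, ¬ h e ⊆ 𝒢)).card := by exact_mod_cast hinj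
      _ ≤ (2 ^ (h e).card * (1 - 1 / 2 ^ r)) * (2 ^ (Ω \ h e).card * (1 - 1 / 2 ^ r) ^ T.card) := by
          gcongr
      _ = (2 ^ (h e).card * 2 ^ (Ω \ h e).card) * (1 - 1 / 2 ^ r) ^ (T.card + 1) := by ring
      _ = _ := by
          rw [← pow_add, card_insert_of_notMem he,
            card_sdiff_of_subset (hΩ e (mem_insert_self _ _)), Nat.add_sub_cancel' hc]

theorem exists_matching [DecidableEq ι] {r Δ : ℕ} (T : Finset ι) (h : ι → Finset α)
    (hr : ∀ e ∈ T, (h e).card ≤ r) (hne : ∀ e ∈ T, (h e).Nonempty)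
    (hΔ : ∀ x, (T.filter (fun e => x ∈ h e)).card ≤ Δ) :
    ∃ T' ⊆ T, (T' : Set ι).PairwiseDisjoint h ∧ T.card ≤ T'.card * (r * Δ) := by
  classical
  obtain ⟨T', hT', hmax⟩ := exists_max_image
    (T.powerset.filter (fun T' : Finset ι => (T' : Set ι).PairwiseDisjoint h)) card
    ⟨∅, mem_filter.2 ⟨empty_mem_powerset _, by simp⟩⟩
  obtain ⟨hT'T, hdis⟩ := mem_filter.1 hT'
  rw [mem_powerset] at hT'T
  refine ⟨T', hT'T, hdis, ?_⟩
  have hcov : T ⊆ (T'.biUnion h).biUnion (fun x => T.filter (fun e => x ∈ h e)) := by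
    intro e he
    by_contra hnot
    have hd : ∀ e' ∈ T', Disjoint (h e) (h e') := by
      intro e' he'
      rw [disjoint_left]
      intro x hx hx'
      exact hnot (mem_biUnion.2 ⟨x, mem_biUnion.2 ⟨e', he', hx'⟩, mem_filter.2 ⟨he, hx⟩⟩)
    have heT' : e ∉ T' := fun h' => by
      obtain ⟨x, hx⟩ := hne e he
      exact disjoint_left.1 (hd e h') hx hx
    have := hmax (insert e T') (mem_filter.2 ⟨mem_powerset.2 (insert_subset he hT'T), by
      rw [coe_insert]
      exact hdis.insert fun e' he' _ => hd e' he'⟩)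
    rw [card_insert_of_notMem heT'] at this
    omega
  refine (card_le_card hcov).trans (card_biUnion_le.trans ((sum_le_card_nsmul _ _ Δ
    fun x _ => hΔ x).trans ?_))
  rw [smul_eq_mul, ← mul_assoc]
  exact Nat.mul_le_mul_right _ (card_biUnion_le.trans (sum_le_card_nsmul _ _ r
    fun e he => hr e (hT'T he)))

theorem one_sub_le_two_rpow_neg {x : ℝ} (hx : 0 ≤ x) : 1 - x ≤ 2 ^ (-x) := by
  have h1 : 1 - x ≤ Real.exp (-x) := by have := Real.add_one_le_exp (-x); linarith
  refine h1.trans ?_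
  rw [Real.rpow_def_of_pos two_pos]
  refine Real.exp_le_exp.2 ?_
  have := Real.log_two_lt_d9
  nlinarith

theorem card_avoiding_le [DecidableEq ι] {r Δ : ℕ} (hr0 : 0 < r) (hΔ0 : 0 < Δ) (T : Finset ι)
    (h : ι → Finset α) (hr : ∀ e ∈ T, (h e).card ≤ r) (hne : ∀ e ∈ T, (h e).Nonempty)
    (hΔ : ∀ x, (T.filter (fun e => x ∈ h e)).card ≤ Δ) (Ω : Finset α) (hΩ : ∀ e ∈ T, h e ⊆ Ω) :
    ((Ω.powerset.filter (fun 𝒢 => ∀ e ∈ T, ¬ h e ⊆ 𝒢)).card : ℝ) ≤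
      2 ^ ((Ω.card : ℝ) - T.card / (2 ^ r * (r * Δ))) := by
  obtain ⟨T', hT'T, hdis, hcard⟩ := exists_matching T h hr hne hΔ
  have hcard' : (T.card : ℝ) ≤ T'.card * (r * Δ) := by exact_mod_cast hcard
  have hr0' : (0 : ℝ) < r := by exact_mod_cast hr0
  have hΔ0' : (0 : ℝ) < Δ := by exact_mod_cast hΔ0
  have h1 := card_avoiding_matching_le T' h (fun e he => hr e (hT'T he)) hdis Ω
    (fun e he => hΩ e (hT'T he))
  have h2 : ((Ω.powerset.filter (fun 𝒢 => ∀ e ∈ T, ¬ h e ⊆ 𝒢)).card : ℝ) ≤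
      (Ω.powerset.filter (fun 𝒢 => ∀ e ∈ T', ¬ h e ⊆ 𝒢)).card :=
    Nat.cast_le.2 (card_le_card (monotone_filter_right _ fun 𝒢 _ h𝒢 e he => h𝒢 e (hT'T he)))
  have hq : (0 : ℝ) ≤ 1 - 1 / 2 ^ r := by
    rw [sub_nonneg, div_le_one (by positivity)]; exact one_le_pow₀ one_le_two
  refine h2.trans (h1.trans ?_)
  calc _ ≤ (2 : ℝ) ^ Ω.card * (2 ^ (-(1 / 2 ^ r) : ℝ)) ^ T'.card := by
        gcongr
        exact one_sub_le_two_rpow_neg (by positivity)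
    _ = 2 ^ ((Ω.card : ℝ) + -(1 / 2 ^ r) * T'.card) := by
        rw [Real.rpow_add two_pos, Real.rpow_natCast, Real.rpow_mul two_pos.le, Real.rpow_natCast]
    _ ≤ _ := by
        refine Real.rpow_le_rpow_of_exponent_le one_le_two ?_
        have : (T.card : ℝ) / (2 ^ r * (r * Δ)) ≤ 1 / 2 ^ r * T'.card := by
          rw [div_le_iff₀ (by positivity)]
          calc (T.card : ℝ) ≤ T'.card * (r * Δ) := hcard'
            _ = _ := by field_simp
        linarith

end Avoidance

end

section

variable {V : Type*} [Fintype V] [DecidableEq V] {k : ℕ}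

/-- The number of clauses of `M` containing the literals `Y`. -/
def litDeg (M : SatFormula V) (Y : Finset (V × Bool)) : ℕ := (M.filter (fun C => Y ⊆ C)).card

/-- The exponents in the thresholds for bad sets of literals. -/
def degExp : ℕ → ℕ
  | 0 => 0
  | j + 1 => 2 * degExp j + 3

theorem degExp_succ_le {i j : ℕ} (h : i < j) : 2 * degExp i + 3 ≤ degExp j := by
  induction j with
  | zero => omega
  | succ j ih =>
    rw [degExp]
    rcases Nat.lt_succ_iff_lt_or_eq.1 h with h | rfl
    · have := ih h; omega
    · omega

theorem degExp_mono {i j : ℕ} (h : i ≤ j) : degExp i ≤ degExp j := by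
  rcases h.lt_or_eq with h | rfl
  · have := degExp_succ_le h; omega
  · rfl

/-- A set of literals of abnormally large degree. -/
def IsBadSet (k t : ℕ) (M : SatFormula V) (Y : Finset (V × Bool)) : Prop :=
  Fintype.card V ^ (k - Y.card) ≤ litDeg M Y * t ^ degExp (k - Y.card)

/-- A bad set of literals with no bad proper subset. -/
def IsMinBadSet (k t : ℕ) (M : SatFormula V) (Y : Finset (V × Bool)) : Prop :=
  IsBadSet k t M Y ∧ ∀ Y' ⊂ Y, ¬ IsBadSet k t M Y'

/-- Removing literals meeting `Y` from `C` gives a set of literals of small degree. -/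
def IsLight (q : ℕ) (M : SatFormula V) (Y C : Finset (V × Bool)) : Prop :=
  ∀ W ⊆ C, (W ∩ Y).Nonempty → litDeg M (C \ W) * q ≤ Fintype.card V ^ W.card

theorem card_kClauses_supersets_le (k : ℕ) (Y : Finset (V × Bool)) :
    ((kClauses k V).filter (fun C => Y ⊆ C)).card ≤ (2 * Fintype.card V) ^ (k - Y.card) := by
  refine (card_le_card (t := (univ.powersetCard k).filter (fun C => Y ⊆ C)) fun C hC => ?_).trans
    ((card_supersets_le k Y).trans (le_of_eq ?_))
  · obtain ⟨h1, h2⟩ := mem_filter.1 hC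
    exact mem_filter.2 ⟨mem_powersetCard.2 ⟨subset_univ _, (mem_kClauses.1 h1).1⟩, h2⟩
  · rw [Fintype.card_prod, Fintype.card_bool, mul_comm]

theorem sum_litDeg_le {M : SatFormula V} (hM : M ⊆ kClauses k V) (Y : Finset (V × Bool))
    (𝒵 : Finset (Finset (V × Bool))) (h𝒵 : ∀ Z ∈ 𝒵, Y ⊆ Z) :
    ∑ Z ∈ 𝒵, litDeg M Z ≤ 2 ^ k * litDeg M Y := by
  have h1 : ∑ Z ∈ 𝒵, litDeg M Z ≤
      ∑ Z ∈ 𝒵, ((M.filter (fun C => Y ⊆ C)).filter (fun C => Z ⊆ C)).card := by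
    refine sum_le_sum fun Z hZ => card_le_card fun C hC => ?_
    obtain ⟨h1, h2⟩ := mem_filter.1 hC
    exact mem_filter.2 ⟨mem_filter.2 ⟨h1, (h𝒵 Z hZ).trans h2⟩, h2⟩
  refine h1.trans ?_
  refine (sum_card_bipartiteAbove_eq_sum_card_bipartiteBelow
    (fun (C Z : Finset (V × Bool)) => Z ⊆ C)).symm.le.trans ?_
  refine (sum_le_card_nsmul _ _ (2 ^ k) fun C hC => ?_).trans (le_of_eq ?_)
  · refine (card_le_card (t := C.powerset) fun Z hZ => mem_powerset.2 (mem_filter.1 hZ).2).trans ?_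
    rw [card_powerset, (mem_kClauses.1 (hM (mem_filter.1 hC).1)).1]
  · rw [smul_eq_mul, litDeg, mul_comm]

open scoped Classical in
theorem card_not_isLight_le {M : SatFormula V} (hM : M ⊆ kClauses k V) {t : ℕ}
    (ht : 4 ^ k * (2 * (2 ^ k * (k + 1))) ≤ t) (hn : 0 < Fintype.card V)
    {Y : Finset (V × Bool)} (hYk : Y.card ≤ k) (hY : IsMinBadSet k t M Y) :
    2 * (M.filter (fun C => Y ⊆ C ∧
      ¬ IsLight (t ^ (degExp (k - Y.card) + 2)) M Y C)).card ≤ litDeg M Y := by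
  set n := Fintype.card V with hndef
  set q := t ^ (degExp (k - Y.card) + 2) with hq
  have ht0 : 0 < t := lt_of_lt_of_le (by positivity) ht
  set 𝒵 : Finset (V × Bool) → ℕ → Finset (Finset (V × Bool)) := fun Y' z =>
    univ.filter (fun Z => Z.card = z ∧ Z ∩ Y = Y' ∧ (Z ∪ Y).card ≤ k ∧
      n ^ (k - z) ≤ litDeg M Z * q) with h𝒵
  set 𝒞 : Finset (V × Bool) → Finset (SatClause V) := fun X =>
    (kClauses k V).filter (fun C => X ⊆ C) with h𝒞
  have hcov : M.filter (fun C => Y ⊆ C ∧ ¬ IsLight q M Y C) ⊆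
      (Y.ssubsets ×ˢ range (k + 1)).biUnion (fun p => (𝒵 p.1 p.2).biUnion
        (fun Z => 𝒞 (Z ∪ Y))) := by
    intro C hC
    obtain ⟨hCM, hYC, hC⟩ := mem_filter.1 hC
    have hCk := mem_kClauses.1 (hM hCM)
    unfold IsLight at hC
    push Not at hC
    obtain ⟨W, hWC, ⟨l, hl⟩, hlt⟩ := hC
    rw [mem_inter] at hl
    have hZC : C \ W ⊆ C := sdiff_subset
    have hcard : (C \ W).card = k - W.card := by
      rw [card_sdiff_of_subset hWC, hCk.1]
    have hWk : W.card ≤ k := hCk.1 ▸ card_le_card hWC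
    refine mem_biUnion.2 ⟨((C \ W) ∩ Y, (C \ W).card), mem_product.2 ⟨mem_ssubsets.2 ?_,
      mem_range.2 ?_⟩, mem_biUnion.2 ⟨C \ W, mem_filter.2 ⟨mem_univ _, rfl, rfl, ?_, ?_⟩,
      mem_filter.2 ⟨hM hCM, union_subset hZC hYC⟩⟩⟩
    · refine ⟨inter_subset_right, fun h => ?_⟩
      have := (mem_inter.1 (h hl.2)).1
      exact (mem_sdiff.1 this).2 hl.1
    · simp only [hcard]; omega
    · rw [← hCk.1]; exact card_le_card (union_subset hZC hYC)
    · have : k - (C \ W).card = W.card := by omega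
      rw [this]; exact hlt.le
  have hterm : ∀ p ∈ Y.ssubsets ×ˢ range (k + 1),
      (2 * (2 ^ k * (k + 1))) * ((𝒵 p.1 p.2).biUnion (fun Z => 𝒞 (Z ∪ Y))).card ≤
        litDeg M Y := by
    rintro ⟨Y', z⟩ hp
    obtain ⟨hY', hz⟩ := mem_product.1 hp
    simp only at hY' hz ⊢
    rw [mem_ssubsets] at hY'
    rw [mem_range] at hz
    have hi' := card_lt_card hY'
    rcases (𝒵 Y' z).eq_empty_or_nonempty with h0 | ⟨Z₀, hZ₀⟩
    · rw [h0]; simp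
    have hcu : ∀ Z ∈ 𝒵 Y' z, (Z ∪ Y).card + Y'.card = z + Y.card := by
      intro Z hZ
      obtain ⟨-, h1, h2, -⟩ := mem_filter.1 hZ
      rw [← h1, ← h2, card_union_add_card_inter]
    set e := k - (z + Y.card - Y'.card) with he
    have he1 : e + (k - Y'.card) = (k - z) + (k - Y.card) := by
      have := hcu Z₀ hZ₀
      obtain ⟨-, -, -, h3, -⟩ := mem_filter.1 hZ₀
      omega
    have h1 : ((𝒵 Y' z).biUnion (fun Z => 𝒞 (Z ∪ Y))).card ≤ (𝒵 Y' z).card * (2 * n) ^ e := by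
      refine card_biUnion_le.trans ((sum_le_card_nsmul _ _ _ fun Z hZ => ?_).trans
        (le_of_eq (smul_eq_mul _ _)))
      have : e = k - (Z ∪ Y).card := by have := hcu Z hZ; omega
      rw [this]
      exact card_kClauses_supersets_le k _
    have h2 : (𝒵 Y' z).card * n ^ (k - z) ≤ 2 ^ k * litDeg M Y' * q := by
      calc (𝒵 Y' z).card * n ^ (k - z) ≤ ∑ Z ∈ 𝒵 Y' z, litDeg M Z * q := by
            rw [← smul_eq_mul]
            exact card_nsmul_le_sum _ _ _ fun Z hZ => (mem_filter.1 hZ).2.2.2.2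
        _ ≤ _ := by
            rw [← sum_mul]
            refine Nat.mul_le_mul_right _ (sum_litDeg_le hM _ _ fun Z hZ => ?_)
            rw [← (mem_filter.1 hZ).2.2.1]; exact inter_subset_left
    have h3 : litDeg M Y' * t ^ degExp (k - Y'.card) ≤ n ^ (k - Y'.card) :=
      (not_le.1 (hY.2 Y' hY')).le
    have h4 : n ^ (k - Y.card) ≤ litDeg M Y * t ^ degExp (k - Y.card) := hY.1
    have h5 : q * t ^ degExp (k - Y.card) * t ≤ t ^ degExp (k - Y'.card) := by
      rw [hq, ← pow_add, ← pow_succ]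
      have := degExp_succ_le (show k - Y.card < k - Y'.card by omega)
      exact Nat.pow_le_pow_right ht0 (by omega)
    have h6 : (2 : ℕ) ^ e ≤ 2 ^ k := Nat.pow_le_pow_right two_pos (by omega)
    set K := 2 * (2 ^ k * (k + 1)) with hK
    have hpos : 0 < n ^ (k - z) * t ^ degExp (k - Y'.card) := by positivity
    refine le_of_mul_le_mul_right ?_ hpos
    calc K * ((𝒵 Y' z).biUnion (fun Z => 𝒞 (Z ∪ Y))).card *
          (n ^ (k - z) * t ^ degExp (k - Y'.card))
        ≤ K * ((𝒵 Y' z).card * (2 * n) ^ e) * (n ^ (k - z) * t ^ degExp (k - Y'.card)) := by gcongr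
      _ = K * (2 * n) ^ e * t ^ degExp (k - Y'.card) * ((𝒵 Y' z).card * n ^ (k - z)) := by ring
      _ ≤ K * (2 * n) ^ e * t ^ degExp (k - Y'.card) * (2 ^ k * litDeg M Y' * q) := by gcongr
      _ = K * 2 ^ e * n ^ e * 2 ^ k * q * (litDeg M Y' * t ^ degExp (k - Y'.card)) := by
          rw [mul_pow]; ring
      _ ≤ K * 2 ^ k * n ^ e * 2 ^ k * q * n ^ (k - Y'.card) := by gcongr
      _ = (4 ^ k * K) * q * n ^ (e + (k - Y'.card)) := by
          rw [pow_add, show (4 : ℕ) = 2 * 2 from rfl, mul_pow]; ring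
      _ = (4 ^ k * K) * q * n ^ (k - z) * n ^ (k - Y.card) := by rw [he1, pow_add]; ring
      _ ≤ t * q * n ^ (k - z) * (litDeg M Y * t ^ degExp (k - Y.card)) := by gcongr
      _ = litDeg M Y * n ^ (k - z) * (q * t ^ degExp (k - Y.card) * t) := by ring
      _ ≤ litDeg M Y * n ^ (k - z) * t ^ degExp (k - Y'.card) := by gcongr
      _ = _ := by ring
  have hsum : (2 * (2 ^ k * (k + 1))) *
      (M.filter (fun C => Y ⊆ C ∧ ¬ IsLight q M Y C)).card ≤ (2 ^ k * (k + 1)) * litDeg M Y := by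
    refine (Nat.mul_le_mul_left _ ((card_le_card hcov).trans card_biUnion_le)).trans ?_
    rw [mul_sum]
    refine (sum_le_card_nsmul _ _ _ hterm).trans ?_
    rw [smul_eq_mul, card_product, card_range]
    refine Nat.mul_le_mul_right _ (Nat.mul_le_mul_right _ ?_)
    calc Y.ssubsets.card ≤ Y.powerset.card :=
          card_le_card fun X hX => mem_powerset.2 (mem_ssubsets.1 hX).1
      _ ≤ 2 ^ k := by rw [card_powerset]; exact Nat.pow_le_pow_right two_pos hYk
  have : 0 < 2 ^ k * (k + 1) := by positivity
  refine le_of_mul_le_mul_left ?_ this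
  calc _ = _ := by ring
    _ ≤ _ := hsum

open scoped Classical in
/-- The minimal bad sets with `i` literals. -/
noncomputable def minBadSets (k t : ℕ) (M : SatFormula V) (i : ℕ) : Finset (Finset (V × Bool)) :=
  univ.filter (fun Y => Y.card = i ∧ IsMinBadSet k t M Y)

theorem mem_minBadSets {t : ℕ} {M : SatFormula V} {i : ℕ} {Y : Finset (V × Bool)} :
    Y ∈ minBadSets k t M i ↔ Y.card = i ∧ IsMinBadSet k t M Y := by
  simp [minBadSets]

/-- The weighted number of minimal bad sets. -/
noncomputable def badWeight (k t : ℕ) (M : SatFormula V) : ℕ :=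
  (range (k + 1)).sup (fun i => (minBadSets k t M i).card * Fintype.card V ^ (k - i))

theorem exists_minBadSet_subset {t : ℕ} {M : SatFormula V} {C : SatClause V} (hC : C ∈ M)
    (hCk : IsKClause k C) : ∃ Y ⊆ C, IsMinBadSet k t M Y := by
  classical
  obtain ⟨Y, hY, hmin⟩ := exists_min_image (C.powerset.filter (IsBadSet k t M)) card
    ⟨C, mem_filter.2 ⟨mem_powerset_self C, by
      rw [IsBadSet, hCk.1, Nat.sub_self, pow_zero, degExp, pow_zero, mul_one]
      exact card_pos.2 ⟨C, mem_filter.2 ⟨hC, Subset.rfl⟩⟩⟩⟩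
  obtain ⟨h1, h2⟩ := mem_filter.1 hY
  rw [mem_powerset] at h1
  refine ⟨Y, h1, h2, fun Y' hY' hb => ?_⟩
  have := hmin Y' (mem_filter.2 ⟨mem_powerset.2 (hY'.1.trans h1), hb⟩)
  exact absurd (card_lt_card hY') (not_lt.2 this)

theorem one_le_badWeight {t : ℕ} {M : SatFormula V} (hM : M ⊆ kClauses k V) (hne : M.Nonempty)
    (hn : 0 < Fintype.card V) : 1 ≤ badWeight k t M := by
  obtain ⟨C, hC⟩ := hne
  have hCk := mem_kClauses.1 (hM hC)
  obtain ⟨Y, hYC, hY⟩ := exists_minBadSet_subset (t := t) hC hCk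
  have hYk : Y.card ≤ k := hCk.1 ▸ card_le_card hYC
  refine le_trans ?_ (le_sup (f := fun i => (minBadSets k t M i).card * Fintype.card V ^ (k - i))
    (mem_range.2 (Nat.lt_succ_of_le hYk)))
  exact Nat.mul_pos (card_pos.2 ⟨Y, mem_minBadSets.2 ⟨rfl, hY⟩⟩) (by positivity)

open scoped Classical in
theorem card_badWeight_le {t : ℕ} (ht : 1 ≤ t) (hn : 0 < Fintype.card V)
    (hnt : 2 * Fintype.card V ≤ 2 ^ t) (X : ℕ) :
    ((kClauses k V).powerset.filter (fun M => badWeight k t M ≤ X)).card ≤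
      2 ^ ((k + 1) * (2 * k + 1 + 2 ^ k) * t * X) := by
  set n := Fintype.card V with hndef
  set Λ : Finset (Finset (V × Bool)) := univ.filter (fun Y => Y.card ≤ k) with hΛ
  set ℱ := Λ.powerset.filter (fun 𝒴 => ∑ Y ∈ 𝒴, n ^ (k - Y.card) ≤ (k + 1) * X) with hℱ
  set 𝒞 : Finset (V × Bool) → Finset (SatClause V) := fun Y =>
    (kClauses k V).filter (fun C => Y ⊆ C) with h𝒞
  have hcov : (kClauses k V).powerset.filter (fun M => badWeight k t M ≤ X) ⊆
      ℱ.biUnion (fun 𝒴 => (𝒴.biUnion 𝒞).powerset) := by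
    intro M hM
    obtain ⟨hMk, hX⟩ := mem_filter.1 hM
    rw [mem_powerset] at hMk
    refine mem_biUnion.2 ⟨(range (k + 1)).biUnion (minBadSets k t M), mem_filter.2
      ⟨mem_powerset.2 (biUnion_subset.2 fun i hi Y hY => mem_filter.2 ⟨mem_univ _, ?_⟩), ?_⟩,
      mem_powerset.2 fun C hC => ?_⟩
    · rw [(mem_minBadSets.1 hY).1]; exact Nat.lt_succ_iff.1 (mem_range.1 hi)
    · rw [sum_biUnion]
      · refine (sum_le_card_nsmul _ _ X fun i hi => ?_).trans (le_of_eq ?_)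
        · rw [sum_congr rfl (g := fun _ => n ^ (k - i)) fun Y hY => by
            rw [(mem_minBadSets.1 hY).1], sum_const, smul_eq_mul]
          exact le_trans (le_sup
            (f := fun i => (minBadSets k t M i).card * Fintype.card V ^ (k - i)) hi) hX
        · rw [card_range, smul_eq_mul]
      · intro i _ j _ hij
        refine disjoint_left.2 fun Y hY hY' => hij ?_
        rw [← (mem_minBadSets.1 hY).1, (mem_minBadSets.1 hY').1]
    · have hCk := mem_kClauses.1 (hMk hC)
      obtain ⟨Y, hYC, hY⟩ := exists_minBadSet_subset (t := t) hC hCk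
      exact mem_biUnion.2 ⟨Y, mem_biUnion.2 ⟨Y.card, mem_range.2
        (Nat.lt_succ_of_le (hCk.1 ▸ card_le_card hYC)), mem_minBadSets.2 ⟨rfl, hY⟩⟩,
        mem_filter.2 ⟨hMk hC, hYC⟩⟩
  have hΛc : Λ.card ≤ 2 ^ ((t + 1) * k) := by
    have : Λ = (univ : Finset (V × Bool)).powerset.filter (fun Y => Y.card ≤ k) := by
      rw [hΛ, powerset_univ]
    rw [this]
    refine (card_subsets_le _ _).trans ?_
    rw [pow_mul, card_univ, Fintype.card_prod, Fintype.card_bool]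
    refine Nat.pow_le_pow_left ?_ k
    have := Nat.one_le_two_pow (n := t)
    rw [pow_succ]; omega
  have hℱc : ℱ.card ≤ 2 ^ (((t + 1) * k + 1) * ((k + 1) * X)) := by
    refine (card_le_card (t := Λ.powerset.filter (fun 𝒴 => 𝒴.card ≤ (k + 1) * X))
      fun 𝒴 h => ?_).trans ((card_subsets_le _ _).trans ?_)
    · obtain ⟨h1, h2⟩ := mem_filter.1 h
      refine mem_filter.2 ⟨h1, le_trans ?_ h2⟩
      rw [card_eq_sum_ones]
      exact sum_le_sum fun Y _ => Nat.one_le_pow _ _ hn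
    · rw [pow_mul 2]
      refine Nat.pow_le_pow_left ?_ _
      have := Nat.one_le_two_pow (n := (t + 1) * k)
      rw [pow_succ]; omega
  refine (card_le_card hcov).trans (card_biUnion_le.trans ((sum_le_card_nsmul _ _
    (2 ^ (2 ^ k * ((k + 1) * X))) fun 𝒴 h𝒴 => ?_).trans ?_))
  · rw [card_powerset]
    refine Nat.pow_le_pow_right two_pos ?_
    calc (𝒴.biUnion 𝒞).card ≤ ∑ Y ∈ 𝒴, (2 * n) ^ (k - Y.card) :=
          card_biUnion_le.trans (sum_le_sum fun Y _ => card_kClauses_supersets_le k Y)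
      _ ≤ ∑ Y ∈ 𝒴, 2 ^ k * n ^ (k - Y.card) := sum_le_sum fun Y _ => by
          rw [mul_pow]
          exact Nat.mul_le_mul_right _ (Nat.pow_le_pow_right two_pos (Nat.sub_le _ _))
      _ ≤ _ := by rw [← mul_sum]; exact Nat.mul_le_mul_left _ (mem_filter.1 h𝒴).2
  · rw [smul_eq_mul]
    refine (Nat.mul_le_mul_right _ hℱc).trans ?_
    rw [← pow_add]
    refine Nat.pow_le_pow_right two_pos ?_
    have : ((t + 1) * k + 1) + 2 ^ k ≤ (2 * k + 1 + 2 ^ k) * t := by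
      have : 0 < 2 ^ k := by positivity
      nlinarith
    calc _ = (((t + 1) * k + 1) + 2 ^ k) * ((k + 1) * X) := by ring
      _ ≤ ((2 * k + 1 + 2 ^ k) * t) * ((k + 1) * X) := Nat.mul_le_mul_right _ this
      _ = _ := by ring

/-- The variables with sign `b` in a clause. -/
def signedVars (b : Bool) (C : SatClause V) : Finset V := (C.filter (fun l => l.2 = b)).image Prod.fst

theorem mem_signedVars {b : Bool} {C : SatClause V} {v : V} : v ∈ signedVars b C ↔ (v, b) ∈ C := by
  simp only [signedVars, mem_image, mem_filter, Prod.exists, exists_and_right, exists_eq_right]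

theorem signedVars_subset (b : Bool) (C : SatClause V) : signedVars b C ⊆ clauseVars C := fun _ hv =>
  mem_clauseVars.2 ⟨b, mem_signedVars.1 hv⟩

/-- The literals with sign `b` on a set of variables. -/
def constLits (b : Bool) (S : Finset V) : Finset (V × Bool) := signedClause (fun _ => b) S

theorem mem_constLits {b b' : Bool} {S : Finset V} {v : V} :
    (v, b') ∈ constLits b S ↔ v ∈ S ∧ b' = b := mem_signedClause

theorem card_constLits (b : Bool) (S : Finset V) : (constLits b S).card = S.card :=
  card_signedClause _ _

theorem eq_union_constLits (C : SatClause V) :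
    C = constLits true (signedVars true C) ∪ constLits false (signedVars false C) := by
  ext ⟨v, b⟩
  rw [mem_union, mem_constLits, mem_constLits, mem_signedVars, mem_signedVars]
  cases b <;> simp

theorem disjoint_constLits (S T : Finset V) : Disjoint (constLits true S) (constLits false T) := by
  refine disjoint_left.2 ?_
  rintro ⟨v, b⟩ h h'
  have h1 := (mem_constLits.1 h).2
  have h2 := (mem_constLits.1 h').2
  exact Bool.noConfusion (h1.symm.trans h2)

theorem card_signedVars_add {C : SatClause V} (hC : IsKClause k C) :
    (signedVars true C).card + (signedVars false C).card = k := by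
  rw [← card_constLits true (signedVars true C), ← card_constLits false (signedVars false C),
    ← card_union_of_disjoint (disjoint_constLits _ _), ← eq_union_constLits, hC.1]

theorem disjoint_signedVars {C : SatClause V} (hC : IsKClause k C) :
    Disjoint (signedVars true C) (signedVars false C) := disjoint_left.2 fun _ h h' =>
  Bool.noConfusion (hC.polarity_unique (mem_signedVars.1 h) (mem_signedVars.1 h'))

/-- The positive set obtained by replacing the negative variables. -/
def fillSet (C : SatClause V) (R : Finset V) (r : V) : Finset V := signedVars true C ∪ insert r R

open scoped Classical in
/-- The variable exchanged for `i`. -/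
noncomputable def pivot (Y C : Finset (V × Bool)) (r i : V) : V :=
  if (Y ∩ constLits false ((signedVars false C).erase i)).Nonempty then r
  else if h : ∃ v, (v, true) ∈ Y then h.choose else r

/-- The fill set with its pivot exchanged for `i`. -/
noncomputable def exchangeSet (Y C : Finset (V × Bool)) (R : Finset V) (r i : V) : Finset V :=
  insert i ((fillSet C R r).erase (pivot Y C r i))

/-- The `k`-sets which cannot all be positive clauses. -/
noncomputable def hyperedge (e : (Finset (V × Bool) × SatClause V) × (Finset V × V)) :
    Finset (Finset V) :=
  insert (fillSet e.1.2 e.2.1 e.2.2)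
    ((signedVars false e.1.2).image (exchangeSet e.1.1 e.1.2 e.2.1 e.2.2))

/-- The valid ways of replacing `s` negative variables. -/
def hyperIndex (𝒟 : Finset (Finset (V × Bool) × SatClause V)) (s : ℕ) :
    Finset ((Finset (V × Bool) × SatClause V) × (Finset V × V)) :=
  (𝒟 ×ˢ (univ.powersetCard (s - 1) ×ˢ univ)).filter (fun e =>
    Disjoint e.2.1 (clauseVars e.1.2) ∧ e.2.2 ∉ clauseVars e.1.2 ∧ e.2.2 ∉ e.2.1)

/-- Pairs of a set of literals and a clause suitable for building hyperedges. -/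
structure GoodPairs (k s q : ℕ) (M : SatFormula V)
    (𝒟 : Finset (Finset (V × Bool) × SatClause V)) : Prop where
  mem : ∀ p ∈ 𝒟, p.2 ∈ M
  isK : ∀ p ∈ 𝒟, IsKClause k p.2
  sub : ∀ p ∈ 𝒟, p.1 ⊆ p.2
  light : ∀ p ∈ 𝒟, IsLight q M p.1 p.2
  nonempty : ∀ p ∈ 𝒟, p.1.Nonempty
  ne_single : ∀ p ∈ 𝒟, ∀ v, p.1 ≠ {(v, false)}
  card_neg : ∀ p ∈ 𝒟, (signedVars false p.2).card = s

variable {s q : ℕ} {M : SatFormula V} {𝒟 : Finset (Finset (V × Bool) × SatClause V)}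

theorem mem_hyperIndex {Y : Finset (V × Bool)} {C : SatClause V} {R : Finset V} {r : V} :
    ((Y, C), (R, r)) ∈ hyperIndex 𝒟 s ↔ (Y, C) ∈ 𝒟 ∧ R.card = s - 1 ∧
      Disjoint R (clauseVars C) ∧ r ∉ clauseVars C ∧ r ∉ R := by
  simp only [hyperIndex, mem_filter, mem_product, mem_powersetCard, subset_univ, true_and, mem_univ,
    and_true, and_assoc]

theorem pivot_spec (h𝒟 : GoodPairs k s q M 𝒟) {Y : Finset (V × Bool)} {C : SatClause V}
    (hp : (Y, C) ∈ 𝒟) (r : V) {i : V} (_hi : i ∈ signedVars false C) :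
    ((Y ∩ constLits false ((signedVars false C).erase i)).Nonempty ∧ pivot Y C r i = r) ∨
      ((pivot Y C r i, true) ∈ Y ∧ pivot Y C r i ∈ signedVars true C) := by
  by_cases h : (Y ∩ constLits false ((signedVars false C).erase i)).Nonempty
  · exact Or.inl ⟨h, by rw [pivot, if_pos h]⟩
  · right
    have hex : ∃ v, (v, true) ∈ Y := by
      by_contra hno
      push Not at hno
      refine h𝒟.ne_single _ hp i ?_
      have hsub : Y ⊆ {(i, false)} := by
        rintro ⟨v, b⟩ hv
        cases b
        · by_contra hne
          rw [mem_singleton, Prod.mk.injEq] at hne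
          refine h ⟨(v, false), mem_inter.2 ⟨hv, mem_constLits.2 ⟨mem_erase.2
            ⟨fun h => hne ⟨h, rfl⟩, mem_signedVars.2 (h𝒟.sub _ hp hv)⟩, rfl⟩⟩⟩
        · exact absurd hv (hno v)
      exact ((subset_singleton_iff.1 hsub).resolve_left (h𝒟.nonempty _ hp).ne_empty)
    have : (pivot Y C r i, true) ∈ Y := by
      rw [pivot, if_neg h, dif_pos hex]; exact hex.choose_spec
    exact ⟨this, mem_signedVars.2 (h𝒟.sub _ hp this)⟩

theorem card_fillSet (hs : 1 ≤ s) (h𝒟 : GoodPairs k s q M 𝒟) {Y : Finset (V × Bool)}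
    {C : SatClause V} {R : Finset V} {r : V} (h : ((Y, C), (R, r)) ∈ hyperIndex 𝒟 s) :
    (fillSet C R r).card = k := by
  obtain ⟨hp, hR, hd, hr, hrR⟩ := mem_hyperIndex.1 h
  rw [fillSet, card_union_of_disjoint, card_insert_of_notMem hrR, hR]
  · have := card_signedVars_add (h𝒟.isK _ hp)
    have := h𝒟.card_neg _ hp
    simp only at *
    omega
  · refine disjoint_insert_right.2 ⟨fun h => hr (signedVars_subset _ _ h), ?_⟩
    exact (hd.mono_right (signedVars_subset _ _)).symm

theorem notMem_fillSet (h𝒟 : GoodPairs k s q M 𝒟) {Y : Finset (V × Bool)}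
    {C : SatClause V} {R : Finset V} {r : V} (h : ((Y, C), (R, r)) ∈ hyperIndex 𝒟 s) {i : V}
    (hi : i ∈ signedVars false C) : i ∉ fillSet C R r := by
  obtain ⟨hp, hR, hd, hr, hrR⟩ := mem_hyperIndex.1 h
  have hiC := signedVars_subset _ _ hi
  rw [fillSet, mem_union, mem_insert]
  rintro (h | rfl | h)
  · exact disjoint_left.1 (disjoint_signedVars (h𝒟.isK _ hp)) h hi
  · exact hr hiC
  · exact disjoint_left.1 hd h hiC

theorem pivot_mem_fillSet (h𝒟 : GoodPairs k s q M 𝒟) {Y : Finset (V × Bool)}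
    {C : SatClause V} (hp : (Y, C) ∈ 𝒟) (R : Finset V) (r : V) {i : V}
    (hi : i ∈ signedVars false C) : pivot Y C r i ∈ fillSet C R r := by
  rw [fillSet, mem_union]
  rcases pivot_spec h𝒟 hp r hi with ⟨-, h⟩ | ⟨-, h⟩
  · rw [h]; exact Or.inr (mem_insert_self _ _)
  · exact Or.inl h

theorem card_exchangeSet (hs : 1 ≤ s) (h𝒟 : GoodPairs k s q M 𝒟) {Y : Finset (V × Bool)}
    {C : SatClause V} {R : Finset V} {r : V} (h : ((Y, C), (R, r)) ∈ hyperIndex 𝒟 s) {i : V}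
    (hi : i ∈ signedVars false C) : (exchangeSet Y C R r i).card = k := by
  have hm := pivot_mem_fillSet h𝒟 (mem_hyperIndex.1 h).1 R r hi
  rw [exchangeSet, card_insert_of_notMem fun hh => notMem_fillSet h𝒟 h hi (mem_of_mem_erase hh),
    card_erase_of_mem hm, card_fillSet hs h𝒟 h]
  have : 0 < (fillSet C R r).card := card_pos.2 ⟨_, hm⟩
  rw [card_fillSet hs h𝒟 h] at this
  omega

theorem hyperedge_subset (hs : 1 ≤ s) (h𝒟 : GoodPairs k s q M 𝒟) :
    ∀ e ∈ hyperIndex 𝒟 s, hyperedge e ⊆ univ.powersetCard k := by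
  rintro ⟨⟨Y, C⟩, R, r⟩ he Q hQ
  refine mem_powersetCard.2 ⟨subset_univ _, ?_⟩
  rcases mem_insert.1 hQ with rfl | hQ
  · exact card_fillSet hs h𝒟 he
  · obtain ⟨i, hi, rfl⟩ := mem_image.1 hQ
    exact card_exchangeSet hs h𝒟 he hi

theorem card_hyperedge_le (h𝒟 : GoodPairs k s q M 𝒟) (hsk : s ≤ k) :
    ∀ e ∈ hyperIndex 𝒟 s, (hyperedge e).card ≤ k + 1 := by
  rintro ⟨⟨Y, C⟩, R, r⟩ he
  refine (card_insert_le _ _).trans (Nat.add_le_add_right (card_image_le.trans ?_) 1)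
  have := h𝒟.card_neg _ (mem_hyperIndex.1 he).1
  simp only at this ⊢
  omega

theorem not_hyperedge_subset (hs : 1 ≤ s) {G : SatFormula V} (hG : MinimalFormula G)
    (h𝒟 : GoodPairs k s q (negClauses G) 𝒟) :
    ∀ e ∈ hyperIndex 𝒟 s, ¬ hyperedge e ⊆ posSets k G := by
  rintro ⟨⟨Y, C⟩, R, r⟩ he hsub
  obtain ⟨hp, hR, hd, hr, hrR⟩ := mem_hyperIndex.1 he
  have hCG : C ∈ G := filter_subset _ _ (h𝒟.mem _ hp)
  have hS := (mem_posSets.1 (hsub (mem_insert_self _ _))).2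
  obtain ⟨w, hw, hw'⟩ := hG _ hS
  have hw1 : ∀ v ∈ fillSet C R r, w v = true := satisfies_signedClause.1 hw
  have hne : (signedVars false C).Nonempty := card_pos.1 (by rw [h𝒟.card_neg _ hp]; exact hs)
  obtain ⟨i₀, hi₀⟩ := hne
  have hex : ∃ i ∈ signedVars false C, w i = true := by
    by_contra hno
    push Not at hno
    have hsat : SatisfiesClause w C := by
      rintro ⟨v, b⟩ hv
      cases b
      · have := hno v (mem_signedVars.2 hv)
        simpa using this
      · exact hw1 v (mem_union_left _ (mem_signedVars.2 hv))
    have := hw' C hCG hsat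
    have hi := mem_signedVars.1 hi₀
    rw [this] at hi
    exact Bool.noConfusion (mem_signedClause.1 hi).2
  obtain ⟨i, hi, hwi⟩ := hex
  have hT := (mem_posSets.1 (hsub (mem_insert_of_mem (mem_image_of_mem _ hi)))).2
  have := hw' _ hT (satisfies_signedClause.2 fun v hv => by
    rcases mem_insert.1 hv with rfl | hv
    · exact hwi
    · exact hw1 v (mem_of_mem_erase hv))
  have h2 := congrArg clauseVars this
  rw [clauseVars_signedClause, clauseVars_signedClause] at h2
  refine notMem_fillSet h𝒟 he hi ?_
  simp only at h2
  rw [← h2]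
  exact mem_insert_self _ _

theorem mul_pow_le_card_hyperIndex (hs : 1 ≤ s) (hsk : s ≤ k) (h𝒟 : GoodPairs k s q M 𝒟)
    (hn : 4 * k ≤ Fintype.card V) :
    𝒟.card * Fintype.card V ^ s ≤ 2 ^ k * k.factorial * (hyperIndex 𝒟 s).card := by
  set n := Fintype.card V with hndef
  set c := (n - k).choose (s - 1) * (n - k - (s - 1)) with hc
  have h1 : c * 𝒟.card ≤ (hyperIndex 𝒟 s).card := by
    refine mul_card_image_le_card_of_maps_to (f := Prod.fst)
      (fun e he => (mem_product.1 (mem_filter.1 he).1).1) c ?_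
    rintro ⟨Y, C⟩ hp
    have hU : ((clauseVars C)ᶜ).card = n - k := by
      rw [card_compl, (h𝒟.isK _ hp).2]
    set 𝒯 := (((clauseVars C)ᶜ).powersetCard (s - 1)).sigma
      (fun R => (clauseVars C)ᶜ \ R) with h𝒯
    have hT : 𝒯.card = c := by
      rw [h𝒯, card_sigma, sum_congr rfl (g := fun _ => n - k - (s - 1)), sum_const,
        card_powersetCard, hU, smul_eq_mul]
      intro R hR
      obtain ⟨h1, h2⟩ := mem_powersetCard.1 hR
      rw [card_sdiff_of_subset h1, hU, h2]
    rw [← hT]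
    refine card_le_card_of_injOn (fun x => ((Y, C), (x.1, x.2))) ?_ ?_
    · rintro ⟨R, r⟩ hx
      obtain ⟨hR, hr⟩ := mem_sigma.1 hx
      obtain ⟨h1, h2⟩ := mem_powersetCard.1 hR
      obtain ⟨h3, h4⟩ := mem_sdiff.1 hr
      refine mem_coe.2 (mem_filter.2 ⟨mem_hyperIndex.2 ⟨hp, h2, ?_, mem_compl.1 h3, h4⟩, rfl⟩)
      exact disjoint_left.2 fun v hv => mem_compl.1 (h1 hv)
    · rintro ⟨R, r⟩ - ⟨R', r'⟩ - h
      simp only [Prod.mk.injEq, true_and] at h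
      obtain ⟨rfl, rfl⟩ := h
      rfl
  have h2 : n ^ s ≤ 2 ^ k * k.factorial * c := by
    have h3 : (n - k + 1 - (s - 1)) ^ (s - 1) ≤ (s - 1).factorial * (n - k).choose (s - 1) := by
      rw [← Nat.descFactorial_eq_factorial_mul_choose]; exact Nat.pow_sub_le_descFactorial _ _
    have h4 : n ≤ 2 * (n - k - (s - 1)) := by omega
    calc n ^ s = n ^ (s - 1) * n := by rw [← pow_succ]; congr 1; omega
      _ ≤ (2 * (n - k + 1 - (s - 1))) ^ (s - 1) * (2 * (n - k - (s - 1))) :=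
          Nat.mul_le_mul (Nat.pow_le_pow_left (by omega) _) h4
      _ = 2 ^ (s - 1 + 1) * ((n - k + 1 - (s - 1)) ^ (s - 1) * (n - k - (s - 1))) := by
          rw [mul_pow]; ring
      _ ≤ 2 ^ k * ((s - 1).factorial * (n - k).choose (s - 1) * (n - k - (s - 1))) :=
          Nat.mul_le_mul (Nat.pow_le_pow_right two_pos (by omega)) (Nat.mul_le_mul_right _ h3)
      _ = 2 ^ k * (s - 1).factorial * c := by rw [hc]; ring
      _ ≤ _ := Nat.mul_le_mul_right _ (Nat.mul_le_mul_left _ (Nat.factorial_le (by omega)))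
  calc 𝒟.card * n ^ s ≤ 𝒟.card * (2 ^ k * k.factorial * c) := Nat.mul_le_mul_left _ h2
    _ = 2 ^ k * k.factorial * (c * 𝒟.card) := by ring
    _ ≤ _ := Nat.mul_le_mul_left _ h1

end

section

variable {V : Type*} [Fintype V] [DecidableEq V] {k : ℕ}
variable {s q : ℕ} {M : SatFormula V} {𝒟 : Finset (Finset (V × Bool) × SatClause V)}

theorem card_index_mul_le (h𝒟 : GoodPairs k s q M 𝒟)
    {T : Finset ((Finset (V × Bool) × SatClause V) × (Finset V × V))} (P : Finset (Finset V × V))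
    (N : ℕ) (hT : ∀ e ∈ T, e.1 ∈ 𝒟 ∧ e.2 ∈ P)
    (hN : ∀ p ∈ P, ((T.filter (fun e => e.2 = p)).image (fun e => e.1.2)).card * q ≤ N) :
    T.card * q ≤ 2 ^ k * N * P.card := by
  rw [card_eq_sum_card_fiberwise (f := Prod.snd) (t := P) fun e he => (hT e he).2, sum_mul,
    mul_comm _ P.card, ← smul_eq_mul P.card]
  refine sum_le_card_nsmul _ _ _ fun p hp => ?_
  have h1 : (T.filter (fun e => e.2 = p)).card ≤
      2 ^ k * ((T.filter (fun e => e.2 = p)).image (fun e => e.1.2)).card := by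
    refine card_le_mul_card_image _ _ fun C hC => ?_
    obtain ⟨e₀, he₀, rfl⟩ := mem_image.1 hC
    have hk : e₀.1.2.card = k := (h𝒟.isK _ (hT e₀ (mem_filter.1 he₀).1).1).1
    rw [← hk, ← card_powerset]
    refine card_le_card_of_injOn (fun e => e.1.1) ?_ ?_
    · intro e he
      obtain ⟨he1, he2⟩ := mem_filter.1 he
      have := h𝒟.sub _ (hT e (mem_filter.1 he1).1).1
      rw [he2] at this
      exact mem_powerset.2 this
    · rintro ⟨⟨Y, C⟩, p₁⟩ he ⟨⟨Y', C'⟩, p₂⟩ he' h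
      obtain ⟨he1, he2⟩ := mem_filter.1 he
      obtain ⟨he1', he2'⟩ := mem_filter.1 he'
      have h3 := (mem_filter.1 he1).2
      have h3' := (mem_filter.1 he1').2
      simp only at h h3 h3' he2 he2'
      rw [h, h3, h3', he2, he2']
  calc _ ≤ 2 ^ k * ((T.filter (fun e => e.2 = p)).image (fun e => e.1.2)).card * q :=
        Nat.mul_le_mul_right _ h1
    _ ≤ _ := by rw [mul_assoc]; exact Nat.mul_le_mul_left _ (hN p hp)

theorem card_image_mul_le_of_light {T : Finset ((Finset (V × Bool) × SatClause V) × (Finset V × V))}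
    (h𝒟 : GoodPairs k s q M 𝒟) (hT : ∀ e ∈ T, e.1 ∈ 𝒟) (Z : Finset (V × Bool)) (j : ℕ)
    (hZ : ∀ e ∈ T, ∃ W ⊆ e.1.2, (W ∩ e.1.1).Nonempty ∧ W.card = j ∧ e.1.2 \ W = Z) :
    (T.image (fun e => e.1.2)).card * q ≤ Fintype.card V ^ j := by
  rcases T.eq_empty_or_nonempty with rfl | ⟨e₀, he₀⟩
  · simp
  obtain ⟨W, hW, hne, hc, hWZ⟩ := hZ e₀ he₀
  have := h𝒟.light _ (hT e₀ he₀) W hW hne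
  rw [hc, hWZ] at this
  refine le_trans (Nat.mul_le_mul_right _ (card_le_card (image_subset_iff.2 fun e he => ?_))) this
  obtain ⟨W', -, -, -, hW'⟩ := hZ e he
  exact mem_filter.2 ⟨h𝒟.mem _ (hT e he), hW' ▸ sdiff_subset⟩

theorem card_fillSet_eq_mul_le {a : ℕ} (hs : 1 ≤ s) (h𝒟 : GoodPairs k s q M 𝒟)
    (hM : SparseNegativeExtensions a M) (ha : a * q ≤ Fintype.card V) (hq : q ≤ Fintype.card V)
    {Q : Finset V} (hQ : Q.card = k) :
    ((hyperIndex 𝒟 s).filter (fun e => fillSet e.1.2 e.2.1 e.2.2 = Q)).card * q ≤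
      2 ^ k * (2 * Fintype.card V ^ s) * (2 ^ k * k) := by
  have hmem : ∀ {Y : Finset (V × Bool)} {C : SatClause V} {R : Finset V} {r : V},
      ((Y, C), (R, r)) ∈ (hyperIndex 𝒟 s).filter (fun e => fillSet e.1.2 e.2.1 e.2.2 = Q) →
        ((Y, C), (R, r)) ∈ hyperIndex 𝒟 s ∧ fillSet C R r = Q := fun h => mem_filter.1 h
  refine (card_index_mul_le h𝒟 (Q.powerset ×ˢ Q) (2 * Fintype.card V ^ s) ?_ ?_).trans
    (by rw [card_product, card_powerset, hQ])
  · rintro ⟨⟨Y, C⟩, R, r⟩ he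
    obtain ⟨heI, rfl⟩ := hmem he
    exact ⟨(mem_hyperIndex.1 heI).1, mem_product.2 ⟨mem_powerset.2
      ((subset_insert _ _).trans subset_union_right), mem_union_right _ (mem_insert_self _ _)⟩⟩
  · rintro ⟨R, r⟩ -
    have hle := hM (constLits true (Q \ insert r R)) s hs
    refine le_trans (Nat.mul_le_mul_right _ (le_trans (card_le_card ?_) hle)) ?_
    · intro C hC
      obtain ⟨⟨⟨Y, C'⟩, R', r'⟩, he, h⟩ := mem_image.1 hC
      obtain ⟨hf, h'⟩ := mem_filter.1 he
      simp only [Prod.mk.injEq] at h h'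
      obtain ⟨rfl, rfl⟩ := h'
      obtain ⟨heI, hQ⟩ := hmem hf
      subst h
      obtain ⟨hp, hR, hd, hr, hrR⟩ := mem_hyperIndex.1 heI
      have hJ : Q \ insert r' R' = signedVars true C' := by
        rw [← hQ, fillSet, union_sdiff_right, sdiff_eq_self_of_disjoint]
        exact disjoint_insert_right.2 ⟨fun h => hr (signedVars_subset _ _ h),
          (hd.mono_right (signedVars_subset _ _)).symm⟩
      have hCZ : C' \ constLits true (signedVars true C') =
          constLits false (signedVars false C') := by
        ext ⟨v, b⟩
        simp only [mem_sdiff, mem_constLits, mem_signedVars]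
        cases b <;> grind
      rw [hJ]
      refine mem_filter.2 ⟨h𝒟.mem _ hp, ?_, ?_, ?_⟩
      · conv_rhs => rw [eq_union_constLits C']
        exact subset_union_left
      · rw [hCZ, card_constLits]; exact h𝒟.card_neg _ hp
      · rw [hCZ]
        rintro ⟨v, b⟩ hv
        exact (mem_constLits.1 hv).2
    · have h1 : Fintype.card V ^ s = Fintype.card V * Fintype.card V ^ (s - 1) := by
        rw [← pow_succ']; congr 1; omega
      rcases Nat.eq_zero_or_pos (Fintype.card V) with h0 | hpos
      · have : q = 0 := by omega
        rw [this]; simp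
      have h2 : 1 ≤ Fintype.card V ^ (s - 1) := Nat.one_le_pow _ _ hpos
      rw [h1]
      calc (1 + a * Fintype.card V ^ (s - 1)) * q
          = q * 1 + (a * q) * Fintype.card V ^ (s - 1) := by ring
        _ ≤ Fintype.card V * Fintype.card V ^ (s - 1) +
            Fintype.card V * Fintype.card V ^ (s - 1) := by gcongr
        _ = _ := by ring

theorem card_exchangeSet_eq_mul_le (hs : 1 ≤ s) (hk : 1 ≤ k) (h𝒟 : GoodPairs k s q M 𝒟)
    {Q : Finset V} (hQ : Q.card = k) (i : V) :
    ((hyperIndex 𝒟 s).filter (fun e => i ∈ signedVars false e.1.2 ∧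
      exchangeSet e.1.1 e.1.2 e.2.1 e.2.2 i = Q)).card * q ≤
      2 ^ k * Fintype.card V ^ s * (2 ^ k * (2 * k)) := by
  set n := Fintype.card V with hn
  set A := (hyperIndex 𝒟 s).filter (fun e => i ∈ signedVars false e.1.2 ∧
      exchangeSet e.1.1 e.1.2 e.2.1 e.2.2 i = Q) with hA
  have hmem : ∀ {Y : Finset (V × Bool)} {C : SatClause V} {R : Finset V} {r : V},
      ((Y, C), (R, r)) ∈ A → ((Y, C), (R, r)) ∈ hyperIndex 𝒟 s ∧ i ∈ signedVars false C ∧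
        exchangeSet Y C R r i = Q := fun h => mem_filter.1 h
  set A₁ := A.filter (fun e => (e.1.1 ∩ constLits false ((signedVars false e.1.2).erase i)).Nonempty ∧
    pivot e.1.1 e.1.2 e.2.2 i = e.2.2) with hA₁
  set A₂ := A.filter (fun e => (pivot e.1.1 e.1.2 e.2.2 i, true) ∈ e.1.1 ∧
    pivot e.1.1 e.1.2 e.2.2 i ∈ signedVars true e.1.2) with hA₂
  have hcov : A ⊆ A₁ ∪ A₂ := by
    rintro ⟨⟨Y, C⟩, R, r⟩ he
    obtain ⟨h1, h2, -⟩ := hmem he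
    rcases pivot_spec h𝒟 (mem_hyperIndex.1 h1).1 r h2 with h | h
    · exact mem_union_left _ (mem_filter.2 ⟨he, h⟩)
    · exact mem_union_right _ (mem_filter.2 ⟨he, h⟩)
  have h1 : A₁.card * q ≤ 2 ^ k * n ^ (s - 1) * (2 ^ k * n) := by
    refine (card_index_mul_le h𝒟 (Q.powerset ×ˢ univ) (n ^ (s - 1)) ?_ ?_).trans
      (by rw [card_product, card_powerset, hQ, card_univ])
    · rintro ⟨⟨Y, C⟩, R, r⟩ he
      obtain ⟨he, hne, hpv⟩ := mem_filter.1 he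
      obtain ⟨hi, hiC, rfl⟩ := hmem he
      obtain ⟨hp, hR, hd, hr, hrR⟩ := mem_hyperIndex.1 hi
      simp only at hpv
      refine ⟨hp, mem_product.2 ⟨mem_powerset.2 fun v hv => ?_, mem_univ _⟩⟩
      simp only [exchangeSet, fillSet, hpv, mem_insert, mem_erase, mem_union]
      exact Or.inr ⟨fun h => hrR (h ▸ hv), Or.inr (Or.inr hv)⟩
    · rintro ⟨R, r⟩ -
      refine card_image_mul_le_of_light h𝒟 (fun e he => ?_)
        (insert (i, false) (constLits true (Q \ insert i R))) (s - 1) ?_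
      · have := (mem_filter.1 (mem_filter.1 (mem_filter.1 he).1).1).1
        exact (mem_hyperIndex.1 this).1
      · rintro ⟨⟨Y, C⟩, R', r'⟩ he
        obtain ⟨hf, h⟩ := mem_filter.1 he
        simp only [Prod.mk.injEq] at h
        obtain ⟨rfl, rfl⟩ := h
        obtain ⟨heA, hne, hpv⟩ := mem_filter.1 hf
        obtain ⟨hi, hiC, rfl⟩ := hmem heA
        obtain ⟨hp, hR, hd, hr, hrR⟩ := mem_hyperIndex.1 hi
        simp only at hpv hne
        have hK := h𝒟.isK _ hp
        have hiJ : i ∉ signedVars true C := fun h =>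
          disjoint_left.1 (disjoint_signedVars hK) h hiC
        have hJR : ∀ v ∈ signedVars true C, v ∉ R' := fun v hv hvR =>
          disjoint_left.1 hd hvR (signedVars_subset _ _ hv)
        have hJr : ∀ v ∈ signedVars true C, v ≠ r' := fun v hv h =>
          hr (h ▸ signedVars_subset _ _ hv)
        have hJ : exchangeSet Y C R' r' i \ insert i R' = signedVars true C := by
          ext v
          simp only [exchangeSet, fillSet, hpv, mem_insert, mem_erase, mem_union, mem_sdiff]
          grind
        refine ⟨constLits false ((signedVars false C).erase i), ?_, ?_, ?_, ?_⟩
        · rintro ⟨v, b⟩ hv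
          obtain ⟨h1, rfl⟩ := mem_constLits.1 hv
          exact mem_signedVars.1 (mem_of_mem_erase h1)
        · rwa [inter_comm]
        · rw [card_constLits, card_erase_of_mem hiC, h𝒟.card_neg _ hp]
        · rw [hJ]
          ext ⟨v, b⟩
          simp only [mem_sdiff, mem_constLits, mem_erase, mem_insert, Prod.mk.injEq, mem_signedVars]
          have := mem_signedVars.1 hiC
          cases b <;> grind
  have h2 : A₂.card * q ≤ 2 ^ k * n ^ s * (2 ^ k * k) := by
    refine (card_index_mul_le h𝒟 (Q.powerset ×ˢ Q) (n ^ s) ?_ ?_).trans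
      (by rw [card_product, card_powerset, hQ])
    · rintro ⟨⟨Y, C⟩, R, r⟩ he
      obtain ⟨he, hne, hpv⟩ := mem_filter.1 he
      obtain ⟨hi, hiC, rfl⟩ := hmem he
      obtain ⟨hp, hR, hd, hr, hrR⟩ := mem_hyperIndex.1 hi
      simp only at hpv
      have hbC := signedVars_subset _ _ hpv
      refine ⟨hp, mem_product.2 ⟨mem_powerset.2 fun v hv => ?_, ?_⟩⟩
      · simp only [exchangeSet, fillSet, mem_insert, mem_erase, mem_union]
        exact Or.inr ⟨fun h => disjoint_left.1 hd hv (h ▸ hbC), Or.inr (Or.inr hv)⟩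
      · simp only [exchangeSet, fillSet, mem_insert, mem_erase, mem_union]
        exact Or.inr ⟨fun h => hr (h ▸ hbC), Or.inr (Or.inl trivial)⟩
    · rintro ⟨R, r⟩ -
      refine card_image_mul_le_of_light h𝒟 (fun e he => ?_)
        (insert (i, false) (constLits true (Q \ insert i (insert r R)))) s ?_
      · have := (mem_filter.1 (mem_filter.1 (mem_filter.1 he).1).1).1
        exact (mem_hyperIndex.1 this).1
      · rintro ⟨⟨Y, C⟩, R', r'⟩ he
        obtain ⟨hf, h⟩ := mem_filter.1 he
        simp only [Prod.mk.injEq] at h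
        obtain ⟨rfl, rfl⟩ := h
        obtain ⟨heA, hbY, hpv⟩ := mem_filter.1 hf
        obtain ⟨hi, hiC, rfl⟩ := hmem heA
        obtain ⟨hp, hR, hd, hr, hrR⟩ := mem_hyperIndex.1 hi
        simp only at hpv hbY
        simp only [exchangeSet]
        set b := pivot Y C r' i with hb
        have hK := h𝒟.isK _ hp
        have hiJ : i ∉ signedVars true C := fun h =>
          disjoint_left.1 (disjoint_signedVars hK) h hiC
        have hJR : ∀ v ∈ signedVars true C, v ∉ R' := fun v hv hvR =>
          disjoint_left.1 hd hvR (signedVars_subset _ _ hv)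
        have hJr : ∀ v ∈ signedVars true C, v ≠ r' := fun v hv h =>
          hr (h ▸ signedVars_subset _ _ hv)
        have hJ : insert i ((fillSet C R' r').erase b) \ insert i (insert r' R') =
            (signedVars true C).erase b := by
          ext v
          simp only [fillSet, mem_insert, mem_erase, mem_union, mem_sdiff]
          grind
        refine ⟨insert (b, true) (constLits false ((signedVars false C).erase i)), ?_, ?_, ?_, ?_⟩
        · refine insert_subset (h𝒟.sub _ hp hbY) ?_
          rintro ⟨v, b⟩ hv
          obtain ⟨h1, rfl⟩ := mem_constLits.1 hv
          exact mem_signedVars.1 (mem_of_mem_erase h1)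
        · exact ⟨_, mem_inter.2 ⟨mem_insert_self _ _, hbY⟩⟩
        · rw [card_insert_of_notMem, card_constLits, card_erase_of_mem hiC, h𝒟.card_neg _ hp]
          · omega
          · intro h
            exact Bool.noConfusion (mem_constLits.1 h).2
        · rw [hJ]
          ext ⟨v, c⟩
          simp only [mem_sdiff, mem_constLits, mem_erase, mem_insert, Prod.mk.injEq, mem_signedVars]
          have := mem_signedVars.1 hiC
          cases c <;> grind
  have h3 : n ^ s = n * n ^ (s - 1) := by rw [← pow_succ']; congr 1; omega
  calc A.card * q ≤ (A₁.card + A₂.card) * q :=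
        Nat.mul_le_mul_right _ ((card_le_card hcov).trans (card_union_le _ _))
    _ ≤ 2 ^ k * n ^ (s - 1) * (2 ^ k * n) + 2 ^ k * n ^ s * (2 ^ k * k) := by
        rw [add_mul]; exact add_le_add h1 h2
    _ = 2 ^ k * n ^ s * (2 ^ k * (1 + k)) := by rw [h3]; ring
    _ ≤ _ := by gcongr; omega

theorem card_hyperedge_mem_mul_le {a : ℕ} (hs : 1 ≤ s) (hk : 1 ≤ k) (h𝒟 : GoodPairs k s q M 𝒟)
    (hM : SparseNegativeExtensions a M) (ha : a * q ≤ Fintype.card V) (hq : q ≤ Fintype.card V)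
    (Q : Finset V) :
    ((hyperIndex 𝒟 s).filter (fun e => Q ∈ hyperedge e)).card * q ≤
      4 * k ^ 2 * 4 ^ k * Fintype.card V ^ s := by
  set n := Fintype.card V with hn
  by_cases hQ : Q.card = k
  swap
  · rw [filter_false_of_mem, card_empty, zero_mul]
    · exact Nat.zero_le _
    · intro e he hQe
      exact hQ (mem_powersetCard.1 (hyperedge_subset hs h𝒟 e he hQe)).2
  have hcov : (hyperIndex 𝒟 s).filter (fun e => Q ∈ hyperedge e) ⊆
      ((hyperIndex 𝒟 s).filter (fun e => fillSet e.1.2 e.2.1 e.2.2 = Q)) ∪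
      Q.biUnion (fun i => (hyperIndex 𝒟 s).filter (fun e => i ∈ signedVars false e.1.2 ∧
      exchangeSet e.1.1 e.1.2 e.2.1 e.2.2 i = Q)) := by
    intro e he
    obtain ⟨heI, hQe⟩ := mem_filter.1 he
    rcases mem_insert.1 hQe with rfl | hQe
    · exact mem_union_left _ (mem_filter.2 ⟨heI, rfl⟩)
    · obtain ⟨i, hi, rfl⟩ := mem_image.1 hQe
      exact mem_union_right _ (mem_biUnion.2 ⟨i, mem_insert_self _ _, mem_filter.2 ⟨heI, hi, rfl⟩⟩)
  calc _ ≤ (((hyperIndex 𝒟 s).filter (fun e => fillSet e.1.2 e.2.1 e.2.2 = Q)).card +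
        ∑ i ∈ Q, ((hyperIndex 𝒟 s).filter (fun e => i ∈ signedVars false e.1.2 ∧
          exchangeSet e.1.1 e.1.2 e.2.1 e.2.2 i = Q)).card) * q :=
        Nat.mul_le_mul_right _ ((card_le_card hcov).trans ((card_union_le _ _).trans
          (Nat.add_le_add_left card_biUnion_le _)))
    _ ≤ 2 ^ k * (2 * n ^ s) * (2 ^ k * k) + k * (2 ^ k * n ^ s * (2 ^ k * (2 * k))) := by
        rw [add_mul, sum_mul]
        refine add_le_add (card_fillSet_eq_mul_le hs h𝒟 hM ha hq hQ) ?_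
        refine (sum_le_card_nsmul _ _ _ fun i _ =>
          card_exchangeSet_eq_mul_le hs hk h𝒟 hQ i).trans (le_of_eq ?_)
        rw [hQ, smul_eq_mul]
    _ = (2 * k + 2 * k ^ 2) * 4 ^ k * n ^ s := by
        rw [show (4 : ℕ) = 2 * 2 from rfl, mul_pow]; ring
    _ ≤ _ := by gcongr; nlinarith

end

section

variable {V : Type*} [Fintype V] [DecidableEq V] {k : ℕ}

open scoped Classical in
/-- The families of positive sets compatible with the non-monotone clauses `M`. -/
noncomputable def compatiblePosSets (k : ℕ) (M : SatFormula V) : Finset (Finset (Finset V)) :=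
  (univ.powersetCard k).powerset.filter (fun 𝒮 => ∃ G, MinimalFormula G ∧ negClauses G = M ∧
    posSets k G = 𝒮)

theorem exists_goodPairs {t : ℕ} {M : SatFormula V} (hM : M ⊆ kClauses k V)
    (hneg : ∀ C ∈ M, (signedVars false C).Nonempty) (hk : 1 ≤ k)
    (ht : 4 ^ k * (2 * (2 ^ k * (k + 1))) ≤ t) (hn : 0 < Fintype.card V)
    (h0 : ¬ IsBadSet k t M ∅) (h1 : ∀ v, ¬ IsBadSet k t M {(v, false)}) :
    ∃ j ≤ k, ∃ s, 1 ≤ s ∧ s ≤ k ∧ ∃ 𝒟, GoodPairs k s (t ^ (degExp j + 2)) M 𝒟 ∧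
      badWeight k t M ≤ 2 * k * 𝒟.card * t ^ degExp j := by
  classical
  obtain ⟨i, hi, hX⟩ := exists_mem_eq_sup (range (k + 1)) ⟨0, by simp⟩
    (fun i => (minBadSets k t M i).card * Fintype.card V ^ (k - i))
  have hik : i ≤ k := Nat.lt_succ_iff.1 (mem_range.1 hi)
  set q := t ^ (degExp (k - i) + 2) with hq
  set 𝒟₀ := (minBadSets k t M i ×ˢ M).filter (fun p => p.1 ⊆ p.2 ∧ IsLight q M p.1 p.2) with h𝒟₀
  have hcard : badWeight k t M ≤ 2 * 𝒟₀.card * t ^ degExp (k - i) := by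
    rw [badWeight, hX]
    have e1 : 𝒟₀.card = ∑ Y ∈ minBadSets k t M i,
        (M.filter (fun C => Y ⊆ C ∧ IsLight q M Y C)).card := by
      rw [h𝒟₀, card_filter, sum_product]
      exact sum_congr rfl fun Y _ => (card_filter _ _).symm
    rw [e1, mul_sum, sum_mul, ← smul_eq_mul (minBadSets k t M i).card]
    refine card_nsmul_le_sum _ _ _ fun Y hY => ?_
    obtain ⟨hYi, hYm⟩ := mem_minBadSets.1 hY
    have h2 := card_not_isLight_le hM ht hn (hYi ▸ hik) hYm
    rw [hYi, ← hq] at h2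
    have h3 : (M.filter (fun C => Y ⊆ C ∧ IsLight q M Y C)).card +
        (M.filter (fun C => Y ⊆ C ∧ ¬ IsLight q M Y C)).card = litDeg M Y := by
      rw [litDeg, ← filter_filter, ← filter_filter]
      exact card_filter_add_card_filter_not _
    have h4 := hYm.1
    rw [IsBadSet, hYi] at h4
    exact h4.trans (Nat.mul_le_mul_right _ (by omega))
  have hmap : ∀ p ∈ 𝒟₀, (signedVars false p.2).card ∈ Icc 1 k := by
    intro p hp
    have hpM := (mem_product.1 (mem_filter.1 hp).1).2
    refine mem_Icc.2 ⟨card_pos.2 (hneg _ hpM), ?_⟩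
    have := card_signedVars_add (mem_kClauses.1 (hM hpM))
    omega
  obtain ⟨s, hs, hsc⟩ := exists_le_card_fiber_of_nsmul_le_card_of_maps_to (M := ℝ)
    (b := (𝒟₀.card : ℝ) / k) hmap ⟨1, mem_Icc.2 ⟨le_rfl, hk⟩⟩ (by
      rw [Nat.card_Icc, Nat.add_sub_cancel, nsmul_eq_mul, mul_div_cancel₀]
      exact_mod_cast (by omega : k ≠ 0))
  rw [mem_Icc] at hs
  rw [div_le_iff₀ (by exact_mod_cast hk)] at hsc
  have hsc' : 𝒟₀.card ≤ (𝒟₀.filter (fun p => (signedVars false p.2).card = s)).card * k := by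
    exact_mod_cast hsc
  refine ⟨k - i, Nat.sub_le _ _, s, hs.1, hs.2,
    𝒟₀.filter (fun p => (signedVars false p.2).card = s), ?_, hcard.trans ?_⟩
  · have key : ∀ p ∈ 𝒟₀.filter (fun p => (signedVars false p.2).card = s),
        IsMinBadSet k t M p.1 ∧ p.2 ∈ M ∧ p.1 ⊆ p.2 ∧ IsLight q M p.1 p.2 ∧
          (signedVars false p.2).card = s := by
      intro p hp
      obtain ⟨hp, h2⟩ := mem_filter.1 hp
      obtain ⟨hp, h3, h4⟩ := mem_filter.1 hp
      obtain ⟨h5, h6⟩ := mem_product.1 hp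
      exact ⟨(mem_minBadSets.1 h5).2, h6, h3, h4, h2⟩
    refine ⟨fun p hp => (key p hp).2.1, fun p hp => mem_kClauses.1 (hM (key p hp).2.1),
      fun p hp => (key p hp).2.2.1, fun p hp => (key p hp).2.2.2.1, fun p hp => ?_,
      fun p hp v hv => ?_, fun p hp => (key p hp).2.2.2.2⟩
    · rw [nonempty_iff_ne_empty]
      intro h
      exact h0 (h ▸ (key p hp).1.1)
    · exact h1 v (hv ▸ (key p hp).1.1)
  · calc 2 * 𝒟₀.card * t ^ degExp (k - i) ≤
          2 * ((𝒟₀.filter (fun p => (signedVars false p.2).card = s)).card * k) *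
            t ^ degExp (k - i) := by gcongr
      _ = _ := by ring

/-- The constant in the exponent of `card_compatiblePosSets_le`. -/
noncomputable def spreadConst (k : ℕ) : ℝ :=
  2 ^ (k + 1) * ((k + 1) * (4 * k ^ 2 * 4 ^ k)) * (2 ^ k * k.factorial * (2 * k))

theorem spreadConst_pos (hk : 1 ≤ k) : 0 < spreadConst k := by
  have hk' : (0 : ℝ) < k := by exact_mod_cast hk
  rw [spreadConst]
  positivity

theorem card_compatiblePosSets_le {t a : ℕ} {M : SatFormula V} (hk : 1 ≤ k)
    (hM : M ⊆ kClauses k V) (hneg : ∀ C ∈ M, (signedVars false C).Nonempty)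
    (ht : 4 ^ k * (2 * (2 ^ k * (k + 1))) ≤ t) (hn : 4 * k ≤ Fintype.card V)
    (htn : t ^ (degExp k + 2) ≤ Fintype.card V) (ha : a * t ^ (degExp k + 2) ≤ Fintype.card V)
    (hsp : SparseNegativeExtensions a M) (h0 : ¬ IsBadSet k t M ∅)
    (h1 : ∀ v, ¬ IsBadSet k t M {(v, false)}) :
    ((compatiblePosSets k M).card : ℝ) ≤
      2 ^ (((Fintype.card V).choose k : ℝ) - badWeight k t M * t ^ 2 / spreadConst k) := by
  classical
  have hB0 := spreadConst_pos hk
  have hn0 : 0 < Fintype.card V := by omega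
  have ht0 : 0 < t := lt_of_lt_of_le (by positivity) ht
  obtain ⟨j, hj, s, hs, hsk, 𝒟, h𝒟, hX⟩ := exists_goodPairs hM hneg hk ht hn0 h0 h1
  set n := Fintype.card V with hndef
  set q := t ^ (degExp j + 2) with hq
  have hqq : q ≤ t ^ (degExp k + 2) :=
    Nat.pow_le_pow_right ht0 (Nat.add_le_add_right (degExp_mono hj) 2)
  have hq0 : 0 < q := by positivity
  have hqn : q ≤ n := hqq.trans htn
  set D := 4 * k ^ 2 * 4 ^ k * n ^ s with hD
  have hΔ : ∀ Q, ((hyperIndex 𝒟 s).filter (fun e => Q ∈ hyperedge e)).card ≤ D / q := fun Q =>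
    (Nat.le_div_iff_mul_le hq0).2 (card_hyperedge_mem_mul_le hs hk h𝒟 hsp
      ((Nat.mul_le_mul_left _ hqq).trans ha) hqn Q)
  have hΔ0 : 0 < D / q := by
    refine Nat.div_pos ?_ hq0
    calc q ≤ n := hqn
      _ ≤ n ^ s := Nat.le_self_pow (by omega) n
      _ ≤ D := Nat.le_mul_of_pos_left _ (by positivity)
  have hmain := card_avoiding_le (Nat.succ_pos k) hΔ0 (hyperIndex 𝒟 s) hyperedge
    (card_hyperedge_le h𝒟 hsk) (fun e _ => ⟨_, mem_insert_self _ _⟩) hΔ (univ.powersetCard k)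
    (hyperedge_subset hs h𝒟)
  refine le_trans (Nat.cast_le.2 (card_le_card ?_)) (hmain.trans ?_)
  · intro 𝒮 h𝒮
    obtain ⟨h2, G, hG, rfl, rfl⟩ := mem_filter.1 h𝒮
    simp only [mem_filter]
    exact ⟨h2, not_hyperedge_subset hs hG h𝒟⟩
  · rw [card_powersetCard, card_univ]
    refine Real.rpow_le_rpow_of_exponent_le one_le_two (sub_le_sub_left ?_ _)
    have hT := mul_pow_le_card_hyperIndex hs hsk h𝒟 hn
    set T := (hyperIndex 𝒟 s).card with hTdef
    have hDq : D / q * q ≤ D := Nat.div_mul_le_self _ _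
    set Δ := D / q with hΔdef
    have hDq' : (Δ : ℝ) * (t ^ degExp j * t ^ 2) ≤ 4 * k ^ 2 * 4 ^ k * n ^ s := by
      rw [← pow_add]; exact_mod_cast hDq
    have hT' : (𝒟.card : ℝ) * n ^ s ≤ 2 ^ k * k.factorial * T := by exact_mod_cast hT
    have hX' : (badWeight k t M : ℝ) ≤ 2 * k * 𝒟.card * t ^ degExp j := by exact_mod_cast hX
    have hΔ0' : (0 : ℝ) < Δ := by exact_mod_cast hΔ0
    have hns : (0 : ℝ) < n ^ s := by positivity
    have ht0' : (0 : ℝ) < t := by exact_mod_cast ht0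
    rw [le_div_iff₀ (by positivity), div_mul_eq_mul_div, div_le_iff₀ hB0]
    refine le_of_mul_le_mul_right ?_ hns
    push_cast
    set N : ℝ := (n : ℝ) ^ s with hN
    set P : ℝ := (t : ℝ) ^ degExp j with hP
    have hP0 : 0 < P := by positivity
    clear_value N P Δ T
    calc (badWeight k t M : ℝ) * t ^ 2 * (2 ^ (k + 1) * ((k + 1) * Δ)) * N
        ≤ (2 * k * 𝒟.card * P) * t ^ 2 * (2 ^ (k + 1) * ((k + 1) * Δ)) * N := by gcongr
      _ = 2 ^ (k + 1) * (k + 1) * (2 * k) * (Δ * (P * t ^ 2)) * (𝒟.card * N) := by ring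
      _ ≤ 2 ^ (k + 1) * (k + 1) * (2 * k) * (4 * k ^ 2 * 4 ^ k * N) *
          (2 ^ k * k.factorial * T) := by gcongr
      _ = T * spreadConst k * N := by rw [spreadConst]; ring

open scoped Classical in
/-- Centred formulae without a variable of large negative degree. -/
noncomputable def spreadFormulas (k : ℕ) (V : Type*) [Fintype V] [DecidableEq V] (x : ℝ) (t a : ℕ) :
    Finset (SatFormula V) :=
  (centeredFormulas k V x).filter (fun G => (negClauses G).Nonempty ∧
    SparseNegativeExtensions a (negClauses G) ∧ ∀ v, ¬ IsBadSet k t (negClauses G) {(v, false)})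

theorem sum_half_pow_le_two (I : Finset ℕ) : ∑ X ∈ I, (1 / 2 : ℝ) ^ X ≤ 2 := by
  exact (summable_geometric_two.sum_le_tsum I fun _ _ => by positivity).trans
    tsum_geometric_two.le

theorem card_spreadFormulas_le {x : ℝ} {t a : ℕ} (hk : 1 ≤ k)
    (ht : 4 ^ k * (2 * (2 ^ k * (k + 1))) ≤ t) (hn : 4 * k ≤ Fintype.card V)
    (hn2 : 2 * Fintype.card V ≤ 2 ^ t)
    (htn : t ^ (degExp k + 2) ≤ Fintype.card V) (ha : a * t ^ (degExp k + 2) ≤ Fintype.card V)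
    (hx : x * t ^ degExp k < (Fintype.card V : ℝ) ^ k)
    (htc : (((k + 1) * (2 * k + 1 + 2 ^ k) + 1 : ℕ) : ℝ) ≤ t / spreadConst k) :
    ((spreadFormulas k V x t a).card : ℝ) ≤
      4 * 2 ^ (Fintype.card V).choose k / 2 ^ t := by
  classical
  set n := Fintype.card V with hndef
  set c' := (k + 1) * (2 * k + 1 + 2 ^ k) with hc'
  have hn0 : 0 < n := by omega
  have ht0 : 1 ≤ t := (Nat.succ_le_of_lt (by positivity)).trans ht
  set ℳ := (kClauses k V).powerset.filter (fun M => M.Nonempty ∧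
    (∀ C ∈ M, (signedVars false C).Nonempty) ∧ SparseNegativeExtensions a M ∧
    ¬ IsBadSet k t M ∅ ∧ ∀ v, ¬ IsBadSet k t M {(v, false)}) with hℳ
  have h1 := card_formulas_le_sum (k := k) (𝒢 := spreadFormulas k V x t a)
    (fun G hG => (centeredFormulas_props (mem_filter.1 hG).1).1) ℳ (compatiblePosSets k)
    fun G hG => by
      obtain ⟨hGc, hne, hsp, hv⟩ := mem_filter.1 hG
      obtain ⟨hGk, hGm, hGx, -⟩ := centeredFormulas_props hGc
      refine ⟨mem_filter.2 ⟨mem_powerset.2 ((filter_subset _ _).trans hGk), hne, fun C hC => ?_,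
        hsp, fun h0 => ?_, hv⟩, mem_filter.2 ⟨mem_powerset.2 (posSets_subset _), G, hGm, rfl, rfl⟩⟩
      · obtain ⟨-, v, hv⟩ := (mem_nonMonotone hGk).1 hC
        exact ⟨v, mem_signedVars.2 hv⟩
      · refine absurd hx (not_lt.2 ?_)
        rw [IsBadSet, card_empty, Nat.sub_zero, litDeg, filter_true_of_mem (fun _ _ =>
          empty_subset _)] at h0
        refine le_trans (by exact_mod_cast h0) (mul_le_mul_of_nonneg_right hGx (by positivity))
  refine (Nat.cast_le.2 h1).trans ?_
  rw [Nat.cast_sum]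
  have h2 : ∀ M ∈ ℳ, 1 ≤ badWeight k t M ∧ ((compatiblePosSets k M).card : ℝ) ≤
      2 ^ ((n.choose k : ℝ) - badWeight k t M * t ^ 2 / spreadConst k) := by
    intro M hM
    obtain ⟨hMk, hne, hneg, hsp, h0, hv⟩ := mem_filter.1 hM
    rw [mem_powerset] at hMk
    exact ⟨one_le_badWeight hMk hne hn0, card_compatiblePosSets_le hk hMk hneg ht hn htn ha hsp h0 hv⟩
  set C : ℝ := (n.choose k : ℝ) with hC
  rw [← sum_fiberwise_of_maps_to (s := ℳ) (t := ℳ.image (badWeight k t))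
    (fun M hM => mem_image_of_mem _ hM)]
  have h3 : ∀ X ∈ ℳ.image (badWeight k t), ∑ M ∈ ℳ with badWeight k t M = X,
      ((compatiblePosSets k M).card : ℝ) ≤ 2 ^ C * 2 / 2 ^ t * (1 / 2) ^ X := by
    intro X hX
    obtain ⟨M₀, hM₀, rfl⟩ := mem_image.1 hX
    set X := badWeight k t M₀ with hXdef
    have hX1 : 1 ≤ X := (h2 M₀ hM₀).1
    have hb : ∀ M ∈ ℳ.filter (fun M => badWeight k t M = X),
        ((compatiblePosSets k M).card : ℝ) ≤ 2 ^ (C - X * t ^ 2 / spreadConst k) := by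
      intro M hM
      obtain ⟨hM, h⟩ := mem_filter.1 hM
      rw [← h]
      exact (h2 M hM).2
    refine (sum_le_card_nsmul _ _ _ hb).trans ?_
    rw [nsmul_eq_mul]
    have hcount : ((ℳ.filter (fun M => badWeight k t M = X)).card : ℝ) ≤
        2 ^ ((c' * t * X : ℕ) : ℝ) := by
      rw [Real.rpow_natCast]
      refine (Nat.cast_le.2 (le_trans (card_le_card fun M hM => ?_)
        (card_badWeight_le (k := k) (V := V) ht0 hn0 hn2 X))).trans (by push_cast [hc']; rfl)
      obtain ⟨hM, h⟩ := mem_filter.1 hM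
      exact mem_filter.2 ⟨(mem_filter.1 hM).1, h.le⟩
    have hmono : (c' * t * X : ℕ) + (C - X * t ^ 2 / spreadConst k) ≤
        C + 1 - t - X := by
      have hX1' : (1 : ℝ) ≤ X := by exact_mod_cast hX1
      have ht1' : (1 : ℝ) ≤ t := by exact_mod_cast ht0
      have e1 : X * t * (c' + 1 : ℝ) ≤ X * (t : ℝ) ^ 2 / spreadConst k := by
        calc X * t * (c' + 1 : ℝ) ≤ X * t * (t / spreadConst k) := by
              gcongr; exact_mod_cast htc
          _ = _ := by ring
      push_cast
      nlinarith [mul_nonneg (sub_nonneg.2 hX1') (sub_nonneg.2 ht1')]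
    calc _ ≤ (2 : ℝ) ^ ((c' * t * X : ℕ) : ℝ) * 2 ^ (C - X * t ^ 2 / spreadConst k) := by gcongr
      _ = 2 ^ (((c' * t * X : ℕ) : ℝ) + (C - X * t ^ 2 / spreadConst k)) :=
          (Real.rpow_add two_pos _ _).symm
      _ ≤ 2 ^ (C + 1 - t - X) := Real.rpow_le_rpow_of_exponent_le one_le_two hmono
      _ = _ := by
          rw [Real.rpow_sub two_pos, Real.rpow_sub two_pos, Real.rpow_add two_pos,
            Real.rpow_natCast _ t, Real.rpow_natCast _ X, Real.rpow_one, one_div, inv_pow]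
          ring
  refine (sum_le_sum h3).trans ?_
  rw [← mul_sum]
  refine (mul_le_mul_of_nonneg_left (sum_half_pow_le_two _) (by positivity)).trans (le_of_eq ?_)
  rw [hC, Real.rpow_natCast]
  ring

/-- The `m`-subsets of `E` all of whose facets lie in `Λ`. -/
def pureSets (E : Finset V) (m : ℕ) (Λ : Finset (Finset V)) : Finset (Finset V) :=
  (E.powersetCard m).filter (fun L => ∀ u ∈ L, L.erase u ∈ Λ)

/-- The `m`-subsets of `E` none of whose facets lie in `Λ`. -/
def copureSets (E : Finset V) (m : ℕ) (Λ : Finset (Finset V)) : Finset (Finset V) :=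
  (E.powersetCard m).filter (fun L => ∀ u ∈ L, L.erase u ∉ Λ)

/-- The `m`-subsets of `E` having facets both in `Λ` and outside `Λ`. -/
def mixedSets (E : Finset V) (m : ℕ) (Λ : Finset (Finset V)) : Finset (Finset V) :=
  E.powersetCard m \ (pureSets E m Λ ∪ copureSets E m Λ)

theorem disjoint_pureSets_copureSets {E : Finset V} {m : ℕ} (hm : 1 ≤ m) (Λ : Finset (Finset V)) :
    Disjoint (pureSets E m Λ) (copureSets E m Λ) := by
  rw [disjoint_left]
  intro L h1 h2
  obtain ⟨hL, h1⟩ := mem_filter.1 h1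
  obtain ⟨u, hu⟩ := card_pos.1 (show 0 < L.card by rw [(mem_powersetCard.1 hL).2]; exact hm)
  exact (mem_filter.1 h2).2 u hu (h1 u hu)

theorem card_pureSets_add {E : Finset V} {m : ℕ} (hm : 1 ≤ m) (Λ : Finset (Finset V)) :
    (pureSets E m Λ).card + (copureSets E m Λ).card + (mixedSets E m Λ).card =
      E.card.choose m := by
  rw [← card_union_of_disjoint (disjoint_pureSets_copureSets hm Λ), mixedSets, add_comm,
    card_sdiff_add_card_eq_card (s := pureSets E m Λ ∪ copureSets E m Λ)
      (union_subset (filter_subset _ _) (filter_subset _ _)), card_powersetCard]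

theorem mixedSets_one (E : Finset V) (Λ : Finset (Finset V)) : mixedSets E 1 Λ = ∅ := by
  rw [mixedSets, sdiff_eq_empty_iff_subset]
  intro L hL
  obtain ⟨v, rfl⟩ := card_eq_one.1 (mem_powersetCard.1 hL).2
  by_cases h : ∅ ∈ Λ
  · exact mem_union_left _ (mem_filter.2 ⟨hL, by simpa using h⟩)
  · exact mem_union_right _ (mem_filter.2 ⟨hL, by simpa using h⟩)

theorem card_pureSets_mul_le {E : Finset V} {m : ℕ} (hm : 1 ≤ m) (Λ : Finset (Finset V)) :
    (pureSets E m Λ).card * (copureSets E m Λ).card ≤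
      (mixedSets E m Λ).card * (2 ^ m * Fintype.card V ^ m) := by
  have hE : E.powersetCard m ⊆ univ.powersetCard m := powersetCard_mono (subset_univ _)
  have h := card_mul_card_le_of_covering (m := m) (t := m)
    ((filter_subset _ _ : pureSets E m Λ ⊆ _).trans hE)
    ((filter_subset _ _ : copureSets E m Λ ⊆ _).trans hE)
    ((sdiff_subset : mixedSets E m Λ ⊆ _).trans hE) ?_
  · rwa [show 2 * m - m = m by omega] at h
  intro L hL L' hL'
  by_contra! hno
  obtain ⟨hLE, hLm⟩ := mem_powersetCard.1 (mem_filter.1 hL).1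
  obtain ⟨hLE', hLm'⟩ := mem_powersetCard.1 (mem_filter.1 hL').1
  refine absurd hL' (disjoint_left.1 (disjoint_pureSets_copureSets hm Λ) ?_)
  refine swap_path (W := L ∪ L') (m := m) (p := fun M => M ∈ pureSets E m Λ) ?_
    subset_union_left subset_union_right hLm hLm' hL
  intro M hM hMm b hb a ha haM hMp
  have hM' : insert a (M.erase b) ∈ E.powersetCard m := by
    refine mem_powersetCard.2 ⟨?_, ?_⟩
    · intro x hx
      rcases mem_insert.1 hx with rfl | hx
      · exact union_subset hLE hLE' ha
      · exact (mem_powersetCard.1 (mem_filter.1 hMp).1).1 (mem_of_mem_erase hx)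
    · rw [card_insert_of_notMem fun h => haM (mem_of_mem_erase h), card_erase_of_mem hb]
      omega
  have hnot : insert a (M.erase b) ∉ mixedSets E m Λ := fun h =>
    hno _ h (insert_subset ha ((erase_subset _ _).trans hM))
  have hco : insert a (M.erase b) ∉ copureSets E m Λ := fun h => by
    refine (mem_filter.1 h).2 a (mem_insert_self _ _) ?_
    rw [erase_insert fun h => haM (mem_of_mem_erase h)]
    exact (mem_filter.1 hMp).2 b hb
  by_contra hp
  exact hnot (mem_sdiff.2 ⟨hM', fun h => (mem_union.1 h).elim hp hco⟩)

/-- The number of sets in `P` containing `Y`. -/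
def lineDeg (P : Finset (Finset V)) (Y : Finset V) : ℕ := (P.filter (fun L => Y ⊆ L)).card

/-- The `(m + 1)`-sets that are the union of a set in `P` and a set in `N`. -/
def crossSets (m : ℕ) (P N : Finset (Finset V)) : Finset (Finset V) :=
  (univ.powersetCard (m + 1)).filter (fun S => ∃ L ∈ P, ∃ L' ∈ N, L ∪ L' = S)

theorem sum_lineDeg_mul_le {E : Finset V} {m : ℕ} (hm : 1 ≤ m) {P N : Finset (Finset V)}
    (hP : P ⊆ E.powersetCard m) (hN : N ⊆ E.powersetCard m) :
    ∑ Y ∈ E.powersetCard (m - 1), lineDeg P Y * lineDeg N Y ≤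
      2 ^ m * (Fintype.card V ^ m + 4 ^ (m + 1) * (crossSets m P N).card) := by
  have h1 : ∑ Y ∈ E.powersetCard (m - 1), lineDeg P Y * lineDeg N Y =
      ∑ p ∈ P ×ˢ N, ((E.powersetCard (m - 1)).filter (fun Y => Y ⊆ p.1 ∧ Y ⊆ p.2)).card := by
    simp_rw [card_filter]
    rw [sum_comm]
    refine sum_congr rfl fun Y _ => ?_
    rw [lineDeg, lineDeg, ← card_product, ← card_filter]
    congr 1
    ext p
    simp only [mem_product, mem_filter]
    tauto
  have hpairs : ∀ p ∈ P ×ˢ N, ∀ Y ∈ (E.powersetCard (m - 1)).filter (fun Y => Y ⊆ p.1 ∧ Y ⊆ p.2),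
      p.1 = p.2 ∨ p.1 ∪ p.2 ∈ crossSets m P N := by
    rintro ⟨L, L'⟩ hp Y hY
    obtain ⟨hL, hL'⟩ := mem_product.1 hp
    simp only at hL hL' ⊢
    obtain ⟨hYE, hYL, hYL'⟩ := mem_filter.1 hY
    have hYc := (mem_powersetCard.1 hYE).2
    have hc := (mem_powersetCard.1 (hP hL)).2
    have hc' := (mem_powersetCard.1 (hN hL')).2
    by_cases h : L = L'
    · exact Or.inl h
    right
    refine mem_filter.2 ⟨mem_powersetCard.2 ⟨subset_univ _, ?_⟩, L, hL, L', hL', rfl⟩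
    have e1 := card_union_add_card_inter L L'
    have e2 : Y.card ≤ (L ∩ L').card := card_le_card (subset_inter hYL hYL')
    have e3 : (L ∩ L').card < m := by
      rw [← hc]
      refine card_lt_card ⟨inter_subset_left, fun hh => h ?_⟩
      exact eq_of_subset_of_card_le (hh.trans inter_subset_right) (by omega)
    omega
  have h2 : ∀ p ∈ P ×ˢ N, ((E.powersetCard (m - 1)).filter (fun Y => Y ⊆ p.1 ∧ Y ⊆ p.2)).card ≤
      if p.1 = p.2 ∨ p.1 ∪ p.2 ∈ crossSets m P N then 2 ^ m else 0 := by
    intro p hp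
    split_ifs with h
    · rw [← (mem_powersetCard.1 (hP (mem_product.1 hp).1)).2, ← card_powerset]
      exact card_le_card fun Y hY => mem_powerset.2 (mem_filter.1 hY).2.1
    · rw [Nat.le_zero, card_eq_zero, eq_empty_iff_forall_notMem]
      exact fun Y hY => h (hpairs p hp Y hY)
  rw [h1]
  refine (sum_le_sum h2).trans ?_
  rw [← sum_filter, sum_const, smul_eq_mul, mul_comm]
  refine Nat.mul_le_mul_left _ ?_
  rw [filter_or]
  refine (card_union_le _ _).trans (Nat.add_le_add ?_ ?_)
  · refine (card_le_card_of_injOn Prod.fst (t := univ.powersetCard m) (fun p hp => ?_)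
      fun p hp q hq h => ?_).trans ?_
    · exact powersetCard_mono (subset_univ _) (hP (mem_product.1 (mem_filter.1 hp).1).1)
    · have e1 := (mem_filter.1 hp).2
      have e2 := (mem_filter.1 hq).2
      exact Prod.ext h (e1 ▸ e2 ▸ h)
    · rw [card_powersetCard, card_univ]
      exact Nat.choose_le_pow _ _
  · have : (P ×ˢ N).filter (fun p => p.1 ∪ p.2 ∈ crossSets m P N) ⊆
        (crossSets m P N).biUnion (fun S => S.powerset ×ˢ S.powerset) := by
      intro p hp
      exact mem_biUnion.2 ⟨_, (mem_filter.1 hp).2, mem_product.2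
        ⟨mem_powerset.2 subset_union_left, mem_powerset.2 subset_union_right⟩⟩
    refine (card_le_card this).trans ?_
    rw [mul_comm]
    refine card_biUnion_le_card_mul _ _ _ fun S hS => ?_
    rw [card_product, card_powerset, (mem_powersetCard.1 (mem_filter.1 hS).1).2, ← mul_pow]
    norm_num

theorem exists_labels {E : Finset V} {m s z y : ℕ} (hm : 1 ≤ m) (hz : 0 < z)
    {P N : Finset (Finset V)} (hP : P ⊆ E.powersetCard m) (hN : N ⊆ E.powersetCard m)
    (hy : (crossSets m P N).card ≤ y)
    (hs : Fintype.card V ^ (m - 1) * z ^ 2 +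
      2 ^ m * (Fintype.card V ^ m + 4 ^ (m + 1) * y) ≤ s * z) :
    ∃ Λ ⊆ E.powersetCard (m - 1), (P \ pureSets E m Λ).card ≤ s ∧
      (N \ copureSets E m Λ).card ≤ s := by
  have hsum : ∑ Y ∈ E.powersetCard (m - 1), min (lineDeg P Y) (lineDeg N Y) ≤ s := by
    refine Nat.le_of_mul_le_mul_right ?_ hz
    calc (∑ Y ∈ E.powersetCard (m - 1), min (lineDeg P Y) (lineDeg N Y)) * z
        ≤ ∑ Y ∈ E.powersetCard (m - 1), (z ^ 2 + lineDeg P Y * lineDeg N Y) := by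
          rw [sum_mul]
          refine sum_le_sum fun Y _ => ?_
          rcases le_total (lineDeg P Y) z with h | h
          · exact le_add_right ((Nat.mul_le_mul_right _ ((min_le_left _ _).trans h)).trans
              (sq z).ge)
          rcases le_total (lineDeg N Y) z with h' | h'
          · exact le_add_right ((Nat.mul_le_mul_right _ ((min_le_right _ _).trans h')).trans
              (sq z).ge)
          · exact le_add_left (Nat.mul_le_mul (min_le_left _ _) h')
      _ ≤ Fintype.card V ^ (m - 1) * z ^ 2 +
          2 ^ m * (Fintype.card V ^ m + 4 ^ (m + 1) * (crossSets m P N).card) := by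
          rw [sum_add_distrib, sum_const, smul_eq_mul, card_powersetCard]
          refine Nat.add_le_add (Nat.mul_le_mul_right _ ?_) (sum_lineDeg_mul_le hm hP hN)
          exact (Nat.choose_le_pow _ _).trans (Nat.pow_le_pow_left (card_le_univ _) _)
      _ ≤ _ := le_trans (by gcongr) hs
  have hfacet : ∀ L ∈ E.powersetCard m, ∀ u ∈ L, L.erase u ∈ E.powersetCard (m - 1) := by
    intro L hL u hu
    obtain ⟨h1, h2⟩ := mem_powersetCard.1 hL
    exact mem_powersetCard.2 ⟨(erase_subset _ _).trans h1, by rw [card_erase_of_mem hu, h2]⟩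
  refine ⟨(E.powersetCard (m - 1)).filter (fun Y => lineDeg N Y ≤ lineDeg P Y),
    filter_subset _ _, ?_, ?_⟩
  · refine le_trans ?_ hsum
    refine le_trans (card_le_card (t := ((E.powersetCard (m - 1)).filter
      (fun Y => ¬ lineDeg N Y ≤ lineDeg P Y)).biUnion (fun Y => P.filter (fun L => Y ⊆ L))) ?_) ?_
    · intro L hL
      obtain ⟨hLP, hL⟩ := mem_sdiff.1 hL
      simp only [pureSets, mem_filter, hP hLP, true_and, not_forall] at hL
      obtain ⟨u, hu, h⟩ := hL
      have := hfacet L (hP hLP) u hu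
      exact mem_biUnion.2 ⟨L.erase u, mem_filter.2 ⟨this, fun h' => h ⟨this, h'⟩⟩,
        mem_filter.2 ⟨hLP, erase_subset _ _⟩⟩
    · refine card_biUnion_le.trans (le_trans (sum_le_sum fun Y hY => ?_)
        (sum_le_sum_of_subset (filter_subset _ _)))
      exact le_min le_rfl (not_le.1 (mem_filter.1 hY).2).le
  · refine le_trans ?_ hsum
    refine le_trans (card_le_card (t := ((E.powersetCard (m - 1)).filter
      (fun Y => lineDeg N Y ≤ lineDeg P Y)).biUnion (fun Y => N.filter (fun L => Y ⊆ L))) ?_) ?_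
    · intro L hL
      obtain ⟨hLN, hL⟩ := mem_sdiff.1 hL
      simp only [copureSets, mem_filter, hN hLN, true_and, not_forall, not_not] at hL
      obtain ⟨u, hu, h⟩ := hL
      exact mem_biUnion.2 ⟨L.erase u, mem_filter.2 h, mem_filter.2 ⟨hLN, erase_subset _ _⟩⟩
    · refine card_biUnion_le.trans (le_trans (sum_le_sum fun Y hY => ?_)
        (sum_le_sum_of_subset (filter_subset _ _)))
      exact le_min (mem_filter.1 hY).2 le_rfl

/-- Pairs of families of `m`-subsets of `E` that nearly consist of pure and copure sets for some
labelling with at least `u` mixed sets. -/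
def labelledPairs (E : Finset V) (m s u : ℕ) :
    Finset (Finset (Finset V) × Finset (Finset V)) :=
  ((E.powersetCard m).powerset ×ˢ (E.powersetCard m).powerset).filter (fun p =>
    ∃ Λ ⊆ E.powersetCard (m - 1), (p.1 \ pureSets E m Λ).card ≤ s ∧
      (p.2 \ copureSets E m Λ).card ≤ s ∧ u ≤ (mixedSets E m Λ).card)

theorem mem_labelledPairs {E : Finset V} {m s u : ℕ}
    {p : Finset (Finset V) × Finset (Finset V)} : p ∈ labelledPairs E m s u ↔
      (p.1 ⊆ E.powersetCard m ∧ p.2 ⊆ E.powersetCard m) ∧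
      ∃ Λ ⊆ E.powersetCard (m - 1), (p.1 \ pureSets E m Λ).card ≤ s ∧
        (p.2 \ copureSets E m Λ).card ≤ s ∧ u ≤ (mixedSets E m Λ).card := by
  simp only [labelledPairs, mem_filter, mem_product, mem_powerset]

theorem card_near_subset_le (A B : Finset (Finset V)) (s : ℕ) :
    (B.powerset.filter (fun P => (P \ A).card ≤ s)).card ≤ 2 ^ A.card * (B.card + 1) ^ s := by
  rw [← card_powerset]
  refine le_trans ?_ (Nat.mul_le_mul_left _ (card_subsets_le B s))
  rw [← card_product]
  refine card_le_card_of_injOn (fun P => (P ∩ A, P \ A)) (fun P hP => ?_) fun P _ Q _ h => ?_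
  · obtain ⟨h1, h2⟩ := mem_filter.1 hP
    exact mem_product.2 ⟨mem_powerset.2 inter_subset_right,
      mem_filter.2 ⟨mem_powerset.2 (sdiff_subset.trans (mem_powerset.1 h1)), h2⟩⟩
  · obtain ⟨h1, h2⟩ := Prod.mk.inj h
    rw [← sdiff_union_inter P A, ← sdiff_union_inter Q A, h1, h2]

theorem card_labelledPairs_mul_le {E : Finset V} {m s u : ℕ} (hm : 1 ≤ m) :
    (labelledPairs E m s u).card * 2 ^ u ≤ 2 ^ E.card.choose (m - 1) *
      (2 ^ E.card.choose m * (E.card.choose m + 1) ^ (2 * s)) := by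
  classical
  set I := (E.powersetCard (m - 1)).powerset.filter (fun Λ => u ≤ (mixedSets E m Λ).card) with hI
  have hsub : labelledPairs E m s u ⊆ I.biUnion (fun Λ =>
      (E.powersetCard m).powerset.filter (fun P => (P \ pureSets E m Λ).card ≤ s) ×ˢ
      (E.powersetCard m).powerset.filter (fun N => (N \ copureSets E m Λ).card ≤ s)) := by
    intro p hp
    obtain ⟨⟨hp1, hp2⟩, Λ, hΛ, h1, h2, h3⟩ := mem_labelledPairs.1 hp
    exact mem_biUnion.2 ⟨Λ, mem_filter.2 ⟨mem_powerset.2 hΛ, h3⟩, mem_product.2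
      ⟨mem_filter.2 ⟨mem_powerset.2 hp1, h1⟩, mem_filter.2 ⟨mem_powerset.2 hp2, h2⟩⟩⟩
  refine (Nat.mul_le_mul_right _ ((card_le_card hsub).trans card_biUnion_le)).trans ?_
  rw [sum_mul]
  have hIc : I.card ≤ 2 ^ E.card.choose (m - 1) := by
    rw [← card_powersetCard, ← card_powerset]
    exact card_le_card (filter_subset _ _)
  refine (sum_le_card_nsmul _ _ _ fun Λ hΛ => ?_).trans
    (by rw [smul_eq_mul]; exact Nat.mul_le_mul_right _ hIc)
  rw [card_product]
  have h := card_pureSets_add (E := E) hm Λ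
  have hu := (mem_filter.1 hΛ).2
  have e1 := card_near_subset_le (pureSets E m Λ) (E.powersetCard m) s
  have e2 := card_near_subset_le (copureSets E m Λ) (E.powersetCard m) s
  rw [card_powersetCard] at e1 e2
  refine (Nat.mul_le_mul_right _ (Nat.mul_le_mul e1 e2)).trans ?_
  set Q := (E.card.choose m + 1) ^ s with hQ
  calc _ = 2 ^ ((pureSets E m Λ).card + (copureSets E m Λ).card + u) * (Q * Q) := by
        rw [pow_add, pow_add]; ring
    _ ≤ 2 ^ E.card.choose m * (E.card.choose m + 1) ^ (2 * s) := by
        rw [hQ, ← pow_add, ← two_mul]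
        exact Nat.mul_le_mul_right _ (Nat.pow_le_pow_right two_pos (by omega))

theorem mem_labelledPairs_of_cross {E : Finset V} {m s z y u d : ℕ} (hm : 1 ≤ m) (hz : 0 < z)
    {P N : Finset (Finset V)} (hP : P ⊆ E.powersetCard m) (hN : N ⊆ E.powersetCard m)
    (hy : (crossSets m P N).card ≤ y) (hdP : d ≤ P.card) (hdN : d ≤ N.card)
    (hs : Fintype.card V ^ (m - 1) * z ^ 2 +
      2 ^ m * (Fintype.card V ^ m + 4 ^ (m + 1) * y) ≤ s * z)
    (hu : ∀ U, (m = 1 → U = 0) → (d - s) * (d - s) ≤ U * (2 ^ m * Fintype.card V ^ m) → u ≤ U) :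
    (P, N) ∈ labelledPairs E m s u := by
  obtain ⟨Λ, hΛ, h1, h2⟩ := exists_labels hm hz hP hN hy hs
  refine mem_labelledPairs.2 ⟨⟨hP, hN⟩, Λ, hΛ, h1, h2,
    hu _ (fun h => ?_) (le_trans (Nat.mul_le_mul ?_ ?_) (card_pureSets_mul_le hm Λ))⟩
  · subst h
    rw [mixedSets_one, card_empty]
  · have := card_le_card_sdiff_add_card (s := P) (t := pureSets E m Λ)
    omega
  · have := card_le_card_sdiff_add_card (s := N) (t := copureSets E m Λ)
    omega

theorem eq_signedClause_of_forall {C : SatClause V} (hC : IsKClause k C) {σ : V → Bool}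
    (h : ∀ u b, (u, b) ∈ C → b = σ u) : C = signedClause σ (clauseVars C) := by
  conv_lhs => rw [hC.eq_signedClause]
  rw [signedClause_congr]
  intro u hu
  exact h u _ (hC.mem_iff.2 ⟨hu, rfl⟩)

/-- The signs that are negative exactly at `v`. -/
abbrev flipAt (v : V) : V → Bool := fun u => decide (u ≠ v)

/-- The sets forming together with `v` a clause of `G` with signs `σ`. -/
def link (k : ℕ) (σ : V → Bool) (v : V) (G : SatFormula V) : Finset (Finset V) :=
  ((univ.erase v).powersetCard (k - 1)).filter (fun L => signedClause σ (insert v L) ∈ G)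

theorem mem_link {σ : V → Bool} {v : V} {G : SatFormula V} {L : Finset V} :
    L ∈ link k σ v G ↔ (v ∉ L ∧ L.card = k - 1) ∧ signedClause σ (insert v L) ∈ G := by
  rw [link, mem_filter, mem_powersetCard]
  refine and_congr_left fun _ => and_congr_left fun _ => ?_
  exact ⟨fun h hv => notMem_erase v _ (h hv), fun h x hx => mem_erase.2
    ⟨fun e => h (e ▸ hx), mem_univ _⟩⟩

theorem link_subset (σ : V → Bool) (v : V) (G : SatFormula V) :
    link k σ v G ⊆ (univ.erase v).powersetCard (k - 1) := filter_subset _ _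

theorem erase_mem_link {C : SatClause V} (hC : IsKClause k C) {σ : V → Bool} {v : V}
    {G : SatFormula V} (hCG : C ∈ G) (hv : v ∈ clauseVars C)
    (h : ∀ u b, (u, b) ∈ C → b = σ u) : (clauseVars C).erase v ∈ link k σ v G := by
  refine mem_link.2 ⟨⟨notMem_erase _ _, by rw [card_erase_of_mem hv, hC.2]⟩, ?_⟩
  rw [insert_erase hv, ← eq_signedClause_of_forall hC h]
  exact hCG

theorem card_link_flipAt_le {G : SatFormula V} (hG : G ⊆ kClauses k V) {v : V}
    (h : (negClauses G).card ≤ (nonMonotone (flipAt v) G).card) :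
    (link k (flipAt v) v G).card ≤ (link k (fun _ => true) v G).card := by
  set A := negClauses G with hA
  set B := nonMonotone (flipAt v) G with hB
  have h1 : (A \ B).card ≤ (B \ A).card := by
    have e1 := card_sdiff_add_card_inter A B
    have e2 := card_sdiff_add_card_inter B A
    rw [inter_comm] at e2
    omega
  refine le_trans ?_ (h1.trans ?_)
  · refine card_le_card_of_injOn (fun L => signedClause (flipAt v) (insert v L)) (fun L hL => ?_)
      fun L hL L' hL' he => ?_
    · obtain ⟨⟨hv, hc⟩, hLG⟩ := mem_link.1 hL
      refine mem_sdiff.2 ⟨(mem_negClauses hG).2 ⟨hLG, v, mem_signedClause.2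
        ⟨mem_insert_self _ _, by simp⟩⟩, fun hh => ?_⟩
      obtain ⟨-, u, hu⟩ := (mem_nonMonotone hG).1 hh
      have := (mem_signedClause.1 hu).2
      simp at this
    · have hL1 := (mem_link.1 hL).1.1
      have hL2 := (mem_link.1 hL').1.1
      have := congrArg clauseVars he
      simp only [clauseVars_signedClause] at this
      rw [← erase_insert hL1, this, erase_insert hL2]
  · have key : ∀ C ∈ B \ A, C ∈ G ∧ IsKClause k C ∧ (∀ u b, (u, b) ∈ C → b = true) ∧
        v ∈ clauseVars C := by
      intro C hC
      obtain ⟨hCB, hCA⟩ := mem_sdiff.1 hC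
      obtain ⟨hCG, u, hu⟩ := (mem_nonMonotone hG).1 hCB
      have hpos : ∀ u b, (u, b) ∈ C → b = true := by
        intro u b hb
        cases b
        · exact absurd ((mem_negClauses hG).2 ⟨hCG, u, hb⟩) hCA
        · rfl
      refine ⟨hCG, mem_kClauses.1 (hG hCG), hpos, ?_⟩
      have := hpos _ _ hu
      have hv : u = v := by simpa using this
      exact mem_clauseVars.2 ⟨_, hv ▸ hu⟩
    refine card_le_card_of_injOn (fun C => (clauseVars C).erase v) (fun C hC => ?_)
      fun C hC C' hC' he => ?_
    · obtain ⟨h1, h2, h3, h4⟩ := key C hC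
      exact erase_mem_link h2 h1 h4 h3
    · obtain ⟨-, h2, h3, h4⟩ := key C hC
      obtain ⟨-, h2', h3', h4'⟩ := key C' hC'
      have : clauseVars C = clauseVars C' := by
        rw [← insert_erase h4, ← insert_erase h4']
        exact congrArg _ he
      rw [eq_signedClause_of_forall h2 h3, eq_signedClause_of_forall h2' h3', this]

/-- The clauses using `v` and having a negative literal of another variable. -/
def roughClauses (v : V) (G : SatFormula V) : SatFormula V :=
  G.filter (fun C => v ∈ clauseVars C ∧ ∃ u ≠ v, (u, false) ∈ C)

theorem card_roughClauses_le {a : ℕ} {G : SatFormula V} (hG : G ⊆ kClauses k V)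
    (hs : SparseNegativeExtensions a (negClauses G)) (v : V) :
    (roughClauses v G).card ≤ 2 * (2 * Fintype.card V) ^ (k - 2) * (1 + a) := by
  have hsub : roughClauses v G ⊆ (univ : Finset Bool).biUnion (fun b =>
      ((univ.powersetCard (k - 1)).filter (fun Z : Finset (V × Bool) => {(v, b)} ⊆ Z)).biUnion
        (fun Z => (negClauses G).filter (fun C => Z ⊆ C ∧ (C \ Z).card = 1 ∧
          ∀ l ∈ C \ Z, l.2 = false))) := by
    intro C hC
    obtain ⟨hCG, hv, u, hu, huC⟩ := mem_filter.1 hC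
    obtain ⟨b, hb⟩ := mem_clauseVars.1 hv
    have hd : C \ C.erase (u, false) = {(u, false)} := by
      ext l
      simp only [mem_sdiff, mem_erase, mem_singleton]
      constructor
      · rintro ⟨h1, h2⟩
        by_contra h
        exact h2 ⟨h, h1⟩
      · rintro rfl
        exact ⟨huC, fun h => h.1 rfl⟩
    refine mem_biUnion.2 ⟨b, mem_univ _, mem_biUnion.2 ⟨C.erase (u, false), mem_filter.2
      ⟨mem_powersetCard.2 ⟨subset_univ _, ?_⟩, ?_⟩, mem_filter.2
        ⟨(mem_negClauses hG).2 ⟨hCG, u, huC⟩, erase_subset _ _, ?_, ?_⟩⟩⟩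
    · rw [card_erase_of_mem huC, (mem_kClauses.1 (hG hCG)).1]
    · rw [singleton_subset_iff, mem_erase]
      exact ⟨fun h => hu (Prod.mk.inj h).1.symm, hb⟩
    · rw [hd, card_singleton]
    · rw [hd]
      rintro l hl
      rw [mem_singleton.1 hl]
  refine (card_le_card hsub).trans ?_
  rw [mul_assoc, ← Fintype.card_bool, ← card_univ]
  refine card_biUnion_le_card_mul _ _ _ fun b _ => ?_
  refine (card_biUnion_le_card_mul _ _ (1 + a) fun Z _ => ?_).trans (Nat.mul_le_mul_right _ ?_)
  · have := hs Z 1 le_rfl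
    simpa using this
  · have := card_supersets_le (k - 1) {(v, b)}
    rw [card_singleton, Fintype.card_prod, Fintype.card_bool, mul_comm] at this
    rw [card_univ, Fintype.card_bool]
    exact this

theorem litDeg_le_rough_add_link {G : SatFormula V} (hG : G ⊆ kClauses k V) (v : V) :
    litDeg (negClauses G) {(v, false)} ≤
      (roughClauses v G).card + (link k (flipAt v) v G).card := by
  have hsub : (negClauses G).filter (fun C => {(v, false)} ⊆ C) ⊆ roughClauses v G ∪
      (link k (flipAt v) v G).image (fun L => signedClause (flipAt v) (insert v L)) := by
    intro C hC
    obtain ⟨hC, hv⟩ := mem_filter.1 hC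
    rw [singleton_subset_iff] at hv
    have hCG := ((mem_negClauses hG).1 hC).1
    have hK := mem_kClauses.1 (hG hCG)
    have hvC : v ∈ clauseVars C := mem_clauseVars.2 ⟨_, hv⟩
    by_cases h : ∃ u ≠ v, (u, false) ∈ C
    · exact mem_union_left _ (mem_filter.2 ⟨hCG, hvC, h⟩)
    push Not at h
    have hs : ∀ u b, (u, b) ∈ C → b = flipAt v u := by
      intro u b hb
      by_cases huv : u = v
      · subst huv
        simpa using hK.polarity_unique hb hv
      · cases b
        · exact absurd hb (h u huv)
        · simpa using huv
    refine mem_union_right _ (mem_image.2 ⟨_, erase_mem_link hK hCG hvC hs, ?_⟩)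
    rw [insert_erase hvC, ← eq_signedClause_of_forall hK hs]
  exact (card_le_card hsub).trans ((card_union_le _ _).trans
    (Nat.add_le_add_left card_image_le _))

theorem crossSets_disjoint_posSets {G : SatFormula V} (hGm : MinimalFormula G) (v : V) :
    Disjoint (crossSets (k - 1) (link k (fun _ => true) v G) (link k (flipAt v) v G))
      (posSets k G) := by
  rw [disjoint_left]
  intro S hS hSG
  obtain ⟨-, L, hL, L', hL', rfl⟩ := mem_filter.1 hS
  obtain ⟨⟨hv, -⟩, hLG⟩ := mem_link.1 hL
  obtain ⟨⟨hv', -⟩, hLG'⟩ := mem_link.1 hL'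
  obtain ⟨w, hw, hw'⟩ := hGm _ (mem_posSets.1 hSG).2
  rw [satisfies_signedClause] at hw
  have hvS : v ∉ L ∪ L' := fun h => (mem_union.1 h).elim hv hv'
  cases hwv : w v
  · have := hw' _ hLG' (satisfies_signedClause.2 fun u hu => ?_)
    · have := congrArg clauseVars this
      simp only [clauseVars_signedClause] at this
      exact hvS (this ▸ mem_insert_self _ _)
    · rcases mem_insert.1 hu with rfl | hu
      · simpa using hwv
      · rw [hw u (mem_union_right _ hu)]
        have : u ≠ v := fun e => hv' (e ▸ hu)
        simpa using this
  · have := hw' _ hLG (satisfies_signedClause.2 fun u hu => ?_)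
    · have := congrArg clauseVars this
      simp only [clauseVars_signedClause] at this
      exact hvS (this ▸ mem_insert_self _ _)
    · rcases mem_insert.1 hu with rfl | hu
      · exact hwv
      · exact hw u (mem_union_left _ hu)

theorem link_negClauses {G : SatFormula V} (hG : G ⊆ kClauses k V) (v : V) :
    link k (flipAt v) v (negClauses G) = link k (flipAt v) v G := by
  ext L
  rw [mem_link, mem_link, mem_negClauses hG]
  refine and_congr_right fun _ => and_iff_left ⟨v, mem_signedClause.2 ⟨mem_insert_self _ _, ?_⟩⟩
  simp

open scoped Classical in
theorem card_large_crossSets_le (hk : 1 ≤ k) (x : ℝ) (y : ℕ) :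
    ((centeredFormulas k V x).filter (fun G => ∃ v, y ≤ (crossSets (k - 1)
      (link k (fun _ => true) v G) (link k (flipAt v) v G)).card)).card * 2 ^ y ≤
      ((2 * Fintype.card V) ^ k + 1) ^ ⌊x⌋₊ * (Fintype.card V *
        (2 ^ (Fintype.card V).choose (k - 1) * 2 ^ (Fintype.card V).choose k)) := by
  set 𝒬 : SatFormula V → Finset (Finset (Finset V)) := fun M => (univ : Finset V).biUnion fun v =>
    ((univ.powersetCard (k - 1)).powerset.filter (fun P => y ≤ (crossSets (k - 1) P
      (link k (flipAt v) v M)).card)).biUnion fun P =>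
        (univ.powersetCard k \ crossSets (k - 1) P (link k (flipAt v) v M)).powerset with h𝒬
  have h := card_formulas_le_sum (k := k) (𝒢 := (centeredFormulas k V x).filter
    (fun G => ∃ v, y ≤ (crossSets (k - 1)
      (link k (fun _ => true) v G) (link k (flipAt v) v G)).card))
    (fun G hG => (centeredFormulas_props (mem_filter.1 hG).1).1) (smallFormulas k V ⌊x⌋₊) 𝒬
    fun G hG => by
      obtain ⟨hGc, v, hv⟩ := mem_filter.1 hG
      obtain ⟨hGk, hGm, -⟩ := centeredFormulas_props hGc
      refine ⟨negClauses_mem_smallFormulas le_rfl hGc, mem_biUnion.2 ⟨v, mem_univ _,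
        mem_biUnion.2 ⟨link k (fun _ => true) v G, mem_filter.2 ⟨mem_powerset.2
          ((link_subset _ _ _).trans (powersetCard_mono (subset_univ _))), ?_⟩, ?_⟩⟩⟩
      · rwa [link_negClauses hGk]
      · rw [link_negClauses hGk, mem_powerset, subset_sdiff]
        exact ⟨posSets_subset _, (crossSets_disjoint_posSets hGm v).symm⟩
  refine (Nat.mul_le_mul_right _ h).trans ?_
  rw [sum_mul]
  refine (sum_le_card_nsmul _ _ _ fun M _ => ?_).trans
    (by rw [smul_eq_mul]; exact Nat.mul_le_mul_right _ (card_smallFormulas_le _ _))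
  refine (Nat.mul_le_mul_right _ card_biUnion_le).trans ?_
  rw [sum_mul]
  refine (sum_le_card_nsmul _ _ _ fun v _ => ?_).trans (by rw [smul_eq_mul, card_univ])
  refine (Nat.mul_le_mul_right _ card_biUnion_le).trans ?_
  rw [sum_mul]
  refine (sum_le_card_nsmul _ _ _ fun P hP => ?_).trans (by
    rw [smul_eq_mul]
    refine Nat.mul_le_mul_right (2 ^ (Fintype.card V).choose k)
      ((card_le_card (filter_subset _ _)).trans ?_)
    rw [card_powerset, card_powersetCard, card_univ])
  have hy := (mem_filter.1 hP).2
  set S := crossSets (k - 1) P (link k (flipAt v) v M) with hS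
  have hSk : S ⊆ univ.powersetCard k := by
    have : S ⊆ univ.powersetCard (k - 1 + 1) := filter_subset _ _
    rwa [Nat.sub_add_cancel hk] at this
  rw [card_powerset, ← pow_add]
  refine Nat.pow_le_pow_right two_pos ?_
  have e := card_sdiff_add_card_eq_card hSk
  rw [card_powersetCard, card_univ] at e
  omega

/-- The map on clauses induced by an embedding of variables. -/
def clauseEmbedding {W : Type*} (φ : W ↪ V) : SatClause W ↪ SatClause V :=
  (mapEmbedding (φ.prodMap (.refl Bool))).toEmbedding

theorem mem_clauseEmbedding {W : Type*} {φ : W ↪ V} {C : SatClause W} {l : V × Bool} :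
    l ∈ clauseEmbedding φ C ↔ ∃ u, (u, l.2) ∈ C ∧ φ u = l.1 := by
  obtain ⟨v, b⟩ := l
  simp [clauseEmbedding]

theorem card_formulas_on_range_le {W : Type*} [Fintype W] [DecidableEq W] (φ : W ↪ V) :
    ((minimalFormulas k V).filter (fun G => ∀ C ∈ G, clauseVars C ⊆ univ.map φ)).card ≤
      (minimalFormulas k W).card := by
  classical
  refine (card_le_card (t := (minimalFormulas k W).image (map (clauseEmbedding φ))) ?_).trans
    card_image_le
  intro G hG
  obtain ⟨hGm, hGφ⟩ := mem_filter.1 hG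
  obtain ⟨hGk, hGm⟩ := mem_minimalFormulas.1 hGm
  have hsurj : ∀ C ∈ G, ∃ D, clauseEmbedding φ D = C := by
    intro C hC
    refine ⟨univ.filter (fun l => (φ l.1, l.2) ∈ C), ?_⟩
    ext ⟨v, b⟩
    rw [mem_clauseEmbedding]
    simp only [mem_filter, mem_univ, true_and]
    constructor
    · rintro ⟨u, hu, rfl⟩
      exact hu
    · intro h
      obtain ⟨u, -, rfl⟩ := mem_map.1 (hGφ C hC (mem_clauseVars.2 ⟨b, h⟩))
      exact ⟨u, h, rfl⟩
  have hvars : ∀ D : SatClause W, clauseVars (clauseEmbedding φ D) = (clauseVars D).map φ := by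
    intro D
    ext v
    simp only [clauseVars, mem_image, mem_map, mem_clauseEmbedding, Prod.exists]
    constructor
    · rintro ⟨_, b, ⟨u, hu, rfl⟩, rfl⟩
      exact ⟨u, ⟨u, b, hu, rfl⟩, rfl⟩
    · rintro ⟨_, ⟨u, b, hu, rfl⟩, rfl⟩
      exact ⟨_, b, ⟨u, hu, rfl⟩, rfl⟩
  have hcard : ∀ D : SatClause W, (clauseEmbedding φ D).card = D.card := fun D => card_map _
  have hsat : ∀ (w : V → Bool) (D : SatClause W),
      SatisfiesClause w (clauseEmbedding φ D) ↔ SatisfiesClause (fun u => w (φ u)) D := by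
    intro w D
    constructor
    · rintro h ⟨u, b⟩ hu
      exact h (φ u, b) (mem_clauseEmbedding.2 ⟨u, hu, rfl⟩)
    · rintro h ⟨v, b⟩ hv
      obtain ⟨u, hu, rfl⟩ := mem_clauseEmbedding.1 hv
      exact h _ hu
  refine mem_image.2 ⟨univ.filter (fun D => clauseEmbedding φ D ∈ G), mem_minimalFormulas.2
    ⟨fun D hD => ?_, fun D hD => ?_⟩, ?_⟩
  · have := hGk _ (mem_filter.1 hD).2
    rwa [IsKClause, hcard, hvars, card_map] at this
  · obtain ⟨w, hw, hw'⟩ := hGm _ (mem_filter.1 hD).2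
    exact ⟨fun u => w (φ u), (hsat _ _).1 hw, fun D' hD' hs => (clauseEmbedding φ).injective
      (hw' _ (mem_filter.1 hD').2 ((hsat _ _).2 hs))⟩
  · ext C
    simp only [mem_map, mem_filter, mem_univ, true_and]
    constructor
    · rintro ⟨D, hD, rfl⟩
      exact hD
    · intro hC
      obtain ⟨D, rfl⟩ := hsurj C hC
      exact ⟨D, hC, rfl⟩

theorem card_formulas_avoiding_le {n : ℕ} (v : Fin (n + 1)) :
    ((minimalFormulas k (Fin (n + 1))).filter (fun G => ∀ C ∈ G, v ∉ clauseVars C)).card ≤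
      (minimalFormulas k (Fin n)).card := by
  refine le_trans (card_le_card fun G hG => ?_) (card_formulas_on_range_le (Fin.succAboveEmb v))
  obtain ⟨h1, h2⟩ := mem_filter.1 hG
  refine mem_filter.2 ⟨h1, fun C hC u hu => ?_⟩
  obtain ⟨z, hz⟩ := Fin.exists_succAbove_eq (x := u) (y := v) fun e => h2 C hC (e ▸ hu)
  exact mem_map.2 ⟨z, mem_univ _, hz⟩

theorem eq_union_links {G : SatFormula V} (hG : G ⊆ kClauses k V) (v : V) :
    G = G.filter (fun C => v ∉ clauseVars C) ∪ roughClauses v G ∪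
      ((link k (fun _ => true) v G).image (fun L => posClause (insert v L)) ∪
        (link k (flipAt v) v G).image (fun L => signedClause (flipAt v) (insert v L))) := by
  refine Subset.antisymm (fun C hC => ?_) (union_subset (union_subset (filter_subset _ _)
    (filter_subset _ _)) (union_subset ?_ ?_))
  · have hK := mem_kClauses.1 (hG hC)
    by_cases hv : v ∈ clauseVars C
    swap
    · exact mem_union_left _ (mem_union_left _ (mem_filter.2 ⟨hC, hv⟩))
    by_cases h : ∃ u ≠ v, (u, false) ∈ C
    · exact mem_union_left _ (mem_union_right _ (mem_filter.2 ⟨hC, hv, h⟩))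
    push Not at h
    refine mem_union_right _ ?_
    obtain ⟨b, hb⟩ := mem_clauseVars.1 hv
    have hs : ∀ u b', (u, b') ∈ C → u ≠ v → b' = true := by
      intro u b' hb' huv
      cases b'
      · exact absurd hb' (h u huv)
      · rfl
    cases b
    · have hs' : ∀ u b', (u, b') ∈ C → b' = flipAt v u := by
        intro u b' hb'
        by_cases huv : u = v
        · subst huv
          simpa using hK.polarity_unique hb' hb
        · simpa [huv] using hs u b' hb' huv
      refine mem_union_right _ (mem_image.2 ⟨_, erase_mem_link hK hC hv hs', ?_⟩)
      rw [insert_erase hv, ← eq_signedClause_of_forall hK hs']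
    · have hs' : ∀ u b', (u, b') ∈ C → b' = true := by
        intro u b' hb'
        by_cases huv : u = v
        · subst huv
          exact hK.polarity_unique hb' hb
        · exact hs u b' hb' huv
      refine mem_union_left _ (mem_image.2 ⟨_, erase_mem_link hK hC hv hs', ?_⟩)
      rw [insert_erase hv, posClause, ← eq_signedClause_of_forall hK hs']
  · intro C hC
    obtain ⟨L, hL, rfl⟩ := mem_image.1 hC
    exact (mem_link.1 hL).2
  · intro C hC
    obtain ⟨L, hL, rfl⟩ := mem_image.1 hC
    exact (mem_link.1 hL).2

open scoped Classical in
/-- Centred formulae with a variable of large negative degree and few crossings in links. -/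
noncomputable def vertexBadFormulas (k : ℕ) (V : Type*) [Fintype V] [DecidableEq V] (x : ℝ)
    (t a y : ℕ) : Finset (SatFormula V) :=
  (centeredFormulas k V x).filter (fun G => SparseNegativeExtensions a (negClauses G) ∧
    (∃ v, IsBadSet k t (negClauses G) {(v, false)}) ∧ ∀ v, (crossSets (k - 1)
      (link k (fun _ => true) v G) (link k (flipAt v) v G)).card ≤ y)

theorem mem_vertexBadFormulas {x : ℝ} {t a y : ℕ} {G : SatFormula V} :
    G ∈ vertexBadFormulas k V x t a y ↔ G ∈ centeredFormulas k V x ∧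
      SparseNegativeExtensions a (negClauses G) ∧
      (∃ v, IsBadSet k t (negClauses G) {(v, false)}) ∧ ∀ v, (crossSets (k - 1)
        (link k (fun _ => true) v G) (link k (flipAt v) v G)).card ≤ y := by
  simp only [vertexBadFormulas, mem_filter]

theorem roughClauses_subset (v : V) (G : SatFormula V) : roughClauses v G ⊆ G :=
  filter_subset _ _

theorem card_vertexBadFormulas_mul_le {n t a y z s r d u : ℕ} (hk : 2 ≤ k) (x : ℝ) (hz : 0 < z)
    (hr : 2 * (2 * (n + 1)) ^ (k - 2) * (1 + a) ≤ r)
    (hd : ∀ D, (n + 1) ^ (k - 1) ≤ D * t ^ degExp (k - 1) → r + d ≤ D)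
    (hs : (n + 1) ^ (k - 2) * z ^ 2 + 2 ^ (k - 1) * ((n + 1) ^ (k - 1) + 4 ^ k * y) ≤ s * z)
    (hu : ∀ U, (k = 2 → U = 0) →
      (d - s) * (d - s) ≤ U * (2 ^ (k - 1) * (n + 1) ^ (k - 1)) → u ≤ U) :
    (vertexBadFormulas k (Fin (n + 1)) x t a y).card * 2 ^ u ≤
      (n + 1) * ((minimalFormulas k (Fin n)).card * (((2 * (n + 1)) ^ k + 1) ^ r *
        (2 ^ n.choose (k - 2) * (2 ^ n.choose (k - 1) * (n.choose (k - 1) + 1) ^ (2 * s))))) := by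
  classical
  set T : Fin (n + 1) → Finset (SatFormula (Fin (n + 1)) × SatFormula (Fin (n + 1)) ×
      (Finset (Finset (Fin (n + 1))) × Finset (Finset (Fin (n + 1))))) := fun v =>
    (minimalFormulas k (Fin (n + 1))).filter (fun G => ∀ C ∈ G, v ∉ clauseVars C) ×ˢ
      smallFormulas k (Fin (n + 1)) r ×ˢ labelledPairs (univ.erase v) (k - 1) s u with hT
  have hfib : ∀ v, ((vertexBadFormulas k (Fin (n + 1)) x t a y).filter (fun G =>
      IsBadSet k t (negClauses G) {(v, false)})).card ≤ (T v).card := by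
    intro v
    refine card_le_card_of_injOn (fun G => (G.filter (fun C => v ∉ clauseVars C),
      roughClauses v G, (link k (fun _ => true) v G, link k (flipAt v) v G)))
      (fun G hG => ?_) fun G hG G' hG' he => ?_
    · obtain ⟨hG, hbad⟩ := mem_filter.1 hG
      obtain ⟨hGc, hsp, -, hy⟩ := mem_vertexBadFormulas.1 hG
      obtain ⟨hGk, hGm, -, hσ⟩ := centeredFormulas_props hGc
      have hrough : (roughClauses v G).card ≤ r :=
        (card_roughClauses_le hGk hsp v).trans (by rw [Fintype.card_fin]; exact hr)
      refine mem_product.2 ⟨mem_filter.2 ⟨mem_minimalFormulas.2 ⟨isKFormula_iff.2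
        ((filter_subset _ _).trans hGk), hGm.mono (filter_subset _ _)⟩,
        fun C hC => (mem_filter.1 hC).2⟩, mem_product.2 ⟨mem_filter.2 ⟨mem_powerset.2
        ((roughClauses_subset v G).trans hGk), hrough⟩, ?_⟩⟩
      have hN : d ≤ (link k (flipAt v) v G).card := by
        rw [IsBadSet, card_singleton, Fintype.card_fin] at hbad
        have h1 := hd _ hbad
        have h2 := litDeg_le_rough_add_link hGk v
        omega
      refine mem_labelledPairs_of_cross (z := z) (y := y) (d := d) (by omega) hz
        (link_subset _ _ _) (link_subset _ _ _) (hy v)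
        (hN.trans (card_link_flipAt_le hGk (hσ _))) hN ?_ ?_
      · rw [Fintype.card_fin, show k - 1 - 1 = k - 2 by omega, show k - 1 + 1 = k by omega]
        exact hs
      · intro U hU
        rw [Fintype.card_fin]
        exact hu U fun h => hU (by omega)
    · obtain ⟨h1, h2, h3, h4⟩ := by simpa only [Prod.mk.injEq] using he
      have hGk := (centeredFormulas_props (mem_vertexBadFormulas.1 (mem_filter.1 hG).1).1).1
      have hGk' := (centeredFormulas_props (mem_vertexBadFormulas.1 (mem_filter.1 hG').1).1).1
      rw [eq_union_links hGk v, eq_union_links hGk' v, h1, h2, h3, h4]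
  have hcover : vertexBadFormulas k (Fin (n + 1)) x t a y ⊆ univ.biUnion (fun v =>
      (vertexBadFormulas k (Fin (n + 1)) x t a y).filter (fun G =>
        IsBadSet k t (negClauses G) {(v, false)})) := by
    intro G hG
    obtain ⟨v, hv⟩ := (mem_vertexBadFormulas.1 hG).2.2.1
    exact mem_biUnion.2 ⟨v, mem_univ _, mem_filter.2 ⟨hG, hv⟩⟩
  refine (Nat.mul_le_mul_right _ ((card_le_card hcover).trans card_biUnion_le)).trans ?_
  rw [sum_mul]
  refine (sum_le_card_nsmul _ _ _ fun v _ => ?_).trans (by rw [smul_eq_mul, card_univ,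
    Fintype.card_fin])
  refine (Nat.mul_le_mul_right _ (hfib v)).trans ?_
  rw [hT, card_product, card_product, mul_assoc, mul_assoc]
  have h1 := card_formulas_avoiding_le (k := k) v
  have h2 := card_smallFormulas_le (V := Fin (n + 1)) k r
  have h3 := card_labelledPairs_mul_le (E := univ.erase v) (m := k - 1) (s := s) (u := u) (by omega)
  rw [Fintype.card_fin] at h2
  rw [card_erase_of_mem (mem_univ _), card_univ, Fintype.card_fin, Nat.add_sub_cancel,
    show k - 1 - 1 = k - 2 by omega] at h3
  refine Nat.mul_le_mul ?_ (Nat.mul_le_mul h2 h3)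
  exact h1

theorem le_two_mul_div_mul {m q : ℕ} (hq : 0 < q) (hqm : q ≤ m) : m ≤ 2 * (m / q) * q := by
  have h1 := Nat.div_add_mod m q
  have h2 := Nat.mod_lt m hq
  have h3 : 1 ≤ m / q := Nat.div_pos hqm hq
  nlinarith

theorem link_separation_bound {k N t s z y g : ℕ} (hk : 2 ≤ k) (ht : 12 * 8 ^ k ≤ t)
    (hN : t ^ (2 * g + 2) ≤ N) (hs : N ^ (k - 1) ≤ 2 * s * t ^ g) (hz : z * t ^ (g + 1) ≤ N)
    (hz' : N ≤ 2 * z * t ^ (g + 1)) (hy : y * t ^ (2 * g + 2) ≤ N ^ k) :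
    N ^ (k - 2) * z ^ 2 + 2 ^ (k - 1) * (N ^ (k - 1) + 4 ^ k * y) ≤ s * z := by
  obtain ⟨j, rfl⟩ := Nat.exists_eq_add_of_le' hk
  simp only [show j + 2 - 2 = j by omega, show j + 2 - 1 = j + 1 by omega] at *
  have h8 : (8:ℕ) ^ (j + 2) = 2 ^ (j + 2) * 4 ^ (j + 2) := by rw [← mul_pow]; norm_num
  have h2 : 1 ≤ 2 ^ (j + 1) := Nat.one_le_two_pow
  have h4 : 1 ≤ 4 ^ (j + 2) := Nat.one_le_pow _ _ (by norm_num)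
  have h22 : (2:ℕ) ^ (j + 2) = 2 * 2 ^ (j + 1) := by rw [pow_succ, mul_comm]
  have ht0 : 0 < t := lt_of_lt_of_le (by positivity) ht
  have hprod : N ^ (j + 2) ≤ 4 * (s * z) * t ^ (2 * g + 1) := by
    calc N ^ (j + 2) = N ^ (j + 1) * N := pow_succ _ _
      _ ≤ (2 * s * t ^ g) * (2 * z * t ^ (g + 1)) := Nat.mul_le_mul hs hz'
      _ = _ := by ring
  set E := 2 ^ (j + 1) * 4 ^ (j + 2) with hE
  have htE : 24 * E ≤ t := by rw [h8, h22] at ht; nlinarith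
  have h2E : 2 ^ (j + 1) ≤ E := by nlinarith
  have hE1 : 1 ≤ E := h2.trans h2E
  have e1 : 3 * (N ^ j * z ^ 2) ≤ s * z := by
    have : N ^ j * z ^ 2 * t * t ^ g ≤ 2 * (s * z) * t ^ g := by
      calc N ^ j * z ^ 2 * t * t ^ g = N ^ j * z * (z * t ^ (g + 1)) := by ring
        _ ≤ N ^ j * z * N := Nat.mul_le_mul_left _ hz
        _ = N ^ (j + 1) * z := by ring
        _ ≤ 2 * s * t ^ g * z := Nat.mul_le_mul_right _ hs
        _ = _ := by ring
    have := Nat.le_of_mul_le_mul_right this (by positivity)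
    have h6 : N ^ j * z ^ 2 * 6 ≤ N ^ j * z ^ 2 * t := Nat.mul_le_mul_left _ (by omega)
    omega
  have e2 : 3 * (2 ^ (j + 1) * N ^ (j + 1)) ≤ s * z := by
    have : N ^ (j + 1) * t * t ^ (2 * g + 1) ≤ 4 * (s * z) * t ^ (2 * g + 1) := by
      calc N ^ (j + 1) * t * t ^ (2 * g + 1) = N ^ (j + 1) * t ^ (2 * g + 2) := by ring
        _ ≤ N ^ (j + 1) * N := Nat.mul_le_mul_left _ hN
        _ ≤ _ := by rw [← pow_succ]; exact hprod
    have := Nat.le_of_mul_le_mul_right this (by positivity)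
    have h6 : N ^ (j + 1) * (12 * 2 ^ (j + 1)) ≤ N ^ (j + 1) * t :=
      Nat.mul_le_mul_left _ (by omega)
    nlinarith
  have e3 : 3 * (E * y) ≤ s * z := by
    have : y * t * t ^ (2 * g + 1) ≤ 4 * (s * z) * t ^ (2 * g + 1) := by
      calc y * t * t ^ (2 * g + 1) = y * t ^ (2 * g + 2) := by ring
        _ ≤ _ := hy.trans hprod
    have := Nat.le_of_mul_le_mul_right this (by positivity)
    have h6 : y * (12 * E) ≤ y * t := Nat.mul_le_mul_left _ (by omega)
    nlinarith
  have : 2 ^ (j + 1) * (N ^ (j + 1) + 4 ^ (j + 2) * y) = 2 ^ (j + 1) * N ^ (j + 1) + E * y := by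
    rw [hE]; ring
  omega

set_option maxHeartbeats 1000000 in
theorem card_vertexBadFormulas_le {n t a y : ℕ} (hk : 2 ≤ k) (x : ℝ) (ht : 12 * 8 ^ k ≤ t)
    (hN : t ^ (4 * degExp (k - 1) + 16) ≤ n + 1) (hn2 : 2 * (n + 1) ≤ 2 ^ t)
    (ha1 : 1 ≤ a) (ha : a * t ^ (2 * degExp (k - 1) + 9) ≤ n + 1)
    (hy : y * t ^ (4 * degExp (k - 1) + 16) ≤ (n + 1) ^ k) :
    (vertexBadFormulas k (Fin (n + 1)) x t a y).card * 2 ^ (2 * (n + 1)) ≤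
      (minimalFormulas k (Fin n)).card * 2 ^ n.choose (k - 1) := by
  set c := degExp (k - 1) with hc
  set N := n + 1 with hNn
  set Q := N ^ (k - 1) with hQ
  have hkt : 8 * k ≤ t := le_trans (by have := (Nat.lt_pow_self (by norm_num : 1 < 8) : k < 8 ^ k); omega) ht
  have h2k : 2 ^ k ≤ t :=
    le_trans (by have := Nat.pow_le_pow_left (by norm_num : 2 ≤ 8) k; omega) ht
  have ht0 : 0 < t := by omega
  have hN0 : 0 < N := by omega
  have hQ0 : 0 < Q := by positivity
  have hNQ : N ≤ Q := Nat.le_self_pow (by omega) _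
  have htpow : ∀ i ≤ 4 * c + 16, t ^ i ≤ N := fun i hi => (Nat.pow_le_pow_right ht0 hi).trans hN
  set s := Q / t ^ (2 * c + 7) with hs
  set z := N / t ^ (2 * c + 8) with hz
  set d := Q / t ^ (c + 1) with hd
  set r := 2 * (2 * N) ^ (k - 2) * (1 + a) with hr
  have hs1 : s * t ^ (2 * c + 7) ≤ Q := Nat.div_mul_le_self _ _
  have hs2 : Q ≤ 2 * s * t ^ (2 * c + 7) :=
    le_two_mul_div_mul (by positivity) ((htpow _ (by omega)).trans hNQ)
  have hz1 : z * t ^ (2 * c + 8) ≤ N := Nat.div_mul_le_self _ _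
  have hz2 : N ≤ 2 * z * t ^ (2 * c + 8) :=
    le_two_mul_div_mul (by positivity) (htpow _ (by omega))
  have hz0 : 0 < z := Nat.div_pos (htpow _ (by omega)) (by positivity)
  have hd1 : d * t ^ (c + 1) ≤ Q := Nat.div_mul_le_self _ _
  have hd2 : Q ≤ 2 * d * t ^ (c + 1) :=
    le_two_mul_div_mul (by positivity) ((htpow _ (by omega)).trans hNQ)
  have hNk : N ^ (k - 2) * N = Q := by rw [hQ, ← pow_succ]; congr 1; omega
  have hr1 : r * t ^ (2 * c + 8) ≤ Q := by
    refine Nat.le_of_mul_le_mul_right (c := t) ?_ ht0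
    calc r * t ^ (2 * c + 8) * t = 2 * (2 * N) ^ (k - 2) * (1 + a) * t ^ (2 * c + 9) := by
          rw [hr]; ring
      _ ≤ 2 * (2 * N) ^ (k - 2) * (2 * a) * t ^ (2 * c + 9) := by gcongr; omega
      _ = 2 ^ (k - 2) * 2 ^ 2 * (N ^ (k - 2) * (a * t ^ (2 * c + 9))) := by rw [mul_pow]; ring
      _ ≤ 2 ^ (k - 2) * 2 ^ 2 * (N ^ (k - 2) * N) := by gcongr
      _ = 2 ^ k * Q := by rw [hNk, ← pow_add]; congr 2; omega
      _ ≤ Q * t := by rw [mul_comm]; exact Nat.mul_le_mul_left _ h2k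
  set u := 3 * N + (t * k + 1) * r + n ^ (k - 2) + 2 * s * (t * k) with hu
  have hsep := link_separation_bound (g := 2 * c + 7) (y := y) hk ht
    (by rwa [show 2 * (2 * c + 7) + 2 = 4 * c + 16 by ring]) hs2 hz1 hz2
    (by rwa [show 2 * (2 * c + 7) + 2 = 4 * c + 16 by ring])
  have hmain := card_vertexBadFormulas_mul_le (n := n) (t := t) (a := a) (y := y) (z := z) (s := s)
    (r := r) (d := d) (u := u) hk x hz0 le_rfl (by
      intro D hD
      refine Nat.le_of_mul_le_mul_right (c := t ^ (c + 1)) ?_ (by positivity)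
      have h1 : r * t ^ (c + 1) ≤ Q :=
        (Nat.mul_le_mul_left _ (Nat.pow_le_pow_right ht0 (by omega))).trans hr1
      have h2 : Q * 2 ≤ D * t ^ c * t := Nat.mul_le_mul hD (by omega)
      rw [add_mul]
      calc _ ≤ Q * 2 := by omega
        _ ≤ _ := h2
        _ = _ := by rw [pow_succ]; ring) hsep (by
      intro U hU hdU
      have h1 : Q ≤ (d - s) * t ^ (c + 2) := by
        have h3 : s * t ^ (c + 2) ≤ Q :=
          (Nat.mul_le_mul_left _ (Nat.pow_le_pow_right ht0 (by omega))).trans hs1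
        have h4 : 2 * Q ≤ d * t ^ (c + 2) := by
          have : 4 * (d * t ^ (c + 1)) ≤ t * (d * t ^ (c + 1)) :=
            Nat.mul_le_mul_right _ (by omega)
          have h5 : d * t ^ (c + 2) = t * (d * t ^ (c + 1)) := by ring
          nlinarith
        rw [Nat.sub_mul]
        omega
      have h2 : Q ≤ U * t ^ (2 * c + 5) := by
        refine Nat.le_of_mul_le_mul_right (c := Q) ?_ hQ0
        calc Q * Q ≤ ((d - s) * t ^ (c + 2)) * ((d - s) * t ^ (c + 2)) := Nat.mul_le_mul h1 h1
          _ = (d - s) * (d - s) * t ^ (2 * c + 4) := by ring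
          _ ≤ U * (2 ^ (k - 1) * Q) * t ^ (2 * c + 4) := Nat.mul_le_mul_right _ hdU
          _ ≤ U * (t * Q) * t ^ (2 * c + 4) := by
              gcongr
              exact (Nat.pow_le_pow_right (by norm_num) (by omega)).trans h2k
          _ = _ := by ring
      rcases hk.eq_or_lt with h | h
      · rw [hU h.symm] at h2; omega
      refine Nat.le_of_mul_le_mul_right (c := t ^ (2 * c + 5)) (le_trans ?_ h2) (by positivity)
      have hQ2 : N * N ≤ Q := by
        rw [← sq, hQ]; exact Nat.pow_le_pow_right hN0 (by omega)
      have htN : 12 * t ^ (2 * c + 5) ≤ N := by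
        refine le_trans ?_ (htpow (2 * c + 6) (by omega))
        rw [pow_succ _ (2 * c + 5), mul_comm]
        exact Nat.mul_le_mul_left _ (by omega)
      have e1 : 4 * (3 * N * t ^ (2 * c + 5)) ≤ Q := by nlinarith
      have e2 : 4 * ((t * k + 1) * r * t ^ (2 * c + 5)) ≤ Q := by
        refine le_trans ?_ hr1
        have : 4 * (t * k + 1) ≤ t ^ 3 := by
          have h5 : t * (8 * k) ≤ t * t := Nat.mul_le_mul_left _ hkt
          have h6 : t * t * 1 ≤ t * t * t := Nat.mul_le_mul_left _ ht0
          have h7 : 1 * t ≤ t * t := Nat.mul_le_mul_right _ ht0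
          rw [pow_succ, sq]
          nlinarith
        calc _ = 4 * (t * k + 1) * (r * t ^ (2 * c + 5)) := by ring
          _ ≤ t ^ 3 * (r * t ^ (2 * c + 5)) := Nat.mul_le_mul_right _ this
          _ = _ := by ring
      have e3 : 4 * (n ^ (k - 2) * t ^ (2 * c + 5)) ≤ Q := by
        rw [← hNk]
        calc _ = n ^ (k - 2) * (4 * t ^ (2 * c + 5)) := by ring
          _ ≤ N ^ (k - 2) * N := by gcongr <;> omega
      have e4 : 4 * (2 * s * (t * k) * t ^ (2 * c + 5)) ≤ Q := by
        refine le_trans ?_ hs1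
        calc _ = (8 * k) * (s * t ^ (2 * c + 6)) := by ring
          _ ≤ t * (s * t ^ (2 * c + 6)) := Nat.mul_le_mul_right _ hkt
          _ = _ := by ring
      rw [hu, add_mul, add_mul, add_mul]
      omega)
  have hbase : (2 * N) ^ k + 1 ≤ 2 ^ (t * k + 1) := by
    have := Nat.pow_le_pow_left hn2 k
    rw [← pow_mul] at this
    have h1 : 1 ≤ 2 ^ (t * k) := Nat.one_le_two_pow
    rw [pow_succ]
    omega
  have hch : n.choose (k - 1) + 1 ≤ 2 ^ (t * k) := by
    have h1 : n.choose (k - 1) ≤ n ^ (k - 1) := Nat.choose_le_pow _ _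
    have h2 : n ^ (k - 1) ≤ N ^ k :=
      (Nat.pow_le_pow_left (by omega) _).trans (Nat.pow_le_pow_right hN0 (by omega))
    have h3 : N ^ k < (2 * N) ^ k := Nat.pow_lt_pow_left (by omega) (by omega)
    have h4 := Nat.pow_le_pow_left hn2 k
    rw [← pow_mul] at h4
    omega
  have hch2 : n.choose (k - 2) ≤ n ^ (k - 2) := Nat.choose_le_pow _ _
  have hNN : N ≤ 2 ^ N := Nat.lt_two_pow_self.le
  refine Nat.le_of_mul_le_mul_right (c := 2 ^ (N + (t * k + 1) * r + n ^ (k - 2) +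
    2 * s * (t * k))) ?_ (by positivity)
  calc _ = (vertexBadFormulas k (Fin N) x t a y).card * 2 ^ u := by
        rw [mul_assoc, ← pow_add]; congr 2; rw [hu]; ring
    _ ≤ _ := hmain
    _ ≤ 2 ^ N * ((minimalFormulas k (Fin n)).card * ((2 ^ (t * k + 1)) ^ r *
          (2 ^ n ^ (k - 2) * (2 ^ n.choose (k - 1) * (2 ^ (t * k)) ^ (2 * s))))) := by
        gcongr
        norm_num
    _ = _ := by
        rw [← pow_mul, ← pow_mul, pow_add, pow_add, pow_add, mul_comm (2 * s) (t * k)]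
        ring

theorem pow_base_le {N t X : ℕ} (hN : 2 * N ≤ 2 ^ t) :
    ((2 * N) ^ k + 1) ^ X ≤ 2 ^ ((t * k + 1) * X) := by
  rw [pow_mul]
  refine Nat.pow_le_pow_left ?_ _
  have h1 := Nat.pow_le_pow_left hN k
  rw [← pow_mul] at h1
  have h2 : 1 ≤ 2 ^ (t * k) := Nat.one_le_two_pow
  rw [pow_succ]
  omega

open scoped Classical in
theorem card_not_meetsLargeSets_mul_le {x : ℝ} {t a : ℕ} (ht : 2 * Fintype.card V ≤ 2 ^ t)
    (ha : a ≤ Fintype.card V)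
    (hx : (t * k + 1) * ⌊x⌋₊ + 2 * Fintype.card V ≤ a.choose k) :
    ((centeredFormulas k V x).filter (fun G => ¬ MeetsLargeSets k a G)).card *
      2 ^ Fintype.card V ≤ 2 ^ (Fintype.card V).choose k := by
  have hC : a.choose k ≤ (Fintype.card V).choose k := Nat.choose_le_choose _ ha
  calc _ ≤ 2 ^ ((t * k + 1) * ⌊x⌋₊) *
        (2 ^ Fintype.card V * 2 ^ ((Fintype.card V).choose k - a.choose k)) *
        2 ^ Fintype.card V :=
        Nat.mul_le_mul_right _ ((card_not_meetsLargeSets_le x a).trans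
          (Nat.mul_le_mul_right _ (pow_base_le ht)))
    _ = 2 ^ ((t * k + 1) * ⌊x⌋₊ + (Fintype.card V + ((Fintype.card V).choose k - a.choose k)) +
          Fintype.card V) := by rw [pow_add, pow_add, pow_add]
    _ ≤ _ := Nat.pow_le_pow_right (by norm_num) (by omega)

open scoped Classical in
theorem card_large_crossSets_mul_le {x : ℝ} {t y : ℕ} (hk : 1 ≤ k)
    (ht : 2 * Fintype.card V ≤ 2 ^ t)
    (hx : (t * k + 1) * ⌊x⌋₊ + 2 * Fintype.card V + Fintype.card V ^ (k - 1) ≤ y) :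
    ((centeredFormulas k V x).filter (fun G => ∃ v, y ≤ (crossSets (k - 1)
      (link k (fun _ => true) v G) (link k (flipAt v) v G)).card)).card *
      2 ^ Fintype.card V ≤ 2 ^ (Fintype.card V).choose k := by
  have h1 : (Fintype.card V).choose (k - 1) ≤ Fintype.card V ^ (k - 1) := Nat.choose_le_pow _ _
  have h2 : Fintype.card V ≤ 2 ^ Fintype.card V := Nat.lt_two_pow_self.le
  refine Nat.le_of_mul_le_mul_right (c := 2 ^ y) ?_ (by positivity)
  rw [mul_right_comm]
  calc _ ≤ 2 ^ ((t * k + 1) * ⌊x⌋₊) * (2 ^ Fintype.card V *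
        (2 ^ (Fintype.card V).choose (k - 1) * 2 ^ (Fintype.card V).choose k)) *
        2 ^ Fintype.card V :=
        Nat.mul_le_mul_right _ ((card_large_crossSets_le hk x y).trans
          (Nat.mul_le_mul (pow_base_le ht) (Nat.mul_le_mul_right _ h2)))
    _ = 2 ^ ((t * k + 1) * ⌊x⌋₊ + (Fintype.card V + ((Fintype.card V).choose (k - 1) +
          (Fintype.card V).choose k)) + Fintype.card V) := by
        rw [pow_add, pow_add, pow_add, pow_add]
    _ ≤ 2 ^ ((Fintype.card V).choose k + y) := Nat.pow_le_pow_right (by norm_num) (by omega)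
    _ = _ := pow_add _ _ _

open scoped Classical in
theorem card_centeredFormulas_le (x : ℝ) (t a y : ℕ) : (centeredFormulas k V x).card ≤
    ((centeredFormulas k V x).filter (fun G => negClauses G = ∅)).card +
    ((centeredFormulas k V x).filter (fun G => ¬ MeetsLargeSets k a G)).card +
    ((centeredFormulas k V x).filter (fun G => ∃ v, y ≤ (crossSets (k - 1)
      (link k (fun _ => true) v G) (link k (flipAt v) v G)).card)).card +
    (spreadFormulas k V x t a).card + (vertexBadFormulas k V x t a y).card := by
  refine le_trans (card_le_card fun G hG => ?_) ((card_union_le _ _).trans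
    (Nat.add_le_add_right ((card_union_le _ _).trans (Nat.add_le_add_right ((card_union_le _ _).trans
      (Nat.add_le_add_right (card_union_le _ _) _)) _)) _))
  simp only [mem_union, mem_filter, mem_vertexBadFormulas, spreadFormulas]
  obtain ⟨hGk, hGm, -⟩ := centeredFormulas_props hG
  by_cases h1 : negClauses G = ∅
  · exact Or.inl (Or.inl (Or.inl (Or.inl ⟨hG, h1⟩)))
  by_cases h2 : MeetsLargeSets k a G
  swap
  · exact Or.inl (Or.inl (Or.inl (Or.inr ⟨hG, h2⟩)))
  have hsp := h2.sparseNegativeExtensions hGk hGm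
  by_cases h3 : ∃ v, y ≤ (crossSets (k - 1) (link k (fun _ => true) v G)
      (link k (flipAt v) v G)).card
  · exact Or.inl (Or.inl (Or.inr ⟨hG, h3⟩))
  by_cases h4 : ∃ v, IsBadSet k t (negClauses G) {(v, false)}
  · push Not at h3
    exact Or.inr ⟨hG, hsp, h4, fun v => (h3 v).le⟩
  · push Not at h4
    exact Or.inl (Or.inr ⟨hG, nonempty_iff_ne_empty.2 h1, hsp, h4⟩)

theorem pow_le_choose_mul {a k : ℕ} (h : 2 * k ≤ a) :
    a ^ k ≤ (2 * k) ^ k * a.choose k := by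
  have h1 : (a + 1 - k) ^ k ≤ k.factorial * a.choose k := by
    rw [← Nat.descFactorial_eq_factorial_mul_choose]
    exact Nat.pow_sub_le_descFactorial a k
  calc a ^ k ≤ (2 * (a + 1 - k)) ^ k := Nat.pow_le_pow_left (by omega) _
    _ = 2 ^ k * (a + 1 - k) ^ k := mul_pow _ _ _
    _ ≤ 2 ^ k * (k ^ k * a.choose k) := by
        gcongr
        exact h1.trans (Nat.mul_le_mul_right _ (Nat.factorial_le_pow _))
    _ = _ := by rw [mul_pow]; ring

theorem error_le_choose {N t a X p m : ℕ} (hk : 2 ≤ k) (ht : 12 * 8 ^ k ≤ t)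
    (hN : t ^ m ≤ N) (hm : p * k + k + 3 ≤ m) (ha : N ≤ 2 * a * t ^ p) (hak : 2 * k ≤ a)
    (hX : X * t ^ m ≤ N ^ k) : (t * k + 1) * X + 2 * N ≤ a.choose k := by
  have hkt : 8 * k ≤ t :=
    le_trans (by have := (Nat.lt_pow_self (by norm_num : 1 < 8) : k < 8 ^ k); omega) ht
  have ht0 : 0 < t := by omega
  have hN0 : 0 < N := (pow_pos ht0 m).trans_le hN
  refine Nat.le_of_mul_le_mul_right (c := t ^ (p * k + k)) ?_ (by positivity)
  have h1 : N ^ k ≤ a.choose k * t ^ (p * k + k) := by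
    calc N ^ k ≤ (2 * a * t ^ p) ^ k := Nat.pow_le_pow_left ha _
      _ = 2 ^ k * t ^ (p * k) * a ^ k := by rw [mul_pow, mul_pow, pow_mul]; ring
      _ ≤ 2 ^ k * t ^ (p * k) * ((2 * k) ^ k * a.choose k) :=
          Nat.mul_le_mul_left _ (pow_le_choose_mul hak)
      _ = a.choose k * (t ^ (p * k) * (4 * k) ^ k) := by
          rw [show 4 * k = 2 * (2 * k) by ring, mul_pow 2 (2 * k)]; ring
      _ ≤ a.choose k * (t ^ (p * k) * t ^ k) := by gcongr; omega
      _ = _ := by rw [pow_add]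
  have h2 : 2 * ((t * k + 1) * X * t ^ (p * k + k)) ≤ N ^ k := by
    refine le_trans ?_ (le_trans (Nat.mul_le_mul_left X (Nat.pow_le_pow_right ht0 hm)) hX)
    have : 2 * (t * k + 1) ≤ t ^ 3 := by
      have h5 : t * (8 * k) ≤ t * t := Nat.mul_le_mul_left _ hkt
      have h6 : t * t * 1 ≤ t * t * t := Nat.mul_le_mul_left _ ht0
      have h7 : 1 * t ≤ t * t := Nat.mul_le_mul_right _ ht0
      rw [pow_succ, sq]
      nlinarith
    calc _ = 2 * (t * k + 1) * (X * t ^ (p * k + k)) := by ring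
      _ ≤ t ^ 3 * (X * t ^ (p * k + k)) := Nat.mul_le_mul_right _ this
      _ = _ := by ring
  have h3 : 2 * (2 * N * t ^ (p * k + k)) ≤ N ^ k := by
    calc _ = N * (4 * t ^ (p * k + k)) := by ring
      _ ≤ N * (t * t ^ (p * k + k)) := by gcongr; omega
      _ = N * t ^ (p * k + k + 1) := by ring
      _ ≤ N * N := Nat.mul_le_mul_left _ ((Nat.pow_le_pow_right ht0 (by omega)).trans hN)
      _ = N ^ 2 := (sq _).symm
      _ ≤ _ := Nat.pow_le_pow_right hN0 hk
  rw [add_mul]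
  omega

theorem error_le_crossings {N t y X e m : ℕ} (hk : 2 ≤ k) (ht : 12 * 8 ^ k ≤ t)
    (hN : t ^ m ≤ N) (hm : e + 3 ≤ m) (hy : N ^ k ≤ 2 * y * t ^ e)
    (hX : X * t ^ m ≤ N ^ k) : (t * k + 1) * X + 2 * N + N ^ (k - 1) ≤ y := by
  have hkt : 8 * k ≤ t :=
    le_trans (by have := (Nat.lt_pow_self (by norm_num : 1 < 8) : k < 8 ^ k); omega) ht
  have ht64 : 64 ≤ t := by have := Nat.pow_le_pow_right (by norm_num : 0 < 8) hk; omega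
  have ht0 : 0 < t := by omega
  have hN0 : 0 < N := (pow_pos ht0 m).trans_le hN
  refine Nat.le_of_mul_le_mul_right (c := 2 * t ^ e) ?_ (by positivity)
  have h2 : 3 * ((t * k + 1) * X * (2 * t ^ e)) ≤ N ^ k := by
    refine le_trans ?_ (le_trans (Nat.mul_le_mul_left X (Nat.pow_le_pow_right ht0 hm)) hX)
    have : 6 * (t * k + 1) ≤ t ^ 3 := by
      have h5 : t * (8 * k) ≤ t * t := Nat.mul_le_mul_left _ hkt
      have h6 : t * t * 2 ≤ t * t * t := Nat.mul_le_mul_left _ (by omega)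
      have h7 : 6 * t ≤ t * t := Nat.mul_le_mul_right _ (by omega)
      rw [pow_succ, sq]
      nlinarith
    calc _ = 6 * (t * k + 1) * (X * t ^ e) := by ring
      _ ≤ t ^ 3 * (X * t ^ e) := Nat.mul_le_mul_right _ this
      _ = _ := by ring
  have h4 : 12 * t ^ e ≤ N := by
    calc _ ≤ t * t ^ e := Nat.mul_le_mul_right _ (by omega)
      _ = t ^ (e + 1) := by ring
      _ ≤ N := (Nat.pow_le_pow_right ht0 (by omega)).trans hN
  have h3 : 3 * (2 * N * (2 * t ^ e)) ≤ N ^ k := by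
    calc _ = N * (12 * t ^ e) := by ring
      _ ≤ N * N := Nat.mul_le_mul_left _ h4
      _ = N ^ 2 := (sq _).symm
      _ ≤ _ := Nat.pow_le_pow_right hN0 hk
  have h5 : 3 * (N ^ (k - 1) * (2 * t ^ e)) ≤ N ^ k := by
    calc _ = N ^ (k - 1) * (6 * t ^ e) := by ring
      _ ≤ N ^ (k - 1) * N := Nat.mul_le_mul_left _ (by omega)
      _ = N ^ k := by rw [← pow_succ]; congr 1; omega
  rw [add_mul, add_mul]
  have h6 : y * (2 * t ^ e) = 2 * y * t ^ e := by ring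
  omega

theorem sum_error_le {f f' A c M B D S W P Q R τ : ℝ} (hτ : 0 < τ) (hP : τ ≤ P) (hQ : 0 ≤ Q)
    (hf : f ≤ A + P * c) (hA : A ≤ Q) (hc : c ≤ M + B + D + S + W) (hM : M ≤ Q)
    (hB : B * P ≤ Q) (hD : D * P ≤ Q) (hS : S ≤ 4 * Q / τ) (hW : W * P ^ 2 ≤ f' * R) :
    f ≤ P * Q * (1 + 7 / τ) + f' * R / P := by
  have hP0 : 0 < P := hτ.trans_le hP
  have h1 : P * c ≤ P * (M + B + D + S + W) := mul_le_mul_of_nonneg_left hc hP0.le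
  have h2 : P * M ≤ P * Q := mul_le_mul_of_nonneg_left hM hP0.le
  have h3 : P * S ≤ P * (4 * Q / τ) := mul_le_mul_of_nonneg_left hS hP0.le
  have h4 : P * W ≤ f' * R / P := by
    rw [le_div_iff₀ hP0]
    linarith [show P * W * P = W * P ^ 2 by ring]
  have h5 : Q ≤ P * Q / τ := by
    rw [le_div_iff₀ hτ, mul_comm]
    exact mul_le_mul_of_nonneg_right hP hQ
  have h6 : P * Q * (1 + 7 / τ) = P * Q + 3 * (P * Q / τ) + P * (4 * Q / τ) := by ring
  rw [h6]
  linarith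

set_option maxHeartbeats 1000000 in
theorem card_minimalFormulas_succ_le (hk : 2 ≤ k) : ∃ K T : ℕ, ∀ t ≥ T, ∀ n : ℕ, t ^ K ≤ n + 1 →
    2 * (n + 1) ≤ 2 ^ t → ((minimalFormulas k (Fin (n + 1))).card : ℝ) ≤
      2 ^ (n + 1) * 2 ^ (n + 1).choose k * (1 + 7 / 2 ^ t) +
        (minimalFormulas k (Fin n)).card * 2 ^ n.choose (k - 1) / 2 ^ (n + 1) := by
  classical
  obtain ⟨K₀, u₀, hfar⟩ := card_far_from_monotone_le hk
  set c := degExp (k - 1) with hc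
  set q := degExp k with hq
  set p := 2 * c + q + 11 with hp
  set e := 4 * c + 16 with he
  set m := p * k + k + e + q + 10 with hm
  set T₀ : ℕ := (k + 1) * (2 * k + 1 + 2 ^ k) + 1 with hT₀
  refine ⟨m * (K₀ + 1), 12 * 8 ^ k + 4 ^ k * (2 * (2 ^ k * (k + 1))) + u₀ +
    ⌈T₀ * spreadConst k⌉₊, fun t ht n hn hn2 => ?_⟩
  have hct : T₀ * spreadConst k ≤ t := (Nat.le_ceil _).trans (Nat.cast_le.2 (by omega))
  have ht12 : 12 * 8 ^ k ≤ t := by omega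
  have hkt : 8 * k ≤ t :=
    le_trans (by have := (Nat.lt_pow_self (by norm_num : 1 < 8) : k < 8 ^ k); omega) ht12
  have ht0 : 0 < t := by omega
  set N := n + 1 with hNn
  have hNm : t ^ m ≤ N := (Nat.pow_le_pow_right ht0 (Nat.le_mul_of_pos_right _ (by omega))).trans hn
  have hNi : ∀ i ≤ m, t ^ i ≤ N := fun i hi => (Nat.pow_le_pow_right ht0 hi).trans hNm
  have hpm : p ≤ m := by have : p * 1 ≤ p * k := Nat.mul_le_mul_left _ (by omega); omega
  have hp1m : p + 1 ≤ m := by have : p * 1 ≤ p * k := Nat.mul_le_mul_left _ (by omega); omega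
  have htN : t ≤ N := by simpa using hNi 1 (by omega)
  have hNk : N ≤ N ^ k := Nat.le_self_pow (by omega) _
  set a := N / t ^ p with ha
  have ha1 : a * t ^ p ≤ N := Nat.div_mul_le_self _ _
  have ha2 : N ≤ 2 * a * t ^ p := le_two_mul_div_mul (by positivity) (hNi _ hpm)
  have hta : t ≤ a := by
    rw [ha, Nat.le_div_iff_mul_le (by positivity), ← pow_succ']
    exact hNi _ hp1m
  set y := N ^ k / t ^ e with hy
  have hy1 : y * t ^ e ≤ N ^ k := Nat.div_mul_le_self _ _
  have hy2 : N ^ k ≤ 2 * y * t ^ e :=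
    le_two_mul_div_mul (by positivity) ((hNi _ (by omega)).trans hNk)
  set x : ℝ := (N : ℝ) ^ k / (t ^ m : ℕ) with hx
  have hx0 : 0 ≤ x := by positivity
  have htm : (0:ℝ) < (t ^ m : ℕ) := by exact_mod_cast pow_pos ht0 m
  have hX : ⌊x⌋₊ * t ^ m ≤ N ^ k := by
    have h1 : (⌊x⌋₊ : ℝ) * (t ^ m : ℕ) ≤ (N : ℝ) ^ k := by
      rw [← le_div_iff₀ htm]; exact Nat.floor_le hx0
    exact_mod_cast h1
  have ha3 : ∀ i ≤ p, a * t ^ i ≤ N := fun i hi =>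
    (Nat.mul_le_mul_left _ (Nat.pow_le_pow_right ht0 hi)).trans ha1
  have haN : a ≤ N := by simpa using ha3 0 (by omega)
  have e0 : (((minimalFormulas k (Fin N)).filter
      (fun G => ∀ σ, x < (nonMonotone σ G).card)).card : ℝ) ≤ 2 ^ N.choose k := by
    have := hfar (t ^ m) (by
      have : t ≤ t ^ m := Nat.le_self_pow (by omega) _
      omega) N (by
        rw [← pow_mul]
        exact (Nat.pow_le_pow_right ht0 (Nat.mul_le_mul_left _ (by omega))).trans hn)
      (hn2.trans (Nat.pow_le_pow_right (by norm_num) (Nat.le_self_pow (by omega) _)))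
    convert this using 3
  have e1 := card_monotone_centered_le (k := k) (V := Fin N) x
  have e2 := card_not_meetsLargeSets_mul_le (k := k) (V := Fin N) (x := x) (t := t) (a := a)
    (by rwa [Fintype.card_fin]) (by rwa [Fintype.card_fin]) (by
      rw [Fintype.card_fin]
      exact error_le_choose hk ht12 hNm (by omega) ha2 (by omega) hX)
  have e3 := card_large_crossSets_mul_le (k := k) (V := Fin N) (x := x) (t := t) (y := y)
    (by omega) (by rwa [Fintype.card_fin]) (by
      rw [Fintype.card_fin]
      exact error_le_crossings hk ht12 hNm (by omega) hy2 hX)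
  have e4 := card_spreadFormulas_le (k := k) (V := Fin N) (x := x) (t := t) (a := a) (by omega)
    (by omega) (by rw [Fintype.card_fin]; omega) (by rwa [Fintype.card_fin])
    (by rw [Fintype.card_fin]; exact hNi _ (by omega))
    (by rw [Fintype.card_fin]; exact ha3 _ (by omega))
    (by
      rw [Fintype.card_fin, hx, div_mul_eq_mul_div, div_lt_iff₀ htm]
      refine mul_lt_mul_of_pos_left ?_ (by positivity)
      exact_mod_cast Nat.pow_lt_pow_right (by omega) (by omega))
    (by rw [le_div_iff₀ (spreadConst_pos (by omega))]; exact hct)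
  have e5 := card_vertexBadFormulas_le (k := k) (n := n) (t := t) (a := a) (y := y) hk x ht12
    (hNi _ (by omega)) hn2 (by omega) (ha3 _ (by omega)) hy1
  have e6 := card_minimalFormulas_le_centered (k := k) (V := Fin N) x
  have e7 := card_centeredFormulas_le (k := k) (V := Fin N) x t a y
  rw [Fintype.card_fin] at e1 e2 e3 e4 e6
  have r1 := (Nat.cast_le (α := ℝ)).2 e1
  have r2 := (Nat.cast_le (α := ℝ)).2 e2
  have r3 := (Nat.cast_le (α := ℝ)).2 e3
  have r5 := (Nat.cast_le (α := ℝ)).2 e5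
  have r6 := (Nat.cast_le (α := ℝ)).2 e6
  have r7 := (Nat.cast_le (α := ℝ)).2 e7
  push_cast at r1 r2 r3 r5 r6 r7
  have hτ : (2:ℝ) ^ t ≤ 2 ^ N := pow_le_pow_right₀ (by norm_num) htN
  rw [mul_comm 2 N, pow_mul] at r5
  exact sum_error_le (by positivity) hτ (by positivity) r6 e0 r7 r1 r2 r3 e4 r5

theorem exists_pow_le_and_le_two_pow (K T : ℕ) :
    ∃ n₀ : ℕ, ∀ n ≥ n₀, ∃ t ≥ T, t ^ K ≤ n ∧ 2 * n ≤ 2 ^ t := by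
  have hlim := tendsto_pow_const_div_const_pow_of_one_lt (K + 1) (by norm_num : (1:ℝ) < 2)
  obtain ⟨t₀, ht₀⟩ := Filter.eventually_atTop.1
    (hlim.eventually_lt_const (by norm_num : (0:ℝ) < 1 / 4))
  refine ⟨(T + t₀ + 1) ^ (K + 1), fun n hn => ?_⟩
  set t := Nat.findGreatest (fun t => t ^ (K + 1) ≤ n) n with ht
  have hle : ∀ j, j ^ (K + 1) ≤ n → j ≤ n := fun j hj => (Nat.le_self_pow (by omega) j).trans hj
  have h1 : T + t₀ + 1 ≤ t := Nat.le_findGreatest (hle _ hn) hn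
  have h2 : t ^ (K + 1) ≤ n :=
    Nat.findGreatest_spec (P := fun t => t ^ (K + 1) ≤ n) (hle _ hn) hn
  have h3 : n < (t + 1) ^ (K + 1) := by
    by_contra! h
    have : t + 1 ≤ t := Nat.le_findGreatest (hle _ h) h
    omega
  refine ⟨t, by omega, (Nat.pow_le_pow_right (by omega) (by omega)).trans h2, ?_⟩
  have h4 := ht₀ (t + 1) (by omega)
  rw [div_lt_iff₀ (by positivity), pow_succ (2:ℝ)] at h4
  have h5 : (2:ℝ) * ((t + 1 : ℕ) : ℝ) ^ (K + 1) ≤ 2 ^ t := by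
    linarith [pow_pos (two_pos : (0:ℝ) < 2) t]
  have h6 : 2 * (t + 1) ^ (K + 1) ≤ 2 ^ t := by exact_mod_cast h5
  omega

theorem upper_bound (k : ℕ) (hk : 2 ≤ k) (ε : ℝ) (hε : 0 < ε) :
    ∃ n₀ : ℕ, ∀ n ≥ n₀,
      ((minimalFormulas k (Fin n)).card : ℝ) ≤ (1 + ε) * 2 ^ (n + n.choose k) := by
  set F : ℕ → ℝ := fun n => (minimalFormulas k (Fin n)).card / 2 ^ (n + n.choose k) with hF
  obtain ⟨K, T, hstep⟩ := card_minimalFormulas_succ_le hk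
  have hF0 : ∀ n, 0 ≤ F n := fun n => by positivity
  have hrec : ∀ δ > 0, ∃ n₀, ∀ n ≥ n₀, F (n + 1) ≤ 1 + δ + δ * F n := by
    intro δ hδ
    obtain ⟨s, hs⟩ := exists_pow_lt_of_lt_one (by positivity : 0 < δ / 7)
      (by norm_num : (1 / 2 : ℝ) < 1)
    obtain ⟨n₀, hn₀⟩ := exists_pow_le_and_le_two_pow K (T + s)
    refine ⟨n₀ + s, fun n hn => ?_⟩
    obtain ⟨t, htT, htK, ht2⟩ := hn₀ (n + 1) (by omega)
    have h := hstep t (by omega) n htK ht2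
    have hch : (n + 1).choose k = n.choose (k - 1) + n.choose k := by
      obtain ⟨j, rfl⟩ := Nat.exists_eq_add_of_le' (by omega : 1 ≤ k)
      exact Nat.choose_succ_succ n j
    have hsmall : ∀ i ≥ s, 7 / (2:ℝ) ^ i ≤ δ := fun i hi => by
      have h1 : (1 / 2 : ℝ) ^ i ≤ (1 / 2) ^ s := pow_le_pow_of_le_one (by norm_num) (by norm_num) hi
      rw [one_div, inv_pow, inv_pow] at h1
      rw [one_div, inv_pow] at hs
      rw [div_eq_mul_inv]
      linarith
    have hPQ : (0:ℝ) < 2 ^ (n + 1 + (n + 1).choose k) := by positivity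
    have hFn : F (n + 1) ≤ 1 + 7 / 2 ^ t + F n / 2 ^ (n + 2) := by
      simp only [hF]
      rw [div_le_iff₀ hPQ]
      refine h.trans (le_of_eq ?_)
      rw [hch]
      simp only [pow_add]
      field_simp
    have h3 : F n / 2 ^ (n + 2) ≤ δ * F n := by
      rw [div_eq_inv_mul]
      refine mul_le_mul_of_nonneg_right ?_ (hF0 n)
      have := hsmall (n + 2) (by omega)
      rw [div_eq_mul_inv] at this
      have h8 : (0:ℝ) < (2 ^ (n + 2))⁻¹ := by positivity
      linarith
    linarith [hsmall t (by omega)]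
  obtain ⟨n₁, h₁⟩ := hrec (1 / 2) (by norm_num)
  set M := max (F n₁) 3 with hM
  have hbd : ∀ n ≥ n₁, F n ≤ M := by
    intro n hn
    induction n, hn using Nat.le_induction with
    | base => exact le_max_left _ _
    | succ n hn ih =>
      have := h₁ n hn
      linarith [le_max_right (F n₁) 3]
  have hM0 : 0 < M := lt_of_lt_of_le (by norm_num) (le_max_right _ _)
  obtain ⟨n₂, h₂⟩ := hrec (ε / (1 + M)) (by positivity)
  refine ⟨n₁ + n₂ + 1, fun n hn => ?_⟩
  obtain ⟨m, rfl⟩ := Nat.exists_eq_add_of_le' (by omega : 1 ≤ n)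
  rw [← div_le_iff₀ (by positivity)]
  have h3 := h₂ m (by omega)
  have h4 : ε / (1 + M) * F m ≤ ε / (1 + M) * M :=
    mul_le_mul_of_nonneg_left (hbd m (by omega)) (by positivity)
  have h5 : ε / (1 + M) + ε / (1 + M) * M = ε := by field_simp
  change F (m + 1) ≤ _
  linarith

end

end KSat

/-- Fix `k ≥ 2`. For every `ε > 0` there is `n₀` such that for all `n ≥ n₀`,
the number of minimal `k`-SAT formulae on the labeled variables `x_1, …, x_n` lies between
`(1−ε)·2^(n + C(n,k))` and `(1+ε)·2^(n + C(n,k))`. -/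
theorem minimal_formula_count (k : ℕ) (hk : 2 ≤ k) (ε : ℝ) (hε : 0 < ε) :
    ∃ n₀ : ℕ, ∀ n ≥ n₀,
      (1 - ε) * 2 ^ (n + n.choose k) ≤
        (Set.ncard {G : SatFormula (Fin n) | IsKFormula k G ∧ MinimalFormula G} : ℝ) ∧
      (Set.ncard {G : SatFormula (Fin n) | IsKFormula k G ∧ MinimalFormula G} : ℝ) ≤
        (1 + ε) * 2 ^ (n + n.choose k) := by
  have hcard : ∀ n : ℕ,
      Set.ncard {G : SatFormula (Fin n) | IsKFormula k G ∧ MinimalFormula G} =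
        (KSat.minimalFormulas k (Fin n)).card := fun n => by
    rw [← Set.ncard_coe_finset]
    congr 1
    ext G
    simp [KSat.mem_minimalFormulas]
  obtain ⟨n₁, h₁⟩ := KSat.lower_bound k hk ε hε
  obtain ⟨n₂, h₂⟩ := KSat.upper_bound k hk ε hε
  refine ⟨max n₁ n₂, fun n hn => ?_⟩
  rw [hcard]
  exact ⟨h₁ n ((le_max_left _ _).trans hn), h₂ n ((le_max_right _ _).trans hn)⟩
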